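/- Let n ≥ 1, let 1 ≤ p ≤ ∞, let φ : ℂⁿ → ℝ be a C² plurisubharmonic function satisfying Cω ≤ i∂∂̄φ ≤ C'ω for some constants C, C' > 0, and let W ⊂ ℂⁿ be a uniformly flat smooth closed complex hypersurface whose upper density satisfies D⁺(W) < 1. Then W is an interpolation hypersurface: for every f ∈ bf^p_φ(W) there exists F ∈ BF^p_φ(ℂⁿ) with F|_W = f. -/

import Mathlib

open MeasureTheory Metric Set
open scoped ENNReal NNReal Topology

noncomputable section

/-- `ℂⁿ` with the Euclidean (Hermitian) norm. -/
abbrev En (n : ℕ) : Type := EuclideanSpace ℂ (Fin n)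

instance (n : ℕ) : MeasurableSpace (En n) := borel _
instance (n : ℕ) : BorelSpace (En n) := ⟨rfl⟩

/-- Lebesgue measure on `ℂⁿ ≅ ℝ^{2n}`, realized as `2n`-dimensional Hausdorff measure. -/
def vol (n : ℕ) : Measure (En n) := μH[(2 * n : ℝ)]

/-- The surface measure `dσ` on a hypersurface `W` induced by `ω^{n-1}`:
a constant multiple of `(2n-2)`-dimensional Hausdorff measure restricted to `W`. -/
def surf (n : ℕ) (W : Set (En n)) : Measure (En n) :=
  ((2 : ℝ≥0∞) ^ (n - 1) * (Nat.factorial (n - 1) : ℝ≥0∞)) •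
    (μH[(2 * n - 2 : ℝ)] : Measure (En n)).restrict W

open Classical in
/-- The weighted `L^p`-"norm" (to the `p`-th power for `p < ∞`) of `F` over the set `S`
with respect to the measure `μ` and the weight `φ`; for `p = ∞` it is the weighted sup. -/
def wNorm {n : ℕ} (p : ℝ≥0∞) (φ : En n → ℝ) (μ : Measure (En n)) (S : Set (En n))
    (F : En n → ℂ) : ℝ≥0∞ :=
  if p = ⊤ then ⨆ z ∈ S, ENNReal.ofReal (‖F z‖ * Real.exp (-φ z))
  else ∫⁻ z in S, ENNReal.ofReal (‖F z‖ ^ p.toReal * Real.exp (-(p.toReal * φ z))) ∂μ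

/-- Real Hessian of `φ` at `z` in the directions `u`, `v`. -/
def hess {n : ℕ} (φ : En n → ℝ) (z u v : En n) : ℝ := fderiv ℝ (fderiv ℝ φ) z u v

/-- The Levi form `i∂∂̄φ(z)(v,v̄) = Σ φ_{j k̄}(z) v_j v̄_k`, expressed through the
real Hessian.  For `φ = ‖z‖²` it equals `‖v‖²`, i.e. `ω = i∂∂̄‖z‖²` corresponds to
`levi = ‖v‖²`. -/
def levi {n : ℕ} (φ : En n → ℝ) (z v : En n) : ℝ :=
  (hess φ z v v + hess φ z (Complex.I • v) (Complex.I • v)) / 4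

/-- `W` is uniformly flat with tubular radius `ε₀`: the neighborhood
`N_{ε₀}(W)` is a tubular neighborhood, i.e. every point of it has a unique nearest
point on `W` and the (smooth) nearest-point projection `pr` is well defined there. -/
def UniformlyFlatWith {n : ℕ} (ε₀ : ℝ) (W : Set (En n)) : Prop :=
  0 < ε₀ ∧ ∃ pr : En n → En n,
    ContDiffOn ℝ (⊤ : ℕ∞) pr {z | Metric.infDist z W < ε₀} ∧
    ∀ z : En n, Metric.infDist z W < ε₀ →
      pr z ∈ W ∧ dist z (pr z) = Metric.infDist z W ∧
        ∀ w ∈ W, dist z w = Metric.infDist z W → w = pr z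

/-- `W` is uniformly flat. -/
def UniformlyFlat {n : ℕ} (W : Set (En n)) : Prop := ∃ ε₀, UniformlyFlatWith ε₀ W

/-- `f` is holomorphic on the complex submanifold `W`: near every point of `W` it is
the restriction of some holomorphic function of the ambient space. -/
def HolOn {n : ℕ} (W : Set (En n)) (f : En n → ℂ) : Prop :=
  ∀ w ∈ W, ∃ U ∈ 𝓝 w, ∃ g : En n → ℂ, DifferentiableOn ℂ g U ∧ Set.EqOn f g (U ∩ W)

/-- The average `φ_r` of `φ` over the ball `B(z,r)`. -/
def avgBall {n : ℕ} (φ : En n → ℝ) (r : ℝ) (z : En n) : ℝ :=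
  ((vol n) (Metric.ball z r)).toReal⁻¹ * ∫ x in Metric.ball z r, φ x ∂(vol n)

/-- The averaged current of integration `Υ_W(z,r)(v,v̄)`: by Lelong–Poincaré,
`Υ_W(z,r)(v,v) = (π / vol B(z,r)) ∫_{W ∩ B(z,r)} |⟨v, n_w⟩|² dσ(w)`, where the unit
normal pairing is `|⟨v, n_w⟩| = ‖dT_w(v)‖ / ‖dT_w‖` for a defining function `T` of `W`. -/
def Upsilon {n : ℕ} (T : En n → ℂ) (W : Set (En n)) (r : ℝ) (z v : En n) : ℝ :=
  (Real.pi / ((vol n) (Metric.ball z r)).toReal) *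
    ∫ w in Metric.ball z r, (‖fderiv ℂ T w v‖ / ‖fderiv ℂ T w‖) ^ 2 ∂(surf n W)

namespace SCV
open Filter
open scoped ContDiff ComplexConjugate InnerProductSpace
open Real (exp exp_add exp_le_exp exp_nat_mul exp_neg exp_pos mul_rpow norm_eq_abs norm_of_nonneg
  smoothTransition sq_sqrt)

open ENNReal (mul_lt_top mul_ne_top ofReal ofReal_add ofReal_le_ofReal ofReal_le_ofReal_iff
  ofReal_mul ofReal_ne_top ofReal_one ofReal_pow rpow_mul tendsto_ofReal toReal_mono toReal_mul
  toReal_nonneg toReal_ofReal)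

open Complex (I I_mul_I conjCLE conj_conj finrank_real_complex mul_conj neg_re normSq_eq_norm_sq
  norm_I norm_exp norm_ofNat norm_real ofRealCLM ofReal_re ofReal_zero re reCLM re_add_im
  re_ofReal_mul re_sum real_smul sub_re)

open Finset (card_univ induction_on mul_sum sum_add_distrib sum_congr sum_insert sum_le_sum sum_mul
  sum_nonneg)

open Function (comp mem_support support uncurry)
open ContinuousLinearMap (apply compL comp_id id_apply integral_apply lsmul smulRight_apply)
variable {n : ℕ} {T : En n → ℂ} {φ : En n → ℝ} {f : En n → ℂ} {r ε₀ : ℝ}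
local notation "Λ" => vol n
local notation "Γ" => En n
local notation "Z" => T ⁻¹' {0}
local notation "∇" => fderiv ℝ
local notation "dT" => fderiv ℂ T
local notation "C∞" => ContDiff ℝ ∞
local notation "C²" => ContDiff ℝ 2
local notation "Hol" => DifferentiableOn ℂ
local notation "Entire" => Differentiable ℂ

lemma finrank_real_En (n : ℕ) : Module.finrank ℝ (En n) = 2 * n := by
  rw [← Module.finrank_mul_finrank ℝ ℂ (En n)]; simp

instance vol_isAddHaar (n : ℕ) : (vol n).IsAddHaarMeasure := by
  have h := isAddHaarMeasure_hausdorffMeasure (E := En n)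
  rw [finrank_real_En] at h
  unfold vol
  push_cast at h
  exact h

/-- The antiholomorphic derivative `∂̄_v h`. -/
def dbar (v : Γ) (h : Γ → ℂ) (z : Γ) : ℂ := (∇ h z v + I * ∇ h z (I • v)) / 2

/-- The holomorphic derivative `∂_v h`. -/
def dz (v : Γ) (h : Γ → ℂ) (z : Γ) : ℂ := (∇ h z v - I * ∇ h z (I • v)) / 2

lemma fderiv_eq_dz_add_dbar (h : Γ → ℂ) (z v : Γ) : ∇ h z v = dz v h z + dbar v h z := by
  unfold dz dbar; ring

lemma dbar_mul {f g : Γ → ℂ} {z : Γ} (v : Γ) (hf : DifferentiableAt ℝ f z) (hg : DifferentiableAt ℝ g z) :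
    dbar v (fun x => f x * g x) z = f z * dbar v g z + dbar v f z * g z := by
  unfold dbar
  rw [fderiv_fun_mul hf hg]
  simp
  ring

lemma dz_mul {f g : Γ → ℂ} {z : Γ} (v : Γ) (hf : DifferentiableAt ℝ f z) (hg : DifferentiableAt ℝ g z) :
    dz v (fun x => f x * g x) z = f z * dz v g z + dz v f z * g z := by
  unfold dz
  rw [fderiv_fun_mul hf hg]
  simp
  ring

lemma dbar_add {f g : Γ → ℂ} {z : Γ} (v : Γ) (hf : DifferentiableAt ℝ f z) (hg : DifferentiableAt ℝ g z) :
    dbar v (fun x => f x + g x) z = dbar v f z + dbar v g z := by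
  unfold dbar
  rw [fderiv_fun_add hf hg]
  simp
  ring

lemma dz_add {f g : Γ → ℂ} {z : Γ} (v : Γ) (hf : DifferentiableAt ℝ f z) (hg : DifferentiableAt ℝ g z) :
    dz v (fun x => f x + g x) z = dz v f z + dz v g z := by
  unfold dz
  rw [fderiv_fun_add hf hg]
  simp
  ring

lemma dbar_neg (f : Γ → ℂ) (v z : Γ) : dbar v (fun x => - f x) z = - dbar v f z := by
  unfold dbar
  rw [fderiv_fun_neg]
  simp
  ring

lemma dbar_conj (f : Γ → ℂ) (v z : Γ) : dbar v (fun x => conj (f x)) z = conj (dz v f z) := by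
  unfold dbar dz
  have : ∇ (fun x => conj (f x)) z = conjCLE.toContinuousLinearMap.comp (∇ f z) :=
    conjCLE.comp_fderiv (f := f) (x := z)
  rw [this]
  simp [map_ofNat]

lemma dz_conj (f : Γ → ℂ) (v z : Γ) : dz v (fun x => conj (f x)) z = conj (dbar v f z) := by
  have := dbar_conj (fun x => conj (f x)) v z
  simp_all

lemma fderiv_real_of_complex {F : Type*} [NormedAddCommGroup F] [NormedSpace ℂ F]
    {f : Γ → F} {z : Γ} (hf : DifferentiableAt ℂ f z) (v : Γ) :
    ∇ f z v = fderiv ℂ f z v := by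
  rw [hf.fderiv_restrictScalars ℝ]; rfl

lemma dbar_eq_zero {z : Γ} (hf : DifferentiableAt ℂ f z) (v : Γ) : dbar v f z = 0 := by
  unfold dbar
  rw [fderiv_real_of_complex hf, fderiv_real_of_complex hf]
  simp
  rw [← mul_assoc, I_mul_I]; ring

lemma dz_eq_fderiv {z : Γ} (hf : DifferentiableAt ℂ f z) (v : Γ) : dz v f z = fderiv ℂ f z v := by
  have := fderiv_eq_dz_add_dbar f z v
  rw [dbar_eq_zero hf, fderiv_real_of_complex hf] at this
  simp_all

/-- Real linearity in the direction, antilinearity over `ℂ`. -/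
lemma dbar_smul (f : Γ → ℂ) (z v : Γ) (c : ℂ) : dbar (c • v) f z = conj c * dbar v f z := by
  have e2 : I • c • v = c.re • (I • v) - c.im • v := by
    ext i; simp
    linear_combination (-(v i) * I) * (re_add_im c) + c.im * v i * I_mul_I
  unfold dbar
  rw [e2, (by ext i; simp; linear_combination (-(v i)) * (re_add_im c) : c • v = c.re • v + c.im • (I • v))]
  rw [(by apply Complex.ext <;> simp : conj c = c.re - c.im * I)]
  simp
  linear_combination ((c.im:ℂ)/2 * ∇ f z (I • v)) * I_mul_I

lemma dz_smul (f : Γ → ℂ) (z v : Γ) (c : ℂ) : dz (c • v) f z = c * dz v f z := by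
  have h := dbar_smul (fun x => conj (f x)) z v c
  rw [dbar_conj, dbar_conj] at h
  have := congrArg conj h
  simpa using this

lemma dbar_add_dir (f : Γ → ℂ) (z u v : Γ) : dbar (u + v) f z = dbar u f z + dbar v f z := by
  unfold dbar
  simp; ring

lemma dz_add_dir (f : Γ → ℂ) (z u v : Γ) : dz (u + v) f z = dz u f z + dz v f z := by
  unfold dz
  simp; ring

lemma contDiff_dbar {m k : ℕ∞ω} (hf : ContDiff ℝ k f) (hk : m + 1 ≤ k) (v : Γ) : ContDiff ℝ m (dbar v f) := by
  unfold dbar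
  fun_prop

lemma contDiff_dz {m k : ℕ∞ω} (hf : ContDiff ℝ k f) (hk : m + 1 ≤ k) (v : Γ) : ContDiff ℝ m (dz v f) := by
  unfold dz
  fun_prop

lemma hasCompactSupport_dbar (hf : HasCompactSupport f) (v : Γ) : HasCompactSupport (dbar v f) := by
  refine (hf.fderiv (𝕜 := ℝ)).mono fun z hz => ?_
  contrapose! hz
  simp at hz ⊢
  simp [dbar, hz]

lemma hasCompactSupport_dz (hf : HasCompactSupport f) (v : Γ) : HasCompactSupport (dz v f) := by
  refine (hf.fderiv (𝕜 := ℝ)).mono fun z hz => ?_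
  contrapose! hz
  simp at hz ⊢
  simp [dz, hz]

/-- Second derivatives of a complex valued function in terms of its derivative. -/
lemma fderiv_comb (hf : C² f) (a : ℂ) (z u v w : Γ) :
    ∇ (fun x => (∇ f x v + a * ∇ f x w) / 2) z u =
      (∇ (∇ f) z u v + a * ∇ (∇ f) z u w) / 2 := by
  have h1 := (hf.fderiv_right (m := 1) (by norm_num)).differentiable (by norm_num)
  have e := fun y =>
    ((apply ℝ ℂ y).hasFDerivAt.comp z (h1 z).hasFDerivAt)
  have e3 : (fun x => (∇ f x v + a * ∇ f x w) / 2) =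
    fun x => (∇ f x v + a * ∇ f x w) * (1/2) := by ext; ring
  rw [e3]
  erw [((((e v).add ((e w).const_mul a)).mul_const (1/2 : ℂ))).fderiv]
  simp
  ring

lemma fderiv_dbar (hf : C² f) (z u v : Γ) : ∇ (dbar v f) z u = (∇ (∇ f) z u v +
      I * ∇ (∇ f) z u (I • v)) / 2 :=
  fderiv_comb hf _ z u v _

lemma fderiv_dz (hf : C² f) (z u v : Γ) : ∇ (dz v f) z u = (∇ (∇ f) z u v -
      I * ∇ (∇ f) z u (I • v)) / 2 := by
  have := fderiv_comb hf (-I) z u v (I • v)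
  rw [sub_eq_add_neg, ← neg_mul, ← this]
  congr 1
  congr 1
  ext x; unfold dz; ring

lemma second_symm (hf : C² f) (z u v : Γ) : ∇ (∇ f) z u v = ∇ (∇ f) z v u :=
  (hf.contDiffAt.isSymmSndFDerivAt (by simp)).eq u v

lemma dbar_dz_comm (hf : C² f) (z u v : Γ) : dbar u (dz v f) z = dz v (dbar u f) z := by
  conv_lhs => unfold dbar
  conv_rhs => unfold dz
  simp [fderiv_dbar hf, fderiv_dz hf]
  rw [second_symm hf z v u, second_symm hf z v (I • u), second_symm hf z (I • v) u, second_symm hf z (I • v) (I • u)]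
  ring

lemma dbar_dbar_comm (hf : C² f) (z u v : Γ) : dbar u (dbar v f) z = dbar v (dbar u f) z := by
  rw [dbar, dbar]
  simp [fderiv_dbar hf]
  rw [second_symm hf z v u, second_symm hf z v (I • u), second_symm hf z (I • v) u, second_symm hf z (I • v) (I • u)]
  ring

/-- A test function: smooth with compact support. -/
structure IsTest (h : Γ → ℂ) : Prop where
  smooth : C∞ h
  supp : HasCompactSupport h

lemma IsTest.dbar {h : Γ → ℂ} (H : IsTest h) (v : Γ) : IsTest (dbar v h) :=
  ⟨contDiff_dbar H.smooth (by norm_num) v, hasCompactSupport_dbar H.supp v⟩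

lemma IsTest.dz {h : Γ → ℂ} (H : IsTest h) (v : Γ) : IsTest (dz v h) :=
  ⟨contDiff_dz H.smooth (by norm_num) v, hasCompactSupport_dz H.supp v⟩

lemma IsTest.add {f g : Γ → ℂ} (hf : IsTest f) (hg : IsTest g) : IsTest (fun x => f x + g x) :=
  ⟨hf.smooth.add hg.smooth, hf.supp.add hg.supp⟩

lemma IsTest.mul_left {f g : Γ → ℂ} (hf : C∞ f) (hg : IsTest g) : IsTest (fun x => f x * g x) :=
  ⟨hf.mul hg.smooth, hg.supp.mul_left⟩

lemma IsTest.conj (hf : IsTest f) : IsTest (fun x => conj (f x)) :=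
  ⟨conjCLE.contDiff.comp hf.smooth, hf.supp.comp_left (map_zero _)⟩

lemma IsTest.neg (hf : IsTest f) : IsTest (fun x => - f x) :=
  ⟨hf.smooth.neg, hf.supp.comp_left (g := fun x => -x) neg_zero⟩

lemma IsTest.continuous (hf : IsTest f) : Continuous f := hf.smooth.continuous

lemma IsTest.zero : IsTest (fun _ : Γ => (0:ℂ)) := ⟨contDiff_const, HasCompactSupport.zero⟩

lemma IsTest.contDiff_two (hf : IsTest f) : C² f := hf.smooth.of_le ENat.LEInfty.out

lemma IsTest.differentiable (hf : IsTest f) : Differentiable ℝ f := hf.smooth.differentiable (by simp)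

lemma integrable_of_compact (hf : Continuous f) (hs : HasCompactSupport f) :
    Integrable f Λ := hf.integrable_of_hasCompactSupport hs

/-- Integration by parts. -/
lemma ibp_fderiv {f g : Γ → ℂ} (hf : ContDiff ℝ 1 f) (hg : ContDiff ℝ 1 g) (hs : HasCompactSupport g) (v : Γ) :
    ∫ x, f x * ∇ g x v ∂Λ = -∫ x, ∇ f x v * g x ∂Λ := by
  have cf := (hf.continuous_fderiv (by norm_num)).clm_apply continuous_const (g := fun _ => v)
  have cg := (hg.continuous_fderiv (by norm_num)).clm_apply continuous_const (g := fun _ => v)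
  apply integral_mul_fderiv_eq_neg_fderiv_mul_of_integrable
  · exact integrable_of_compact (cf.mul hg.continuous) hs.mul_left
  · refine integrable_of_compact (hf.continuous.mul cg) (HasCompactSupport.mul_left ?_)
    exact hs.fderiv_apply (𝕜 := ℝ) v
  · exact integrable_of_compact (hf.continuous.mul hg.continuous) hs.mul_left
  · exact fun x _ => (hf.differentiable (by norm_num)) x
  · exact fun x _ => (hg.differentiable (by norm_num)) x

lemma ibp_dbar {f g : Γ → ℂ} (hf : ContDiff ℝ 1 f) (hg : ContDiff ℝ 1 g) (hs : HasCompactSupport g) (v : Γ) :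
    ∫ x, f x * dbar v g x ∂Λ = -∫ x, dbar v f x * g x ∂Λ := by
  have I1 v : Integrable (fun x => f x * ∇ g x v) Λ :=
    integrable_of_compact (hf.continuous.mul ((hg.continuous_fderiv (by norm_num)).clm_apply
      continuous_const)) (HasCompactSupport.mul_left (hs.fderiv_apply (𝕜 := ℝ) v))
  have I2 v : Integrable (fun x => ∇ f x v * g x) Λ :=
    integrable_of_compact (((hf.continuous_fderiv (by norm_num)).clm_apply
      continuous_const).mul hg.continuous) hs.mul_left
  have e1 x : f x * dbar v g x = (1/2:ℂ) * (f x * ∇ g x v) +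
    (I/2) * (f x * ∇ g x (I • v)) := by unfold dbar; ring
  have e2 x : dbar v f x * g x = (1/2:ℂ) * (∇ f x v * g x) +
    (I/2) * (∇ f x (I • v) * g x) := by unfold dbar; ring
  simp_rw [e1, e2]
  rw [integral_add ((I1 _).const_mul _) ((I1 _).const_mul _), integral_add ((I2 _).const_mul _) ((I2 _).const_mul _)]
  simp [integral_const_mul]
  rw [ibp_fderiv hf hg hs, ibp_fderiv hf hg hs]
  ring

lemma ibp_dz {f g : Γ → ℂ} (hf : ContDiff ℝ 1 f) (hg : ContDiff ℝ 1 g) (hs : HasCompactSupport g) (v : Γ) :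
    ∫ x, f x * dz v g x ∂Λ = -∫ x, dz v f x * g x ∂Λ := by
  have h := ibp_dbar (f := fun x => conj (f x)) (g := fun x => conj (g x))
    (conjCLE.contDiff.comp hf) (conjCLE.contDiff.comp hg)
    (hs.comp_left (map_zero _)) v
  simp_rw [dbar_conj, ← map_mul, integral_conj] at h
  rw [← map_neg] at h
  exact star_injective h

/-- The sesquilinear Levi form. -/
def leviForm (φ : Γ → ℝ) (z u v : Γ) : ℂ := dz u (dbar v (fun x => (φ x : ℂ))) z

lemma fderiv_ofReal {z : Γ} (h : DifferentiableAt ℝ φ z) (v : Γ) :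
    ∇ (fun x => (φ x : ℂ)) z v = (∇ φ z v : ℂ) := by
  have := ofRealCLM.hasFDerivAt.comp z h.hasFDerivAt
  change ∇ (ofRealCLM ∘ φ) z v = _
  rw [this.fderiv]; rfl

lemma contDiff_ofReal {k : ℕ∞ω} (h : ContDiff ℝ k φ) : ContDiff ℝ k (fun x => (φ x : ℂ)) := ofRealCLM.contDiff.comp h

lemma fderiv2_ofReal (h : C² φ) (z u v : Γ) :
    ∇ (∇ (fun x => (φ x : ℂ))) z u v = (hess φ z u v : ℂ) := by
  have h1 := (h.fderiv_right (m := 1) (by norm_num)).differentiable (by norm_num)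
  have e : ∇ (fun x => (φ x : ℂ)) = fun x => ofRealCLM.comp (∇ φ x) := by
    ext x v; rw [fderiv_ofReal ((h.differentiable (by norm_num)) x)]; rfl
  rw [e]
  have := ((compL ℝ Γ ℝ ℂ ofRealCLM).hasFDerivAt.comp z (h1 z).hasFDerivAt).fderiv
  change ∇ ((compL ℝ Γ ℝ ℂ ofRealCLM) ∘ ∇ φ) z u v = _
  rw [this]; rfl

lemma hess_symm (h : C² φ) (z u v : Γ) : hess φ z u v = hess φ z v u :=
  (h.contDiffAt.isSymmSndFDerivAt (by simp)).eq u v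

lemma leviForm_self (h : C² φ) (z v : Γ) : leviForm φ z v v = (levi φ z v : ℂ) := by
  unfold leviForm
  conv_lhs => unfold dz
  simp [fderiv_dbar (contDiff_ofReal h), fderiv2_ofReal h]
  rw [hess_symm h z (I • v) v]
  unfold levi
  push_cast
  linear_combination (-(hess φ z (I • v) (I • v) : ℂ)/4) * I_mul_I

lemma leviForm_smul_left (φ : Γ → ℝ) (z u v : Γ) (c : ℂ) :
    leviForm φ z (c • u) v = c * leviForm φ z u v := dz_smul _ _ _ _

lemma leviForm_smul_right (h : C² φ) (z u v : Γ) (c : ℂ) :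
    leviForm φ z u (c • v) = conj c * leviForm φ z u v := by
  unfold leviForm
  rw [← dbar_dz_comm (contDiff_ofReal h), ← dbar_dz_comm (contDiff_ofReal h), dbar_smul]

lemma leviForm_add_left (φ : Γ → ℝ) (z u u' v : Γ) :
    leviForm φ z (u + u') v = leviForm φ z u v + leviForm φ z u' v := dz_add_dir _ _ _ _

lemma leviForm_add_right (h : C² φ) (z u v v' : Γ) :
    leviForm φ z u (v + v') = leviForm φ z u v + leviForm φ z u v' := by
  unfold leviForm
  rw [← dbar_dz_comm (contDiff_ofReal h), ← dbar_dz_comm (contDiff_ofReal h),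
    ← dbar_dz_comm (contDiff_ofReal h), dbar_add_dir]

/-- The standard basis vectors. -/
def ee (j : Fin n) : Γ := EuclideanSpace.single j 1

local notation:max "ð" j:max => dbar (ee j)
local notation:max "đ" j:max => dz (ee j)

lemma sum_ee (v : Γ) : v = ∑ j, v j • ee j := by
  ext i
  simp [ee, Pi.single_apply]

/-- Real-linear maps of `dz` type in the basis. -/
lemma dz_sum_dir {ι : Type*} (s : Finset ι) (f : Γ → ℂ) (z : Γ) (v : ι → Γ) :
    dz (∑ j ∈ s, v j) f z = ∑ j ∈ s, dz (v j) f z := by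
  classical
  induction s using induction_on with
  | empty => simp [dz]
  | insert a s ha ih => rw [sum_insert ha, dz_add_dir, ih, sum_insert ha]

lemma dbar_sum_dir {ι : Type*} (s : Finset ι) (f : Γ → ℂ) (z : Γ) (v : ι → Γ) :
    dbar (∑ j ∈ s, v j) f z = ∑ j ∈ s, dbar (v j) f z := by
  classical
  induction s using induction_on with
  | empty => simp [dbar]
  | insert a s ha ih => rw [sum_insert ha, dbar_add_dir, ih, sum_insert ha]

lemma dbar_basis (f : Γ → ℂ) (z v : Γ) : dbar v f z = ∑ j, conj (v j) * ð j f z := by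
  conv_lhs => rw [sum_ee v]
  rw [dbar_sum_dir]
  exact sum_congr rfl fun j _ => dbar_smul _ _ _ _

lemma dz_basis (f : Γ → ℂ) (z v : Γ) : dz v f z = ∑ j, v j * đ j f z := by
  conv_lhs => rw [sum_ee v]
  rw [dz_sum_dir]
  exact sum_congr rfl fun j _ => dz_smul _ _ _ _

lemma levi_eq_sum (h : C² φ) (z v : Γ) :
    (levi φ z v : ℂ) = ∑ j, ∑ k, leviForm φ z (ee j) (ee k) * v j * conj (v k) := by
  rw [← leviForm_self h]
  unfold leviForm
  rw [dz_basis]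
  refine sum_congr rfl fun j _ => ?_
  rw [← dbar_dz_comm (contDiff_ofReal h), dbar_basis, mul_sum]
  refine sum_congr rfl fun k _ => ?_
  rw [dbar_dz_comm (contDiff_ofReal h)]; ring

/-- A smooth radial cutoff, equal to `1` on `‖x‖ ≤ r` and supported in `‖x‖ ≤ 2 r`. -/
def rad (r : ℝ) (x : Γ) : ℝ := smoothTransition (2 - ‖x‖ ^ 2 / r ^ 2)

lemma rad_nonneg (r : ℝ) (x : Γ) : 0 ≤ rad r x := smoothTransition.nonneg _

lemma rad_le_one (r : ℝ) (x : Γ) : rad r x ≤ 1 := smoothTransition.le_one _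

lemma rad_eq_one (hr : 0 < r) {x : Γ} (hx : ‖x‖ ≤ r) : rad r x = 1 := by
  apply smoothTransition.one_of_one_le
  have : ‖x‖ ^ 2 / r ^ 2 ≤ 1 := by rw [div_le_one (by positivity)]; gcongr
  linarith

lemma rad_eq_zero (hr : 0 < r) {x : Γ} (hx : 2 * r ^ 2 ≤ ‖x‖ ^ 2) : rad r x = 0 := by
  apply smoothTransition.zero_of_nonpos
  have : 2 ≤ ‖x‖ ^ 2 / r ^ 2 := by rwa [le_div_iff₀ (by positivity)]
  linarith

lemma rad_eq_zero' (hr : 0 < r) {x : Γ} (hx : 2 * r ≤ ‖x‖) : rad r x = 0 := by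
  apply rad_eq_zero hr
  nlinarith

lemma rad_congr (r : ℝ) {x y : Γ} (h : ‖x‖ = ‖y‖) : rad r x = rad r y := by unfold rad; rw [h]

lemma contDiff_normSq : C∞ (fun x : Γ => ‖x‖ ^ 2) := contDiff_norm_sq ℝ

lemma contDiff_rad (r : ℝ) : C∞ (rad r : Γ → ℝ) :=
  smoothTransition.contDiff.comp (contDiff_const.sub (contDiff_normSq.div_const _))

lemma continuous_rad (r : ℝ) : Continuous (rad r : Γ → ℝ) := (contDiff_rad r).continuous

lemma hasCompactSupport_rad (hr : 0 < r) : HasCompactSupport (rad r : Γ → ℝ) := by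
  apply HasCompactSupport.intro (isCompact_closedBall 0 (2 * r))
  intro x hx
  apply rad_eq_zero' hr
  simp at hx
  exact hx.le

lemma integrable_rad (hr : 0 < r) : Integrable (rad r : Γ → ℝ) Λ :=
  (continuous_rad r).integrable_of_hasCompactSupport (hasCompactSupport_rad hr)

/-- The total mass of the cutoff. -/
def radMass (n : ℕ) (r : ℝ) : ℝ := ∫ x : En n, rad r x ∂(vol n)

lemma vol_ball_le_radMass (hr : 0 < r) : (Λ).real (closedBall 0 r) ≤ radMass n r := by
  rw [radMass, ← integral_indicator_one measurableSet_closedBall]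
  apply integral_mono_of_nonneg
  · exact Eventually.of_forall fun x => indicator_nonneg (fun _ _ => zero_le_one) _
  · exact integrable_rad hr
  · refine Eventually.of_forall fun x => ?_
    by_cases hx : x ∈ closedBall 0 r
    · rw [indicator_of_mem hx, rad_eq_one hr (by simpa using hx)]; simp
    · rw [indicator_of_notMem hx]; exact rad_nonneg _ _

lemma vol_real_ball_pos (hr : 0 < r) (x : Γ) : 0 < (Λ).real (closedBall x r) := by
  rw [measureReal_def, ENNReal.toReal_pos_iff]
  exact ⟨measure_closedBall_pos _ _ hr, measure_closedBall_lt_top⟩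

lemma radMass_pos (hr : 0 < r) : 0 < radMass n r := (vol_real_ball_pos hr _).trans_le (vol_ball_le_radMass hr)

/-- The normalized radial mollifier. -/
def moll (r : ℝ) (x : Γ) : ℝ := rad r x / radMass n r

lemma moll_nonneg (hr : 0 < r) (x : Γ) : 0 ≤ moll r x := div_nonneg (rad_nonneg _ _) (radMass_pos hr).le

lemma contDiff_moll (r : ℝ) : C∞ (moll r : Γ → ℝ) := (contDiff_rad r).div_const _

lemma continuous_moll (r : ℝ) : Continuous (moll r : Γ → ℝ) := (contDiff_moll r).continuous

lemma hasCompactSupport_moll (hr : 0 < r) : HasCompactSupport (moll r : Γ → ℝ) :=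
  (hasCompactSupport_rad hr).mono fun x hx h => hx (by simp [moll, h])

lemma moll_congr (r : ℝ) {x y : Γ} (h : ‖x‖ = ‖y‖) : moll r x = moll r y := by unfold moll; rw [rad_congr r h]

lemma moll_eq_zero (hr : 0 < r) {x : Γ} (hx : 2 * r ≤ ‖x‖) : moll r x = 0 := by
  rw [moll, rad_eq_zero' hr hx, zero_div]

lemma integrable_moll (hr : 0 < r) : Integrable (moll r : Γ → ℝ) Λ := (integrable_rad hr).div_const _

lemma integral_moll (hr : 0 < r) : ∫ x : Γ, moll r x ∂Λ = 1 := by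
  simp [moll, integral_div]
  exact div_self (radMass_pos hr).ne'

lemma integral_moll_sub (hr : 0 < r) (x : Γ) : ∫ y : Γ, moll r (x - y) ∂Λ = 1 := by
  rw [integral_sub_left_eq_self (moll r) Λ x, integral_moll hr]

lemma moll_sub_comm (r : ℝ) (x y : Γ) : moll r (x - y) = moll r (y - x) := moll_congr r (norm_sub_rev _ _)

section conv
variable {F : Type*} [NormedAddCommGroup F] [NormedSpace ℝ F]
/-- Mollification. -/
def mconv (r : ℝ) (f : Γ → F) : Γ → F := MeasureTheory.convolution (moll r) f (lsmul ℝ ℝ) Λ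

lemma mconv_eq (r : ℝ) (f : Γ → F) (x : Γ) : mconv r f x = ∫ y, moll r y • f (x - y) ∂Λ := rfl

lemma mconv_eq' (r : ℝ) (f : Γ → F) (x : Γ) :
    mconv r f x = ∫ y, moll r (x - y) • f y ∂Λ := convolution_lsmul_swap

lemma mconv_eq_add (r : ℝ) (f : Γ → F) (x : Γ) : mconv r f x = ∫ y, moll r y • f (x + y) ∂Λ := by
  rw [mconv_eq, ← integral_neg_eq_self]
  congr 1; ext y
  rw [sub_neg_eq_add, moll_congr r (norm_neg y)]

lemma contDiff_mconv (hr : 0 < r) {f : Γ → F} (hf : LocallyIntegrable f Λ) : C∞ (mconv r f) :=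
  (hasCompactSupport_moll hr).contDiff_convolution_left _ (contDiff_moll r) hf

lemma integrable_moll_smul (hr : 0 < r) {f : Γ → F} (hf : LocallyIntegrable f Λ) (x : Γ) :
    Integrable (fun y => moll r (x - y) • f y) Λ := by
  apply hf.integrable_smul_left_of_hasCompactSupport
  · exact (continuous_moll r).comp (continuous_const.sub continuous_id)
  · exact (hasCompactSupport_moll hr).comp_homeomorph (Homeomorph.subLeft x)

lemma fderiv_mconv (hr : 0 < r) {f : Γ → F} (hf : LocallyIntegrable f Λ) (x v : Γ) :
    ∇ (mconv r f) x v = ∫ y, ∇ (moll r) (x - y) v • f y ∂Λ := by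
  have h := (hasCompactSupport_moll hr).hasFDerivAt_convolution_left
    (lsmul ℝ ℝ) ((contDiff_moll r).of_le ENat.LEInfty.out) hf x
  rw [mconv, h.fderiv, convolution_eq_swap, integral_apply]
  · rfl
  · have := (((hasCompactSupport_moll hr).fderiv ℝ).convolutionExists_left ((lsmul ℝ ℝ).precompL Γ)
      ((contDiff_moll r).continuous_fderiv (by simp)) hf) x
    exact this.integrable_swap

lemma ae_tendsto_mconv [CompleteSpace F] {f : Γ → F} (hf : LocallyIntegrable f Λ) :
    ∀ᵐ x ∂Λ, Tendsto (fun k : ℕ => mconv (1 / ((k:ℝ) + 1)) f x) atTop (𝓝 (f x)) := by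
  have hr (k : ℕ) : 0 < 1 / ((k:ℝ) + 1) := Nat.one_div_pos_of_nat
  filter_upwards [(Besicovitch.vitaliFamily Λ).ae_tendsto_average_norm_sub hf] with x₀ h₀
  simp only [mconv_eq']
  have h1 : Tendsto (fun k : ℕ => 2 * (1 / ((k:ℝ) + 1))) atTop (𝓝 0) := by
    simpa using tendsto_one_div_add_atTop_nhds_zero_nat.const_mul (2:ℝ)
  have h2 :=
    tendsto_nhdsWithin_iff.2 ⟨h1, Eventually.of_forall fun k => mul_pos two_pos (hr k)⟩
  have := (h₀.comp (Besicovitch.tendsto_filterAt Λ x₀)).comp h2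
  apply tendsto_integral_smul_of_tendsto_average_norm_sub (2 ^ Module.finrank ℝ Γ) this
  · filter_upwards with k using hf.integrableOn_isCompact (isCompact_closedBall _ _)
  · exact tendsto_const_nhds.congr fun k => (integral_moll_sub (hr k) x₀).symm
  · filter_upwards with k y hy
    rw [mem_closedBall_comm, mem_closedBall_iff_norm]
    by_contra! h
    exact hy (moll_eq_zero (hr k) h.le)
  · filter_upwards with k y
    rw [abs_of_nonneg (moll_nonneg (hr k) _), measureReal_def, Measure.addHaar_closedBall_mul _ _ two_pos.le (hr k).le,
      toReal_mul, toReal_ofReal (by positivity), ← measureReal_def,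
      div_mul_cancel_left₀ (by positivity), ← one_div]
    rw [moll]
    gcongr
    · exact vol_real_ball_pos (hr k) _
    · exact rad_le_one _ _
    · exact vol_ball_le_radMass (hr k)

end conv

lemma isTest_moll_sub (hr : 0 < r) (x : Γ) : IsTest (fun y : Γ => ((moll r (x - y) : ℝ) : ℂ)) :=
  ⟨contDiff_ofReal ((contDiff_moll r).comp (contDiff_const.sub contDiff_id)),
    ((hasCompactSupport_moll hr).comp_homeomorph (Homeomorph.subLeft x)).comp_left
      (g := fun t : ℝ => (t : ℂ)) ofReal_zero⟩

lemma fderiv_moll_sub (r : ℝ) (x y v : Γ) : ∇ (fun y : Γ => ((moll r (x - y) : ℝ) : ℂ)) y v =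
      - (∇ (moll r) (x - y) v : ℝ) := by
  have d : Differentiable ℝ (moll r : Γ → ℝ) := (contDiff_moll r).differentiable (by simp)
  rw [fderiv_ofReal (φ := fun y => moll r (x - y))
    ((d _).comp y (differentiableAt_const x |>.sub differentiableAt_id))]
  have h1 : HasFDerivAt (fun y => x - y) (-(ContinuousLinearMap.id ℝ Γ)) y :=
    (hasFDerivAt_id y).const_sub x
  have h2 : HasFDerivAt (fun y => moll r (x - y))
      ((∇ (moll r) (x - y)).comp (-(ContinuousLinearMap.id ℝ Γ))) y :=
    (d (x - y)).hasFDerivAt.comp y h1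
  rw [h2.fderiv]
  simp

lemma fderiv_mconv_eq (hr : 0 < r) (hf : LocallyIntegrable f Λ) (x v : Γ) : ∇ (mconv r f) x v =
      - ∫ y, f y * ∇ (fun y : Γ => ((moll r (x - y) : ℝ) : ℂ)) y v ∂Λ := by
  rw [fderiv_mconv hr hf, ← integral_neg]
  congr 1; ext y
  rw [fderiv_moll_sub, real_smul]; ring

lemma integrable_mul_test {f h : Γ → ℂ} (hf : LocallyIntegrable f Λ) (hh : Continuous h)
    (hs : HasCompactSupport h) : Integrable (fun y => f y * h y) Λ := by
  have := hf.integrable_smul_left_of_hasCompactSupport hh hs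
  simpa [mul_comm] using this

lemma dbar_mconv (hr : 0 < r) (hf : LocallyIntegrable f Λ) (x v : Γ) : dbar v (mconv r f) x =
      - ∫ y, f y * dbar v (fun y : Γ => ((moll r (x - y) : ℝ) : ℂ)) y ∂Λ := by
  have I := fun v =>
    integrable_mul_test hf (((isTest_moll_sub hr x).smooth.continuous_fderiv (by simp)).clm_apply
      continuous_const) ((isTest_moll_sub hr x).supp.fderiv_apply (𝕜 := ℝ) v)
  conv_lhs => unfold dbar
  rw [fderiv_mconv_eq hr hf, fderiv_mconv_eq hr hf]
  have e y : f y * dbar v (fun y => ((moll r (x - y) : ℝ) : ℂ)) y =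
    (1/2 : ℂ) * (f y * ∇ (fun y => ((moll r (x - y) : ℝ) : ℂ)) y v) +
    Complex.I / 2 * (f y * ∇ (fun y => ((moll r (x - y) : ℝ) : ℂ)) y (Complex.I • v)) := by unfold dbar; ring
  simp_rw [e]
  rw [integral_add ((I _).const_mul _) ((I _).const_mul _)]
  simp [integral_const_mul]
  ring

lemma dz_mconv (hr : 0 < r) (hf : LocallyIntegrable f Λ) (x v : Γ) : dz v (mconv r f) x =
      - ∫ y, f y * dz v (fun y : Γ => ((moll r (x - y) : ℝ) : ℂ)) y ∂Λ := by
  have I := fun v =>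
    integrable_mul_test hf (((isTest_moll_sub hr x).smooth.continuous_fderiv (by simp)).clm_apply
      continuous_const) ((isTest_moll_sub hr x).supp.fderiv_apply (𝕜 := ℝ) v)
  conv_lhs => unfold dz
  rw [fderiv_mconv_eq hr hf, fderiv_mconv_eq hr hf]
  have e y : f y * dz v (fun y => ((moll r (x - y) : ℝ) : ℂ)) y =
    (1/2 : ℂ) * (f y * ∇ (fun y => ((moll r (x - y) : ℝ) : ℂ)) y v) +
    (-Complex.I / 2) * (f y * ∇ (fun y => ((moll r (x - y) : ℝ) : ℂ)) y (Complex.I • v)) := by unfold dz; ring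
  simp_rw [e]
  rw [integral_add ((I _).const_mul _) ((I _).const_mul _)]
  simp [integral_const_mul]
  ring

/-- Young's inequality for the mollifier in `L²`. -/
lemma lintegral_mconv_sq_le {F : Type*} [NormedAddCommGroup F] (hr : 0 < r) {f : Γ → F} (hf : AEStronglyMeasurable f Λ) :
    ∫⁻ x, ofReal (∫ y, moll r (x - y) * ‖f y‖ ∂Λ) ^ 2 ∂Λ ≤ ∫⁻ x, ‖f x‖ₑ ^ 2 ∂Λ := by
  set k : Γ → ℝ≥0∞ := fun x => ofReal (moll r x) with hk
  have km : Measurable k := (continuous_moll r).measurable.ennreal_ofReal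
  have k1 : ∫⁻ y, k y ∂Λ = 1 := by
    rw [hk, ← ofReal_integral_eq_lintegral_ofReal (integrable_moll hr)
      (Eventually.of_forall (moll_nonneg hr)), integral_moll hr, ofReal_one]
  have step x : ofReal (∫ y, moll r (x - y) * ‖f y‖ ∂Λ) ^ 2 ≤ ∫⁻ y, k (x - y) * ‖f y‖ₑ ^ 2 ∂Λ := by
    have a : ofReal (∫ y, moll r (x - y) * ‖f y‖ ∂Λ) ≤ ∫⁻ y, k (x - y) * ‖f y‖ₑ ∂Λ := by
      rw [integral_eq_lintegral_of_nonneg_ae]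
      · refine ENNReal.ofReal_toReal_le.trans (lintegral_mono fun y => ?_)
        rw [ofReal_mul (moll_nonneg hr _), ofReal_norm]
      · exact Eventually.of_forall fun y => mul_nonneg (moll_nonneg hr _) (norm_nonneg _)
      · exact ((continuous_moll r).comp (continuous_const.sub continuous_id)).aestronglyMeasurable.mul hf.norm
    have b := ENNReal.lintegral_mul_le_Lp_mul_Lq Λ (p := 2) (q := 2) (by constructor <;> norm_num)
      (f := fun y => k (x - y) ^ (1/2 : ℝ)) (g := fun y => k (x - y) ^ (1/2:ℝ) * ‖f y‖ₑ)
      (by fun_prop) (by have := hf.enorm; fun_prop)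
    have e1 y : (k (x - y) ^ (1/2:ℝ)) ^ (2:ℝ) = k (x - y) := by rw [← rpow_mul]; norm_num
    have e2 y : (k (x - y) ^ (1/2:ℝ) * ‖f y‖ₑ) ^ (2:ℝ) = k (x - y) * ‖f y‖ₑ ^ 2 := by
      rw [ENNReal.mul_rpow_of_nonneg _ _ (by norm_num), e1]; norm_num
    have e3 y : k (x - y) * ‖f y‖ₑ = ((fun y => k (x - y) ^ (1/2 : ℝ)) *
        fun y => k (x - y) ^ (1/2:ℝ) * ‖f y‖ₑ) y := by
      simp
      rw [← mul_assoc, ← ENNReal.rpow_add_of_nonneg _ _ (by norm_num) (by norm_num)]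
      norm_num
    simp_rw [e1, e2] at b
    rw [lintegral_sub_left_eq_self k x, k1, ENNReal.one_rpow, one_mul] at b
    simp_rw [e3] at a
    calc _ ≤ ((∫⁻ y, k (x - y) * ‖f y‖ₑ ^ 2 ∂Λ) ^ (1/2:ℝ)) ^ 2 := by gcongr; exact a.trans b
      _ = _ := by rw [← ENNReal.rpow_natCast, ← rpow_mul]; norm_num
  calc _ ≤ ∫⁻ x, ∫⁻ y, k (x - y) * ‖f y‖ₑ ^ 2 ∂Λ ∂Λ := lintegral_mono step
    _ = ∫⁻ y, ∫⁻ x, k (x - y) * ‖f y‖ₑ ^ 2 ∂Λ ∂Λ := by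
      apply lintegral_lintegral_swap
      refine AEMeasurable.mul (f := fun p => k (p.1 - p.2))
        (g := fun p : Γ × Γ => ‖f p.2‖ₑ ^ 2) ?_ ?_
      · exact (km.comp (measurable_fst.sub measurable_snd)).aemeasurable
      · exact (hf.enorm.pow_const 2).comp_snd
    _ = _ := by
      congr 1; ext y
      rw [lintegral_mul_const (f := fun x => k (x - y)) _ (km.comp (measurable_id.sub_const y)), lintegral_sub_right_eq_self k y, k1, one_mul]

/-- The complexification of a real weight. -/
def cx (ψ : Γ → ℝ) : Γ → ℂ := fun x => (ψ x : ℂ)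

/-- Formal adjoint of the twisted antiholomorphic derivative. -/
def del (ψ : Γ → ℝ) (j : Fin n) (a : Γ → ℂ) (x : Γ) : ℂ := - đ j a x + đ j (cx ψ) x * a x

/-- The twisted antiholomorphic derivative. -/
def DD (ψ : Γ → ℝ) (j : Fin n) (a : Γ → ℂ) (x : Γ) : ℂ := ð j a x + ð j (cx ψ) x * a x

section
variable {ψ : En n → ℝ} (hψ : ContDiff ℝ ∞ ψ)
include hψ

lemma contDiff_cx : C∞ (cx ψ) := contDiff_ofReal hψ

lemma isTest_del {a : Γ → ℂ} (ha : IsTest a) (j : Fin n) : IsTest (del ψ j a) :=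
  (ha.dz _).neg.add (IsTest.mul_left (contDiff_dz (contDiff_cx hψ) (by norm_num) _) ha)

lemma isTest_DD {a : Γ → ℂ} (ha : IsTest a) (j : Fin n) : IsTest (DD ψ j a) :=
  (ha.dbar _).add (IsTest.mul_left (contDiff_dbar (contDiff_cx hψ) (by norm_num) _) ha)

omit hψ in
lemma conj_dbar_cx (v x : Γ) : conj (dbar v (cx ψ) x) = dz v (cx ψ) x := by
  rw [← dz_conj]
  congr 1
  ext y; simp [cx]

omit hψ in
lemma IsTest.integrable {a : Γ → ℂ} (ha : IsTest a) : Integrable a Λ :=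
  integrable_of_compact ha.continuous ha.supp

omit hψ in
lemma IsTest.mul {a b : Γ → ℂ} (ha : IsTest a) (hb : IsTest b) : IsTest (fun x => a x * b x) :=
  hb.mul_left ha.smooth

lemma adjoint_del {a b : Γ → ℂ} (ha : IsTest a) (hb : IsTest b) (j : Fin n) :
    ∫ x, del ψ j a x * conj (b x) ∂Λ = ∫ x, a x * conj (DD ψ j b x) ∂Λ := by
  have e1 x : del ψ j a x * conj (b x) = -(đ j a x * conj (b x)) +
      đ j (cx ψ) x * (a x * conj (b x)) := by unfold del; ring
  have e2 x : a x * conj (DD ψ j b x) = a x * đ j (fun y => conj (b y)) x +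
      đ j (cx ψ) x * (a x * conj (b x)) := by
    unfold DD
    rw [map_add, map_mul, conj_dbar_cx, dz_conj]; ring
  simp_rw [e1, e2]
  have i0 := (IsTest.mul_left (contDiff_dz (m := ∞) (contDiff_cx hψ) (by norm_num) (ee j)) (ha.mul hb.conj)).integrable
  rw [integral_add (((ha.dz _).mul hb.conj).neg).integrable i0,
    integral_add (ha.mul (hb.conj.dz _)).integrable i0, integral_neg,
    ibp_dz (ha.smooth.of_le (ENat.LEInfty.out)) (hb.conj.smooth.of_le (ENat.LEInfty.out)) hb.conj.supp]

lemma comm_DD_del {a : Γ → ℂ} (ha : IsTest a) (j k : Fin n) (x : Γ) :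
    DD ψ k (del ψ j a) x = del ψ j (DD ψ k a) x + 2 * leviForm ψ x (ee j) (ee k) * a x := by
  have hPd := (contDiff_dz (m := ∞) (contDiff_cx hψ) (by norm_num) (ee j)).differentiable (by simp)
  have hQd := (contDiff_dbar (m := ∞) (contDiff_cx hψ) (by norm_num) (ee k)).differentiable (by simp)
  have e1 : ð k (del ψ j a) x = - ð k (đ j a) x +
      (đ j (cx ψ) x * ð k a x + ð k (đ j (cx ψ)) x * a x) := by
    unfold del
    rw [dbar_add _ (((ha.dz _).neg).differentiable x) ((hPd x).fun_mul (ha.differentiable x)),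
      dbar_neg, dbar_mul _ (hPd x) (ha.differentiable x)]
  have e2 : đ j (DD ψ k a) x = đ j (ð k a) x +
      (ð k (cx ψ) x * đ j a x + đ j (ð k (cx ψ)) x * a x) := by
    unfold DD
    rw [dz_add _ ((ha.dbar _).differentiable x) ((hQd x).fun_mul (ha.differentiable x)),
      dz_mul _ (hQd x) (ha.differentiable x)]
  conv_lhs => unfold DD
  rw [e1]
  conv_rhs => unfold del
  rw [e2, dbar_dz_comm ha.contDiff_two, dbar_dz_comm ((contDiff_cx hψ).of_le ENat.LEInfty.out)]
  unfold del DD leviForm cx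
  ring

lemma del_del {a b : Γ → ℂ} (ha : IsTest a) (hb : IsTest b) (j k : Fin n) :
    ∫ x, del ψ j a x * conj (del ψ k b x) ∂Λ = ∫ x, DD ψ k a x * conj (DD ψ j b x) ∂Λ +
      ∫ x, 2 * leviForm ψ x (ee j) (ee k) * a x * conj (b x) ∂Λ := by
  have h2 := congrArg conj (adjoint_del hψ hb (isTest_del hψ ha j) k)
  rw [← integral_conj, ← integral_conj] at h2
  simp at h2
  have h3 : ∫ x, del ψ j a x * conj (del ψ k b x) ∂Λ = ∫ x, DD ψ k (del ψ j a) x * conj (b x) ∂Λ := by grind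
  rw [h3, ← adjoint_del hψ (isTest_DD hψ ha k) hb j, ← integral_add]
  · congr 1; ext x; rw [comm_DD_del hψ ha]; ring
  · exact ((isTest_del hψ (isTest_DD hψ ha k) j).mul hb.conj).integrable
  · have hL : C∞ (fun x => 2 * leviForm ψ x (ee j) (ee k)) :=
      contDiff_const.mul (contDiff_dz (contDiff_dbar (contDiff_cx hψ) (m := ∞) (by norm_num) _) (by norm_num) _)
    simpa [mul_assoc] using (IsTest.mul_left hL (ha.mul hb.conj)).integrable

omit hψ in
lemma enorm_sq_int {a : Γ → ℂ} (ha : IsTest a) :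
    ∫⁻ x, ‖a x‖ₑ ^ 2 ∂Λ = ofReal (∫ x, a x * conj (a x) ∂Λ).re := by
  have e x : a x * conj (a x) = ((‖a x‖ ^ 2 : ℝ) : ℂ) := by rw [mul_conj, normSq_eq_norm_sq]
  simp_rw [e]
  rw [integral_complex_ofReal, ofReal_re, ofReal_integral_eq_lintegral_ofReal]
  · congr 1; ext x
    simp
  · have := (ha.mul ha.conj).integrable
    simp_rw [e] at this
    exact this.re
  · exact Eventually.of_forall fun x => by positivity

omit hψ in
lemma re_int_nonneg (a : Γ → ℂ) : 0 ≤ (∫ x, a x * conj (a x) ∂Λ).re := by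
  simp_rw [(fun x => by rw [mul_conj, normSq_eq_norm_sq] : ∀ x, a x * conj (a x) = ((‖a x‖ ^ 2 : ℝ) : ℂ))]
  rw [integral_complex_ofReal, ofReal_re]
  positivity

omit hψ in
lemma IsTest.sum {ι : Type*} (s : Finset ι) {f : ι → Γ → ℂ} (hf : ∀ i ∈ s, IsTest (f i)) :
    IsTest (fun x => ∑ i ∈ s, f i x) := by
  classical
  induction s using induction_on with
  | empty => simpa using IsTest.zero
  | insert a s ha ih =>
    simp [sum_insert ha]
    exact (hf a (by simp)).add (ih fun i hi => hf i (by simp [hi]))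

/-- The basic identity. -/
lemma basic_identity {α : Fin n → Γ → ℂ} (hα : ∀ j, IsTest (α j)) :
    (∫ x, (∑ j, del ψ j (α j) x) * conj (∑ j, del ψ j (α j) x) ∂Λ) +
      (1/2) * ∑ j, ∑ k, ∫ x, (DD ψ j (α k) x - DD ψ k (α j) x) * conj (DD ψ j (α k) x - DD ψ k (α j) x) ∂Λ =
    (∑ j, ∑ k, ∫ x, DD ψ j (α k) x * conj (DD ψ j (α k) x) ∂Λ) +
      ∑ j, ∑ k, ∫ x, 2 * leviForm ψ x (ee j) (ee k) * α j x * conj (α k x) ∂Λ := by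
  have hD := fun j k => isTest_DD hψ (hα k) j
  have hd := fun j => isTest_del hψ (hα j) j
  have e1 : (∫ x, (∑ j, del ψ j (α j) x) * conj (∑ j, del ψ j (α j) x) ∂Λ) =
      ∑ j, ∑ k, ∫ x, del ψ j (α j) x * conj (del ψ k (α k) x) ∂Λ := by
    simp_rw [map_sum, Finset.sum_mul_sum]
    rw [integral_finsetSum _ fun j _ => (IsTest.sum _ fun k _ => (hd j).mul (hd k).conj).integrable]
    exact sum_congr rfl fun j _ => integral_finsetSum _ fun k _ => ((hd j).mul (hd k).conj).integrable
  have e2 j k : ∫ x, (DD ψ j (α k) x - DD ψ k (α j) x) * conj (DD ψ j (α k) x - DD ψ k (α j) x) ∂Λ =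
      (∫ x, DD ψ j (α k) x * conj (DD ψ j (α k) x) ∂Λ) +
      (∫ x, DD ψ k (α j) x * conj (DD ψ k (α j) x) ∂Λ) -
      (∫ x, DD ψ j (α k) x * conj (DD ψ k (α j) x) ∂Λ) -
      (∫ x, DD ψ k (α j) x * conj (DD ψ j (α k) x) ∂Λ) := by
    have i1 := ((hD j k).mul (hD j k).conj).integrable
    have i2 := ((hD k j).mul (hD k j).conj).integrable
    have i3 := ((hD j k).mul (hD k j).conj).integrable
    have e x : (DD ψ j (α k) x - DD ψ k (α j) x) * conj (DD ψ j (α k) x - DD ψ k (α j) x) =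
      DD ψ j (α k) x * conj (DD ψ j (α k) x) + DD ψ k (α j) x * conj (DD ψ k (α j) x) -
      DD ψ j (α k) x * conj (DD ψ k (α j) x) - DD ψ k (α j) x * conj (DD ψ j (α k) x) := by
      simp; ring
    simp_rw [e]
    rw [integral_sub, integral_sub, integral_add]
    · exact i1
    · exact i2
    · exact i1.add i2
    · exact i3
    · exact (i1.add i2).sub i3
    · exact (((hD k j).mul (hD j k).conj).integrable)
  rw [e1]
  simp_rw [e2, del_del hψ (hα _) (hα _)]
  simp [sum_add_distrib]
  rw [Finset.sum_comm (f := fun k j => ∫ x, DD ψ j (α k) x * conj (DD ψ j (α k) x) ∂Λ),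
    Finset.sum_comm (f := fun k j => ∫ x, DD ψ j (α k) x * conj (DD ψ k (α j) x) ∂Λ)]
  ring

/-- The a priori estimate for smooth compactly supported forms. -/
lemma basic_estimate {c : ℝ} (hc : 0 < c) (hlevi : ∀ z v, c * ‖v‖ ^ 2 ≤ levi ψ z v)
    {b : Γ → Γ} (hα : ∀ j, IsTest (fun x => b x j)) :
    ofReal (2 * c) * ∫⁻ x, ‖b x‖ₑ ^ 2 ∂Λ ≤ ∫⁻ x, ‖∑ j, del ψ j (fun x => b x j) x‖ₑ ^ 2 ∂Λ +
      ∑ j, ∑ k, ∫⁻ x, ‖DD ψ j (fun x => b x k) x - DD ψ k (fun x => b x j) x‖ₑ ^ 2 ∂Λ := by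
  have hB := congrArg re (basic_identity hψ hα)
  have hD := fun j k => isTest_DD hψ (hα k) j
  rw [enorm_sq_int (IsTest.sum _ fun j _ => (fun j => isTest_del hψ (hα j) j) j)]
  have e2 j k : ∫⁻ x, ‖DD ψ j (fun x => b x k) x - DD ψ k (fun x => b x j) x‖ₑ ^ 2 ∂Λ =
      ofReal (∫ x, (DD ψ j (fun x => b x k) x - DD ψ k (fun x => b x j) x) *
        conj (DD ψ j (fun x => b x k) x - DD ψ k (fun x => b x j) x) ∂Λ).re :=
    enorm_sq_int (by simpa [sub_eq_add_neg] using (hD j k).add (hD k j).neg)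
  simp_rw [e2]
  have hnn := fun j k => re_int_nonneg (fun x => DD ψ j (fun x => b x k) x - DD ψ k (fun x => b x j) x)
  have hnn2 := fun j k => re_int_nonneg (fun x => DD ψ j (fun x => b x k) x)
  have e3 : ∑ j, ∑ k, ofReal (∫ x, (DD ψ j (fun x => b x k) x - DD ψ k (fun x => b x j) x) *
        conj (DD ψ j (fun x => b x k) x - DD ψ k (fun x => b x j) x) ∂Λ).re =
      ofReal (∑ j, ∑ k, (∫ x, (DD ψ j (fun x => b x k) x - DD ψ k (fun x => b x j) x) *
        conj (DD ψ j (fun x => b x k) x - DD ψ k (fun x => b x j) x) ∂Λ).re) := by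
    rw [ENNReal.ofReal_sum_of_nonneg fun j _ => sum_nonneg fun k _ => hnn j k]
    exact sum_congr rfl fun j _ => (ENNReal.ofReal_sum_of_nonneg fun k _ => hnn j k).symm
  rw [e3, ← ofReal_add (re_int_nonneg _) (sum_nonneg fun j _ => sum_nonneg fun k _ => hnn j k)]
  have hLk j k : Integrable (fun x => 2 * leviForm ψ x (ee j) (ee k) * b x j * conj (b x k)) Λ := by
    have hL : C∞ (fun x => 2 * leviForm ψ x (ee j) (ee k)) :=
      contDiff_const.mul (contDiff_dz (contDiff_dbar (contDiff_cx hψ) (m := ∞) (by norm_num) _) (by norm_num) _)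
    simpa [mul_assoc] using (IsTest.mul_left hL ((hα j).mul (hα k).conj)).integrable
  have e4 : ∑ j, ∑ k, ∫ x, 2 * leviForm ψ x (ee j) (ee k) * b x j * conj (b x k) ∂Λ =
      ((∫ x, 2 * levi ψ x (b x) ∂Λ : ℝ) : ℂ) := by
    rw [← integral_complex_ofReal]
    simp_rw [← integral_finsetSum _ fun k _ => hLk _ k]
    rw [← integral_finsetSum _ fun j _ => integrable_finsetSum _ fun k _ => hLk j k]
    congr 1; ext x
    push_cast
    rw [levi_eq_sum (hψ.of_le ENat.LEInfty.out)]
    simp [mul_sum, mul_assoc]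
  have hbi : Integrable (fun x => ‖b x‖ ^ 2) Λ := by
    simp_rw [EuclideanSpace.norm_sq_eq]
    refine integrable_finsetSum _ fun j _ => ?_
    have := ((hα j).mul (hα j).conj).integrable
    simp_rw [(fun x => by rw [mul_conj, normSq_eq_norm_sq] : ∀ x, b x j * conj (b x j) = ((‖b x j‖ ^ 2 : ℝ) : ℂ))] at this
    exact this.re
  have hli : Integrable (fun x => 2 * levi ψ x (b x)) Λ := by
    have : Integrable (fun x => ((2 * levi ψ x (b x) : ℝ) : ℂ)) Λ := by
      have := integrable_finsetSum (Finset.univ) fun j _ => integrable_finsetSum (Finset.univ) fun k _ => hLk j k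
      refine this.congr (Eventually.of_forall fun x => ?_)
      push_cast
      rw [levi_eq_sum (hψ.of_le ENat.LEInfty.out)]
      simp [mul_sum, mul_assoc]
    exact this.re
  have e5 : ofReal (2 * c) * ∫⁻ x, ‖b x‖ₑ ^ 2 ∂Λ = ofReal (∫ x, 2 * (c * ‖b x‖ ^ 2) ∂Λ) := by
    simp_rw [← mul_assoc]
    rw [integral_const_mul, ofReal_mul (p := 2 * c) (by positivity),
      ofReal_integral_eq_lintegral_ofReal hbi (Eventually.of_forall fun x => by positivity)]
    congr 2; ext x; rw [ofReal_pow (norm_nonneg _), ofReal_norm]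
  rw [e5]
  apply ofReal_le_ofReal
  have h6 : ∫ x, 2 * (c * ‖b x‖ ^ 2) ∂Λ ≤ ∫ x, 2 * levi ψ x (b x) ∂Λ := by
    apply integral_mono ((hbi.const_mul c).const_mul 2) hli
    intro x
    have := hlevi x (b x)
    simp only
    linarith
  rw [e4] at hB
  simp only [Complex.add_re, ofReal_re] at hB
  rw [show (1/2:ℂ) = ((1/2:ℝ):ℂ) by norm_num, re_ofReal_mul] at hB
  simp only [re_sum] at hB
  have p1 := sum_nonneg fun j (_ : j ∈ Finset.univ) => sum_nonneg fun k (_ : k ∈ Finset.univ) => hnn j k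
  have p2 := sum_nonneg fun j (_ : j ∈ Finset.univ) => sum_nonneg fun k (_ : k ∈ Finset.univ) => hnn2 j k
  linarith

end

lemma norm_ee (j : Fin n) : ‖(ee j : Γ)‖ = 1 := by simp [ee]

lemma norm_dbar_le {z v : Γ} {s : ℝ} (h : ‖∇ f z‖ ≤ s) : ‖dbar v f z‖ ≤ s * ‖v‖ := by
  unfold dbar
  have h1 := (∇ f z).le_of_opNorm_le h v
  have h2 := (∇ f z).le_of_opNorm_le h (I • v)
  rw [norm_smul, norm_I, one_mul] at h2
  rw [norm_div, norm_ofNat, div_le_iff₀ (by norm_num)]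
  calc _ ≤ ‖∇ f z v‖ + ‖I * ∇ f z (I • v)‖ := norm_add_le _ _
    _ ≤ _ := by rw [norm_mul, norm_I, one_mul]; linarith

lemma norm_dz_le {z v : Γ} {s : ℝ} (h : ‖∇ f z‖ ≤ s) : ‖dz v f z‖ ≤ s * ‖v‖ := by
  unfold dz
  have h1 := (∇ f z).le_of_opNorm_le h v
  have h2 := (∇ f z).le_of_opNorm_le h (I • v)
  rw [norm_smul, norm_I, one_mul] at h2
  rw [norm_div, norm_ofNat, div_le_iff₀ (by norm_num)]
  calc _ ≤ ‖∇ f z v‖ + ‖I * ∇ f z (I • v)‖ := norm_sub_le _ _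
    _ ≤ _ := by rw [norm_mul, norm_I, one_mul]; linarith

lemma cx_fderiv_norm_le {f : Γ → ℝ} {x : Γ} {s : ℝ} (hf : DifferentiableAt ℝ f x)
    (h : ‖∇ f x‖ ≤ s) : ‖∇ (cx f) x‖ ≤ s := by
  refine ContinuousLinearMap.opNorm_le_bound _ ((norm_nonneg _).trans h) fun v => ?_
  unfold cx
  rw [fderiv_ofReal hf, norm_real]
  exact (∇ f x).le_of_opNorm_le h v

lemma rad_scale (hr : 0 < r) (x : Γ) : rad r x = rad 1 (r⁻¹ • x) := by
  unfold rad
  rw [norm_smul, norm_of_nonneg (by positivity)]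
  grind

/-- The derivative of the cutoff decays like the inverse of the radius. -/
lemma exists_fderiv_rad_le (n : ℕ) : ∃ A : ℝ, 0 < A ∧ ∀ r : ℝ, 0 < r → ∀ x : En n, ‖∇ (rad r) x‖ ≤ A / r := by
  have hd := (contDiff_rad (n := n) 1).continuous_fderiv (by simp)
  obtain ⟨A, hA⟩ := hd.bounded_above_of_compact_support ((hasCompactSupport_rad (n := n) one_pos).fderiv (𝕜 := ℝ))
  refine ⟨|A| + 1, by positivity, fun r hr x => ?_⟩
  rw [(funext fun x => rad_scale hr x), fderiv_comp_smul, norm_smul, norm_of_nonneg (by positivity), div_eq_inv_mul]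
  gcongr
  exact (hA _).trans ((le_abs_self A).trans (by linarith))

lemma isTest_cx {f : Γ → ℝ} (hf : C∞ f) (hs : HasCompactSupport f) : IsTest (cx f) :=
  ⟨contDiff_ofReal hf, hs.comp_left (g := fun t : ℝ => (t : ℂ)) ofReal_zero⟩

lemma isTest_cx_rad (hr : 0 < r) : IsTest (cx (rad r) : Γ → ℂ) :=
  isTest_cx (contDiff_rad r) (hasCompactSupport_rad hr)

lemma locInt_comp {β : Γ → Γ} (hβ : MemLp β 2 Λ) (j : Fin n) :
    LocallyIntegrable (fun y => β y j) Λ := by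
  have : MemLp (fun y => β y j) 2 Λ := by
    refine hβ.mono ?_ (Eventually.of_forall fun y => PiLp.norm_apply_le _ _)
    exact (EuclideanSpace.proj (𝕜 := ℂ) j).continuous.comp_aestronglyMeasurable hβ.1
  exact this.locallyIntegrable (by norm_num)

section
variable {ψ : En n → ℝ} (hψ : ContDiff ℝ ∞ ψ)
include hψ

/-- The mollified cutoff form. -/
def cutConv (R ε : ℝ) (β : Γ → Γ) (x : Γ) : Γ :=
  WithLp.toLp 2 fun j => mconv ε (fun y => cx (rad R) y * β y j) x

omit hψ in
lemma locInt_cut {R : ℝ} {β : Γ → Γ} (hβ : MemLp β 2 Λ) (j : Fin n) :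
    LocallyIntegrable (fun y => cx (rad R) y * β y j) Λ := by
  have hm := (locInt_comp hβ j).aestronglyMeasurable
  have hc : Continuous (cx (rad R) : Γ → ℂ) := (contDiff_cx (contDiff_rad R)).continuous
  refine (locInt_comp hβ j).mono (hc.aestronglyMeasurable.mul hm) (Eventually.of_forall fun y => ?_)
  rw [norm_mul, cx, norm_real, norm_of_nonneg (rad_nonneg _ _)]
  exact mul_le_of_le_one_left (norm_nonneg _) (rad_le_one _ _)

omit hψ in
lemma hasCompactSupport_mconv (hr : 0 < r) (hf : HasCompactSupport f) : HasCompactSupport (mconv r f) := by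
  have := HasCompactSupport.convolution (μ := Λ) (lsmul ℝ ℝ) (hasCompactSupport_moll hr) hf
  exact this

omit hψ in
lemma isTest_cutConv {R ε : ℝ} (hR : 0 < R) (hε : 0 < ε) {β : Γ → Γ}
    (hβ : MemLp β 2 Λ) (j : Fin n) : IsTest (fun x => cutConv R ε β x j) := by
  refine ⟨contDiff_mconv hε (locInt_cut hβ j), ?_⟩
  have h1 : HasCompactSupport (fun y => cx (rad R) y * β y j) := (isTest_cx_rad hR).supp.mul_right
  have h2 := hasCompactSupport_mconv hε h1
  exact h2

omit hψ in
lemma norm_integral_le_of_le {g : Γ → ℝ} (hg : Integrable g Λ)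
    (h : ∀ x, ‖f x‖ ≤ g x) : ‖∫ x, f x ∂Λ‖ ≤ ∫ x, g x ∂Λ :=
  norm_integral_le_of_norm_le hg (Eventually.of_forall h)

omit hψ in
lemma exists_eps_unif (F : Fin n → Γ → ℂ) (hF : ∀ j, Continuous (F j)) {R s : ℝ} (hR : 0 < R)
    (hs : 0 < s) : ∃ ε₀ > 0, ∀ ε, 0 < ε → ε < ε₀ → ∀ j x y, moll ε (x - y) * rad R y ≠ 0 → ‖F j x - F j y‖ ≤ s := by
  have hu := fun j => (isCompact_closedBall 0 (2 * R + 1)).uniformContinuousOn_of_continuous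
    (hF j).continuousOn
  choose δ hδ hδ' using (fun j => (Metric.uniformContinuousOn_iff_le.1 (hu j)) s hs)
  obtain ⟨d, hd, hd'⟩ : ∃ d > 0, ∀ j, d ≤ δ j := by
    rcases isEmpty_or_nonempty (Fin n) with h | h
    · exact ⟨1, one_pos, fun j => h.elim j⟩
    · exact ⟨Finset.univ.inf' Finset.univ_nonempty δ, by simp [hδ], fun j => Finset.inf'_le _ (by simp)⟩
  refine ⟨min (d / 2) (1 / 2), by positivity, fun ε hε hε' j x y hxy => ?_⟩
  have h1 : ‖x - y‖ < 2 * ε := by by_contra! h; exact hxy (by rw [moll_eq_zero hε h, zero_mul])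
  have h2 : ‖y‖ < 2 * R := by by_contra! h; exact hxy (by rw [rad_eq_zero' hR h, mul_zero])
  have h3 := lt_min_iff.1 hε'
  rw [← dist_eq_norm]
  apply hδ' j
  · rw [mem_closedBall_zero_iff]
    have := norm_le_norm_add_norm_sub' x y
    linarith
  · rw [mem_closedBall_zero_iff]; linarith
  · rw [dist_eq_norm]; linarith [hd' j]

omit hψ in
lemma integrable_moll_norm {ε : ℝ} (hε : 0 < ε) {F : Type*} [NormedAddCommGroup F] [NormedSpace ℝ F]
    {f : Γ → F} (hf : LocallyIntegrable f Λ) (x : Γ) :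
    Integrable (fun y => moll ε (x - y) * ‖f y‖) Λ := by
  have := (integrable_moll_smul hε hf x).norm
  refine this.congr (Eventually.of_forall fun y => ?_)
  simp [norm_smul, norm_of_nonneg (moll_nonneg hε _)]

lemma del_cutConv_le {R ε s : ℝ} (hR : 0 < R) (hε : 0 < ε) (hs : ∀ x : Γ, ‖∇ (rad R) x‖ ≤ s)
    (hP : ∀ j x y, moll ε (x - y) * rad R y ≠ 0 → ‖đ j (cx ψ) x - đ j (cx ψ) y‖ ≤ s)
    {β : Γ → Γ} (hβ : MemLp β 2 Λ) {κ : Γ → ℂ} (hκ : MemLp κ 2 Λ)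
    (hδ : ∀ h, IsTest h → ∫ x, h x * κ x ∂Λ =
      ∑ j, ∫ x, (đ j h x + đ j (cx ψ) x * h x) * β x j ∂Λ) (x : Γ) :
    ‖∑ j, del ψ j (fun x => cutConv R ε β x j) x‖ ≤ ∫ y, moll ε (x - y) * ‖‖κ y‖ + 2 * n * s * ‖β y‖‖ ∂Λ := by
  have hs0 := (norm_nonneg _).trans (hs 0)
  set m := fun y => ((moll ε (x - y) : ℝ) : ℂ) with hm
  have tm := isTest_moll_sub hε x
  have tη : IsTest (cx (rad R) : Γ → ℂ) := isTest_cx_rad hR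
  set h := fun y => cx (rad R) y * m y with hh
  have th := tη.mul tm
  have lβ := fun j => locInt_comp hβ j
  have e1 j : del ψ j (fun x => cutConv R ε β x j) x =
      ∫ y, β y j * (cx (rad R) y * đ j m y + đ j (cx ψ) x * h y) ∂Λ := by
    have : (fun x => cutConv R ε β x j) = mconv ε (fun y => cx (rad R) y * β y j) := rfl
    rw [del, this, dz_mconv hε (locInt_cut hβ j), neg_neg, show cutConv R ε β x j = mconv ε (fun y => cx (rad R) y * β y j) x from rfl, mconv_eq', ← integral_const_mul, ← integral_add]
    · congr 1; ext y
      simp; ring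
    · exact integrable_mul_test (locInt_cut hβ j) (tm.dz _).continuous (tm.dz _).supp
    · exact (integrable_moll_smul hε (locInt_cut hβ j) x).const_mul _
  have t1 j : IsTest (fun y => cx (rad R) y * đ j m y + đ j (cx ψ) x * h y) := (tη.mul (tm.dz _)).add (th.mul_left contDiff_const)
  have t2 j : IsTest (fun y => đ j h y + đ j (cx ψ) y * h y) := (th.dz _).add (th.mul_left ((fun j => contDiff_dz (m := ∞) (contDiff_cx hψ) (by norm_num) (ee j)) j))
  have e2 : ∑ j, del ψ j (fun x => cutConv R ε β x j) x = ∫ y, h y * κ y ∂Λ +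
      ∑ j, ∫ y, β y j * (m y * (-đ j (cx (rad R)) y +
        (đ j (cx ψ) x - đ j (cx ψ) y) * cx (rad R) y)) ∂Λ := by
    rw [hδ h th, ← sum_add_distrib]
    refine sum_congr rfl fun j _ => ?_
    rw [e1, ← sub_eq_iff_eq_add', ← integral_sub]
    · congr 1; ext y
      rw [hh, dz_mul _ (tη.differentiable y) (tm.differentiable y)]
      ring
    · exact integrable_mul_test (lβ j) (t1 j).continuous (t1 j).supp
    · simp_rw [mul_comm _ (β _ j)]
      exact integrable_mul_test (lβ j) (t2 j).continuous (t2 j).supp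
  rw [e2]
  have i1 := integrable_moll_norm hε (hκ.locallyIntegrable (by norm_num)) x
  have i2 := integrable_moll_norm hε (hβ.locallyIntegrable (by norm_num)) x
  have b1 : ‖∫ y, h y * κ y ∂Λ‖ ≤ ∫ y, moll ε (x - y) * ‖κ y‖ ∂Λ := by
    refine norm_integral_le_of_le i1 fun y => ?_
    rw [hh, norm_mul, norm_mul, hm, cx, norm_real, norm_real,
      norm_of_nonneg (moll_nonneg hε _), norm_of_nonneg (rad_nonneg _ _)]
    gcongr
    exact mul_le_of_le_one_left (moll_nonneg hε _) (rad_le_one _ _)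
  have b2 j : ‖∫ y, β y j * (m y * (-đ j (cx (rad R)) y +
        (đ j (cx ψ) x - đ j (cx ψ) y) * cx (rad R) y)) ∂Λ‖ ≤
        ∫ y, 2 * s * (moll ε (x - y) * ‖β y‖) ∂Λ := by
    refine norm_integral_le_of_le (i2.const_mul _) fun y => ?_
    have q1 : ‖đ j (cx (rad R)) y‖ ≤ s := by
      have := norm_dz_le (v := ee j) (cx_fderiv_norm_le ((contDiff_rad R).differentiable (by simp) y) (hs y))
      rwa [norm_ee, mul_one] at this
    have q2 : ‖m y * ((đ j (cx ψ) x - đ j (cx ψ) y) * cx (rad R) y)‖ ≤ moll ε (x - y) * s := by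
      rw [norm_mul, norm_mul, hm, cx, norm_real, norm_real,
        norm_of_nonneg (moll_nonneg hε _), norm_of_nonneg (rad_nonneg _ _)]
      by_cases h0 : moll ε (x - y) * rad R y = 0
      · rw [mul_comm (‖_‖) (rad R y), ← mul_assoc, h0, zero_mul]
        exact mul_nonneg (moll_nonneg hε _) hs0
      · exact mul_le_mul_of_nonneg_left ((mul_le_of_le_one_right (norm_nonneg _) (rad_le_one _ _)).trans
          (hP j x y h0)) (moll_nonneg hε _)
    rw [norm_mul, mul_add]
    have q3 : ‖m y * -đ j (cx (rad R)) y‖ ≤ moll ε (x - y) * s := by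
      rw [norm_mul, norm_neg, hm, norm_real, norm_of_nonneg (moll_nonneg hε _)]
      exact mul_le_mul_of_nonneg_left q1 (moll_nonneg hε _)
    have q4 := norm_add_le_of_le q3 q2
    calc _ ≤ ‖β y‖ * (moll ε (x - y) * s + moll ε (x - y) * s) := by
          gcongr
          exact PiLp.norm_apply_le _ _
      _ = _ := by ring
  calc _ ≤ ∫ y, moll ε (x - y) * ‖κ y‖ ∂Λ + ∑ j, ∫ y, 2 * s * (moll ε (x - y) * ‖β y‖) ∂Λ :=
        norm_add_le_of_le b1 (norm_sum_le_of_le _ fun j _ => b2 j)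
    _ = _ := by
      rw [Finset.sum_const, card_univ, Fintype.card_fin, nsmul_eq_mul, ← integral_const_mul,
        ← integral_add i1 ((i2.const_mul _).const_mul _)]
      congr 1; ext y
      rw [norm_of_nonneg (by positivity)]; ring

lemma curl_cutConv_le {R ε s : ℝ} (hR : 0 < R) (hε : 0 < ε) (hs : ∀ x : Γ, ‖∇ (rad R) x‖ ≤ s)
    (hQ : ∀ j x y, moll ε (x - y) * rad R y ≠ 0 → ‖ð j (cx ψ) x - ð j (cx ψ) y‖ ≤ s)
    {β : Γ → Γ} (hβ : MemLp β 2 Λ)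
    (hcurl : ∀ j k h, IsTest h → ∫ x, β x k * (- ð j h x + ð j (cx ψ) x * h x) ∂Λ =
      ∫ x, β x j * (- ð k h x + ð k (cx ψ) x * h x) ∂Λ)
    (j k : Fin n) (x : Γ) :
    ‖DD ψ j (fun x => cutConv R ε β x k) x - DD ψ k (fun x => cutConv R ε β x j) x‖ ≤
      ∫ y, moll ε (x - y) * ‖4 * s * ‖β y‖‖ ∂Λ := by
  have hs0 := (norm_nonneg _).trans (hs 0)
  set m := fun y => ((moll ε (x - y) : ℝ) : ℂ) with hm
  have tm := isTest_moll_sub hε x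
  have tη : IsTest (cx (rad R) : Γ → ℂ) := isTest_cx_rad hR
  set h := fun y => cx (rad R) y * m y with hh
  have th := tη.mul tm
  have lβ := fun j => locInt_comp hβ j
  have e1 j k : DD ψ j (fun x => cutConv R ε β x k) x =
      ∫ y, β y k * (- (cx (rad R) y * ð j m y) + ð j (cx ψ) x * h y) ∂Λ := by
    have : (fun x => cutConv R ε β x k) = mconv ε (fun y => cx (rad R) y * β y k) := rfl
    rw [DD, this, dbar_mconv hε (locInt_cut hβ k), show cutConv R ε β x k = mconv ε (fun y => cx (rad R) y * β y k) x from rfl, mconv_eq', ← integral_const_mul, ← integral_neg, ← integral_add]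
    · congr 1; ext y
      simp; ring
    · exact (integrable_mul_test (locInt_cut hβ k) (tm.dbar _).continuous (tm.dbar _).supp).neg
    · exact (integrable_moll_smul hε (locInt_cut hβ k) x).const_mul _
  have t1 j : IsTest (fun y => -(cx (rad R) y * ð j m y) + ð j (cx ψ) x * h y) := (tη.mul (tm.dbar _)).neg.add (th.mul_left contDiff_const)
  have t2 j : IsTest (fun y => -ð j h y + ð j (cx ψ) y * h y) := (th.dbar _).neg.add (th.mul_left ((fun j => contDiff_dbar (m := ∞) (contDiff_cx hψ) (by norm_num) (ee j)) j))
  have e2 j k : DD ψ j (fun x => cutConv R ε β x k) x -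
      ∫ x, β x k * (- ð j h x + ð j (cx ψ) x * h x) ∂Λ =
      ∫ y, β y k * (m y * (ð j (cx (rad R)) y +
        (ð j (cx ψ) x - ð j (cx ψ) y) * cx (rad R) y)) ∂Λ := by
    rw [e1, ← integral_sub]
    · congr 1; ext y
      rw [hh, dbar_mul _ (tη.differentiable y) (tm.differentiable y)]
      ring
    · exact integrable_mul_test (lβ k) (t1 j).continuous (t1 j).supp
    · exact integrable_mul_test (lβ k) (t2 j).continuous (t2 j).supp
  have e3 : DD ψ j (fun x => cutConv R ε β x k) x - DD ψ k (fun x => cutConv R ε β x j) x =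
      (∫ y, β y k * (m y * (ð j (cx (rad R)) y +
        (ð j (cx ψ) x - ð j (cx ψ) y) * cx (rad R) y)) ∂Λ) -
      (∫ y, β y j * (m y * (ð k (cx (rad R)) y +
        (ð k (cx ψ) x - ð k (cx ψ) y) * cx (rad R) y)) ∂Λ) := by
    rw [← e2, ← e2, hcurl j k h th]; ring
  rw [e3]
  have i2 := integrable_moll_norm hε (hβ.locallyIntegrable (by norm_num)) x
  have b2 j k : ‖∫ y, β y k * (m y * (ð j (cx (rad R)) y +
        (ð j (cx ψ) x - ð j (cx ψ) y) * cx (rad R) y)) ∂Λ‖ ≤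
        ∫ y, 2 * s * (moll ε (x - y) * ‖β y‖) ∂Λ := by
    refine norm_integral_le_of_le (i2.const_mul _) fun y => ?_
    have q1 : ‖ð j (cx (rad R)) y‖ ≤ s := by
      have := norm_dbar_le (v := ee j) (cx_fderiv_norm_le ((contDiff_rad R).differentiable (by simp) y) (hs y))
      rwa [norm_ee, mul_one] at this
    have q2 : ‖m y * ((ð j (cx ψ) x - ð j (cx ψ) y) * cx (rad R) y)‖ ≤ moll ε (x - y) * s := by
      rw [norm_mul, norm_mul, hm, cx, norm_real, norm_real,
        norm_of_nonneg (moll_nonneg hε _), norm_of_nonneg (rad_nonneg _ _)]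
      by_cases h0 : moll ε (x - y) * rad R y = 0
      · rw [mul_comm (‖_‖) (rad R y), ← mul_assoc, h0, zero_mul]
        exact mul_nonneg (moll_nonneg hε _) hs0
      · exact mul_le_mul_of_nonneg_left ((mul_le_of_le_one_right (norm_nonneg _) (rad_le_one _ _)).trans
          (hQ j x y h0)) (moll_nonneg hε _)
    rw [norm_mul, mul_add]
    have q3 : ‖m y * ð j (cx (rad R)) y‖ ≤ moll ε (x - y) * s := by
      rw [norm_mul, hm, norm_real, norm_of_nonneg (moll_nonneg hε _)]
      exact mul_le_mul_of_nonneg_left q1 (moll_nonneg hε _)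
    have q4 := norm_add_le_of_le q3 q2
    calc _ ≤ ‖β y‖ * (moll ε (x - y) * s + moll ε (x - y) * s) := by
          gcongr
          exact PiLp.norm_apply_le _ _
      _ = _ := by ring
  calc _ ≤ ∫ y, 2 * s * (moll ε (x - y) * ‖β y‖) ∂Λ + ∫ y, 2 * s * (moll ε (x - y) * ‖β y‖) ∂Λ :=
        norm_sub_le_of_le (b2 j k) (b2 k j)
    _ = _ := by
      rw [← integral_add (i2.const_mul _) (i2.const_mul _)]
      congr 1; ext y
      rw [norm_of_nonneg (by positivity)]; ring

end

lemma fatou_bound {X : Type*} [MeasurableSpace X] {μ : Measure X} {f : ℕ → X → ℝ≥0∞} {g : X → ℝ≥0∞}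
    (hf : ∀ k, AEMeasurable (f k) μ) (h : ∀ᵐ x ∂μ, Tendsto (fun k => f k x) atTop (𝓝 (g x)))
    {B : ℝ≥0∞} (hB : ∀ᶠ k in atTop, ∫⁻ x, f k x ∂μ ≤ B) : ∫⁻ x, g x ∂μ ≤ B := by
  have e :=
    lintegral_congr_ae (h.mono fun x hx => hx.liminf_eq.symm)
  rw [e]
  refine (lintegral_liminf_le' hf).trans ?_
  exact liminf_le_of_frequently_le' hB.frequently

lemma enorm_sq_add_le (a b : ℝ≥0∞) : (a + b) ^ 2 ≤ 2 * a ^ 2 + 2 * b ^ 2 := by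
  rcases eq_or_ne a ⊤ with rfl | ha
  · simp
  rcases eq_or_ne b ⊤ with rfl | hb
  · simp
  lift a to ℝ≥0 using ha
  lift b to ℝ≥0 using hb
  have := add_sq_le (a := a) (b := b)
  rw [mul_add] at this
  exact_mod_cast this

section
variable {ψ : En n → ℝ} (hψ : ContDiff ℝ ∞ ψ)
include hψ

omit hψ in
lemma isTest_continuous_form {b : Γ → Γ} (hb : ∀ j, IsTest (fun x => b x j)) : Continuous b := by
  have : b = fun x => WithLp.toLp 2 (fun j => b x j) := rfl
  rw [this]
  exact (PiLp.continuous_toLp 2 _).comp (continuous_pi fun j => (hb j).continuous)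

/-- The a priori estimate for square integrable weakly closed forms. -/
lemma density_estimate {c : ℝ} (hc : 0 < c) (hlevi : ∀ z v, c * ‖v‖ ^ 2 ≤ levi ψ z v)
    {β : Γ → Γ} (hβ : MemLp β 2 Λ) {κ : Γ → ℂ} (hκ : MemLp κ 2 Λ)
    (hδ : ∀ h, IsTest h → ∫ x, h x * κ x ∂Λ =
      ∑ j, ∫ x, (đ j h x + đ j (cx ψ) x * h x) * β x j ∂Λ)
    (hcurl : ∀ j k h, IsTest h → ∫ x, β x k * (- ð j h x + ð j (cx ψ) x * h x) ∂Λ =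
      ∫ x, β x j * (- ð k h x + ð k (cx ψ) x * h x) ∂Λ) :
    ofReal c * ∫⁻ x, ‖β x‖ₑ ^ 2 ∂Λ ≤ ∫⁻ x, ‖κ x‖ₑ ^ 2 ∂Λ := by
  set B := ∫⁻ x, ‖β x‖ₑ ^ 2 ∂Λ
  set N := ∫⁻ x, ‖κ x‖ₑ ^ 2 ∂Λ
  have hBt : B ≠ ⊤ := by
    have := hβ.eLpNorm_lt_top
    rw [eLpNorm_lt_top_iff_lintegral_rpow_enorm_lt_top (by norm_num) (by norm_num)] at this
    simpa using this.ne
  have c2 : ofReal (2 * c) ≠ 0 := by simp [hc]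
  have mβ := hβ.1.enorm
  have mκ := hκ.1.enorm
  obtain ⟨A, hA, hAr⟩ := exists_fderiv_rad_le n
  have main s (hs : 0 < s) : ofReal (2 * c) * B ≤ 2 * N + ofReal (24 * n ^ 2 * s ^ 2) * B := by
    set D := 2 * N + ofReal (24 * n ^ 2 * s ^ 2) * B with hD
    have step R (hR : 0 < R) (hAR : A / R ≤ s) : ∫⁻ x, ‖rad R x • β x‖ₑ ^ 2 ∂Λ ≤ D / ofReal (2 * c) := by
      have hfs := fun x => (hAr R hR x).trans hAR
      obtain ⟨ε₁, hε₁, hP⟩ := exists_eps_unif (fun j => đ j (cx ψ))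
        (fun j => (contDiff_dz (m := ∞) (contDiff_cx hψ) (by norm_num) (ee j)).continuous) hR hs
      obtain ⟨ε₂, hε₂, hQ⟩ := exists_eps_unif (fun j => ð j (cx ψ))
        (fun j => (contDiff_dbar (m := ∞) (contDiff_cx hψ) (by norm_num) (ee j)).continuous) hR hs
      have hpos (k : ℕ) : 0 < 1 / ((k:ℝ) + 1) := Nat.one_div_pos_of_nat
      apply fatou_bound (f := fun k x => ‖cutConv R (1 / ((k:ℝ) + 1)) β x‖ₑ ^ 2)
      · intro k
        exact ((isTest_continuous_form fun j => isTest_cutConv hR (hpos k) hβ j).enorm.measurable.pow_const 2).aemeasurable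
      · have := fun j => ae_tendsto_mconv (locInt_cut (R := R) hβ j)
        filter_upwards [ae_all_iff.2 this] with x hx
        have h1 : Tendsto (fun k : ℕ => cutConv R (1 / ((k:ℝ) + 1)) β x) atTop (𝓝 (rad R x • β x)) := by
          rw [(by ext j; simp [cx] : rad R x • β x = WithLp.toLp 2 (fun j => cx (rad R) x * β x j))]
          exact (PiLp.continuous_toLp 2 _).continuousAt.tendsto.comp (tendsto_pi_nhds.2 hx)
        exact ((ENNReal.continuous_pow 2).tendsto _).comp h1.enorm
      · have hev :=
          tendsto_one_div_add_atTop_nhds_zero_nat.eventually_lt_const (lt_min hε₁ hε₂)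
        filter_upwards [hev] with k hk
        set ε := 1 / ((k:ℝ) + 1)
        have hεp := hpos k
        rw [ENNReal.le_div_iff_mul_le (Or.inl c2) (Or.inl ofReal_ne_top), mul_comm]
        refine (basic_estimate hψ hc hlevi (b := cutConv R ε β) fun j => isTest_cutConv hR hεp hβ j).trans ?_
        have p1 := fun j x y => hP ε hεp (hk.trans_le (min_le_left _ _)) j x y
        have p2 := fun j x y => hQ ε hεp (hk.trans_le (min_le_right _ _)) j x y
        have q1 : ∫⁻ x, ‖∑ j, del ψ j (fun x => cutConv R ε β x j) x‖ₑ ^ 2 ∂Λ ≤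
            2 * N + ofReal (8 * n ^ 2 * s ^ 2) * B := by
          calc _ ≤ ∫⁻ x, ofReal (∫ y, moll ε (x - y) * ‖‖κ y‖ + 2 * n * s * ‖β y‖‖ ∂Λ) ^ 2 ∂Λ := by
                gcongr with x
                rw [← ofReal_norm]
                exact ofReal_le_ofReal ((del_cutConv_le hψ hR hεp hfs p1 hβ hκ hδ) x)
            _ ≤ ∫⁻ x, ‖‖κ x‖ + 2 * n * s * ‖β x‖‖ₑ ^ 2 ∂Λ :=
                lintegral_mconv_sq_le hεp (hκ.1.norm.add (hβ.1.norm.const_mul _))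
            _ ≤ ∫⁻ x, (2 * ‖κ x‖ₑ ^ 2 + ofReal (8 * n ^ 2 * s ^ 2) * ‖β x‖ₑ ^ 2) ∂Λ := by
                gcongr with x
                have : ‖‖κ x‖ + 2 * n * s * ‖β x‖‖ₑ = ‖κ x‖ₑ + ofReal (2 * n * s) * ‖β x‖ₑ := by
                  rw [← ofReal_norm, norm_of_nonneg (by positivity), ofReal_add (by positivity) (by positivity),
                    ofReal_mul (by positivity), ofReal_norm, ofReal_norm]
                rw [this]
                refine (enorm_sq_add_le _ _).trans (le_of_eq ?_)
                rw [mul_pow, ← ofReal_pow (by positivity), ← mul_assoc]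
                congr 2
                rw [show (2:ℝ≥0∞) = ofReal 2 by simp, ← ofReal_mul (by norm_num)]
                congr 1; ring
            _ = _ := by
                rw [lintegral_add_left' ((mκ.pow_const 2).const_mul _), lintegral_const_mul'' _ (mκ.pow_const 2),
                  lintegral_const_mul'' _ (mβ.pow_const 2)]
        have q2 j k : ∫⁻ x, ‖DD ψ j (fun x => cutConv R ε β x k) x - DD ψ k (fun x => cutConv R ε β x j) x‖ₑ ^ 2 ∂Λ ≤
            ofReal (16 * s ^ 2) * B := by
          calc _ ≤ ∫⁻ x, ofReal (∫ y, moll ε (x - y) * ‖4 * s * ‖β y‖‖ ∂Λ) ^ 2 ∂Λ := by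
                gcongr with x
                rw [← ofReal_norm]
                exact ofReal_le_ofReal ((curl_cutConv_le hψ hR hεp hfs p2 hβ hcurl) j k x)
            _ ≤ ∫⁻ x, ‖4 * s * ‖β x‖‖ₑ ^ 2 ∂Λ := lintegral_mconv_sq_le hεp (hβ.1.norm.const_mul _)
            _ = ∫⁻ x, ofReal (16 * s ^ 2) * ‖β x‖ₑ ^ 2 ∂Λ := by
                congr 1; ext x
                rw [← ofReal_norm, norm_of_nonneg (by positivity), ofReal_mul (by positivity), ofReal_norm,
                  mul_pow, ← ofReal_pow (by positivity)]
                congr 2; ring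
            _ = _ := lintegral_const_mul'' _ (mβ.pow_const 2)
        calc _ ≤ (2 * N + ofReal (8 * n ^ 2 * s ^ 2) * B) + ∑ j, ∑ k, ofReal (16 * s ^ 2) * B := by
              gcongr
              exact q2 _ _
          _ = D := by
              rw [hD]
              simp only [Finset.sum_const, card_univ, Fintype.card_fin]
              rw [show (24 * (n:ℝ) ^ 2 * s ^ 2) = 8 * n ^ 2 * s ^ 2 + n * (n * (16 * s ^ 2)) by ring,
                ofReal_add (by positivity) (by positivity), ofReal_mul (p := (n:ℝ)) (by positivity),
                ofReal_mul (p := (n:ℝ)) (by positivity), ENNReal.ofReal_natCast]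
              ring
    have : B ≤ D / ofReal (2 * c) := by
      apply fatou_bound (f := fun k x => ‖rad (k:ℝ) x • β x‖ₑ ^ 2)
      · intro k
        exact (((continuous_rad (k:ℝ)).aestronglyMeasurable.smul hβ.1).enorm).pow_const 2
      · refine Eventually.of_forall fun x => ?_
        apply tendsto_const_nhds.congr'
        obtain ⟨k₀, hk₀⟩ := exists_nat_gt ‖x‖
        filter_upwards [eventually_ge_atTop k₀, eventually_gt_atTop 0] with k hk hk'
        have : (k₀ : ℝ) ≤ k := by exact_mod_cast hk
        rw [rad_eq_one (by exact_mod_cast hk') (hk₀.le.trans this), one_smul]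
      · have hev :=
          (tendsto_const_div_atTop_nhds_zero_nat A).eventually_lt_const hs
        filter_upwards [hev, eventually_gt_atTop 0] with k hk hk'
        exact step k (by exact_mod_cast hk') hk.le
    rwa [ENNReal.le_div_iff_mul_le (Or.inl c2) (Or.inl ofReal_ne_top), mul_comm] at this
  have lim : Tendsto (fun k : ℕ => 2 * N + ofReal (24 * n ^ 2 * (1 / ((k:ℝ) + 1)) ^ 2) * B) atTop
      (𝓝 (2 * N + 0 * B)) := by
    apply Tendsto.add tendsto_const_nhds
    refine ENNReal.Tendsto.mul_const ?_ (Or.inr hBt)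
    have := ((tendsto_one_div_add_atTop_nhds_zero_nat (𝕜 := ℝ)).pow 2).const_mul (24 * (n:ℝ) ^ 2)
    have := tendsto_ofReal this
    simpa using this
  have := ge_of_tendsto' lim fun k => main (1 / ((k:ℝ) + 1)) Nat.one_div_pos_of_nat
  rw [zero_mul, add_zero, ofReal_mul (by norm_num), mul_assoc] at this
  simp at this
  exact (ENNReal.mul_le_mul_iff_right (by norm_num) (by norm_num)).1 this

end

/-- A bounded functional on the range of a linear map into a Hilbert space is represented by a
vector in the closure of the range. -/
lemma exists_repr_of_bound {V H : Type*} [AddCommGroup V] [Module ℂ V] [NormedAddCommGroup H]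
    [InnerProductSpace ℂ H] [CompleteSpace H] (S : V →ₗ[ℂ] H) (l : V →ₗ[ℂ] ℂ) {A : ℝ} (hA : 0 ≤ A)
    (hb : ∀ a, ‖l a‖ ≤ A * ‖S a‖) :
    ∃ w : H, (∀ a, l a = ⟪w, S a⟫_ℂ) ∧ ‖w‖ ≤ A ∧ ∀ h : H, (∀ a, ⟪h, S a⟫_ℂ = 0) → ⟪h, w⟫_ℂ = 0 := by
  have hk : S.ker ≤ l.ker := fun a ha => by
    have := hb a
    rw [LinearMap.mem_ker] at ha
    rw [ha, norm_zero, mul_zero] at this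
    simpa using this
  let f : S.range →ₗ[ℂ] ℂ := (S.ker.liftQ l hk).comp S.quotKerEquivRange.symm.toLinearMap
  have hf a : f ⟨S a, a, rfl⟩ = l a := by
    have := LinearMap.quotKerEquivRange_symm_apply_image S a (LinearMap.mem_range_self S a)
    simp [f]
    erw [this]
    rfl
  have hfb : ∀ x, ‖f x‖ ≤ A * ‖x‖ := by
    rintro ⟨_, a, rfl⟩
    rw [hf]; exact hb a
  obtain ⟨G, hG, hGn⟩ := exists_extension_norm_eq S.range (f.mkContinuous A hfb)
  set w₀ := (InnerProductSpace.toDual ℂ H).symm G with hw₀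
  have hw₀n : ‖w₀‖ ≤ A := by
    rw [hw₀, LinearIsometryEquiv.norm_map, hGn]
    exact f.mkContinuous_norm_le hA hfb
  have hw₀S a : ⟪w₀, S a⟫_ℂ = l a := by
    rw [hw₀, InnerProductSpace.toDual_symm_apply, ← hf]
    exact hG ⟨S a, a, rfl⟩
  let K := S.range.topologicalClosure
  have : CompleteSpace K := S.range.isClosed_topologicalClosure.completeSpace_coe
  refine ⟨K.starProjection w₀, fun a => ?_, (K.norm_starProjection_apply_le _).trans hw₀n, fun h hh => ?_⟩
  · rw [K.inner_starProjection_left_eq_right, Submodule.starProjection_eq_self_iff.2, hw₀S]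
    exact S.range.le_topologicalClosure ⟨a, rfl⟩
  · have h1 : h ∈ S.rangeᗮ := by
      rw [Submodule.mem_orthogonal']
      rintro _ ⟨a, rfl⟩
      exact hh a
    rw [← Submodule.orthogonal_closure] at h1
    exact Submodule.inner_left_of_mem_orthogonal (K.starProjection_apply_mem _) h1

lemma enorm_sq_Lp {F : Type*} [NormedAddCommGroup F] (f : Lp F 2 Λ) :
    ofReal (‖f‖ ^ 2) = ∫⁻ x, ‖f x‖ₑ ^ 2 ∂Λ := by
  have := eLpNorm_nnreal_pow_eq_lintegral (f := f) (μ := Λ) (p := 2) (by norm_num)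
  rw [ofReal_pow (norm_nonneg _), ofReal_norm, Lp.enorm_def]
  simpa using this

lemma enorm_sq_toLp {F : Type*} [NormedAddCommGroup F] {f : Γ → F} (hf : MemLp f 2 Λ) :
    ofReal (‖hf.toLp f‖ ^ 2) = ∫⁻ x, ‖f x‖ₑ ^ 2 ∂Λ := by
  rw [enorm_sq_Lp]
  refine lintegral_congr_ae (hf.coeFn_toLp.mono fun x hx => ?_)
  simp [hx]

lemma IsTest.memLp {a : Γ → ℂ} (ha : IsTest a) : MemLp a 2 Λ :=
  ha.continuous.memLp_of_hasCompactSupport ha.supp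

lemma memLp_of_comp {b : Γ → Γ} (hb : ∀ j, MemLp (fun x => b x j) 2 Λ) : MemLp b 2 Λ := by
  have e : b = fun x => ∑ j, b x j • ee j := by
    ext1 x
    ext i
    simp [ee, Pi.single_apply]
  rw [e]
  refine memLp_finsetSum _ fun j _ => ?_
  exact (hb j).mono ((hb j).1.smul_const _) (ae_of_all _ fun x => by rw [norm_smul, norm_ee, mul_one])

lemma memLp_form {b : Γ → Γ} (hb : ∀ j, IsTest (fun x => b x j)) : MemLp b 2 Λ :=
  memLp_of_comp fun j => (hb j).memLp

lemma inner_form {b : Γ → Γ} (hb : ∀ j, IsTest (fun x => b x j)) {B : Γ → Γ} (hB : MemLp B 2 Λ) :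
    ∫ x, ⟪b x, B x⟫_ℂ ∂Λ = ∑ j, ∫ x, B x j * conj (b x j) ∂Λ := by
  rw [← integral_finsetSum _ fun j _ =>
    integrable_mul_test (locInt_comp hB j) (hb j).conj.continuous (hb j).conj.supp]
  simp [PiLp.inner_apply]

section
variable {ψ : En n → ℝ} (hψ : ContDiff ℝ ∞ ψ)
include hψ

lemma DD_comm {a : Γ → ℂ} (ha : IsTest a) (j k : Fin n) (x : Γ) :
    DD ψ j (DD ψ k a) x = DD ψ k (DD ψ j a) x := by
  have hQd := fun j => ((fun j => contDiff_dbar (m := ∞) (contDiff_cx hψ) (by norm_num) (ee j)) j).differentiable (by simp)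
  have e j k : DD ψ j (DD ψ k a) x = ð j (ð k a) x +
      (ð k (cx ψ) x * ð j a x + ð j (ð k (cx ψ)) x * a x) +
      ð j (cx ψ) x * (ð k a x + ð k (cx ψ) x * a x) := by
    conv_lhs => unfold DD
    rw [dbar_add _ ((ha.dbar _).differentiable x) ((hQd k x).fun_mul (ha.differentiable x)),
      dbar_mul _ (hQd k x) (ha.differentiable x)]
  rw [e, e, dbar_dbar_comm ha.contDiff_two, dbar_dbar_comm ((contDiff_cx hψ).of_le ENat.LEInfty.out)]
  ring

/-- The test expression dual to the twisted divergence. -/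
def Sf (ψ : Γ → ℝ) (α : Fin n → Γ → ℂ) (x : Γ) : ℂ :=
  ∑ j, (- ð j (α j) x + ð j (cx ψ) x * α j x)

lemma isTest_Sf {α : Fin n → Γ → ℂ} (hα : ∀ j, IsTest (α j)) : IsTest (Sf ψ α) :=
  IsTest.sum _ fun j _ => ((hα j).dbar _).neg.add
    (IsTest.mul_left (contDiff_dbar (m := ∞) (contDiff_cx hψ) (by norm_num) _) (hα j))

lemma form_bound {c : ℝ} (hc : 0 < c) (hlevi : ∀ z v, c * ‖v‖ ^ 2 ≤ levi ψ z v)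
    {γ : Γ → Γ} (hγ : MemLp γ 2 Λ)
    (hcurl : ∀ j k h, IsTest h → ∫ x, γ x k * (- ð j h x + ð j (cx ψ) x * h x) ∂Λ =
      ∫ x, γ x j * (- ð k h x + ð k (cx ψ) x * h x) ∂Λ)
    {α : Fin n → Γ → ℂ} (hα : ∀ j, IsTest (α j)) :
    ‖∑ j, ∫ x, γ x j * α j x ∂Λ‖ ≤ (√c)⁻¹ * ‖hγ.toLp γ‖ * ‖(isTest_Sf hψ hα).memLp.toLp (Sf ψ α)‖ := by
  classical
  set a := fun x => WithLp.toLp 2 fun j => conj (α j x) with ha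
  have ta j : IsTest (fun x => a x j) := (hα j).conj
  set aL := (memLp_form ta).toLp a with haL
  have inner_eq : ∀ {b : Γ → Γ} (hb : ∀ j, IsTest (fun x => b x j)) (B : Lp Γ 2 Λ),
      ⟪(memLp_form hb).toLp b, B⟫_ℂ = ∑ j, ∫ x, B x j * conj (b x j) ∂Λ := fun {b} hb B => by
    rw [L2.inner_def, ← inner_form hb (Lp.memLp B)]
    refine integral_congr_ae ((memLp_form hb).coeFn_toLp.mono fun x hx => ?_)
    simp [hx]
  -- the curl test forms
  let q : Fin n → (Γ → ℂ) → Γ → ℂ := fun j h x => - ð j h x + ð j (cx ψ) x * h x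
  have tq : ∀ j {h}, IsTest h → IsTest (q j h) := fun j h hh => (hh.dbar _).neg.add
    (IsTest.mul_left (contDiff_dbar (m := ∞) (contDiff_cx hψ) (by norm_num) _) hh)
  let τ : Fin n → Fin n → (Γ → ℂ) → Γ → Γ := fun j k h x => WithLp.toLp 2 fun i =>
    (if i = k then conj (q j h x) else 0) + - (if i = j then conj (q k h x) else 0)
  have tτ : ∀ j k {h}, IsTest h → ∀ i, IsTest (fun x => τ j k h x i) := fun j k h hh i => by
    simp
    refine IsTest.add ?_ (IsTest.neg ?_)
    · by_cases e : i = k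
      · simpa [e] using (tq j hh).conj
      · simpa [e] using IsTest.zero
    · by_cases e : i = j
      · simpa [e] using (tq k hh).conj
      · simpa [e] using IsTest.zero
  have iτ : ∀ j k {h} (hh : IsTest h) (B : Lp Γ 2 Λ),
      ⟪(memLp_form (tτ j k hh)).toLp _, B⟫_ℂ = (∫ x, B x k * q j h x ∂Λ) - ∫ x, B x j * q k h x ∂Λ := by
    intro j k h hh B
    have lB := locInt_comp (Lp.memLp B)
    rw [L2.inner_def, ← integral_sub (integrable_mul_test (lB k) (tq j hh).continuous (tq j hh).supp)
      (integrable_mul_test (lB j) (tq k hh).continuous (tq k hh).supp)]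
    refine integral_congr_ae ((memLp_form (tτ j k hh)).coeFn_toLp.mono fun x hx => ?_)
    simp [hx, τ, PiLp.inner_apply, mul_add,
      apply_ite conj, sum_add_distrib]
    ring
  let K : Set (Lp Γ 2 Λ) := {B | ∃ j k h, ∃ hh : IsTest h, B = (memLp_form (tτ j k hh)).toLp _}
  let N := (Submodule.span ℂ K)ᗮ
  have memN B : B ∈ N ↔ ∀ j k h, IsTest h →
      ∫ x, B x k * q j h x ∂Λ = ∫ x, B x j * q k h x ∂Λ := by
    constructor
    · intro hB j k h hh
      have := hB _ (Submodule.subset_span ⟨j, k, h, hh, rfl⟩)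
      rw [iτ j k hh] at this
      exact sub_eq_zero.1 this
    · intro hB
      have : Submodule.span ℂ K ≤ (Submodule.span ℂ {B})ᗮ := by
        rw [Submodule.span_le]
        rintro _ ⟨j, k, h, hh, rfl⟩
        rw [SetLike.mem_coe, Submodule.mem_orthogonal_singleton_iff_inner_left, iτ j k hh, hB j k h hh, sub_self]
      intro u hu
      exact Submodule.mem_orthogonal_singleton_iff_inner_left.1 (this hu)
  have γN : hγ.toLp γ ∈ N := by
    rw [memN]
    intro j k h hh
    have : ∀ j k, ∫ x, (hγ.toLp γ) x k * q j h x ∂Λ = ∫ x, γ x k * q j h x ∂Λ := fun j k =>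
      integral_congr_ae (hγ.coeFn_toLp.mono fun x hx => by simp [hx])
    rw [this, this]
    exact hcurl j k h hh
  set b := N.starProjection aL with hb
  set κ := fun x => ∑ j, del ψ j (fun x => a x j) x with hκ
  have tκ : IsTest κ := IsTest.sum _ fun j _ => isTest_del hψ (ta j) j
  have hδ h (hh : IsTest h) : ∫ x, h x * κ x ∂Λ =
      ∑ j, ∫ x, (đ j h x + đ j (cx ψ) x * h x) * b x j ∂Λ := by
    let tf : Γ → Γ := fun x => WithLp.toLp 2 fun j => DD ψ j (fun x => conj (h x)) x
    have ttf j : IsTest (fun x => tf x j) := isTest_DD hψ hh.conj j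
    have tfN : (memLp_form ttf).toLp tf ∈ N := by
      rw [memN]
      intro j k h' hh'
      have e j k : ∫ x, ((memLp_form ttf).toLp tf) x k * q j h' x ∂Λ =
          ∫ x, DD ψ j (DD ψ k fun x => conj (h x)) x * h' x ∂Λ := by
        have t1 := isTest_DD hψ hh.conj k
        have : ∫ x, ((memLp_form ttf).toLp tf) x k * q j h' x ∂Λ =
            ∫ x, (- (DD ψ k (fun x => conj (h x)) x * ð j h' x) +
              ð j (cx ψ) x * (DD ψ k (fun x => conj (h x)) x * h' x)) ∂Λ :=
          integral_congr_ae ((memLp_form ttf).coeFn_toLp.mono fun x hx => by simp [hx]; ring)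
        have i1 := (IsTest.mul_left (contDiff_dbar (m := ∞) (contDiff_cx hψ) (by norm_num) (ee j)) (t1.mul hh')).integrable
        rw [this, integral_add (t1.mul (hh'.dbar _)).neg.integrable i1, integral_neg,
          ibp_dbar (t1.smooth.of_le ENat.LEInfty.out) (hh'.smooth.of_le ENat.LEInfty.out) hh'.supp, neg_neg,
          ← integral_add ((t1.dbar _).mul hh').integrable i1]
        congr 1; ext x
        unfold DD; ring
      rw [e, e]
      simp_rw [DD_comm hψ hh.conj j k]
    have e1 : ⟪(memLp_form ttf).toLp tf, b⟫_ℂ = ⟪(memLp_form ttf).toLp tf, aL⟫_ℂ := by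
      rw [hb, ← Submodule.inner_starProjection_left_eq_right, Submodule.starProjection_eq_self_iff.2 tfN]
    have e2 j x : conj (tf x j) = đ j h x + đ j (cx ψ) x * h x := by
      simp [tf, DD, conj_dbar_cx, dbar_conj]
    rw [inner_eq ttf, inner_eq ttf] at e1
    simp_rw [e2] at e1
    simp_rw [mul_comm _ (b _ _)]
    rw [e1, hκ]
    simp_rw [mul_sum]
    rw [integral_finsetSum _ fun j _ => (hh.mul (isTest_del hψ (ta j) j)).integrable]
    refine sum_congr rfl fun j _ => ?_
    have i1 := (IsTest.mul_left (contDiff_dz (m := ∞) (contDiff_cx hψ) (by norm_num) (ee j)) ((ta j).mul hh)).integrable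
    have : ∫ x, aL x j * (đ j h x + đ j (cx ψ) x * h x) ∂Λ =
        ∫ x, (a x j * đ j h x + đ j (cx ψ) x * (a x j * h x)) ∂Λ :=
      integral_congr_ae ((memLp_form ta).coeFn_toLp.mono fun x hx => by simp [haL, hx]; ring)
    rw [this, integral_add ((ta j).mul (hh.dz _)).integrable i1,
      ibp_dz ((ta j).smooth.of_le ENat.LEInfty.out) (hh.smooth.of_le ENat.LEInfty.out) hh.supp, ← integral_neg,
      ← integral_add ((((ta j).dz _).mul hh).neg).integrable i1]
    congr 1; ext x
    unfold del; ring
  have hest := density_estimate hψ hc hlevi (Lp.memLp b) tκ.memLp hδ ((memN b).1 (N.starProjection_apply_mem _))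
  have eκ x : ‖κ x‖ₑ = ‖Sf ψ α x‖ₑ := by
    have : κ x = conj (Sf ψ α x) := by
      simp [hκ, ha, Sf, del, conj_dbar_cx, dz_conj]
    rw [this, ← ofReal_norm, ← ofReal_norm, RCLike.norm_conj]
  have e3 : ∑ j, ∫ x, γ x j * α j x ∂Λ = ⟪b, hγ.toLp γ⟫_ℂ := by
    rw [hb, Submodule.inner_starProjection_left_eq_right, Submodule.starProjection_eq_self_iff.2 γN, inner_eq ta]
    refine sum_congr rfl fun j _ => ?_
    refine integral_congr_ae (hγ.coeFn_toLp.mono fun x hx => ?_)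
    simp [hx, ha]
  rw [e3]
  refine (norm_inner_le_norm _ _).trans ?_
  have h4 : ‖b‖ ≤ (√c)⁻¹ * ‖(isTest_Sf hψ hα).memLp.toLp (Sf ψ α)‖ := by
    rw [← enorm_sq_Lp] at hest
    simp_rw [eκ] at hest
    rw [← enorm_sq_toLp (isTest_Sf hψ hα).memLp, ← ofReal_mul hc.le, ofReal_le_ofReal_iff (by positivity)] at hest
    rw [le_inv_mul_iff₀ (by positivity)]
    refine abs_le_of_sq_le_sq' ?_ (norm_nonneg _) |>.2
    rw [mul_pow, sq_sqrt hc.le]; exact hest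
  calc _ ≤ ((√c)⁻¹ * ‖(isTest_Sf hψ hα).memLp.toLp (Sf ψ α)‖) * ‖hγ.toLp γ‖ := by gcongr
    _ = _ := by ring

end

/-- The exponential of a real function, as a complex valued function. -/
def expw (ψ : Γ → ℝ) (x : Γ) : ℂ := ((exp (ψ x) : ℝ) : ℂ)

lemma contDiff_expw {k : ℕ∞ω} {ψ : Γ → ℝ} (hψ : ContDiff ℝ k ψ) : ContDiff ℝ k (expw ψ) := contDiff_ofReal hψ.exp

lemma dbar_expw {ψ : Γ → ℝ} {x : Γ} (hψ : DifferentiableAt ℝ ψ x) (v : Γ) :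
    dbar v (expw ψ) x = expw ψ x * dbar v (cx ψ) x := by
  have e v : ∇ (expw ψ) x v = expw ψ x * ∇ (cx ψ) x v := by
    unfold expw cx
    rw [fderiv_ofReal hψ.exp, fderiv_ofReal hψ, fderiv_exp hψ]
    simp
  unfold dbar
  rw [e, e]; ring

/-- `u` solves `∂̄u = g` in the sense of distributions. -/
def WeakDbar (u : Γ → ℂ) (g : Γ → Γ) : Prop :=
  ∀ j h, IsTest h → ∫ x, u x * ð j h x ∂Λ = - ∫ x, g x j * h x ∂Λ

/-- `∂̄u = 0` in the sense of distributions. -/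
def WeakHol (u : Γ → ℂ) : Prop := ∀ j h, IsTest h → ∫ x, u x * ð j h x ∂Λ = 0

/-- `∂̄g = 0` in the sense of distributions. -/
def WeakClosed (g : Γ → Γ) : Prop := ∀ j k h, IsTest h →
    ∫ x, g x j * ð k h x ∂Λ = ∫ x, g x k * ð j h x ∂Λ

section
variable {ψ : En n → ℝ} (hψ : ContDiff ℝ ∞ ψ)
include hψ

lemma isTest_expw_mul {h : Γ → ℂ} (hh : IsTest h) : IsTest (fun x => expw ψ x * h x) :=
  IsTest.mul_left (contDiff_expw hψ) hh

lemma dbar_expw_mul {h : Γ → ℂ} (hh : IsTest h) (v x : Γ) :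
    dbar v (fun x => expw ψ x * h x) x = expw ψ x * (dbar v h x + dbar v (cx ψ) x * h x) := by
  rw [dbar_mul v ((contDiff_expw hψ).differentiable (by simp) x) (hh.differentiable x),
    dbar_expw (hψ.differentiable (by simp) x)]
  ring

lemma dbar_expw_neg_mul {h : Γ → ℂ} (hh : IsTest h) (v x : Γ) :
    dbar v (fun x => expw (fun y => -ψ y) x * h x) x =
      expw (fun y => -ψ y) x * (dbar v h x - dbar v (cx ψ) x * h x) := by
  rw [dbar_expw_mul hψ.neg hh]
  have : dbar v (cx fun y => -ψ y) x = - dbar v (cx ψ) x := by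
    have : (cx fun y => -ψ y) = fun y => - cx ψ y := by ext; simp [cx]
    rw [this, dbar_neg]
  rw [this]; ring

/-- The `L²` existence theorem for `∂̄`, with the minimality of the solution. -/
theorem hormander {c : ℝ} (hc : 0 < c) (hlevi : ∀ z v, c * ‖v‖ ^ 2 ≤ levi ψ z v)
    {g : Γ → Γ} (hg : MemLp (fun x => exp (-ψ x) • g x) 2 Λ)
    (hclosed : WeakClosed g) :
    ∃ u : Γ → ℂ, MemLp (fun x => exp (-ψ x) • u x) 2 Λ ∧ WeakDbar u g ∧
      (∀ h : Γ → ℂ, MemLp (fun x => exp (-ψ x) • h x) 2 Λ → WeakHol h →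
        ∫ x, (exp (-ψ x) • u x) * conj (exp (-ψ x) • h x) ∂Λ = 0) ∧
      ofReal c * ∫⁻ x, ‖exp (-ψ x) • u x‖ₑ ^ 2 ∂Λ ≤ ∫⁻ x, ‖exp (-ψ x) • g x‖ₑ ^ 2 ∂Λ := by
  classical
  have hψn := hψ.neg
  have hee x : expw ψ x * expw (fun y => -ψ y) x = 1 := by
    simp only [expw]; rw [← Complex.ofReal_mul, ← exp_add]; simp
  set γ := fun x => exp (-ψ x) • g x with hγ
  have γe x j : γ x j = expw (fun y => -ψ y) x * g x j := by simp [hγ, expw]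
  have hcurl j k h (hh : IsTest h) : ∫ x, γ x k * (- ð j h x + ð j (cx ψ) x * h x) ∂Λ =
      ∫ x, γ x j * (- ð k h x + ð k (cx ψ) x * h x) ∂Λ := by
    have e j k : ∫ x, γ x k * (- ð j h x + ð j (cx ψ) x * h x) ∂Λ =
        - ∫ x, g x k * ð j (fun x => expw (fun y => -ψ y) x * h x) x ∂Λ := by
      rw [← integral_neg]
      congr 1; ext x
      rw [dbar_expw_neg_mul hψ hh, γe]; ring
    rw [e, e, hclosed k j _ (isTest_expw_mul hψn hh)]
  let V : Submodule ℂ (Fin n → Γ → ℂ) :=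
    { carrier := {α | ∀ j, IsTest (α j)}
      add_mem' := fun ha hb j => (ha j).add (hb j)
      zero_mem' := fun j => IsTest.zero
      smul_mem' := fun c a ha j => IsTest.mul_left contDiff_const (ha j) }
  have tS (α : V) : IsTest (Sf ψ α.1) := isTest_Sf hψ α.2
  have hadd (α : V) (β : V) : Sf ψ (α + β).1 = Sf ψ α.1 + Sf ψ β.1 := by
    ext x
    simp only [Sf, Pi.add_apply, ← sum_add_distrib]
    refine sum_congr rfl fun j _ => ?_
    have : ((α + β : V) : Fin n → Γ → ℂ) j = fun x => α.1 j x + β.1 j x := rfl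
    rw [this, dbar_add _ ((α.2 j).differentiable x) ((β.2 j).differentiable x)]
    ring
  have hsmul (c : ℂ) (α : V) : Sf ψ (c • α).1 = c • Sf ψ α.1 := by
    ext x
    simp only [Sf, Pi.smul_apply, smul_eq_mul, mul_sum]
    refine sum_congr rfl fun j _ => ?_
    have : ((c • α : V) : Fin n → Γ → ℂ) j = fun x => c * α.1 j x := rfl
    rw [this, dbar_mul _ (differentiableAt_const c) ((α.2 j).differentiable x)]
    have : ð j (fun _ => c) x = 0 := dbar_eq_zero (differentiableAt_const c) _
    rw [this]; ring
  let S : V →ₗ[ℂ] Lp ℂ 2 Λ :=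
    { toFun := fun α => (tS α).memLp.toLp _
      map_add' := fun α β => by
        rw [← MemLp.toLp_add (tS α).memLp (tS β).memLp]
        congr 1; exact hadd α β
      map_smul' := fun c α => by
        rw [RingHom.id_apply, ← MemLp.toLp_const_smul c (tS α).memLp]
        congr 1; exact hsmul c α }
  have iγ : ∀ (α : V) j, Integrable (fun x => γ x j * α.1 j x) Λ := fun α j =>
    integrable_mul_test (locInt_comp hg j) (α.2 j).continuous (α.2 j).supp
  let l : V →ₗ[ℂ] ℂ :=
    { toFun := fun α => ∑ j, ∫ x, γ x j * α.1 j x ∂Λ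
      map_add' := fun α β => by
        rw [← sum_add_distrib]
        refine sum_congr rfl fun j _ => ?_
        rw [← integral_add (iγ α j) (iγ β j)]
        congr 1; ext x
        have : ((α + β : V) : Fin n → Γ → ℂ) j x = α.1 j x + β.1 j x := rfl
        rw [this]; ring
      map_smul' := fun c α => by
        rw [RingHom.id_apply, smul_eq_mul, mul_sum]
        refine sum_congr rfl fun j _ => ?_
        rw [← integral_const_mul]
        congr 1; ext x
        have : ((c • α : V) : Fin n → Γ → ℂ) j x = c * α.1 j x := rfl
        rw [this]; ring }
  obtain ⟨w, hw, hwn, hwo⟩ := exists_repr_of_bound S l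
    (A := (√c)⁻¹ * ‖hg.toLp γ‖) (by positivity) fun α => form_bound hψ hc hlevi hg hcurl α.2
  have inS H α : ⟪H, S α⟫_ℂ = ∫ x, Sf ψ α.1 x * conj (H x) ∂Λ := by
    rw [L2.inner_def]
    refine integral_congr_ae ((tS α).memLp.coeFn_toLp.mono fun x hx => ?_)
    simp only [RCLike.inner_apply]
    change (MemLp.toLp _ (tS α).memLp) x * _ = _
    rw [hx]
  set u := fun x => expw ψ x * conj (w x) with hu
  have ue x : exp (-ψ x) • u x = conj (w x) := by
    rw [real_smul]
    change expw (fun y => -ψ y) x * _ = _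
    rw [hu, ← mul_assoc, mul_comm (expw _ x), hee, one_mul]
  have hwc :=
    (Lp.memLp w).mono (Complex.continuous_conj.comp_aestronglyMeasurable (Lp.memLp w).1)
      (ae_of_all _ fun x => by simp)
  refine ⟨u, ?_, ?_, ?_, ?_⟩
  · simpa only [ue] using hwc
  · intro j h hh
    let α : V := ⟨Pi.single j fun x => expw ψ x * h x, fun i => by
      by_cases e : i = j
      · subst e; simpa using isTest_expw_mul hψ hh
      · rw [Pi.single_eq_of_ne e]; exact IsTest.zero⟩
    have αj : α.1 j = fun x => expw ψ x * h x := Pi.single_eq_same _ _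
    have αi i (e : i ≠ j) : α.1 i = fun _ => 0 := Pi.single_eq_of_ne e _
    have h1 := hw α
    rw [inS] at h1
    have h2 : l α = ∫ x, g x j * h x ∂Λ := by
      change ∑ i, ∫ x, γ x i * α.1 i x ∂Λ = _
      rw [Finset.sum_eq_single j (fun i _ e => by simp [αi i e]) (by simp), αj]
      congr 1; ext x
      rw [γe]
      linear_combination (g x j * h x) * hee x
    have h3 x : Sf ψ α.1 x = - (expw ψ x * ð j h x) := by
      unfold Sf
      rw [Finset.sum_eq_single j _ (by simp), αj, dbar_expw_mul hψ hh]
      · ring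
      · intro i _ e
        rw [αi i e, dbar_eq_zero (differentiableAt_const _)]; simp
    rw [← h2, h1, ← integral_neg]
    congr 1; ext x
    rw [h3, hu]; ring
  · intro h hm hh
    have hmc :=
      hm.mono (Complex.continuous_conj.comp_aestronglyMeasurable hm.1) (ae_of_all _ fun x => by simp)
    have h0 α : ⟪hmc.toLp _, S α⟫_ℂ = 0 := by
      have lh := hm.locallyIntegrable (by norm_num)
      have tt j : IsTest (fun x => - ð j (α.1 j) x + ð j (cx ψ) x * α.1 j x) := ((α.2 j).dbar _).neg.add
          (IsTest.mul_left (contDiff_dbar (m := ∞) (contDiff_cx hψ) (by norm_num) _) (α.2 j))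
      have : ⟪hmc.toLp _, S α⟫_ℂ = ∫ x, ∑ j, (exp (-ψ x) • h x) *
          (- ð j (α.1 j) x + ð j (cx ψ) x * α.1 j x) ∂Λ := by
        rw [inS]
        refine integral_congr_ae (hmc.coeFn_toLp.mono fun x hx => ?_)
        simp only [hx, conj_conj, Sf]
        rw [← mul_sum, mul_comm]
      rw [this, integral_finsetSum _ fun j _ => integrable_mul_test lh (tt j).continuous (tt j).supp]
      refine Finset.sum_eq_zero fun j _ => ?_
      have := hh j _ (isTest_expw_mul hψn (α.2 j))
      rw [← neg_eq_zero, ← integral_neg] at this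
      rw [← this]
      congr 1; ext x
      rw [dbar_expw_neg_mul hψ (α.2 j), real_smul]
      simp [expw]
      ring
    have h1 := hwo _ h0
    rw [L2.inner_def] at h1
    rw [← map_eq_zero (starRingEnd ℂ), ← integral_conj, ← h1]
    refine integral_congr_ae (hmc.coeFn_toLp.mono fun x hx => ?_)
    simp only [hx, ue, RCLike.inner_apply, map_mul, conj_conj]
  · simp [ue]
    have : ∀ x, ‖conj (w x)‖ₑ = ‖w x‖ₑ := fun x => by
      rw [← ofReal_norm, ← ofReal_norm, RCLike.norm_conj]
    simp
    rw [← enorm_sq_Lp, ← enorm_sq_toLp hg, ← ofReal_mul hc.le]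
    refine ofReal_le_ofReal ?_
    have h4 : √c * ‖w‖ ≤ ‖hg.toLp γ‖ := by rwa [le_inv_mul_iff₀ (by positivity)] at hwn
    calc c * ‖w‖ ^ 2 = (√c * ‖w‖) ^ 2 := by rw [mul_pow, sq_sqrt hc.le]
      _ ≤ _ := by gcongr

end

lemma measurePreserving_rot {c : ℂ} (hc : ‖c‖ = 1) : MeasurePreserving (fun y : Γ => c • y) Λ Λ := by
  have h0 : c ≠ 0 := fun h => by simp [h] at hc
  let e : Γ ≃ᵢ Γ :=
    { toFun := fun y => c • y
      invFun := fun y => c⁻¹ • y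
      left_inv := fun y => inv_smul_smul₀ h0 y
      right_inv := fun y => smul_inv_smul₀ h0 y
      isometry_toFun := Isometry.of_dist_eq fun x y => by rw [dist_smul₀, hc, one_mul] }
  exact e.measurePreserving_hausdorffMeasure _

lemma measurableEmbedding_rot {c : ℂ} (hc : ‖c‖ = 1) : MeasurableEmbedding (fun y : Γ => c • y) :=
  (Homeomorph.smulOfNeZero c fun h => by simp [h] at hc).measurableEmbedding

/-- The mean value property of holomorphic functions, for the mollifier. -/
lemma mconv_eq_self (hr : 0 < r) {x : Γ} (hf : Hol f (ball x (3 * r))) : mconv r f x = f x := by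
  have e1 θ : ∫ y, moll r y • f (x + circleMap 0 1 θ • y) ∂Λ = mconv r f x := by
    have hc : ‖circleMap 0 1 θ‖ = 1 := by simp
    rw [mconv_eq_add, ← (measurePreserving_rot hc).integral_comp (measurableEmbedding_rot hc)
      (fun y => moll r y • f (x + y))]
    congr 1; ext y
    rw [moll_congr r (show ‖circleMap 0 1 θ • y‖ = ‖y‖ by rw [norm_smul, hc, one_mul])]
  have cont : Continuous (fun q : ℝ × Γ => moll r q.2 • f (x + circleMap 0 1 q.1 • q.2)) := by
    rw [continuous_iff_continuousAt]
    rintro ⟨θ, y⟩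
    rcases lt_or_ge ‖y‖ (3 * r) with h | h
    · have h1 : x + circleMap 0 1 θ • y ∈ ball x (3 * r) := by simpa [norm_smul] using h
      have h2 :=
        (hf.differentiableAt (isOpen_ball.mem_nhds h1)).continuousAt
      refine ContinuousAt.smul ((continuous_moll r).comp continuous_snd).continuousAt ?_
      refine ContinuousAt.comp (f := fun q : ℝ × Γ => x + circleMap 0 1 q.1 • q.2) h2 ?_
      have : Continuous fun q : ℝ × Γ => x + circleMap 0 1 q.1 • q.2 := by
        have := continuous_circleMap 0 1
        fun_prop
      exact this.continuousAt
    · have : (fun q => moll r q.2 • f (x + circleMap 0 1 q.1 • q.2)) =ᶠ[𝓝 (θ, y)] fun _ => 0 := by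
        have ho : {q : ℝ × Γ | 2 * r < ‖q.2‖} ∈ 𝓝 (θ, y) :=
          (isOpen_lt continuous_const continuous_snd.norm).mem_nhds (by simp; linarith)
        filter_upwards [ho] with q hq
        rw [moll_eq_zero hr (le_of_lt hq), zero_smul]
      exact continuousAt_const.congr this.symm
  have swap : ∫ θ in (0:ℝ)..(2 * Real.pi), ∫ y, moll r y • f (x + circleMap 0 1 θ • y) ∂Λ =
      ∫ y, (∫ θ in (0:ℝ)..(2 * Real.pi), moll r y • f (x + circleMap 0 1 θ • y)) ∂Λ := by
    simp [intervalIntegral.integral_of_le Real.two_pi_pos.le]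
    refine integral_integral_swap ?_
    have hK : IsCompact (Icc (0:ℝ) (2 * Real.pi) ×ˢ closedBall (0 : Γ) (2 * r)) :=
      isCompact_Icc.prod (isCompact_closedBall _ _)
    have h1 := cont.continuousOn.integrableOn_compact (μ := (volume : Measure ℝ).prod Λ) hK
    rw [IntegrableOn, ← Measure.prod_restrict] at h1
    have h2 : (volume.restrict (Ioc (0:ℝ) (2 * Real.pi))).prod Λ =
      (volume.restrict (Ioc (0:ℝ) (2 * Real.pi))).prod ((Λ).restrict univ) := by rw [Measure.restrict_univ]
    rw [h2, Measure.prod_restrict]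
    rw [Measure.prod_restrict] at h1
    refine IntegrableOn.of_forall_sdiff_eq_zero (s := Ioc (0:ℝ) (2 * Real.pi) ×ˢ closedBall 0 (2 * r))
      (IntegrableOn.mono_set h1 (prod_mono Ioc_subset_Icc_self subset_rfl))
      (measurableSet_Ioc.prod .univ) ?_
    rintro ⟨θ, y⟩ ⟨⟨h3, _⟩, h4⟩
    have : 2 * r ≤ ‖y‖ := by
      by_contra h5
      exact h4 ⟨h3, by simpa using (not_le.1 h5).le⟩
    simp [moll_eq_zero hr this]
  simp only [e1] at swap
  have e2 y : ∫ θ in (0:ℝ)..(2 * Real.pi), moll r y • f (x + circleMap 0 1 θ • y) =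
      moll r y • ((2 * Real.pi) • f x) := by
    rw [intervalIntegral.integral_smul]
    rcases lt_or_ge ‖y‖ (2 * r) with h | h
    · congr 1
      have hd : DiffContOnCl ℂ (fun ζ : ℂ => f (x + ζ • y)) (ball 0 |1|) := by
        apply DifferentiableOn.diffContOnCl
        rw [abs_one, closure_ball _ one_ne_zero]
        refine hf.comp (by fun_prop) fun ζ hζ => ?_
        rw [mem_closedBall_zero_iff] at hζ
        have : ‖ζ‖ * ‖y‖ ≤ 1 * ‖y‖ := by gcongr
        rw [mem_ball, dist_self_add_left, norm_smul]
        linarith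
      have := hd.circleAverage
      rw [Real.circleAverage, inv_smul_eq_iff₀ (by positivity)] at this
      simpa using this
    · rw [moll_eq_zero hr h, zero_smul, zero_smul]
  simp only [e2] at swap
  rw [integral_smul_const, integral_moll hr, one_smul, intervalIntegral.integral_const, sub_zero] at swap
  exact smul_right_injective _ (by positivity : (2 * Real.pi) ≠ 0) swap

/-- Real differentiability together with the Cauchy-Riemann equations. -/
lemma differentiableAt_of_dbar {z : Γ} (hf : DifferentiableAt ℝ f z)
    (h : ∀ v, dbar v f z = 0) : DifferentiableAt ℂ f z := by
  rw [differentiableAt_iff_restrictScalars ℝ hf]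
  have hI v : ∇ f z (I • v) = I * ∇ f z v := by
    have := h v
    unfold dbar at this
    have h2 : ∇ f z v + I * ∇ f z (I • v) = 0 := by simpa using this
    linear_combination (-I) * h2 + ∇ f z (I • v) * I_mul_I
  refine ⟨⟨{ toFun := ∇ f z, map_add' := map_add _, map_smul' := fun c v => ?_ },
    (∇ f z).continuous⟩, rfl⟩
  have : c • v = c.re • v + c.im • (I • v) := by
    conv_lhs => rw [← re_add_im c]
    rw [add_smul, mul_smul, Complex.coe_smul, Complex.coe_smul]
  simp
  rw [this, map_add, map_smul, map_smul, hI]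
  conv_rhs => rw [← re_add_im c]
  simp only [real_smul]
  ring

/-- Holomorphic functions on a ball are smooth. -/
lemma contDiffAt_of_differentiableOn {w : Γ} {R : ℝ} (hR : 0 < R)
    (hf : Hol f (ball w R)) : ContDiffAt ℝ ∞ f w := by
  set v := (closedBall w (R/2)).indicator f with hv
  have hsub : closedBall w (R/2) ⊆ ball w R := closedBall_subset_ball (by linarith)
  have iv : Integrable v Λ := by
    rw [hv, integrable_indicator_iff measurableSet_closedBall]
    exact (hf.continuousOn.mono hsub).integrableOn_compact (isCompact_closedBall _ _)
  have hr : 0 < R / 16 := by positivity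
  refine ((contDiff_mconv hr iv.locallyIntegrable).contDiffAt).congr_of_eventuallyEq ?_
  filter_upwards [ball_mem_nhds w hr] with x hx
  have hx' : dist x w < R / 16 := hx
  have hs : ball x (3 * (R / 16)) ⊆ ball w (R/2) := ball_subset_ball' (by linarith)
  have hvf y (hy : y ∈ ball x (3 * (R/16))) : v y = f y := indicator_of_mem (ball_subset_closedBall (hs hy)) f
  rw [mconv_eq_self hr ((hf.mono (hs.trans (ball_subset_closedBall.trans hsub))).congr hvf),
    hvf _ (mem_ball_self (by linarith))]

lemma contDiff_of_differentiable (hf : Entire f) : C∞ f :=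
  contDiff_iff_contDiffAt.2 fun _ => contDiffAt_of_differentiableOn one_pos hf.differentiableOn

lemma mconv_comm {r s : ℝ} (hr : 0 < r) (hs : 0 < s) {u : Γ → ℂ} (hu : Integrable u Λ) :
    mconv r (mconv s u) = mconv s (mconv r u) := by
  have key : ∀ {r s : ℝ}, 0 < r → 0 < s → ∀ x, mconv r (mconv s u) x =
      ∫ z, (∫ y, moll r y * moll s (x - z - y) ∂Λ) • u z ∂Λ := by
    intro r s hr hs x
    rw [mconv_eq]
    simp_rw [mconv_eq', ← integral_smul, ← integral_smul_const]
    have e y z : moll r y • moll s (x - y - z) • u z = (moll r y * moll s (x - z - y)) • u z := by rw [smul_smul, sub_right_comm]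
    simp_rw [e]
    refine integral_integral_swap ?_
    have h1 := (integrable_moll (n := n) hr).ofReal (𝕜 := ℂ) |>.mul_prod hu
    have hb : ∃ B, ∀ x : Γ, ‖moll s x‖ ≤ B :=
      (hasCompactSupport_moll hs).exists_bound_of_continuous (continuous_moll s)
    obtain ⟨B, hB⟩ := hb
    have h2 := h1.bdd_mul (f := fun q => ((moll s (x - q.2 - q.1) : ℝ) : ℂ)) (c := B) (by
        have := continuous_moll (n := n) s
        apply Continuous.aestronglyMeasurable
        fun_prop) (ae_of_all _ fun q => by simpa using hB _)
    refine h2.congr (ae_of_all _ fun q => ?_)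
    simp [uncurry]; ring
  ext x
  rw [key hr hs, key hs hr]
  congr 1; ext z
  congr 1
  rw [← integral_sub_left_eq_self _ Λ (x - z)]
  congr 1; ext y
  rw [sub_sub_cancel, mul_comm]

lemma differentiable_mconv (hr : 0 < r)     (hf : LocallyIntegrable f Λ) : Differentiable ℝ (mconv r f) :=
  (contDiff_mconv hr hf).differentiable (by simp)

lemma tsupport_moll_sub (hr : 0 < r) (x : Γ) :
    tsupport (fun y : Γ => ((moll r (x - y) : ℝ) : ℂ)) ⊆ closedBall x (2 * r) := by
  refine closure_minimal (fun y hy => ?_) isClosed_closedBall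
  by_contra h
  rw [mem_closedBall, not_le] at h
  refine hy ?_
  simp only
  rw [moll_sub_comm, moll_eq_zero hr (by rw [← dist_eq_norm]; exact h.le), ofReal_zero]

lemma mconv_congr_ball {F : Type*} [NormedAddCommGroup F] [NormedSpace ℝ F] (hr : 0 < r)
    {f g : Γ → F} {x : Γ} (h : ∀ y ∈ ball x (2 * r), f y = g y) : mconv r f x = mconv r g x := by
  rw [mconv_eq', mconv_eq']
  congr 1; ext y
  by_cases hy : y ∈ ball x (2 * r)
  · rw [h y hy]
  · rw [moll_sub_comm, moll_eq_zero hr (by rw [← dist_eq_norm]; simpa using hy), zero_smul, zero_smul]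

/-- Weyl's lemma for the Cauchy-Riemann operator, local form. -/
lemma weyl_local {u : Γ → ℂ} (hu : LocallyIntegrable u Λ) {w : Γ} {R : ℝ} (hR : 0 < R)
    (h : ∀ j h, IsTest h → tsupport h ⊆ ball w R → ∫ x, u x * ð j h x ∂Λ = 0)
    {ε : ℝ} (hε : 0 < ε) (hεR : ε ≤ R / 16) :
    Hol (mconv ε u) (ball w (R / 2)) ∧ ∀ᵐ x ∂Λ, x ∈ ball w (R / 2) → u x = mconv ε u x := by
  have hol : ∀ {δ}, 0 < δ → ∀ x ∈ ball w (R - 2 * δ), DifferentiableAt ℂ (mconv δ u) x := by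
    intro δ hδ x hx
    refine differentiableAt_of_dbar (differentiable_mconv hδ hu x) fun v => ?_
    rw [dbar_basis]
    refine Finset.sum_eq_zero fun j _ => ?_
    rw [dbar_mconv hδ hu, h j _ (isTest_moll_sub hδ x), neg_zero, mul_zero]
    refine (tsupport_moll_sub hδ x).trans (closedBall_subset_ball' ?_)
    have : dist x w < R - 2 * δ := hx
    linarith
  refine ⟨fun x hx => (hol hε x (ball_subset_ball (by linarith) hx)).differentiableWithinAt, ?_⟩
  set v := (closedBall w R).indicator u with hv
  have iv : Integrable v Λ := by
    rw [hv, integrable_indicator_iff measurableSet_closedBall]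
    exact hu.integrableOn_isCompact (isCompact_closedBall _ _)
  have hmv : ∀ {δ}, 0 < δ → ∀ x ∈ ball w (R - 2 * δ), mconv δ v x = mconv δ u x := fun {δ} hδ x hx =>
    mconv_congr_ball hδ fun y hy => (fun y hy => indicator_of_mem (ball_subset_closedBall hy) u) y (ball_subset_ball' (by
      have : dist x w < R - 2 * δ := hx
      linarith) hy)
  have hself : ∀ {δ δ'}, 0 < δ → 0 < δ' → δ ≤ R / 16 → δ' ≤ R / 16 → ∀ x ∈ ball w (R/2),
      mconv δ' (mconv δ v) x = mconv δ u x := by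
    intro δ δ' hδ hδ' h1 h2 x hx
    have hx' : dist x w < R / 2 := hx
    have hs : ball x (3 * δ') ⊆ ball w (R - 2 * δ) := ball_subset_ball' (by linarith)
    rw [← hmv hδ x (ball_subset_ball (by linarith) hx)]
    refine mconv_eq_self hδ' ?_
    refine DifferentiableOn.congr (fun y hy => (hol hδ y (hs hy)).differentiableWithinAt) fun y hy => ?_
    exact hmv hδ y (hs hy)
  have hlim := tendsto_one_div_add_atTop_nhds_zero_nat (𝕜 := ℝ)
  filter_upwards [ae_tendsto_mconv hu] with x hx hxb
  refine tendsto_nhds_unique hx (tendsto_const_nhds.congr' ?_)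
  filter_upwards [((hlim.eventually (ge_mem_nhds (by positivity))) : ∀ᶠ k : ℕ in atTop, 1 / ((k:ℝ) + 1) ≤ R / 16)] with k hk
  have hk0 : 0 < 1 / ((k:ℝ) + 1) := Nat.one_div_pos_of_nat
  rw [← hself hε hk0 hεR hk x hxb, mconv_comm hk0 hε iv, hself hk0 hε hk hεR x hxb]

lemma weyl_global {u : Γ → ℂ} (hu : LocallyIntegrable u Λ) (h : WeakHol u) :
    Entire (mconv 1 u) ∧ u =ᵐ[Λ] mconv 1 u := by
  have key (k : ℕ) : _ := weyl_local hu (w := 0) (R := (k:ℝ) + 16) (by positivity)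
    (fun j h' hh _ => h j h' hh) one_pos (by linarith [(Nat.cast_nonneg k : (0:ℝ) ≤ k)])
  have hmem x : ∃ k : ℕ, x ∈ ball (0 : Γ) (((k:ℝ) + 16) / 2) := by
    obtain ⟨k, hk⟩ := exists_nat_gt (2 * ‖x‖)
    exact ⟨k, by rw [mem_ball_zero_iff]; linarith⟩
  constructor
  · intro x
    obtain ⟨k, hk⟩ := hmem x
    exact ((key k).1).differentiableAt (isOpen_ball.mem_nhds hk)
  · filter_upwards [ae_all_iff.2 fun k => (key k).2] with x hx
    obtain ⟨k, hk⟩ := hmem x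
    exact hx k hk

lemma integral_swap_of_compact {E : Type*} [NormedAddCommGroup E] [NormedSpace ℝ E]
    {F : ℝ → Γ → E} (hF : Continuous (uncurry F)) {K : Set Γ} (hK : IsCompact K)
    (h0 : ∀ t, ∀ y ∉ K, F t y = 0) {a b : ℝ} (hab : a ≤ b) :
    ∫ t in a..b, (∫ y, F t y ∂Λ) = ∫ y, (∫ t in a..b, F t y) ∂Λ := by
  simp [intervalIntegral.integral_of_le hab]
  refine integral_integral_swap ?_
  have h1 := hF.continuousOn.integrableOn_compact (μ := (volume : Measure ℝ).prod Λ)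
    ((isCompact_Icc (a := a) (b := b)).prod hK)
  rw [← Measure.restrict_univ (μ := Λ), Measure.prod_restrict]
  refine IntegrableOn.of_forall_sdiff_eq_zero (s := Ioc a b ×ˢ K)
    (IntegrableOn.mono_set h1 (prod_mono Ioc_subset_Icc_self subset_rfl))
    (measurableSet_Ioc.prod .univ) ?_
  rintro ⟨θ, y⟩ ⟨⟨h3, _⟩, h4⟩
  exact h0 _ _ fun h5 => h4 ⟨h3, h5⟩

/-- A radial potential whose gradient is `-moll r x • x`. -/
def pot (r : ℝ) (x : Γ) : ℝ :=
  (∫ s in (‖x‖ ^ 2)..(2 * r ^ 2), smoothTransition (2 - s / r ^ 2)) / (2 * radMass n r)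

lemma continuous_transition (r : ℝ) : Continuous fun s : ℝ => smoothTransition (2 - s / r ^ 2) :=
  smoothTransition.continuous.comp (by fun_prop)

lemma transition_eq_zero (hr : 0 < r) {s : ℝ} (hs : 2 * r ^ 2 ≤ s) : smoothTransition (2 - s / r ^ 2) = 0 := by
  apply smoothTransition.zero_of_nonpos
  have : 2 ≤ s / r ^ 2 := by rwa [le_div_iff₀ (by positivity)]
  linarith

lemma pot_eq_zero (hr : 0 < r) {x : Γ} (h2 : 2 * r ^ 2 ≤ ‖x‖ ^ 2) : pot r x = 0 := by
  rw [pot, intervalIntegral.integral_symm, intervalIntegral.integral_congr (g := fun _ => 0)]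
  · simp
  · intro s hs
    rw [uIcc_of_le h2] at hs
    exact transition_eq_zero hr hs.1

lemma pot_nonneg (hr : 0 < r) (x : Γ) : 0 ≤ pot r x := by
  rcases le_total (‖x‖ ^ 2) (2 * r ^ 2) with h | h
  · exact div_nonneg (intervalIntegral.integral_nonneg h fun _ _ => smoothTransition.nonneg _)
      (by have := radMass_pos (n := n) hr; positivity)
  · rw [pot_eq_zero hr h]

lemma hasCompactSupport_pot (hr : 0 < r) : HasCompactSupport (pot r : Γ → ℝ) := by
  refine HasCompactSupport.intro (isCompact_closedBall 0 (2 * r)) fun x hx => pot_eq_zero hr ?_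
  simp at hx
  nlinarith

lemma hasDerivAt_pot_aux (r s : ℝ) : HasDerivAt (fun s => ∫ σ in s..(2 * r ^ 2), smoothTransition (2 - σ / r ^ 2))
      (-smoothTransition (2 - s / r ^ 2)) s :=
  intervalIntegral.integral_hasDerivAt_left ((continuous_transition r).intervalIntegrable _ _)
    (continuous_transition r).stronglyMeasurable.stronglyMeasurableAtFilter
    (continuous_transition r).continuousAt

lemma contDiff_pot (r : ℝ) : ContDiff ℝ 1 (pot r : Γ → ℝ) := by
  have h : ContDiff ℝ 1 (fun s => ∫ σ in s..(2 * r ^ 2), smoothTransition (2 - σ / r ^ 2)) := by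
    rw [contDiff_one_iff_deriv]
    refine ⟨fun s => (hasDerivAt_pot_aux r s).differentiableAt, ?_⟩
    have : deriv (fun s => ∫ σ in s..(2 * r ^ 2), smoothTransition (2 - σ / r ^ 2)) =
      fun s => -smoothTransition (2 - s / r ^ 2) := funext fun s => (hasDerivAt_pot_aux r s).deriv
    rw [this]
    fun_prop
  exact (h.comp (contDiff_normSq.of_le ENat.LEInfty.out)).div_const _

lemma fderiv_pot (x v : Γ) : ∇ (pot r) x v = - moll r x * inner ℝ x v := by
  have h1 := (hasStrictFDerivAt_norm_sq (F := Γ) x).hasFDerivAt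
  have : pot r = fun y => ((fun s => ∫ σ in s..(2 * r ^ 2),
      smoothTransition (2 - σ / r ^ 2)) ∘ fun y : Γ => ‖y‖ ^ 2) y * (2 * radMass n r)⁻¹ := by
    ext y; simp [pot, div_eq_mul_inv]
  rw [this, ((((hasDerivAt_pot_aux r (‖x‖ ^ 2)).comp_hasFDerivAt x h1).mul_const (2 * radMass n r)⁻¹).fderiv)]
  simp [moll, rad]
  ring

lemma dbar_pot (x : Γ) (j : Fin n) : ð j (cx (pot r)) x = - (moll r x * x j) / 2 := by
  have hd := (contDiff_pot r).differentiable (by simp) x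
  have e1 : inner ℝ x (ee j) = (x j).re := by simp [PiLp.inner_apply, ee, apply_ite re]
  have e2 : inner ℝ x (I • ee j) = (x j).im := by simp [PiLp.inner_apply, ee, apply_ite re]
  unfold dbar cx
  rw [fderiv_ofReal hd, fderiv_ofReal hd, fderiv_pot, fderiv_pot, e1, e2]
  conv_rhs => rw [← re_add_im (x j)]
  push_cast
  ring

lemma fderiv_comp_affine {F : Type*} [NormedAddCommGroup F] [NormedSpace ℝ F] {f : Γ → F}
    (hf : Differentiable ℝ f) (z : Γ) (t : ℝ) (y v : Γ) :
    ∇ (fun y => f (z + t • y)) y v = t • ∇ f (z + t • y) v := by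
  have h1 : HasFDerivAt (fun y => z + t • y) (t • ContinuousLinearMap.id ℝ Γ) y :=
    ((hasFDerivAt_id y).const_smul t).const_add z
  have := ((hf (z + t • y)).hasFDerivAt.comp y h1).fderiv
  change ∇ (f ∘ fun y => z + t • y) y v = _
  rw [this]; simp

lemma dbar_comp_affine (hf : Differentiable ℝ f) (z : Γ) (t : ℝ) (y v : Γ) :
    dbar v (fun y => f (z + t • y)) y = t * dbar v f (z + t • y) := by
  unfold dbar
  rw [fderiv_comp_affine hf, fderiv_comp_affine hf, real_smul, real_smul]
  ring

lemma fderiv_eq_re_dz {h : Γ → ℝ} {x : Γ} (hd : DifferentiableAt ℝ h x) (v : Γ) :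
    ∇ h x v = 2 * (∑ j, v j * đ j (cx h) x).re := by
  have h1 : ∇ h x v = dz v (cx h) x + conj (dz v (cx h) x) := by
    rw [← fderiv_ofReal hd, ← dbar_conj]
    change ∇ (cx h) x v = _
    rw [fderiv_eq_dz_add_dbar]
    congr 2; ext y; simp [cx]
  rw [Complex.add_conj] at h1
  rw [← dz_basis]
  exact_mod_cast h1

lemma mconv_sub_self {h : Γ → ℝ} (hh : C² h) (hr : 0 < r) (z : Γ) :
    mconv r h z - h z = ∫ t in (0:ℝ)..1, 4 * ∑ j, (∫ y, t * levi h (z + t • y) (ee j) * pot r y ∂Λ) := by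
  have hd := hh.differentiable (by simp)
  have hcx : C² (cx h) := contDiff_ofReal hh
  have cA j : ContDiff ℝ 1 (đ j (cx h)) := contDiff_dz hcx (by norm_num) _
  have cfd := hh.continuous_fderiv (by simp)
  -- radial derivative
  have e1 y : h (z + y) - h z = ∫ t in (0:ℝ)..1, ∇ h (z + t • y) y := by
    rw [intervalIntegral.integral_eq_sub_of_hasDerivAt (f := fun t => h (z + t • y))]
    · simp
    · intro t _
      have h1 : HasDerivAt (fun t => z + t • y) y t := by
        simpa using ((hasDerivAt_id t).smul_const y).const_add z
      exact (hd (z + t • y)).hasFDerivAt.comp_hasDerivAt t h1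
    · exact (by fun_prop : Continuous fun t => ∇ h (z + t • y) y).intervalIntegrable _ _
  have e2 : mconv r h z - h z = ∫ y, moll r y * (h (z + y) - h z) ∂Λ := by
    have i1 : Integrable (fun y => moll r y * h (z + y)) Λ := by
      refine Continuous.integrable_of_hasCompactSupport ?_ (hasCompactSupport_moll hr).mul_right
      exact (continuous_moll r).mul (hh.continuous.comp (by fun_prop))
    simp_rw [mul_sub]
    rw [integral_sub i1 ((integrable_moll hr).mul_const _), integral_mul_const, integral_moll hr,
      one_mul, mconv_eq_add]
    rfl
  have e3 : mconv r h z - h z = ∫ t in (0:ℝ)..1, (∫ y, moll r y * ∇ h (z + t • y) y ∂Λ) := by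
    rw [integral_swap_of_compact (K := closedBall 0 (2 * r)) _ (isCompact_closedBall _ _) _ zero_le_one, e2]
    · congr 1; ext y
      rw [e1, intervalIntegral.integral_const_mul]
    · have := continuous_moll (n := n) r
      unfold uncurry
      fun_prop
    · intro t y hy
      rw [mem_closedBall_zero_iff, not_le] at hy
      rw [moll_eq_zero hr hy.le, zero_mul]
  have e4 t : ∫ y, moll r y * ∇ h (z + t • y) y ∂Λ =
      4 * ∑ j, (∫ y, t * levi h (z + t • y) (ee j) * pot r y ∂Λ) := by
    have cAt j : ContDiff ℝ 1 (fun y => đ j (cx h) (z + t • y)) := (cA j).comp (by fun_prop)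
    have cP : ContDiff ℝ 1 (cx (pot r : Γ → ℝ)) := contDiff_ofReal (contDiff_pot r)
    have sP : HasCompactSupport (cx (pot r : Γ → ℝ)) := (hasCompactSupport_pot hr).comp_left ofReal_zero
    have hI j : Integrable (fun y => đ j (cx h) (z + t • y) * ð j (cx (pot r)) y) Λ := integrable_of_compact ((cAt j).continuous.mul
        (contDiff_dbar (m := 0) cP (by norm_num) _).continuous) (hasCompactSupport_dbar sP _).mul_left
    have h1 y : moll r y * ∇ h (z + t • y) y =
        (-4 * ∑ j, đ j (cx h) (z + t • y) * ð j (cx (pot r)) y).re := by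
      rw [fderiv_eq_re_dz (hd _), ← mul_assoc, mul_comm _ (2:ℝ), mul_assoc, ← re_ofReal_mul,
        show (2:ℝ) = ((2:ℝ):ℂ).re from rfl]
      rw [ofReal_re, ← re_ofReal_mul, mul_sum, mul_sum, mul_sum]
      congr 1
      refine sum_congr rfl fun j _ => ?_
      rw [dbar_pot]; push_cast; ring
    have h2 : ∫ y, moll r y * ∇ h (z + t • y) y ∂Λ =
        (∫ y, -4 * ∑ j, đ j (cx h) (z + t • y) * ð j (cx (pot r)) y ∂Λ).re := by
      simp_rw [h1]
      exact integral_re ((integrable_finsetSum _ fun j _ => hI j).const_mul _)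
    rw [h2, integral_const_mul, integral_finsetSum _ fun j _ => hI j]
    have h3 j : ∫ y, đ j (cx h) (z + t • y) * ð j (cx (pot r)) y ∂Λ =
        ((- ∫ y, t * levi h (z + t • y) (ee j) * pot r y ∂Λ : ℝ) : ℂ) := by
      rw [ibp_dbar (cAt j) cP sP, Complex.ofReal_neg, ← integral_complex_ofReal]
      congr 2; ext y
      rw [dbar_comp_affine ((cA j).differentiable (by simp)), dbar_dz_comm hcx]
      have := leviForm_self hh (z + t • y) (ee j)
      unfold leviForm at this
      push_cast
      rw [← this]
      rfl
    simp_rw [h3]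
    rw [← Complex.ofReal_sum]
    have : (-4 : ℂ) = ((-4 : ℝ) : ℂ) := by norm_num
    rw [this, ← Complex.ofReal_mul, ofReal_re, Finset.sum_neg_distrib, neg_mul_neg]
  rw [e3]
  exact intervalIntegral.integral_congr fun t _ => e4 t

/-- The sub-mean value property with respect to the mollifier. -/
lemma sub_mean {h : Γ → ℝ} (hh : C² h) (hl : ∀ z v, 0 ≤ levi h z v)     (hr : 0 < r) (z : Γ) : h z ≤ mconv r h z := by
  rw [← sub_nonneg, mconv_sub_self hh hr]
  refine intervalIntegral.integral_nonneg zero_le_one fun t ht => ?_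
  refine mul_nonneg (by norm_num) (sum_nonneg fun j _ => integral_nonneg fun y => ?_)
  exact mul_nonneg (mul_nonneg ht.1 (hl _ _)) (pot_nonneg hr y)

lemma hess_comp_add (φ : Γ → ℝ) (a z u v : Γ) : hess (fun x => φ (a + x)) z u v = hess φ (a + z) u v := by
  unfold hess
  have : ∇ (fun x => φ (a + x)) = fun x => ∇ φ (a + x) := funext fun x => fderiv_comp_add_left a
  rw [this, fderiv_comp_add_left (f := ∇ φ) a]

lemma levi_comp_add (φ : Γ → ℝ) (a z v : Γ) : levi (fun x => φ (a + x)) z v = levi φ (a + z) v := by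
  unfold levi; rw [hess_comp_add, hess_comp_add]

lemma fderiv_normSq (x v : Γ) : ∇ (fun y : Γ => ‖y‖ ^ 2) x v = 2 * inner ℝ x v := by simp

lemma hess_normSq (x u v : Γ) : hess (fun y : Γ => ‖y‖ ^ 2) x u v = 2 * inner ℝ u v := by
  unfold hess
  have : ∇ (fun y => ‖y‖ ^ 2) = fun x => (2 • innerSL ℝ (E := Γ)) x := by
    ext x v; rw [fderiv_normSq]; simp
  rw [this, ContinuousLinearMap.fderiv]; simp; rfl

lemma levi_normSq (x v : Γ) : levi (fun y : Γ => ‖y‖ ^ 2) x v = ‖v‖ ^ 2 := by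
  unfold levi
  rw [hess_normSq, hess_normSq, real_inner_self_eq_norm_sq, real_inner_self_eq_norm_sq, norm_smul]
  simp; ring

lemma hess_add {φ ψ : Γ → ℝ} (hφ : C² φ) (hψ : C² ψ) (z u v : Γ) :
    hess (fun x => φ x + ψ x) z u v = hess φ z u v + hess ψ z u v := by
  have d : ∀ {φ : Γ → ℝ}, C² φ → Differentiable ℝ φ := fun h => h.differentiable (by simp)
  have d2 : ∀ {φ : Γ → ℝ}, C² φ → Differentiable ℝ (∇ φ) := fun h =>
    (h.fderiv_right (m := 1) (by norm_num)).differentiable (by simp)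
  unfold hess
  have : ∇ (fun x => φ x + ψ x) = fun x => ∇ φ x + ∇ ψ x :=
    funext fun x => fderiv_fun_add (d hφ x) (d hψ x)
  rw [this, fderiv_fun_add (d2 hφ z) (d2 hψ z)]; rfl

lemma hess_const_mul (hφ : C² φ) (c : ℝ) (z u v : Γ) :
    hess (fun x => c * φ x) z u v = c * hess φ z u v := by
  unfold hess
  have : ∇ (fun x => c * φ x) = fun x => c • ∇ φ x :=
    funext fun x => fderiv_const_mul (hφ.differentiable (by simp) x) c
  rw [this, fderiv_fun_const_smul ((hφ.fderiv_right (m := 1) (by norm_num)).differentiable (by simp) z)]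
  rfl

lemma levi_add {φ ψ : Γ → ℝ} (hφ : C² φ) (hψ : C² ψ) (z v : Γ) :
    levi (fun x => φ x + ψ x) z v = levi φ z v + levi ψ z v := by
  unfold levi; rw [hess_add hφ hψ, hess_add hφ hψ]; ring

lemma levi_const_mul (hφ : C² φ) (c : ℝ) (z v : Γ) : levi (fun x => c * φ x) z v = c * levi φ z v := by
  unfold levi; rw [hess_const_mul hφ, hess_const_mul hφ]; ring

lemma levi_neg (hφ : C² φ) (z v : Γ) : levi (fun x => - φ x) z v = - levi φ z v := by
  have := levi_const_mul hφ (-1) z v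
  simp_all

lemma levi_sub {φ ψ : Γ → ℝ} (hφ : C² φ) (hψ : C² ψ) (z v : Γ) :
    levi (fun x => φ x - ψ x) z v = levi φ z v - levi ψ z v := by
  simp_rw [sub_eq_add_neg]
  rw [levi_add hφ hψ.neg, levi_neg hψ]

lemma levi_const (c : ℝ) (z v : Γ) : levi (fun _ => c) z v = 0 := by
  simp [levi, hess]

/-- The real part of a holomorphic function is pluriharmonic. -/
lemma levi_re {H : Γ → ℂ} (hH : Entire H) (z v : Γ) : levi (fun x => (H x).re) z v = 0 := by
  have hs := contDiff_of_differentiable hH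
  have h2 : C² fun x => (H x).re := reCLM.contDiff.comp (hs.of_le ENat.LEInfty.out)
  have h0 : ((levi (fun x => (H x).re) z v : ℝ) : ℂ) = 0 := by
    rw [← leviForm_self h2]
    unfold leviForm
    have e : (fun x => (((H x).re : ℝ) : ℂ)) = fun x => (1/2 : ℂ) * (H x + conj (H x)) := by
      ext x; rw [Complex.add_conj]; push_cast; ring
    have hd := hs.differentiable (by simp)
    have hdc : Differentiable ℝ fun x => conj (H x) := conjCLE.differentiable.comp hd
    have e2 : dbar v (fun x => (((H x).re : ℝ) : ℂ)) = fun x => (1/2 : ℂ) * conj (dz v H x) := by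
      ext x
      rw [e, dbar_mul _ (differentiableAt_const _) ((hd x).fun_add (hdc x)), dbar_add _ (hd x) (hdc x),
        dbar_eq_zero (hH x), dbar_eq_zero (differentiableAt_const _), dbar_conj]
      ring
    have e3 : dz v (dbar v H) z = 0 := by
      have : dbar v H = fun _ => 0 := funext fun x => dbar_eq_zero (hH x) v
      rw [this]; simp [dz]
    have hdz := (contDiff_dz (m := ∞) hs (by norm_num) v).differentiable (by simp)
    have e4 : dz v (fun _ => (1/2 : ℂ)) z = 0 := by simp [dz]
    have hdzc : Differentiable ℝ fun x => conj (dz v H x) := conjCLE.differentiable.comp hdz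
    rw [e2, dz_mul _ (differentiableAt_const _) (hdzc z), e4, dz_conj, dbar_dz_comm (hs.of_le ENat.LEInfty.out)]
    rw [e3]; simp
  simp_all

lemma norm_leviForm_le {A : ℝ} (h2 : C² φ) (h0 : ∀ z v, 0 ≤ levi φ z v)
    (h1 : ∀ z v, levi φ z v ≤ A * ‖v‖ ^ 2) (hA : 0 ≤ A) (z u v : Γ) :
    ‖leviForm φ z u v‖ ≤ A * (‖u‖ + ‖v‖) ^ 2 := by
  have key (c : ℂ) (hc : ‖c‖ = 1) : ‖(levi φ z (u + c • v) : ℂ)‖ ≤ A * (‖u‖ + ‖v‖) ^ 2 := by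
    rw [norm_real, norm_of_nonneg (h0 _ _)]
    refine (h1 _ _).trans ?_
    gcongr
    exact (norm_add_le _ _).trans (by rw [norm_smul, hc, one_mul])
  have pol : leviForm φ z u v = (1/4) * ((levi φ z (u + (1:ℂ) • v) : ℂ) - levi φ z (u + (-1:ℂ) • v) +
      I * levi φ z (u + I • v) - I * levi φ z (u + (-I) • v)) := by
    simp only [← leviForm_self h2, leviForm_add_left, leviForm_add_right h2, leviForm_smul_left,
      leviForm_smul_right h2, map_one, map_neg, Complex.conj_I]
    linear_combination (leviForm φ z u v / 2 - leviForm φ z v u / 2) * Complex.I_sq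
  rw [pol]
  have k1 := key 1 (by simp)
  have k2 := key (-1) (by simp)
  have k3 := key I (by simp)
  have k4 := key (-I) (by simp)
  rw [norm_mul]
  have t1 := norm_sub_le ((levi φ z (u + (1:ℂ) • v) : ℂ) - levi φ z (u + (-1:ℂ) • v) +
      I * levi φ z (u + I • v)) (I * levi φ z (u + (-I) • v))
  have t2 := norm_add_le ((levi φ z (u + (1:ℂ) • v) : ℂ) - levi φ z (u + (-1:ℂ) • v)) (I * levi φ z (u + I • v))
  have t3 := norm_sub_le (levi φ z (u + (1:ℂ) • v) : ℂ) (levi φ z (u + (-1:ℂ) • v) : ℂ)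
  rw [norm_mul, norm_I, one_mul] at t1 t2
  have : ‖(1/4 : ℂ)‖ = 1/4 := by norm_num
  rw [this]
  linarith

lemma exp_neg_le_pow (m : ℕ) {c s : ℝ} (hc : 0 < c) (hs : 0 ≤ s) :
    exp (-(c * s)) ≤ (exp c * m.factorial / c ^ m) * (1 + s) ^ (-(m:ℝ)) := by
  have h := Real.pow_div_factorial_le_exp (x := c * (1 + s)) (by positivity) m
  rw [mul_pow] at h
  have e : exp (-(c * s)) = exp c * (exp (c * (1 + s)))⁻¹ := by rw [← exp_neg, ← exp_add]; congr 1; ring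
  rw [e, Real.rpow_neg (by positivity), Real.rpow_natCast]
  have : (exp (c * (1 + s)))⁻¹ ≤ (c ^ m * (1 + s) ^ m / m.factorial)⁻¹ := by gcongr
  calc _ ≤ exp c * (c ^ m * (1 + s) ^ m / m.factorial)⁻¹ := by gcongr
    _ = _ := by field_simp

lemma integrable_exp_neg_norm {c : ℝ} (hc : 0 < c) (a : Γ) :
    Integrable (fun x : Γ => exp (-(c * ‖x - a‖))) Λ := by
  have h0 : Integrable (fun x => exp (-(c * ‖x‖))) Λ := by
    have h1 := (integrable_one_add_norm (E := Γ) (μ := Λ) (r := ((2 * n + 1 : ℕ) : ℝ)) (by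
      rw [finrank_real_En]; push_cast; linarith)).const_mul
      (exp c * (2 * n + 1).factorial / c ^ (2 * n + 1))
    refine h1.mono' (by apply Continuous.aestronglyMeasurable; fun_prop) (ae_of_all _ fun x => ?_)
    rw [norm_of_nonneg (exp_pos _).le]
    exact exp_neg_le_pow _ hc (norm_nonneg x)
  exact h0.comp_sub_right a

/-- Radial primitive of `2∂φ`. -/
def radPrim (φ : Γ → ℝ) (z : Γ) : ℂ := 2 * ∫ t in (0:ℝ)..1, dz z (cx φ) (t • z)

/-- The `(0,1)`-form `∂̄ (radPrim φ)`. -/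
def radForm (φ : Γ → ℝ) (z : Γ) : Γ :=
  WithLp.toLp 2 fun j => 2 * ∫ t in (0:ℝ)..1, (t : ℂ) * leviForm φ (t • z) z (ee j)

lemma continuous_dz_radial (hφ : C∞ φ) :
    Continuous (uncurry fun (t : ℝ) (z : Γ) => dz z (cx φ) (t • z)) := by
  have h k : Continuous (đ k (cx φ)) :=
    (contDiff_dz (m := ∞) (contDiff_ofReal hφ) (by norm_num) _).continuous
  have e : (uncurry fun (t : ℝ) z => dz z (cx φ) (t • z)) =
      fun p => ∑ k, p.2 k * đ k (cx φ) (p.1 • p.2) := by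
    ext p; simp [uncurry]; rw [dz_basis]
  rw [e]
  refine continuous_finsetSum _ fun k _ => ?_
  have := h k
  fun_prop

lemma leviForm_sum_left (x z v : Γ) : leviForm φ x z v = ∑ k, z k * leviForm φ x (ee k) v := dz_basis _ _ _

lemma contDiff_leviForm (hφ : C∞ φ) (u v : Γ) : C∞ fun x => leviForm φ x u v :=
  contDiff_dz (m := ∞) (contDiff_dbar (m := ∞) (contDiff_ofReal hφ) (by norm_num) _) (by norm_num) _

lemma continuous_leviForm_radial (hφ : C∞ φ) (j : Fin n) : Continuous (uncurry fun (t : ℝ) (z : Γ) =>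
      (t : ℂ) * leviForm φ (t • z) z (ee j)) := by
  have e : (uncurry fun (t : ℝ) z => t * leviForm φ (t • z) z (ee j)) =
      fun p => (p.1 : ℂ) * ∑ k, p.2 k * leviForm φ (p.1 • p.2) (ee k) (ee j) := by
    ext p; simp only [uncurry]; rw [leviForm_sum_left]
  rw [e]
  refine (Complex.continuous_ofReal.comp continuous_fst).mul (continuous_finsetSum _ fun k _ => ?_)
  have := (contDiff_leviForm hφ (ee k) (ee j)).continuous
  fun_prop

lemma continuous_radPrim (hφ : C∞ φ) : Continuous (radPrim φ) := by
  refine continuous_const.mul ?_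
  exact intervalIntegral.continuous_parametric_intervalIntegral_of_continuous'
    (f := fun z t => dz z (cx φ) (t • z))
    ((continuous_dz_radial hφ).comp continuous_swap) 0 1

lemma continuous_radForm (hφ : C∞ φ) (j : Fin n) : Continuous fun z => radForm φ z j := by
  refine continuous_const.mul ?_
  exact intervalIntegral.continuous_parametric_intervalIntegral_of_continuous'
    (f := fun z t => t * leviForm φ (t • z) z (ee j))
    ((continuous_leviForm_radial hφ j).comp continuous_swap) 0 1

lemma dbar_dz_radial (hφ : C∞ φ) (t : ℝ) (z v : Γ) :
    dbar v (fun y => dz y (cx φ) (t • y)) z = (t : ℂ) * leviForm φ (t • z) z v := by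
  have hc : C∞ (cx φ) := contDiff_ofReal hφ
  have hD k : C∞ (đ k (cx φ)) := contDiff_dz (m := ∞) hc (by norm_num) _
  have hDt := fun k =>
    (hD k).comp (contDiff_const_smul t)
  have hk k : Entire (fun y : Γ => y k) := by fun_prop
  have e : (fun y => dz y (cx φ) (t • y)) = fun y => ∑ k, y k * đ k (cx φ) (t • y) := by ext y; rw [dz_basis]
  have hkd := fun k => (hk k).restrictScalars ℝ
  have hDtd k : Differentiable ℝ (fun y => đ k (cx φ) (t • y)) := (hDt k).differentiable (by simp)
  have e1 k : dbar v (fun y => y k * đ k (cx φ) (t • y)) z =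
      z k * (t * leviForm φ (t • z) (ee k) v) := by
    rw [dbar_mul v (hkd k z) (hDtd k z), dbar_eq_zero (hk k z)]
    have := dbar_comp_affine ((hD k).differentiable (by simp)) 0 t z v
    simp at this
    rw [this, dbar_dz_comm (hc.of_le ENat.LEInfty.out)]
    simp; left; left; rfl
  have hsum : dbar v (fun y => ∑ k, y k * đ k (cx φ) (t • y)) z =
      ∑ k, dbar v (fun y => y k * đ k (cx φ) (t • y)) z := by
    have hf : ∇ (fun y => ∑ k, y k * đ k (cx φ) (t • y)) z =
        ∑ k, ∇ (fun y => y k * đ k (cx φ) (t • y)) z :=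
      fderiv_fun_sum fun k _ => (hkd k z).mul (hDtd k z)
    simp [dbar]
    rw [hf, _root_.sum_apply, _root_.sum_apply, mul_sum, ← sum_add_distrib, Finset.sum_div]
  rw [e, hsum, leviForm_sum_left, mul_sum]
  exact sum_congr rfl fun k _ => by rw [e1]; ring

lemma weakDbar_radPrim (hφ : C∞ φ) : WeakDbar (radPrim φ) (radForm φ) := by
  intro j h hh
  have hD k : C∞ (đ k (cx φ)) :=
    contDiff_dz (m := ∞) (contDiff_ofReal hφ) (by norm_num) _
  have c1 (t : ℝ) : ContDiff ℝ 1 (fun y => dz y (cx φ) (t • y)) := by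
    rw [(by ext y; rw [dz_basis] : (fun y => dz y (cx φ) (t • y)) = fun y => ∑ k, y k * đ k (cx φ) (t • y))]
    refine ContDiff.sum fun k _ => ContDiff.mul (by fun_prop) ?_
    exact ((hD k).of_le ENat.LEInfty.out).comp (contDiff_const_smul t)
  have L : ∫ x, radPrim φ x * ð j h x ∂Λ =
      2 * ∫ t in (0:ℝ)..1, (∫ x, dz x (cx φ) (t • x) * ð j h x ∂Λ) := by
    rw [integral_swap_of_compact (F := fun t x => dz x (cx φ) (t • x) * ð j h x) ?_
      (hh.dbar (ee j)).supp.isCompact ?_ zero_le_one, ← integral_const_mul]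
    · congr 1; ext x; rw [radPrim, intervalIntegral.integral_mul_const]; ring
    · exact (continuous_dz_radial hφ).mul ((hh.dbar (ee j)).continuous.comp continuous_snd)
    · intro t y hy; rw [image_eq_zero_of_notMem_tsupport hy, mul_zero]
  have R : ∫ x, radForm φ x j * h x ∂Λ =
      2 * ∫ t in (0:ℝ)..1, (∫ x, (t * leviForm φ (t • x) x (ee j)) * h x ∂Λ) := by
    rw [integral_swap_of_compact (F := fun t x => (t * leviForm φ (t • x) x (ee j)) * h x) ?_
      hh.supp.isCompact ?_ zero_le_one, ← integral_const_mul]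
    · congr 1; ext x
      have : radForm φ x j = 2 * ∫ t in (0:ℝ)..1, t * leviForm φ (t • x) x (ee j) := rfl
      rw [this, intervalIntegral.integral_mul_const]; ring
    · exact (continuous_leviForm_radial hφ j).mul (hh.continuous.comp continuous_snd)
    · intro t y hy; rw [image_eq_zero_of_notMem_tsupport hy, mul_zero]
  have hI (t : ℝ) : ∫ x, dz x (cx φ) (t • x) * ð j h x ∂Λ =
      - ∫ x, (t * leviForm φ (t • x) x (ee j)) * h x ∂Λ := by
    rw [ibp_dbar (c1 t) (hh.smooth.of_le ENat.LEInfty.out) hh.supp]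
    simp_rw [dbar_dz_radial hφ]
  rw [L, R]
  simp_rw [hI]
  rw [intervalIntegral.integral_neg]; ring

lemma WeakDbar.weakClosed {u : Γ → ℂ} {g : Γ → Γ} (h : WeakDbar u g) : WeakClosed g := by
  intro j k t ht
  have h1 := h j _ (ht.dbar (ee k))
  have e : ð j (ð k t) = ð k (ð j t) :=
    funext fun x => dbar_dbar_comm ht.contDiff_two _ _ _
  rw [e, (h k _ (ht.dbar (ee j)))] at h1
  simp_all

lemma re_radPrim (hφ : C∞ φ) (z : Γ) : (radPrim φ z).re = φ z - φ 0 := by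
  have hcont :=
    (continuous_dz_radial hφ).comp (by fun_prop : Continuous fun t => (t, z))
  have hd := hφ.differentiable (by simp)
  have h1 t : HasDerivAt (fun t : ℝ => φ (t • z)) (2 * (dz z (cx φ) (t • z)).re) t := by
    have := (hd (t • z)).hasFDerivAt.comp_hasDerivAt t (by simpa using (hasDerivAt_id t).smul_const z)
    rwa [fderiv_eq_re_dz (hd _), ← dz_basis] at this
  have h3 := intervalIntegral.integral_eq_sub_of_hasDerivAt (a := 0) (b := 1) (fun t _ => h1 t)
    (by apply Continuous.intervalIntegrable; have := Complex.continuous_re.comp hcont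
        exact continuous_const.mul this)
  have h4 : (∫ t in (0:ℝ)..1, dz z (cx φ) (t • z)).re = ∫ t in (0:ℝ)..1, (dz z (cx φ) (t • z)).re := by
    have := reCLM.intervalIntegral_comp_comm (hcont.intervalIntegrable (μ := volume) 0 1)
    simp_all
  simp only [one_smul, zero_smul] at h3
  rw [← h3, radPrim, intervalIntegral.integral_const_mul, ← h4]
  simp

lemma norm_radForm_le {A : ℝ} (hφ : C∞ φ)
    (h0 : ∀ z v, 0 ≤ levi φ z v) (h1 : ∀ z v, levi φ z v ≤ A * ‖v‖ ^ 2) (hA : 0 ≤ A)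
    (z : Γ) (j : Fin n) : ‖radForm φ z j‖ ≤ 2 * A * (‖z‖ + 1) ^ 2 := by
  have : radForm φ z j = 2 * ∫ t in (0:ℝ)..1, t * leviForm φ (t • z) z (ee j) := rfl
  rw [this, norm_mul, norm_ofNat, mul_assoc]
  gcongr
  have := intervalIntegral.norm_integral_le_of_norm_le_const (a := (0:ℝ)) (b := 1)
    (C := A * (‖z‖ + 1) ^ 2) (f := fun t => t * leviForm φ (t • z) z (ee j)) ?_
  · simpa using this
  · intro t ht
    rw [uIoc_of_le zero_le_one] at ht
    rw [norm_mul, norm_real, norm_of_nonneg ht.1.le]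
    have := norm_leviForm_le (hφ.of_le ENat.LEInfty.out) h0 h1 hA (t • z) z (ee j)
    rw [norm_ee] at this
    calc _ ≤ 1 * ‖leviForm φ (t • z) z (ee j)‖ := by gcongr; exact ht.2
      _ ≤ _ := by rwa [one_mul]

lemma integrable_radForm {A : ℝ} (hφ : C∞ φ)
    (h0 : ∀ z v, 0 ≤ levi φ z v) (h1 : ∀ z v, levi φ z v ≤ A * ‖v‖ ^ 2) (hA : 0 ≤ A) (x : Γ) :
    ‖exp (-‖x‖ ^ 2) • radForm φ x‖ ^ 2 ≤ 96 * n * A ^ 2 * exp 3 * exp (-(1 * ‖x - 0‖)) := by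
  have hb : ‖radForm φ x‖ ^ 2 ≤ n * (2 * A * (‖x‖ + 1) ^ 2) ^ 2 := by
    rw [EuclideanSpace.norm_sq_eq]
    refine (sum_le_sum fun j _ => pow_le_pow_left₀ (norm_nonneg _) (norm_radForm_le hφ h0 h1 hA x j) 2).trans ?_
    simp
  set s := ‖x‖ with hs
  have hs0 := norm_nonneg x
  have h4 : (s + 1) ^ 4 ≤ 24 * exp (s + 1) := by
    have := Real.pow_div_factorial_le_exp (x := s + 1) (by positivity) 4
    linarith
  rw [norm_smul, mul_pow, norm_of_nonneg (exp_pos _).le, sub_zero, ← hs]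
  have e1 : exp (-s ^ 2) ^ 2 ≤ exp (2 - 4 * s) := by
    rw [← exp_nat_mul]; apply exp_le_exp.2; push_cast; nlinarith [sq_nonneg (s - 1)]
  calc _ ≤ exp (2 - 4 * s) * (n * (2 * A * (s + 1) ^ 2) ^ 2) := by gcongr
    _ = 4 * n * A ^ 2 * (exp (2 - 4 * s) * (s + 1) ^ 4) := by ring
    _ ≤ 4 * n * A ^ 2 * (exp (2 - 4 * s) * (24 * exp (s + 1))) := by gcongr
    _ = 96 * n * A ^ 2 * (exp (2 - 4 * s) * exp (s + 1)) := by ring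
    _ = 96 * n * A ^ 2 * exp (3 - 3 * s) := by rw [← exp_add]; ring_nf
    _ ≤ 96 * n * A ^ 2 * exp (3 + -(1 * s)) := by gcongr; linarith
    _ = _ := by rw [exp_add]; ring

/-- A local average of `w` is controlled by a Gaussian `L²` norm. -/
lemma mconv_le_gaussian {w : Γ → ℝ} (hw : Continuous w) {v : Γ → ℂ}
    (hv : Integrable (fun x => ‖exp (-‖x‖ ^ 2) • v x‖ ^ 2) Λ) {B : ℝ}
    (hB : ∫ x, ‖exp (-‖x‖ ^ 2) • v x‖ ^ 2 ∂Λ ≤ B)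
    (hwv : ∀ᵐ x ∂Λ, w x ≤ ‖v x‖) {z : Γ} (hz : ‖z‖ < 2) :
    mconv 1 w z ≤ 1 / 2 + exp 32 / (2 * radMass n 1) * B := by
  rw [mconv_eq']
  have hpt : ∀ᵐ y ∂Λ, moll 1 (z - y) • w y ≤ moll 1 (z - y) * (1 / 2) +
      exp 32 / (2 * radMass n 1) * ‖exp (-‖y‖ ^ 2) • v y‖ ^ 2 := by
    filter_upwards [hwv] with y hy
    have hm := moll_nonneg one_pos (z - y)
    have hrm := radMass_pos (n := n) one_pos
    by_cases hy4 : 2 * 1 ≤ ‖z - y‖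
    · rw [moll_eq_zero one_pos hy4]; simp; positivity
    · have hyn : ‖y‖ ≤ 4 := by
        have : ‖y‖ ≤ ‖z‖ + ‖z - y‖ := by have := norm_sub_le z (z - y); simpa using this
        linarith
      have hm1 : moll 1 (z - y) ≤ 1 / radMass n 1 := by unfold moll; gcongr; exact rad_le_one _ _
      have h1 : w y ≤ (1 + ‖v y‖ ^ 2) / 2 := by nlinarith [sq_nonneg (‖v y‖ - 1)]
      have he : 1 ≤ exp 32 * exp (-‖y‖ ^ 2) ^ 2 := by
        rw [← exp_nat_mul, ← exp_add]
        apply Real.one_le_exp; push_cast; nlinarith [norm_nonneg y]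
      rw [norm_smul, mul_pow, norm_of_nonneg (exp_pos _).le, smul_eq_mul]
      calc moll 1 (z - y) * w y ≤ moll 1 (z - y) * ((1 + ‖v y‖ ^ 2) / 2) := by gcongr
        _ = moll 1 (z - y) * (1 / 2) + moll 1 (z - y) * (1 * ‖v y‖ ^ 2 / 2) := by ring
        _ ≤ moll 1 (z - y) * (1 / 2) + 1 / radMass n 1 * ((exp 32 * exp (-‖y‖ ^ 2) ^ 2) * ‖v y‖ ^ 2 / 2) := by gcongr
        _ = _ := by field_simp
  have hi := (integrable_moll (n := n) one_pos).comp_sub_left z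
  refine (integral_mono_ae (integrable_moll_smul one_pos hw.locallyIntegrable z)
    ((hi.mul_const _).add (hv.const_mul _)) hpt).trans ?_
  simp only [Pi.add_apply]
  rw [integral_add (hi.mul_const _) (hv.const_mul _), integral_mul_const, integral_const_mul,
    integral_moll_sub one_pos, one_mul]
  have hrm := radMass_pos (n := n) one_pos
  gcongr

/-- A plurisubharmonic function with bounded Levi form is, on balls of fixed radius, within a
uniform constant of the real part of an entire function. -/
theorem exists_pluriharmonic_approx (n : ℕ) {A : ℝ} (hA : 0 ≤ A) : ∃ K : ℝ, ∀ φ : En n → ℝ,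
    C∞ φ → (∀ z v, 0 ≤ levi φ z v) → (∀ z v, levi φ z v ≤ A * ‖v‖ ^ 2) → ∀ a : En n,
    ∃ H : En n → ℂ, Entire H ∧ ∀ z ∈ ball a 2, |φ z - (H z).re| ≤ K := by
  set B := 96 * n * A ^ 2 * exp 3 * ∫ x, exp (-(1 * ‖x - 0‖)) ∂(vol n) with hBdef
  set M := 1 / 2 + exp 32 / (2 * radMass n 1) * B with hM
  refine ⟨M + A * 16, fun φ₀ hφ₀ h00 h01 a => ?_⟩
  set φ := fun x => φ₀ (a + x) with hφdef
  have hφ : C∞ φ := hφ₀.comp (contDiff_const.add contDiff_id)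
  have h0 z v : 0 ≤ levi φ z v := by rw [levi_comp_add]; exact h00 _ _
  have h1 z v : levi φ z v ≤ A * ‖v‖ ^ 2 := by rw [levi_comp_add]; exact h01 _ _
  have hgc : Continuous (radForm φ) := by
    have : Continuous fun x => WithLp.toLp 2 fun j => radForm φ x j :=
      (PiLp.continuous_toLp 2 _).comp (continuous_pi fun j => continuous_radForm hφ j)
    exact this
  have hnc : Continuous fun x : En n => exp (-‖x‖ ^ 2) := by fun_prop
  have hbd := integrable_radForm hφ h0 h1 hA
  have hdom := (integrable_exp_neg_norm (n := n) one_pos 0).const_mul (96 * n * A ^ 2 * exp 3)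
  have hgi : Integrable (fun x => ‖exp (-‖x‖ ^ 2) • radForm φ x‖ ^ 2) (vol n) :=
    hdom.mono' ((hnc.smul hgc).norm.pow 2).aestronglyMeasurable
      (ae_of_all _ fun x => by rw [norm_of_nonneg (by positivity)]; exact hbd x)
  have hgm :=
    (memLp_two_iff_integrable_sq_norm (hnc.smul hgc).aestronglyMeasurable).2 hgi
  have hW := weakDbar_radPrim hφ
  obtain ⟨v, hv, hvd, -, hve⟩ := hormander (ψ := fun x => ‖x‖ ^ 2) contDiff_normSq one_pos
    (fun z v => by rw [levi_normSq, one_mul]) hgm hW.weakClosed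
  have hvi := (memLp_two_iff_integrable_sq_norm hv.1).1 hv
  have key : ∀ {F : Type} [NormedAddCommGroup F] {u : En n → F}, Integrable (fun x => ‖u x‖ ^ 2) (vol n) →
      ∫⁻ x, ‖u x‖ₑ ^ 2 ∂(vol n) = ofReal (∫ x, ‖u x‖ ^ 2 ∂(vol n)) := fun {F} _ u hu => by
    rw [ofReal_integral_eq_lintegral_ofReal hu (ae_of_all _ fun x => by positivity)]
    congr 1; ext x
    rw [ofReal_pow (norm_nonneg _), ofReal_norm]
  have hgB : ∫ x, ‖exp (-‖x‖ ^ 2) • radForm φ x‖ ^ 2 ∂(vol n) ≤ B := by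
    rw [hBdef, ← integral_const_mul]
    exact integral_mono hgi hdom hbd
  have hvB : ∫ x, ‖exp (-‖x‖ ^ 2) • v x‖ ^ 2 ∂(vol n) ≤ B := by
    rw [ofReal_one, one_mul, key hvi, key hgi] at hve
    exact ((ofReal_le_ofReal_iff (integral_nonneg fun x => by positivity)).1 hve).trans hgB
  have hvl : LocallyIntegrable v (vol n) := by
    have h2 := hv.locallyIntegrable (by norm_num)
    refine (h2.continuous_smul (by fun_prop : Continuous fun x => exp (‖x‖ ^ 2))).congr (ae_of_all _ fun x => ?_)
    simp only [smul_smul, ← exp_add]; simp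
  have hsl := (continuous_radPrim hφ).locallyIntegrable (μ := vol n)
  have hhol : WeakHol (fun x => radPrim φ x - v x) := fun j h hh => by
    simp_rw [sub_mul]
    rw [integral_sub (integrable_mul_test hsl (hh.dbar _).continuous (hh.dbar _).supp) (integrable_mul_test hvl (hh.dbar _).continuous (hh.dbar _).supp),
      hW j h hh, hvd j h hh]; ring
  have hloc : LocallyIntegrable (fun x => radPrim φ x - v x) (vol n) := hsl.sub hvl
  obtain ⟨hH, hHe⟩ := weyl_global hloc hhol
  set H := mconv 1 (fun x => radPrim φ x - v x)
  set h := fun x => φ x - φ 0 - (H x).re with hh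
  have hre : C² fun x => (H x).re := 
    reCLM.contDiff.comp ((contDiff_of_differentiable hH).of_le ENat.LEInfty.out)
  have hφ2 : C² φ := hφ.of_le ENat.LEInfty.out
  have hh2 : C² h := (hφ2.sub contDiff_const).sub hre
  have hlev z v : levi h z v = levi φ z v := by
    rw [hh, levi_sub (hφ2.sub contDiff_const) hre, levi_sub hφ2 contDiff_const, levi_const, levi_re hH]
    ring
  have habs : ∀ᵐ x ∂(vol n), |h x| ≤ ‖v x‖ := by
    filter_upwards [hHe] with x hx
    have : h x = (v x).re := by simp [hh]; rw [← hx, sub_re, re_radPrim hφ]; ring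
    rw [this]; exact Complex.abs_re_le_norm _
  have up := fun z hz =>
    (sub_mean hh2 (fun z v => by rw [hlev]; exact h0 z v) one_pos z).trans
      (mconv_le_gaussian hh2.continuous hvi hvB (habs.mono fun x hx => (le_abs_self _).trans hx) hz)
  have lo z (hz : ‖z‖ < 2) : - h z ≤ M + A * 16 := by
    have hn2 : C² fun x : En n => A * ‖x‖ ^ 2 := (contDiff_normSq.of_le ENat.LEInfty.out).const_smul A
    have hs := sub_mean (hh2.neg.add hn2) (fun z v => by
      rw [levi_add hh2.neg hn2, levi_neg hh2,
        levi_const_mul (contDiff_normSq.of_le ENat.LEInfty.out), levi_normSq, hlev]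
      linarith [h1 z v]) one_pos z
    have hm1 := mconv_le_gaussian hh2.continuous.neg hvi hvB (habs.mono fun x hx => (neg_le_abs _).trans hx) hz
    have hm2 : mconv 1 (fun x => A * ‖x‖ ^ 2) z ≤ A * 16 := by
      rw [mconv_eq']
      calc _ ≤ ∫ y, moll 1 (z - y) * (A * 16) ∂(vol n) := by
            refine integral_mono (integrable_moll_smul one_pos hn2.continuous.locallyIntegrable z)
              (((integrable_moll one_pos).comp_sub_left z).mul_const _) fun y => ?_
            have hm := moll_nonneg one_pos (z - y)
            by_cases hy4 : 2 * 1 ≤ ‖z - y‖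
            · simp [moll_eq_zero one_pos hy4]
            · have hyn : ‖y‖ ≤ 4 := by
                have : ‖y‖ ≤ ‖z‖ + ‖z - y‖ := by have := norm_sub_le z (z - y); simpa using this
                linarith
              simp
              gcongr
              nlinarith [norm_nonneg y]
        _ = A * 16 := by rw [integral_mul_const, integral_moll_sub one_pos, one_mul]
    have hadd : mconv 1 (fun x => -h x + A * ‖x‖ ^ 2) z =
        mconv 1 (fun x => -h x) z + mconv 1 (fun x => A * ‖x‖ ^ 2) z := by
      simp only [mconv_eq', smul_add]
      exact integral_add (integrable_moll_smul one_pos hh2.continuous.neg.locallyIntegrable z)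
        (integrable_moll_smul one_pos hn2.continuous.locallyIntegrable z)
    have hz2 : 0 ≤ A * ‖z‖ ^ 2 := by positivity
    have hm1' : mconv 1 (fun x => -h x) z ≤ M := hm1
    simp at hs
    linarith
  refine ⟨fun z => H (z - a) + φ 0, (hH.comp (differentiable_id.sub_const a)).add_const _, fun z hz => ?_⟩
  have hz' : ‖z - a‖ < 2 := by rwa [mem_ball, dist_eq_norm] at hz
  rw [(by simp [hh, hφdef]; ring : φ₀ z - (H (z - a) + φ 0).re = h (z - a)), abs_le]
  constructor
  · linarith [lo _ hz']
  · linarith [up _ hz']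

/-- A smooth version of the distance to `a`. -/
def jap (a z : Γ) : ℝ := Real.sqrt (1 + ‖z - a‖ ^ 2)

lemma one_le_jap (a z : Γ) : 1 ≤ jap a z := by unfold jap; rw [Real.one_le_sqrt]; nlinarith [norm_nonneg (z - a)]

lemma norm_le_jap (a z : Γ) : ‖z - a‖ ≤ jap a z := by unfold jap; apply Real.le_sqrt_of_sq_le; linarith

lemma jap_le (a z : Γ) : jap a z ≤ 1 + ‖z - a‖ := by
  unfold jap; rw [Real.sqrt_le_left (by positivity)]; nlinarith [norm_nonneg (z - a)]

lemma jap_sub_le (a b z : Γ) : jap a z ≤ jap b z + ‖a - b‖ := by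
  have h1 := norm_le_jap b z
  have h2 : ‖z - a‖ ≤ ‖z - b‖ + ‖a - b‖ := by have := norm_sub_le (z - b) (a - b); simpa using this
  have h3 : jap b z ^ 2 = 1 + ‖z - b‖ ^ 2 := sq_sqrt (by positivity)
  conv_lhs => unfold jap
  have := one_le_jap b z
  rw [Real.sqrt_le_left (by positivity)]
  nlinarith [norm_nonneg (z - a), norm_nonneg (a - b)]

lemma contDiff_jap (a : Γ) : C∞ (jap a) := by
  have : C∞ fun z => 1 + ‖z - a‖ ^ 2 :=
    contDiff_const.add (contDiff_normSq.comp (contDiff_id.sub contDiff_const))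
  exact this.sqrt fun z => by positivity

lemma hasFDerivAt_jap (a z : Γ) : HasFDerivAt (jap a) ((jap a z)⁻¹ • innerSL ℝ (z - a)) z := by
  have h1 : HasFDerivAt (fun z => 1 + ‖z - a‖ ^ 2) (2 • innerSL ℝ (z - a)) z := by
    have := (hasStrictFDerivAt_norm_sq (F := Γ) (z - a)).hasFDerivAt.comp z ((hasFDerivAt_id z).sub_const a)
    fun_prop
  have h3 : (jap a z)⁻¹ • innerSL ℝ (z - a) = (1 / (2 * jap a z)) • 2 • innerSL ℝ (z - a) := by
    have : 2 • innerSL ℝ (z - a) = (2 : ℝ) • innerSL ℝ (z - a) := by rw [← Nat.cast_smul_eq_nsmul ℝ]; norm_num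
    rw [this, smul_smul]
    simp
  rw [h3]
  exact (h1.sqrt (by positivity))

lemma norm_fderiv_jap_le (a z : Γ) : ‖∇ (jap a) z‖ ≤ 1 := by
  rw [(hasFDerivAt_jap a z).fderiv, norm_smul, innerSL_apply_norm, norm_inv,
    norm_of_nonneg (zero_le_one.trans (one_le_jap a z)), inv_mul_le_one₀ (by linarith [one_le_jap a z])]
  exact norm_le_jap a z

lemma hess_jap (a z u : Γ) :
    hess (jap a) z u u = (jap a z)⁻¹ * ‖u‖ ^ 2 - (inner ℝ (z - a) u) ^ 2 * (jap a z)⁻¹ ^ 3 := by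
  unfold hess
  have h0 :=
    funext fun z => (hasFDerivAt_jap a z).fderiv
  have h1 : HasFDerivAt (fun z => (jap a z)⁻¹) (-(jap a z ^ 2)⁻¹ • ((jap a z)⁻¹ • innerSL ℝ (z - a))) z :=
    (hasDerivAt_inv (by linarith [one_le_jap a z])).comp_hasFDerivAt z (hasFDerivAt_jap a z)
  have h2 : HasFDerivAt (fun z => innerSL ℝ (z - a)) (innerSL ℝ (E := Γ)) z :=
    (innerSL ℝ (E := Γ)).hasFDerivAt.comp z ((hasFDerivAt_id z).sub_const a)
  rw [h0, (h1.fun_smul h2).fderiv]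
  simp only [_root_.add_apply, _root_.smul_apply, smulRight_apply, innerSL_apply_apply, smul_eq_mul]
  rw [innerSL_apply_apply, real_inner_self_eq_norm_sq]
  field_simp
  ring

lemma hess_jap_bounds (a z u : Γ) : 0 ≤ hess (jap a) z u u ∧ hess (jap a) z u u ≤ ‖u‖ ^ 2 := by
  rw [hess_jap]
  have h1 := one_le_jap a z
  have h2 : (inner ℝ (z - a) u) ^ 2 ≤ (jap a z) ^ 2 * ‖u‖ ^ 2 := by
    rw [← sq_abs, ← mul_pow]
    gcongr
    exact (abs_real_inner_le_norm _ _).trans (by gcongr; exact norm_le_jap a z)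
  have h3 := inv_le_one_of_one_le₀ h1
  constructor
  · have : (inner ℝ (z - a) u) ^ 2 * (jap a z)⁻¹ ^ 3 ≤ (jap a z) ^ 2 * ‖u‖ ^ 2 * (jap a z)⁻¹ ^ 3 := by gcongr
    have e : (jap a z) ^ 2 * ‖u‖ ^ 2 * (jap a z)⁻¹ ^ 3 = (jap a z)⁻¹ * ‖u‖ ^ 2 := by field_simp
    linarith
  · have : 0 ≤ (inner ℝ (z - a) u) ^ 2 * (jap a z)⁻¹ ^ 3 := by positivity
    nlinarith

lemma levi_jap_bounds (a z v : Γ) : 0 ≤ levi (jap a) z v ∧ levi (jap a) z v ≤ ‖v‖ ^ 2 / 2 := by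
  have h1 := hess_jap_bounds a z v
  have h2 := hess_jap_bounds a z (I • v)
  rw [norm_smul, norm_I, one_mul] at h2
  unfold levi
  constructor <;> linarith

lemma memLp_exp_smul {F : Type*} [NormedAddCommGroup F] [NormedSpace ℝ F] {b : Γ → ℝ}
    (hb : Continuous b) {C : ℝ} (hC : ∀ x, b x ≤ C) {f : Γ → F} (hf : MemLp f 2 Λ) :
    MemLp (fun x => exp (b x) • f x) 2 Λ := by
  refine hf.of_le_mul (c := exp C)
    ((Real.continuous_exp.comp hb).aestronglyMeasurable.smul hf.1) (ae_of_all _ fun x => ?_)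
  rw [norm_smul, norm_of_nonneg (exp_pos _).le]
  gcongr; exact hC x

lemma locallyIntegrable_of_memLp_exp {F : Type*} [NormedAddCommGroup F] [NormedSpace ℝ F]
    {b : Γ → ℝ} (hb : Continuous b) {f : Γ → F}
    (hf : MemLp (fun x => exp (b x) • f x) 2 Λ) : LocallyIntegrable f Λ := by
  have h2 := hf.locallyIntegrable (by norm_num)
  refine (h2.continuous_smul (by fun_prop : Continuous fun x => exp (-b x))).congr (ae_of_all _ fun x => ?_)
  simp only [smul_smul, ← exp_add]; simp

lemma lintegral_sq_eq {F : Type*} [NormedAddCommGroup F] {u : Γ → F} (hu : MemLp u 2 Λ) :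
    ∫⁻ x, ‖u x‖ₑ ^ 2 ∂Λ = ofReal (∫ x, ‖u x‖ ^ 2 ∂Λ) := by
  rw [ofReal_integral_eq_lintegral_ofReal ((memLp_two_iff_integrable_sq_norm hu.1).1 hu)
    (ae_of_all _ fun x => by positivity)]
  congr 1; ext x
  rw [ofReal_pow (norm_nonneg _), ofReal_norm]

lemma WeakDbar.expw_mul {u : Γ → ℂ} {g : Γ → Γ} {χ : Γ → ℝ} (hχ : C∞ χ)
    (hu : LocallyIntegrable u Λ) (hg : Continuous g) (h : WeakDbar u g) :
    WeakDbar (fun x => expw χ x * u x)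
      (fun x => WithLp.toLp 2 fun j => expw χ x * (g x j + u x * ð j (cx χ) x)) := by
  intro j t ht
  have hE := isTest_expw_mul hχ ht
  have ht2 : IsTest fun x => ð j (cx χ) x * (expw χ x * t x) :=
    IsTest.mul_left (contDiff_dbar (m := ∞) (contDiff_cx hχ) (by norm_num) _) hE
  have e1 x : expw χ x * u x * ð j t x = u x * ð j (fun x => expw χ x * t x) x
        - u x * (ð j (cx χ) x * (expw χ x * t x)) := by
    rw [dbar_expw_mul hχ ht]; ring
  have e2 x : expw χ x * (g x j + u x * ð j (cx χ) x) * t x =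
      g x j * (expw χ x * t x) + u x * (ð j (cx χ) x * (expw χ x * t x)) := by ring
  simp_rw [e1, e2]
  rw [integral_sub (integrable_mul_test hu (hE.dbar _).continuous (hE.dbar _).supp)
    (integrable_mul_test hu ht2.continuous ht2.supp),
    integral_add (integrable_mul_test (by fun_prop : Continuous fun x => g x j).locallyIntegrable hE.continuous hE.supp)
    (integrable_mul_test hu ht2.continuous ht2.supp), (h j _ hE)]
  ring

/-- Weighted solution of `∂̄u = g` with pointwise-type control: the local `L²` norm of the solution
is governed by a slowly varying majorant of the data. -/
theorem exists_weighted_solution (n : ℕ) {c : ℝ} (hc : 0 < c) : ∃ ε > 0, ∃ K ≥ 0,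
    ∀ ψ : En n → ℝ, C∞ ψ → (∀ z v, c * ‖v‖ ^ 2 ≤ levi ψ z v) →
    ∀ g : En n → En n, Continuous g → WeakClosed g →
    ∀ M : En n → ℝ, (∀ a z, M z ≤ M a * exp (ε * ‖z - a‖)) →
    (∀ z, ‖g z‖ * exp (-ψ z) ≤ M z) →
    ∃ u : En n → ℂ, LocallyIntegrable u (vol n) ∧ WeakDbar u g ∧
      ∀ a, IntegrableOn (fun x => ‖exp (-ψ x) • u x‖ ^ 2) (ball a 1) (vol n) ∧
        ∫ x in ball a 1, ‖exp (-ψ x) • u x‖ ^ 2 ∂(vol n) ≤ K * M a ^ 2 := by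
  set ε : ℝ := min 1 (c / (32 * (n + 1))) with hε
  have hε0 : 0 < ε := by positivity
  have hε1 : ε ≤ 1 := min_le_left _ _
  have hεc : 32 * (n + 1) * ε ≤ c := by
    have : ε ≤ c / (32 * (n + 1)) := min_le_right _ _
    rw [le_div_iff₀ (by positivity)] at this; linarith
  have hεc1 : ε ≤ c := by nlinarith [(Nat.cast_nonneg n : (0:ℝ) ≤ n)]
  have hεc2 : 32 * n * ε ^ 2 ≤ c := by
    have : (0:ℝ) ≤ n := Nat.cast_nonneg n
    nlinarith
  set J : ℝ := ∫ x : En n, exp (-(ε / 2 * ‖x - 0‖)) ∂(vol n) with hJ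
  have hJ0 : 0 ≤ J := integral_nonneg fun x => (exp_pos _).le
  refine ⟨ε / 4, by positivity, exp 2 * (8 / c * J), by positivity, fun ψ hψ hlev g hg hgc M hM hgM => ?_⟩
  have hψ2 : C² ψ := hψ.of_le ENat.LEInfty.out
  have hj2 : ∀ a : En n, C² (jap a) := fun a => (contDiff_jap a).of_le ENat.LEInfty.out
  have hjc : ∀ a : En n, Continuous (jap a) := fun a => (contDiff_jap a).continuous
  have hψc : Continuous ψ := hψ.continuous
  have hM0 : ∀ z, 0 ≤ M z := fun z => le_trans (by positivity) (hgM z)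
  -- weighted bound for `g`
  have hgb : ∀ a x, ‖exp (-(ψ x + ε / 2 * jap a x)) • g x‖ ^ 2 ≤ M a ^ 2 * exp (-(ε / 2 * ‖x - a‖)) := fun a x => by
    rw [norm_smul, norm_of_nonneg (exp_pos _).le]
    have h1 : exp (-(ψ x + ε / 2 * jap a x)) * ‖g x‖ ≤ M a * exp (-(ε / 4 * ‖x - a‖)) := by
      have e : exp (-(ψ x + ε / 2 * jap a x)) = exp (-ψ x) * exp (-(ε / 2 * jap a x)) := by rw [← exp_add]; ring_nf
      calc _ = (‖g x‖ * exp (-ψ x)) * exp (-(ε / 2 * jap a x)) := by rw [e]; ring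
        _ ≤ M x * exp (-(ε / 2 * ‖x - a‖)) := by
            have := hM0 x
            gcongr
            · exact hgM x
            · exact norm_le_jap a x
        _ ≤ (M a * exp (ε / 4 * ‖x - a‖)) * exp (-(ε / 2 * ‖x - a‖)) := by gcongr; exact hM a x
        _ = _ := by rw [mul_assoc, ← exp_add]; ring_nf
    calc _ ≤ (M a * exp (-(ε / 4 * ‖x - a‖))) ^ 2 := by gcongr
      _ = _ := by rw [mul_pow, ← exp_nat_mul]; push_cast; ring_nf
  have hdom : ∀ a : En n, Integrable (fun x => M a ^ 2 * exp (-(ε / 2 * ‖x - a‖))) (vol n) :=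
    fun a => (integrable_exp_neg_norm (by positivity) a).const_mul _
  have hgi : ∀ a : En n, Integrable (fun x => ‖exp (-(ψ x + ε / 2 * jap a x)) • g x‖ ^ 2) (vol n) :=
    fun a => (hdom a).mono' (by
      have := hjc a
      apply Continuous.aestronglyMeasurable; fun_prop)
      (ae_of_all _ fun x => by rw [norm_of_nonneg (by positivity)]; exact hgb a x)
  have hgm : ∀ a : En n, MemLp (fun x => exp (-(ψ x + ε / 2 * jap a x)) • g x) 2 (vol n) :=
    fun a => (memLp_two_iff_integrable_sq_norm (by
      have := hjc a
      apply Continuous.aestronglyMeasurable; fun_prop)).2 (hgi a)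
  have hgJ : ∀ a : En n, ∫ x, ‖exp (-(ψ x + ε / 2 * jap a x)) • g x‖ ^ 2 ∂(vol n) ≤ M a ^ 2 * J := fun a => by
      refine (integral_mono (hgi a) (hdom a) (hgb a)).trans (le_of_eq ?_)
      rw [integral_const_mul]
      congr 1
      rw [hJ, ← integral_sub_right_eq_self (fun x : En n => exp (-(ε / 2 * ‖x - 0‖))) a]
      simp
  -- the minimal solution
  set ψ₁ : En n → ℝ := fun x => ψ x + ε / 2 * jap 0 x with hψ₁
  have hψ₁s : C∞ ψ₁ := hψ.add (contDiff_const.mul (contDiff_jap 0))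
  obtain ⟨u, hu, hud, huo, -⟩ := hormander hψ₁s hc (fun z v => by
    rw [hψ₁, levi_add hψ2 (contDiff_const.mul (hj2 0)), levi_const_mul (hj2 0)]
    have := mul_nonneg (half_pos hε0).le (levi_jap_bounds 0 z v).1
    linarith [hlev z v]) (hgm 0) hgc
  have hul : LocallyIntegrable u (vol n) := locallyIntegrable_of_memLp_exp hψ₁s.continuous.neg hu
  refine ⟨u, hul, hud, fun a => ?_⟩
  set χ : En n → ℝ := fun x => ε * (jap 0 x - jap a x) with hχ
  have hχs : C∞ χ := contDiff_const.mul ((contDiff_jap 0).sub (contDiff_jap a))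
  have hχb : ∀ x, χ x ≤ ε * ‖a‖ := fun x => by
    have := jap_sub_le 0 a x
    rw [zero_sub, norm_neg] at this
    simp only [hχ]; gcongr; linarith
  have hχd : ∀ x, ‖∇ (cx χ) x‖ ≤ 2 * ε := fun x => by
    have e : ∇ (cx χ) x = ofRealCLM.comp (∇ χ x) :=
      (ofRealCLM.hasFDerivAt.comp x (hχs.differentiable (by simp) x).hasFDerivAt).fderiv
    have d : ∀ a : En n, DifferentiableAt ℝ (jap a) x := fun a => (contDiff_jap a).differentiable (by simp) x
    have e2 : ∇ χ x = ε • (∇ (jap 0) x - ∇ (jap a) x) := by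
      rw [← fderiv_fun_sub (d 0) (d a)]
      exact fderiv_const_mul ((d 0).fun_sub (d a)) ε
    rw [e, e2]
    refine (ContinuousLinearMap.opNorm_comp_le _ _).trans ?_
    rw [Complex.ofRealCLM_norm, one_mul, norm_smul, norm_of_nonneg hε0.le]
    have := norm_sub_le (∇ (jap 0) x) (∇ (jap a) x)
    have h1 := norm_fderiv_jap_le 0 x
    have h2 := norm_fderiv_jap_le a x
    nlinarith
  set ψ₂ : En n → ℝ := fun x => ψ x + (ε * jap 0 x - ε / 2 * jap a x) with hψ₂
  have hψ₂s : C∞ ψ₂ := hψ.add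
    ((contDiff_const.mul (contDiff_jap 0)).sub (contDiff_const.mul (contDiff_jap a)))
  have hψ₂l : ∀ z v, c / 2 * ‖v‖ ^ 2 ≤ levi ψ₂ z v := fun z v => by
    rw [hψ₂, levi_add hψ2 ((contDiff_const.mul (hj2 0)).sub (contDiff_const.mul (hj2 a))),
      levi_sub (contDiff_const.mul (hj2 0)) (contDiff_const.mul (hj2 a)),
      levi_const_mul (hj2 0), levi_const_mul (hj2 a)]
    have h1 := mul_nonneg hε0.le (levi_jap_bounds 0 z v).1
    have h2 := mul_le_mul_of_nonneg_left (levi_jap_bounds a z v).2 (half_pos hε0).le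
    have h3 := hlev z v
    nlinarith [sq_nonneg ‖v‖]
  have hV : ∀ x, -ψ₂ x + χ x = -(ψ x + ε / 2 * jap a x) := fun x => by simp only [hψ₂, hχ]; ring
  have hV1 : ∀ x, -ψ₂ x + χ x = χ x / 2 + -ψ₁ x := fun x => by simp only [hψ₂, hχ, hψ₁]; ring
  have hV2 : ∀ x, -ψ₁ x = χ x / 2 + -ψ₂ x := fun x => by simp only [hψ₂, hχ, hψ₁]; ring
  set G : En n → En n := fun x => WithLp.toLp 2 fun j => expw χ x * (g x j + u x * ð j (cx χ) x) with hG
  have hGd : WeakDbar (fun x => expw χ x * u x) G := hud.expw_mul hχs hul hg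
  have hexp : ∀ x (w : ℂ), exp (-ψ₂ x) • (expw χ x * w) = exp (-(ψ x + ε / 2 * jap a x)) • w := fun x w => by
    rw [← hV, exp_add, mul_smul, expw, real_smul, real_smul, real_smul]
  set V : En n → ℂ := fun x => exp (-(ψ x + ε / 2 * jap a x)) • u x with hVdef
  have hχc : Continuous χ := hχs.continuous
  have hVm : MemLp V 2 (vol n) := by
    have := memLp_exp_smul (b := fun x => χ x / 2) (by fun_prop) (C := ε * ‖a‖ / 2) (fun x => by linarith [hχb x]) hu
    refine this.ae_eq (ae_of_all _ fun x => ?_)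
    simp only [hVdef, ← hV, hV1, exp_add, mul_smul]
  have hVi := (memLp_two_iff_integrable_sq_norm hVm.1).1 hVm
  -- the form `G`
  have hGe : ∀ x, exp (-ψ₂ x) • G x = exp (-(ψ x + ε / 2 * jap a x)) • g x +
      V x • WithLp.toLp 2 (fun j => ð j (cx χ) x) := fun x => by
    ext j
    have := hexp x (g x j + u x * ð j (cx χ) x)
    simp only [hG, hVdef, PiLp.smul_apply, PiLp.add_apply, this, smul_add, smul_eq_mul, real_smul]
    ring
  have hDn : ∀ x, ‖(WithLp.toLp 2 (fun j => ð j (cx χ) x) : En n)‖ ^ 2 ≤ 4 * n * ε ^ 2 := fun x => by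
      rw [EuclideanSpace.norm_sq_eq]
      have : ∀ j : Fin n, ‖ð j (cx χ) x‖ ^ 2 ≤ (2 * ε) ^ 2 := fun j => by
        have := norm_dbar_le (v := ee j) (hχd x)
        rw [norm_ee, mul_one] at this
        gcongr
      refine (sum_le_sum fun j _ => this j).trans (le_of_eq ?_)
      simp; ring
  have hDc : Continuous fun x => (WithLp.toLp 2 (fun j => ð j (cx χ) x) : En n) :=
    (PiLp.continuous_toLp 2 _).comp (continuous_pi fun j =>
      (contDiff_dbar (m := ∞) (contDiff_cx hχs) (by norm_num) _).continuous)
  have hVDm : MemLp (fun x => V x • (WithLp.toLp 2 (fun j => ð j (cx χ) x) : En n)) 2 (vol n) := by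
    refine hVm.of_le_mul (c := Real.sqrt (4 * n * ε ^ 2)) (hVm.1.smul hDc.aestronglyMeasurable)
      (ae_of_all _ fun x => ?_)
    rw [norm_smul, mul_comm]
    gcongr
    exact Real.le_sqrt_of_sq_le (hDn x)
  have hGm : MemLp (fun x => exp (-ψ₂ x) • G x) 2 (vol n) := by simp_rw [hGe]; exact (hgm a).add hVDm
  have hGi := (memLp_two_iff_integrable_sq_norm hGm.1).1 hGm
  obtain ⟨v, hv, hvd, -, hve⟩ := hormander hψ₂s (half_pos hc) hψ₂l hGm hGd.weakClosed
  have hvi := (memLp_two_iff_integrable_sq_norm hv.1).1 hv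
  have hvl : LocallyIntegrable v (vol n) := locallyIntegrable_of_memLp_exp hψ₂s.continuous.neg hv
  have hel : LocallyIntegrable (fun x => expw χ x * u x) (vol n) := hul.continuous_smul (contDiff_expw hχs).continuous
  -- orthogonality
  set D : En n → ℂ := fun x => expw χ x * u x - v x with hD
  have hDe : ∀ x, exp (-ψ₂ x) • D x = V x - exp (-ψ₂ x) • v x := fun x => by rw [hD, smul_sub, hexp]
  have hDm : MemLp (fun x => exp (-ψ₂ x) • D x) 2 (vol n) := by simp_rw [hDe]; exact hVm.sub hv
  have hDm1 : MemLp (fun x => exp (-ψ₁ x) • D x) 2 (vol n) := by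
    have := memLp_exp_smul (b := fun x => χ x / 2) (by fun_prop) (C := ε * ‖a‖ / 2) (fun x => by linarith [hχb x]) hDm
    refine this.ae_eq (ae_of_all _ fun x => ?_)
    simp only [hV2, exp_add, mul_smul]
  have hDh : WeakHol D := fun j h hh => by
    simp only [hD, sub_mul]
    rw [integral_sub (integrable_mul_test hel (hh.dbar _).continuous (hh.dbar _).supp)
      (integrable_mul_test hvl (hh.dbar _).continuous (hh.dbar _).supp), hGd j h hh, hvd j h hh]
    ring
  have horth := huo D hDm1 hDh
  have horth' : ∫ x, V x * conj (exp (-ψ₂ x) • D x) ∂(vol n) = 0 := by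
    rw [← horth]; congr 1; ext x
    simp only [hVdef, ← hV, hV1, hV2, exp_add, mul_smul, real_smul, map_mul, Complex.conj_ofReal]
    ring
  have hVle : ∫ x, ‖V x‖ ^ 2 ∂(vol n) ≤ ∫ x, ‖exp (-ψ₂ x) • v x‖ ^ 2 ∂(vol n) := by
    have hi : Integrable (fun x => V x * conj (exp (-ψ₂ x) • D x)) (vol n) := hVm.integrable_mul hDm.star
    have hir : Integrable (fun x => (V x * conj (exp (-ψ₂ x) • D x)).re) (vol n) := hi.re
    have hre : ∫ x, (V x * conj (exp (-ψ₂ x) • D x)).re ∂(vol n) = 0 := by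
      have := integral_re hi
      simp only [RCLike.re_eq_complex_re] at this
      rw [this, horth']; simp
    calc _ ≤ ∫ x, (‖exp (-ψ₂ x) • v x‖ ^ 2 + 2 * (V x * conj (exp (-ψ₂ x) • D x)).re) ∂(vol n) := by
          refine integral_mono hVi (hvi.add (hir.const_mul 2)) fun x => ?_
          have e : exp (-ψ₂ x) • v x = V x - exp (-ψ₂ x) • D x := by rw [hDe]; ring
          simp only []
          rw [e]
          generalize exp (-ψ₂ x) • D x = d
          rw [← normSq_eq_norm_sq, ← normSq_eq_norm_sq, Complex.normSq_sub]
          have := Complex.normSq_nonneg d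
          linarith
      _ = _ := by rw [integral_add hvi (hir.const_mul 2), integral_const_mul, hre]; simp
  have hve' : c / 2 * ∫ x, ‖exp (-ψ₂ x) • v x‖ ^ 2 ∂(vol n) ≤ ∫ x, ‖exp (-ψ₂ x) • G x‖ ^ 2 ∂(vol n) := by
    rw [lintegral_sq_eq hv, lintegral_sq_eq hGm, ← ofReal_mul (by positivity)] at hve
    exact (ofReal_le_ofReal_iff (integral_nonneg fun x => by positivity)).1 hve
  have hGle : ∫ x, ‖exp (-ψ₂ x) • G x‖ ^ 2 ∂(vol n) ≤
      2 * (M a ^ 2 * J) + 8 * n * ε ^ 2 * ∫ x, ‖V x‖ ^ 2 ∂(vol n) := by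
    calc _ ≤ ∫ x, (2 * ‖exp (-(ψ x + ε / 2 * jap a x)) • g x‖ ^ 2 + 8 * n * ε ^ 2 * ‖V x‖ ^ 2) ∂(vol n) := by
          refine integral_mono hGi (((hgi a).const_mul 2).add (hVi.const_mul _)) fun x => ?_
          simp only [hGe]
          have h1 := norm_add_le (exp (-(ψ x + ε / 2 * jap a x)) • g x)
            (V x • (WithLp.toLp 2 (fun j => ð j (cx χ) x) : En n))
          have h2 : ‖V x • (WithLp.toLp 2 (fun j => ð j (cx χ) x) : En n)‖ ^ 2 ≤
              4 * n * ε ^ 2 * ‖V x‖ ^ 2 := by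
            rw [norm_smul, mul_pow, mul_comm]; gcongr; exact hDn x
          have h3 := pow_le_pow_left₀ (norm_nonneg _) h1 2
          have h4 := add_sq_le (a := ‖exp (-(ψ x + ε / 2 * jap a x)) • g x‖)
            (b := ‖V x • (WithLp.toLp 2 (fun j => ð j (cx χ) x) : En n)‖)
          linarith
      _ ≤ _ := by
          rw [integral_add ((hgi a).const_mul 2) (hVi.const_mul _), integral_const_mul, integral_const_mul]
          gcongr; exact hgJ a
  have hVfin : ∫ x, ‖V x‖ ^ 2 ∂(vol n) ≤ 8 / c * J * M a ^ 2 := by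
    have hV0 : 0 ≤ ∫ x, ‖V x‖ ^ 2 ∂(vol n) := integral_nonneg fun x => by positivity
    have h1 := mul_le_mul_of_nonneg_left hVle (half_pos hc).le
    have h2 := mul_le_mul_of_nonneg_right hεc2 hV0
    have h3 : c * ∫ x, ‖V x‖ ^ 2 ∂(vol n) ≤ 8 * J * M a ^ 2 := by linarith
    rw [div_mul_eq_mul_div, div_mul_eq_mul_div, le_div_iff₀ hc]; linarith
  have hpt : ∀ x ∈ ball a 1, ‖exp (-ψ x) • u x‖ ^ 2 ≤ exp 2 * ‖V x‖ ^ 2 := fun x hx => by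
    rw [mem_ball, dist_eq_norm] at hx
    have hj := jap_le a x
    simp only [hVdef, norm_smul, mul_pow, norm_of_nonneg (exp_pos _).le]
    rw [← mul_assoc]
    gcongr
    rw [← exp_nat_mul, ← exp_nat_mul, ← exp_add]
    apply exp_le_exp.2
    push_cast
    nlinarith [one_le_jap a x]
  have hint : IntegrableOn (fun x => ‖exp (-ψ x) • u x‖ ^ 2) (ball a 1) (vol n) := by
    refine Integrable.mono' ((hVi.const_mul (exp 2)).integrableOn) ?_ ?_
    · have : Continuous fun x => exp (-ψ x) := by fun_prop
      exact ((this.aestronglyMeasurable.smul hul.aestronglyMeasurable).norm.pow 2).restrict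
    · filter_upwards [ae_restrict_mem measurableSet_ball] with x hx
      rw [norm_of_nonneg (by positivity)]; exact hpt x hx
  refine ⟨hint, ?_⟩
  calc _ ≤ ∫ x in ball a 1, exp 2 * ‖V x‖ ^ 2 ∂(vol n) :=
        setIntegral_mono_on hint (hVi.const_mul _).integrableOn measurableSet_ball hpt
    _ ≤ ∫ x, exp 2 * ‖V x‖ ^ 2 ∂(vol n) :=
        setIntegral_le_integral (hVi.const_mul _) (ae_of_all _ fun x => by positivity)
    _ ≤ _ := by
        rw [integral_const_mul]
        have := mul_le_mul_of_nonneg_left hVfin (exp_pos 2).le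
        linarith

/-- An entire function whose zero set is a uniformly flat smooth hypersurface. -/
structure FlatZero (T : Γ → ℂ) (ε₀ : ℝ) : Prop where
  diff : Entire T
  dne : ∀ z, T z = 0 → fderiv ℂ T z ≠ 0
  flat : UniformlyFlatWith ε₀ (T ⁻¹' {0})

/-- The unit complex normal vector at `w` of the level set of `T`. -/
def nrm (T : Γ → ℂ) (w : Γ) : Γ :=
  ((‖fderiv ℂ T w‖⁻¹ : ℝ) : ℂ) • (InnerProductSpace.toDual ℂ Γ).symm (fderiv ℂ T w)

lemma norm_nrm {w : Γ} (h : dT w ≠ 0) : ‖nrm T w‖ = 1 := by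
  rw [nrm, norm_smul, LinearIsometryEquiv.norm_map, norm_real, norm_inv, norm_norm]
  simp_all

lemma fderiv_eq_inner_nrm {w : Γ} (h : dT w ≠ 0) (v : Γ) :
    dT w v = ‖dT w‖ * ⟪nrm T w, v⟫_ℂ := by
  rw [nrm, inner_smul_left, InnerProductSpace.toDual_symm_apply]
  rw [Complex.conj_ofReal, ← mul_assoc, ← Complex.ofReal_mul,
    mul_inv_cancel₀ (norm_ne_zero_iff.mpr h), Complex.ofReal_one, one_mul]

lemma fderiv_nrm {w : Γ} (h : dT w ≠ 0) : dT w (nrm T w) = ‖dT w‖ := by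
  rw [fderiv_eq_inner_nrm h, inner_self_eq_norm_sq_to_K, norm_nrm h]; simp

/-- Second order Taylor estimate. -/
lemma taylor_two (hT : Entire T) (w : Γ) : ∃ K ≥ (0 : ℝ), ∃ δ > 0, ∀ y ∈ ball w δ,
      ‖T y - T w - dT w (y - w)‖ ≤ K * ‖y - w‖ ^ 2 := by
  have hC : C² T := (contDiff_of_differentiable hT).of_le ENat.LEInfty.out
  obtain ⟨K, t, ht, hK⟩ := ((hC.fderiv_right (by norm_num)).contDiffAt (x := w)).exists_lipschitzOnWith
  obtain ⟨δ, hδ, hsub⟩ := Metric.mem_nhds_iff.mp ht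
  refine ⟨K, K.2, δ, hδ, fun y hy => ?_⟩
  have hball x (hx : x ∈ closedBall w ‖y - w‖) : ‖∇ T x - ∇ T w‖ ≤ K * ‖y - w‖ := by
    have hx' : x ∈ ball w δ := by rw [mem_ball] at hy ⊢; rw [mem_closedBall, ← dist_eq_norm] at hx; linarith
    have := hK.dist_le_mul x (hsub hx') w (hsub (mem_ball_self hδ))
    rw [dist_eq_norm] at this
    refine this.trans (mul_le_mul_of_nonneg_left ?_ K.2)
    simp_all
  have := (convex_closedBall w ‖y - w‖).norm_image_sub_le_of_norm_hasFDerivWithin_le'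
    (f := T) (f' := ∇ T) (φ := ∇ T w)
    (fun x _ => ((hC.differentiable (by simp)) x).hasFDerivAt.hasFDerivWithinAt) hball
    (mem_closedBall_self (norm_nonneg _)) (by rw [mem_closedBall, dist_eq_norm] : y ∈ _)
  calc _ = ‖T y - T w - ∇ T w (y - w)‖ := by rw [← (((hT w).fderiv_restrictScalars ℝ).symm)]; rfl
    _ ≤ _ := this
    _ = _ := by ring

lemma FlatZero.infDist_small (hF : FlatZero T ε₀) {w : Γ}
    (hw : T w = 0) : ∃ s₀ > 0, ∀ c : ℂ, ‖c‖ ≤ s₀ → ‖c‖ ≤ infDist (w + c • nrm T w) Z := by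
  obtain ⟨K, hK, δ, hδ, h⟩ := taylor_two hF.diff w
  have hd := hF.dne w hw
  have hdpos : 0 < ‖dT w‖ := norm_pos_iff.mpr hd
  set D := ‖dT w‖
  refine ⟨min (δ / 4) (D / (2 * (K + 1))), by positivity, fun c hc => ?_⟩
  have hc1 := hc.trans (min_le_left _ _)
  have hc2 := hc.trans (min_le_right _ _)
  have hn := norm_nrm hd
  refine (le_infDist ⟨w, hw⟩).mpr fun y hy => ?_
  by_contra! hlt
  have hcn : ‖c • nrm T w‖ = ‖c‖ := by rw [norm_smul, hn, mul_one]
  have hyw : ‖y - w‖ < 2 * ‖c‖ := by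
    have : y - w = c • nrm T w - (w + c • nrm T w - y) := by abel
    rw [this]
    refine (norm_sub_le _ _).trans_lt ?_
    rw [dist_eq_norm] at hlt
    linarith
  have hc0 : 0 < ‖c‖ := lt_of_le_of_lt dist_nonneg hlt
  have hyδ : y ∈ ball w δ := by rw [mem_ball, dist_eq_norm]; linarith
  have hq := h y hyδ
  have hy0 : T y = 0 := hy
  rw [hy0, hw, sub_zero, zero_sub, norm_neg, fderiv_eq_inner_nrm hd, norm_mul, norm_real, norm_norm] at hq
  have hsq : dist (w + c • nrm T w) y ^ 2 = ‖c‖ ^ 2 - 2 * (⟪c • nrm T w, y - w⟫_ℂ).re + ‖y - w‖ ^ 2 := by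
    rw [dist_eq_norm, show w + c • nrm T w - y = c • nrm T w - (y - w) by abel, @norm_sub_sq ℂ, hcn]; rfl
  have hre : (⟪c • nrm T w, y - w⟫_ℂ).re ≤ ‖c‖ * ‖⟪nrm T w, y - w⟫_ℂ‖ := by
    refine (Complex.re_le_norm _).trans ?_
    rw [inner_smul_left, norm_mul, RCLike.norm_conj]
  have h4 : ‖c‖ * (2 * (K + 1)) ≤ D := by rwa [le_div_iff₀ (by positivity)] at hc2
  set i := ‖⟪nrm T w, y - w⟫_ℂ‖
  have hi : 2 * ‖c‖ * i ≤ ‖y - w‖ ^ 2 := by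
    have h5 : D * (2 * ‖c‖ * i) ≤ D * ‖y - w‖ ^ 2 := by
      calc D * (2 * ‖c‖ * i) = 2 * ‖c‖ * (D * i) := by ring
        _ ≤ 2 * ‖c‖ * (K * ‖y - w‖ ^ 2) := by gcongr
        _ = (‖c‖ * (2 * K)) * ‖y - w‖ ^ 2 := by ring
        _ ≤ D * ‖y - w‖ ^ 2 := by gcongr; nlinarith
    exact le_of_mul_le_mul_left h5 hdpos
  have : dist (w + c • nrm T w) y ^ 2 < ‖c‖ ^ 2 := pow_lt_pow_left₀ hlt dist_nonneg two_ne_zero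
  rw [hsq] at this
  nlinarith

/-- Extension of a foot-point segment beyond a point of the tubular neighbourhood. -/
lemma extend_segment {W : Set Γ} (h : UniformlyFlatWith ε₀ W) {w x : Γ}
    (hwW : w ∈ W) (hx : infDist x W < ε₀) (hxw : dist x w = infDist x W) :
    ∃ l > (1 : ℝ), ‖l • (x - w)‖ ≤ infDist (w + l • (x - w)) W := by
  obtain ⟨hε, pr, hpr, hprop⟩ := h
  have hopen : IsOpen {z : Γ | infDist z W < ε₀} := isOpen_lt (continuous_infDist_pt W) continuous_const
  have hat : ContDiffAt ℝ 1 pr x := ((hpr.contDiffAt (hopen.mem_nhds hx))).of_le (by exact_mod_cast le_top)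
  obtain ⟨K, t, ht, hK⟩ := hat.exists_lipschitzOnWith
  obtain ⟨ρ, hρ, hsub⟩ := Metric.nhds_basis_closedBall.mem_iff.mp (inter_mem ht (hopen.mem_nhds hx))
  have hxpr := (hprop x hx).2.2 w hwW hxw
  set A := K * ρ + dist x w + K + 1 + ρ
  have hA : 0 < A := by have := K.2; positivity
  set m := min (ρ / (2 * A)) (1 / (2 * A))
  have hm : 0 < m := by positivity
  have hmA1 : m * A ≤ ρ / 2 := by
    calc m * A ≤ ρ / (2 * A) * A := by gcongr; exact min_le_left _ _
      _ = _ := by field_simp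
  have hmA2 : m * A ≤ 1 / 2 := by
    calc m * A ≤ 1 / (2 * A) * A := by gcongr; exact min_le_right _ _
      _ = _ := by field_simp
  -- fixed point of `y ↦ x + m (x - pr y)`
  set Φ := fun y => x + m • (x - pr y)
  have hxB : x ∈ closedBall x ρ := mem_closedBall_self hρ.le
  have hprb y (hy : y ∈ closedBall x ρ) : dist (pr y) (pr x) ≤ K * dist y x :=
    hK.dist_le_mul y (hsub hy).1 x (hsub hxB).1
  have hmaps : MapsTo Φ (closedBall x ρ) (closedBall x ρ) := by
    intro y hy
    rw [mem_closedBall]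
    simp [Φ, norm_smul, abs_of_pos hm]
    have h1 : ‖x - pr y‖ ≤ A := by
      rw [← dist_eq_norm]
      have h2 := hprb y hy
      have h3 := dist_triangle x (pr x) (pr y)
      rw [dist_comm (pr x)] at h3
      rw [← hxpr] at h2 h3
      have : K * dist y x ≤ K * ρ := mul_le_mul_of_nonneg_left (mem_closedBall.mp hy) K.2
      have := K.2
      simp; linarith
    have := mul_le_mul_of_nonneg_left h1 hm.le
    linarith
  have hcontr : ContractingWith (1 / 2 : ℝ≥0) (hmaps.restrict Φ _ _) := by
    refine ⟨by rw [← NNReal.coe_lt_coe]; norm_num, LipschitzWith.of_dist_le_mul fun a b => ?_⟩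
    have h1 : dist (Φ a) (Φ b) = m * dist (pr b) (pr a) := by
      simp only [Φ, dist_add_left, dist_smul₀, norm_eq_abs, abs_of_pos hm, dist_sub_left]
      rw [dist_comm]
    have h2 := hK.dist_le_mul b.1 (hsub b.2).1 a.1 (hsub a.2).1
    rw [Subtype.dist_eq, Subtype.dist_eq]
    simp only [MapsTo.val_restrict_apply]
    rw [h1]
    calc m * dist (pr b) (pr a) ≤ m * (K * dist b.1 a.1) := by gcongr
      _ = (m * K) * dist a.1 b.1 := by rw [dist_comm]; ring
      _ ≤ (m * A) * dist a.1 b.1 := by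
        gcongr
        have : 0 ≤ K * ρ := by positivity
        have : 0 ≤ dist x w := dist_nonneg
        simp; linarith
      _ ≤ _ := by
        have : ((1 / 2 : ℝ≥0) : ℝ) = 1 / 2 := by push_cast; ring
        rw [this]; gcongr
  obtain ⟨y, hyB, hfix, -⟩ := hcontr.exists_fixedPoint' isClosed_closedBall.isComplete hmaps hxB (edist_ne_top _ _)
  have hy : x + m • (x - pr y) = y := hfix
  have hyN := (hsub hyB).2
  obtain ⟨hpW, hpd, -⟩ := hprop y hyN
  have hyp : y - pr y = (1 + m) • (x - pr y) := by
    rw [add_smul, one_smul]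
    nth_rewrite 1 [← hy]
    abel
  have hyx : y - x = m • (x - pr y) := by rw [sub_eq_iff_eq_add', hy]
  have hd1 : infDist y W = (1 + m) * dist x (pr y) := by
    rw [← hpd, dist_eq_norm, hyp, norm_smul, norm_eq_abs, abs_of_pos (by positivity), dist_eq_norm]
  have hd2 : dist y x = m * dist x (pr y) := by
    rw [dist_eq_norm, hyx, norm_smul, norm_eq_abs, abs_of_pos hm, dist_eq_norm]
  have hle : infDist y W ≤ infDist x W + dist y x := infDist_le_infDist_add_dist
  have hge : infDist x W ≤ dist x (pr y) := infDist_le_dist_of_mem hpW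
  have heq : dist x (pr y) = infDist x W := by
    refine le_antisymm ?_ hge
    rw [hd2] at hle; linarith
  have hpy : pr y = w := by rw [hxpr]; exact (hprop x hx).2.2 _ hpW heq
  refine ⟨1 + m, by linarith, ?_⟩
  have : w + (1 + m) • (x - w) = y := by rw [← hpy, ← hyp]; abel
  rw [this, ← hpd, dist_eq_norm, hyp, hpy]

/-- Normal segments of length `< ε₀` minimize the distance to the hypersurface. -/
lemma FlatZero.le_infDist (hF : FlatZero T ε₀) {w : Γ} (hw : T w = 0) {c : ℂ} (hc : ‖c‖ < ε₀) :
    ‖c‖ ≤ infDist (w + c • nrm T w) Z := by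
  rcases eq_or_ne c 0 with rfl | hc0
  · simpa using infDist_nonneg
  have hcp : 0 < ‖c‖ := norm_pos_iff.mpr hc0
  have hn := norm_nrm (hF.dne w hw)
  set ν := c • nrm T w with hν
  have hνn : ‖ν‖ = ‖c‖ := by rw [hν, norm_smul, hn, mul_one]
  set W := Z
  have hwW : w ∈ W := hw
  obtain ⟨s₀, hs₀, hs⟩ := hF.infDist_small hw
  set S := {s | s ∈ Icc 0 1 ∧ s * ‖c‖ ≤ infDist (w + s • ν) W}
  have hScl : IsClosed S := by
    refine isClosed_Icc.inter (isClosed_le (f := fun s => s * ‖c‖) (by fun_prop) ?_)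
    exact (continuous_infDist_pt W).comp (by fun_prop)
  have h0 : 0 ∈ S := ⟨by simp, by simpa using infDist_nonneg⟩
  have hbd : BddAbove S := ⟨1, fun s hs => hs.1.2⟩
  have hmem := hScl.csSup_mem ⟨0, h0⟩ hbd
  set s := sSup S
  have hspos : 0 < s := by
    have : min 1 (s₀ / ‖c‖) ∈ S := by
      refine ⟨⟨by positivity, min_le_left _ _⟩, ?_⟩
      set a := min 1 (s₀ / ‖c‖)
      have ha : 0 ≤ a := by positivity
      have ha2 : a * ‖c‖ ≤ s₀ := by rw [← le_div_iff₀ hcp]; exact min_le_right _ _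
      have h3 := hs (a * c) (by rw [norm_mul, norm_real, norm_of_nonneg ha]; exact ha2)
      rw [norm_mul, norm_real, norm_of_nonneg ha, mul_smul] at h3
      exact h3
    exact lt_of_lt_of_le (by positivity) (le_csSup hbd this)
  rcases eq_or_lt_of_le hmem.1.2 with h1 | h1
  · have := hmem.2
    rwa [h1, one_mul, one_smul] at this
  exfalso
  have hdist : dist (w + s • ν) w = s * ‖c‖ := by
    rw [dist_eq_norm, add_sub_cancel_left, norm_smul, norm_of_nonneg hspos.le, hνn]
  have heq : dist (w + s • ν) w = infDist (w + s • ν) W := le_antisymm (hdist ▸ hmem.2) (infDist_le_dist_of_mem hwW)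
  have hlt : infDist (w + s • ν) W < ε₀ := by rw [← heq, hdist]; nlinarith
  obtain ⟨l, hl, hle⟩ := extend_segment hF.flat hwW hlt heq
  rw [add_sub_cancel_left, smul_smul, norm_smul, hνn, norm_of_nonneg (by positivity)] at hle
  set l' := min l (1 / s)
  have hl' : 1 < l' := lt_min hl (by rw [lt_div_iff₀ hspos]; linarith)
  have : l' * s ∈ S := by
    refine ⟨⟨by positivity, ?_⟩, ?_⟩
    · rw [← le_div_iff₀ hspos]; exact min_le_right _ _
    · have h5 : infDist (w + (l * s) • ν) W ≤
          infDist (w + (l' * s) • ν) W + dist (w + (l * s) • ν) (w + (l' * s) • ν) :=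
        infDist_le_infDist_add_dist
      have h6 : dist (w + (l * s) • ν) (w + (l' * s) • ν) = (l - l') * s * ‖c‖ := by
        rw [dist_add_left, dist_eq_norm, ← sub_smul, norm_smul, hνn, ← sub_mul,
          norm_of_nonneg (mul_nonneg (sub_nonneg.mpr (min_le_left _ _)) hspos.le)]
      rw [h6] at h5
      nlinarith
  have := le_csSup hbd this
  nlinarith

/-- Zeros of `T` near a normal line of the zero set are close to the foot point. -/
lemma FlatZero.annulus (hF : FlatZero T ε₀) {w x : Γ}
    (hw : T w = 0) {c : ℂ} (hc : ‖c‖ < ε₀) (h : T (w + x + c • nrm T w) = 0) : ‖c‖ ≤ ‖x‖ := by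
  refine (hF.le_infDist hw hc).trans ((infDist_le_dist_of_mem (y := w + x + c • nrm T w) h).trans_eq ?_)
  rw [dist_eq_norm, ← norm_neg]; congr 1; abel

lemma contDiffAt_of_isOpen {Ω : Set Γ} (hΩ : IsOpen Ω)
    (hf : Hol f Ω) {z : Γ} (hz : z ∈ Ω) : ContDiffAt ℝ ∞ f z := by
  obtain ⟨r, hr, hsub⟩ := Metric.isOpen_iff.mp hΩ z hz
  exact contDiffAt_of_differentiableOn hr (hf.mono hsub)

lemma continuousOn_fderiv {Ω : Set Γ} (hΩ : IsOpen Ω)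
    (hf : Hol f Ω) : ContinuousOn (fderiv ℂ f) Ω := by
  rw [continuousOn_clm_apply]
  intro v z hz
  have h1 : ContinuousAt (fun y => ∇ f y v) z :=
    (((contDiffAt_of_isOpen hΩ hf hz).fderiv_right (m := 0) (by simp)).continuousAt).clm_apply continuousAt_const
  refine (h1.congr ?_).continuousWithinAt
  filter_upwards [hΩ.mem_nhds hz] with y hy
  rw [((hf y hy).differentiableAt (hΩ.mem_nhds hy)).fderiv_restrictScalars ℝ]; rfl

/-- The derivative in a fixed direction of an entire function is entire. -/
lemma differentiable_fderiv_apply (hT : Entire T) (v : Γ) :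
    Entire (fun z => dT z v) := by
  have hs := contDiff_of_differentiable hT
  have : (fun z => dT z v) = dz v T := by ext z; rw [dz_eq_fderiv (hT z)]
  rw [this]
  have h1 : ContDiff ℝ 1 (dz v T) := contDiff_dz (hs.of_le ENat.LEInfty.out : C² T) (by norm_num) v
  intro z
  refine differentiableAt_of_dbar (h1.differentiable (by simp) z) fun u => ?_
  rw [dbar_dz_comm (hs.of_le ENat.LEInfty.out)]
  have : dbar u T = fun _ => 0 := by ext y; exact dbar_eq_zero (hT y) u
  rw [this]; simp [dz]

/-- Circle integrals of a holomorphic function over translated circles depend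
holomorphically on the centre. -/
lemma differentiableOn_circle {Φ : Γ → ℂ} {Ω U : Set Γ} (hΩ : IsOpen Ω)
    (hΦ : Hol Φ Ω) {ρ : ℝ} (hρ : 0 ≤ ρ) {a : ℂ → ℂ}
    (ha : ContinuousOn a (sphere 0 ρ)) (ν : Γ) (hU : IsOpen U)
    (hUΩ : ∀ x ∈ U, ∀ ξ ∈ sphere (0 : ℂ) ρ, x + ξ • ν ∈ Ω) :
    Hol (fun x => ∮ ξ in C(0, ρ), a ξ * Φ (x + ξ • ν)) U := by
  intro x₀ hx₀
  obtain ⟨r, hr, hsub⟩ := Metric.nhds_basis_closedBall.mem_iff.mp (hU.mem_nhds hx₀)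
  have hsph θ : circleMap 0 ρ θ ∈ sphere 0 ρ := circleMap_mem_sphere _ hρ θ
  set K := (fun p : Γ × ℂ => p.1 + p.2 • ν) '' (closedBall x₀ r ×ˢ sphere 0 ρ)
  have hK : IsCompact K := ((isCompact_closedBall x₀ r).prod (isCompact_sphere 0 ρ)).image (by fun_prop)
  have hKΩ : K ⊆ Ω := by
    rintro _ ⟨⟨x, ξ⟩, ⟨hx, hξ⟩, rfl⟩
    exact hUΩ x (hsub hx) ξ hξ
  have hfc := continuousOn_fderiv hΩ hΦ
  obtain ⟨B, hB⟩ := hK.exists_bound_of_continuousOn (hfc.mono hKΩ)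
  have hac : Continuous (fun θ => a (circleMap 0 ρ θ)) := ha.comp_continuous (continuous_circleMap 0 ρ) hsph
  have hdc : Continuous (fun θ => deriv (circleMap 0 ρ) θ) := by simp only [deriv_circleMap]; fun_prop
  have hlin x : Continuous (fun θ => x + circleMap 0 ρ θ • ν) := by fun_prop
  have hFc x (hx : x ∈ U) : Continuous
      (fun θ => deriv (circleMap 0 ρ) θ • (a (circleMap 0 ρ θ) * Φ (x + circleMap 0 ρ θ • ν))) := hdc.smul (hac.mul (hΦ.continuousOn.comp_continuous (hlin x) (fun θ => hUΩ x hx _ (hsph θ))))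
  have hF'c : Continuous (fun θ => (deriv (circleMap 0 ρ) θ * a (circleMap 0 ρ θ)) •
      fderiv ℂ Φ (x₀ + circleMap 0 ρ θ • ν)) :=
    (hdc.mul hac).smul (hfc.comp_continuous (hlin x₀) (fun θ => hUΩ x₀ hx₀ _ (hsph θ)))
  refine DifferentiableAt.differentiableWithinAt ?_
  refine (intervalIntegral.hasFDerivAt_integral_of_dominated_of_fderiv_le (𝕜 := ℂ)
    (F := fun x θ => deriv (circleMap 0 ρ) θ • (a (circleMap 0 ρ θ) * Φ (x + circleMap 0 ρ θ • ν)))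
    (F' := fun x θ => (deriv (circleMap 0 ρ) θ * a (circleMap 0 ρ θ)) • fderiv ℂ Φ (x + circleMap 0 ρ θ • ν))
    (bound := fun θ => ‖deriv (circleMap 0 ρ) θ * a (circleMap 0 ρ θ)‖ * B)
    (s := ball x₀ r) (ball_mem_nhds _ hr) ?_ ?_ ?_ ?_ ?_ ?_).differentiableAt
  · filter_upwards [hU.mem_nhds hx₀] with x hx using (hFc x hx).aestronglyMeasurable
  · exact (hFc x₀ hx₀).intervalIntegrable _ _
  · exact hF'c.aestronglyMeasurable
  · refine ae_of_all _ fun θ _ x hx => ?_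
    rw [norm_smul]
    gcongr
    exact hB _ ⟨(x, circleMap 0 ρ θ), ⟨ball_subset_closedBall hx, hsph θ⟩, rfl⟩
  · exact ((hdc.mul hac).norm.mul continuous_const).intervalIntegrable _ _
  · refine ae_of_all _ fun θ _ x hx => ?_
    have hmem := hUΩ x (hsub (ball_subset_closedBall hx)) _ (hsph θ)
    have h1 :=
      ((hΦ _ hmem).differentiableAt (hΩ.mem_nhds hmem)).hasFDerivAt
    have h2 := (h1.comp x ((hasFDerivAt_id x).add_const (circleMap 0 ρ θ • ν))).const_smul
      (deriv (circleMap 0 ρ) θ * a (circleMap 0 ρ θ))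
    rw [comp_id] at h2
    refine h2.congr_of_eventuallyEq (Eventually.of_forall fun y => ?_)
    simp [mul_assoc]

/-- Residue computations for an entire function with a unique simple zero in a disc. -/
lemma unique_root_integrals {f : ℂ → ℂ} (hf : Entire f) {ρ : ℝ} {g : ℂ}
    (hg : ‖g‖ < ρ) (h0 : f g = 0) (h1 : deriv f g ≠ 0)
    (hu : ∀ ξ : ℂ, ‖ξ‖ ≤ ρ → f ξ = 0 → ξ = g) :
    (∮ ξ in C(0, ρ), ξ * (deriv f ξ / f ξ)) = 2 * Real.pi * I * g ∧
    ∀ ζ : ℂ, ‖ζ‖ < ρ → f ζ * (∮ ξ in C(0, ρ), (ξ - g) / (ξ - ζ) * (1 / f ξ)) = 2 * Real.pi * I * (ζ - g) := by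
  have hρ : 0 < ρ := (norm_nonneg _).trans_lt hg
  set h := dslope f g
  have hh : Entire h := by
    have := (Complex.differentiableOn_dslope (s := univ) (c := g) (f := f) univ_mem).mpr hf.differentiableOn
    exact differentiableOn_univ.mp this
  have hfh ξ : f ξ = (ξ - g) * h ξ := by
    have := sub_smul_dslope f g ξ
    rw [h0, sub_zero] at this
    exact this.symm
  have hne ξ (hξ : ‖ξ‖ ≤ ρ) : h ξ ≠ 0 := by
    intro h2
    rw [(hu ξ hξ (by rw [hfh, h2, mul_zero]))] at h2
    exact h1 (by rw [← h2]; exact (dslope_same f g).symm)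
  have hf' ξ : deriv f ξ = h ξ + (ξ - g) * deriv h ξ := by
    have : f = fun ξ => (ξ - g) * h ξ := funext hfh
    rw [this]
    have := ((hasDerivAt_id ξ).sub_const g).mul (hh ξ).hasDerivAt
    have h2 := this.deriv
    simp at h2
    exact h2
  have hdh : Entire (deriv h) := hh.deriv
  have hgb : g ∈ ball 0 ρ := by simpa using hg
  have hsub ξ (hξ : ξ ∈ sphere (0 : ℂ) ρ) ζ (hζ : ‖ζ‖ < ρ) : ξ - ζ ≠ 0 := by
    intro h4
    rw [sub_eq_zero] at h4
    rw [mem_sphere_zero_iff_norm, h4] at hξ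
    linarith
  constructor
  · have hd : Hol (fun ξ => ξ + (ξ - g) * ξ * deriv h ξ / h ξ) (closedBall 0 ρ) := by
      intro ξ hξ
      have := hne ξ (by simpa using hξ)
      have h5 := hdh ξ
      exact DifferentiableAt.differentiableWithinAt (by fun_prop (disch := assumption))
    have := hd.circleIntegral_sub_inv_smul hgb
    simp at this
    rw [← this]
    refine circleIntegral.integral_congr hρ.le fun ξ hξ => ?_
    have h5 := hne ξ (by rw [mem_sphere_zero_iff_norm] at hξ; exact hξ.le)
    simp [hf', hfh ξ]
    field_simp
  · intro ζ hζ
    have hd : Hol (fun ξ => 1 / h ξ) (closedBall 0 ρ) := by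
      intro ξ hξ
      have := hne ξ (by simpa using hξ)
      have h6 := hh ξ
      exact DifferentiableAt.differentiableWithinAt (by fun_prop (disch := assumption))
    have := hd.circleIntegral_sub_inv_smul (w := ζ) (by simpa using hζ)
    simp only [smul_eq_mul] at this
    have h7 : (∮ ξ in C(0, ρ), (ξ - g) / (ξ - ζ) * (1 / f ξ)) = ∮ ξ in C(0, ρ), (ξ - ζ)⁻¹ * (1 / h ξ) := by
      refine circleIntegral.integral_congr hρ.le fun ξ hξ => ?_
      have h6 := hsub ξ hξ g hg
      simp [hfh ξ]
      field_simp
    rw [h7, this, hfh ζ]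
    have := hne ζ hζ.le
    field_simp

/-- The holomorphic chart `y ↦ y + (T y - ⟪n, y⟫) n` straightening the zero set. -/
def psi (T : Γ → ℂ) (w y : Γ) : Γ := y + (T y - ⟪nrm T w, y⟫_ℂ) • nrm T w

lemma inner_psi {w : Γ} (h : dT w ≠ 0) (y : Γ) : ⟪nrm T w, psi T w y⟫_ℂ = T y := by
  rw [psi, inner_add_right, inner_smul_right, inner_self_eq_norm_sq_to_K, norm_nrm h]
  simp

lemma hasFDerivAt_psi (hT : Entire T) (w y : Γ) :
    HasFDerivAt (psi T w) (ContinuousLinearMap.id ℂ Γ +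
      (dT y - innerSL ℂ (nrm T w)).smulRight (nrm T w)) y := by
  exact (hasFDerivAt_id y).add (((hT y).hasFDerivAt.sub ((innerSL ℂ (nrm T w)).hasFDerivAt)).smul_const (nrm T w))

lemma exists_psi_homeo (hT : Entire T) {w : Γ} (hd : dT w ≠ 0) :
    ∃ e : OpenPartialHomeomorph Γ Γ, w ∈ e.source ∧ ⇑e = psi T w := by
  set N := nrm T w
  set D := ((‖dT w‖ : ℝ) : ℂ)
  have hD : D ≠ 0 := by simpa [D] using hd
  have hNN : ⟪N, N⟫_ℂ = 1 := by rw [inner_self_eq_norm_sq_to_K, norm_nrm hd]; simp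
  have hfN : ∀ v, dT w v = D * ⟪N, v⟫_ℂ := fderiv_eq_inner_nrm hd
  set A := ContinuousLinearMap.id ℂ Γ + (dT w - innerSL ℂ N).smulRight N
  set B := ContinuousLinearMap.id ℂ Γ + ((D⁻¹ - 1) • innerSL ℂ N).smulRight N
  have hA v : A v = v + (D * ⟪N, v⟫_ℂ - ⟪N, v⟫_ℂ) • N := by
    simp [A, hfN]
  have hB v : B v = v + ((D⁻¹ - 1) * ⟪N, v⟫_ℂ) • N := by
    simp [B]
  have hBA : Function.LeftInverse B A := fun v => by
    rw [hB, hA]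
    simp only [inner_add_right, inner_smul_right, hNN]
    rw [add_assoc, ← add_smul]
    convert add_zero v
    rw [smul_eq_zero]; left
    field_simp
    ring
  have hAB : Function.RightInverse B A := fun v => by
    rw [hB, hA]
    simp only [inner_add_right, inner_smul_right, hNN]
    rw [add_assoc, ← add_smul]
    convert add_zero v
    rw [smul_eq_zero]; left
    field_simp
    ring
  let E : Γ ≃L[ℂ] Γ := ContinuousLinearEquiv.equivOfInverse A B hBA hAB
  have hcd : C∞ (psi T w) := by
    have h1 := contDiff_of_differentiable hT
    unfold psi
    exact contDiff_id.add ((h1.sub (((innerSL ℂ (nrm T w)).restrictScalars ℝ).contDiff)).smul contDiff_const)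
  have hst : HasStrictFDerivAt (psi T w) ((E.restrictScalars ℝ : Γ ≃L[ℝ] Γ) : Γ →L[ℝ] Γ) w :=
    hcd.contDiffAt.hasStrictFDerivAt' ((hasFDerivAt_psi hT w w).restrictScalars ℝ) (by simp)
  exact ⟨hst.toOpenPartialHomeomorph _, hst.mem_toOpenPartialHomeomorph_source, rfl⟩

/-- Local existence and uniqueness of zeros of `T` along normal lines. -/
lemma FlatZero.local_root (hF : FlatZero T ε₀) {w : Γ}
    (hw : T w = 0) {ρ : ℝ} (hρ : 0 < ρ) (hρε : ρ < ε₀) : ∃ δ > 0, ∀ x ∈ ball (0 : Γ) δ,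
      ∃ g : ℂ, ‖g‖ < ρ ∧ T (w + x + g • nrm T w) = 0 ∧ dT (w + x + g • nrm T w) (nrm T w) ≠ 0 ∧
        ∀ ξ : ℂ, ‖ξ‖ ≤ ρ → T (w + x + ξ • nrm T w) = 0 → ξ = g := by
  have hd := hF.dne w hw
  obtain ⟨e, hwe, he⟩ := exists_psi_homeo hF.diff hd
  set N := nrm T w
  have hNn := norm_nrm hd
  have hNN : ⟪N, N⟫_ℂ = 1 := by rw [inner_self_eq_norm_sq_to_K, hNn]; simp
  have hN0 : N ≠ 0 := by rw [← norm_ne_zero_iff, hNn]; simp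
  -- a ball where the chart is injective and the normal derivative does not vanish
  have hev : ∀ᶠ y in 𝓝 w, y ∈ e.source ∧ dT y N ≠ 0 := by
    refine Filter.Eventually.and (e.open_source.mem_nhds hwe) ?_
    refine ((differentiable_fderiv_apply hF.diff N).continuous.continuousAt).eventually_ne ?_
    rw [fderiv_nrm hd]; simpa using hd
  obtain ⟨r, hr, hball⟩ := Metric.eventually_nhds_iff_ball.mp hev
  -- existence
  have hPc : Continuous (fun x => (w + x) - ⟪N, w + x⟫_ℂ • N) :=
    (by fun_prop : Continuous fun x => w + x).sub
      (((innerSL ℂ N).continuous.comp (by fun_prop : Continuous fun x => w + x)).smul continuous_const)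
  have hP0 : (w + 0) - ⟪N, w + 0⟫_ℂ • N = e w := by rw [he, psi, hw, add_zero, zero_sub, neg_smul, sub_eq_add_neg]
  have htgt : ∀ᶠ x in 𝓝 0, (w + x) - ⟪N, w + x⟫_ℂ • N ∈ e.target ∧
      e.symm ((w + x) - ⟪N, w + x⟫_ℂ • N) ∈ ball w (min (r / 2) (ρ / 2)) := by
    have h1 : Tendsto (fun x => (w + x) - ⟪N, w + x⟫_ℂ • N) (𝓝 0) (𝓝 (e w)) := by
      have := hPc.tendsto 0
      rwa [hP0] at this
    have h2 := e.open_target.mem_nhds (e.map_source hwe)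
    exact (h1.eventually h2).and (h1.eventually ((e.tendsto_symm hwe).eventually (ball_mem_nhds _ (by positivity))))
  obtain ⟨δ, hδ, hδb⟩ := Metric.eventually_nhds_iff_ball.mp htgt
  refine ⟨min δ (min (r / 2) (ρ / 2)), by positivity, fun x hx => ?_⟩
  have hxn : ‖x‖ < min δ (min (r / 2) (ρ / 2)) := by simpa using hx
  have hx1 := hxn.trans_le (min_le_left _ _)
  have hx2 := hxn.trans_le ((min_le_right _ _).trans (min_le_left _ _))
  have hx3 := hxn.trans_le ((min_le_right _ _).trans (min_le_right _ _))
  obtain ⟨ht, hy⟩ := hδb x (by simpa using hx1)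
  set P := (w + x) - ⟪N, w + x⟫_ℂ • N
  set y := e.symm P
  have hey : psi T w y = P := by rw [← he]; exact e.right_inv ht
  have hTy : T y = 0 := by
    rw [← inner_psi hd y, hey]
    simp [P]
    change _ - _ * ⟪N, N⟫_ℂ = 0
    rw [hNN, mul_one, sub_self]
  set g := ⟪N, y⟫_ℂ - ⟪N, w + x⟫_ℂ
  have hyg : y = w + x + g • N := by
    rw [psi, hTy, zero_sub] at hey
    have : y = P + ⟪N, y⟫_ℂ • N := by rw [← hey]; change _ = y + -⟪N, y⟫_ℂ • N + ⟪N, y⟫_ℂ • N; module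
    rw [this]; simp [P, g]; module
  have hgn : ‖g‖ < ρ := by
    rw [(by simp [g]; ring : g = ⟪N, (y - w) - x⟫_ℂ)]
    refine (norm_inner_le_norm _ _).trans_lt ?_
    rw [hNn, one_mul]
    refine (norm_sub_le _ _).trans_lt ?_
    rw [mem_ball, dist_eq_norm] at hy
    have := hy.trans_le (min_le_right _ _)
    linarith
  refine ⟨g, hgn, hyg ▸ hTy, ?_, fun ξ hξ hT0 => ?_⟩
  · rw [← hyg]
    refine (hball y ?_).2
    exact (ball_subset_ball ((min_le_left _ _).trans (by linarith))) hy
  · have hξ2 := hF.annulus hw (hξ.trans_lt hρε) hT0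
    set y' := w + x + ξ • N
    have hy' : y' ∈ ball w r := by
      rw [mem_ball, dist_eq_norm, show y' - w = x + ξ • N by simp [y']; abel]
      refine (norm_add_le _ _).trans_lt ?_
      rw [norm_smul, hNn]; linarith
    have : y' = y := by
      refine e.injOn (hball _ hy').1 (hball _ ((ball_subset_ball ((min_le_left _ _).trans (by linarith))) hy)).1 ?_
      rw [he, hey, psi, hT0, zero_sub]
      change y' + -⟪N, y'⟫_ℂ • N = P
      simp only [y', P, inner_add_right, inner_smul_right, hNN]
      module
    rw [hyg] at this
    have := add_left_cancel this
    exact smul_left_injective ℂ hN0 this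

/-- Identity theorem on a ball of `ℂⁿ`. -/
lemma eq_zero_of_eventually {F : Γ → ℂ} {ρ : ℝ} (hρ : 0 < ρ)
    (hF : Hol F (ball 0 ρ)) (h : ∀ᶠ x in 𝓝 0, F x = 0) :
    ∀ x ∈ ball (0 : Γ) ρ, F x = 0 := by
  intro x hx
  set U : Set ℂ := (fun t => t • x) ⁻¹' ball 0 ρ
  have hUo : IsOpen U := isOpen_ball.preimage (by fun_prop)
  have hUc := (convex_ball 0 ρ).is_linear_preimage
      (((LinearMap.toSpanSingleton ℂ Γ x).restrictScalars ℝ).isLinear)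
  have hd : Hol (fun t => F (t • x)) U := hF.comp (by fun_prop) (mapsTo_preimage _ _)
  have hev : (fun t : ℂ => F (t • x)) =ᶠ[𝓝 0] 0 := by
    have : Tendsto (fun t : ℂ => t • x) (𝓝 0) (𝓝 0) := by
      have : Continuous (fun t : ℂ => t • x) := by fun_prop
      simpa using this.tendsto 0
    exact this.eventually h
  have := (hd.analyticOnNhd hUo).eqOn_zero_of_preconnected_of_eventuallyEq_zero hUc.isPreconnected (by simp [U, hρ]) hev
  simpa using (this (show 1 ∈ U by simpa [U] using hx))

lemma differentiableOn_div {f g : Γ → ℂ} {S : Set Γ} (hf : Hol f S)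
    (hg : Hol g S) (h : ∀ z ∈ S, g z ≠ 0) :
    Hol (fun z => f z / g z) S := by
  simp [div_eq_mul_inv]
  exact hf.mul (hg.inv h)

/-- Zeros of `T` along lines in the direction of the normal at `w` form a holomorphic graph. -/
theorem FlatZero.exists_root (hF : FlatZero T ε₀) {w : Γ} (hw : T w = 0) {ρ : ℝ} (hρ : 0 < ρ) (hρε : ρ < ε₀) :
    ∃ zt : Γ → ℂ, Hol zt (ball 0 ρ) ∧ ∀ x ∈ ball (0 : Γ) ρ,
      ‖zt x‖ ≤ ‖x‖ ∧ T (w + x + zt x • nrm T w) = 0 ∧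
      dT (w + x + zt x • nrm T w) (nrm T w) ≠ 0 ∧
      ∀ ξ : ℂ, ‖ξ‖ ≤ ρ → T (w + x + ξ • nrm T w) = 0 → ξ = zt x := by
  obtain ⟨δ, hδ, hloc⟩ := hF.local_root hw hρ hρε
  have hd := hF.dne w hw
  set N := nrm T w
  have hT := hF.diff
  have hTc := hT.continuous
  set c := 2 * Real.pi * I
  have hc : c ≠ 0 := by simp [c]
  have hΩ : IsOpen {z : Γ | T z ≠ 0} := isOpen_ne_fun hTc continuous_const
  have hcirc x (hx : x ∈ ball 0 ρ) ξ (hξ : ξ ∈ sphere (0 : ℂ) ρ) : T (w + x + ξ • N) ≠ 0 := by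
    intro h0
    rw [mem_sphere_zero_iff_norm] at hξ
    have := hF.annulus hw (hξ ▸ hρε) h0
    rw [mem_ball_zero_iff] at hx; linarith
  have hlin : Hol (fun x => w + x) (ball 0 ρ) := by fun_prop
  -- the derivative along the line
  have hder y ξ : HasDerivAt (fun ξ : ℂ => T (y + ξ • N)) (dT (y + ξ • N) N) ξ := by
    exact (hT _).hasFDerivAt.comp_hasDerivAt ξ (by simpa using ((hasDerivAt_id ξ).smul_const N).const_add y)
  have hfd y : Entire (fun ξ => T (y + ξ • N)) := fun ξ => (hder y ξ).differentiableAt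
  set zt := fun x => c⁻¹ * ∮ ξ in C(0, ρ), ξ * (dT (w + x + ξ • N) N / T (w + x + ξ • N))
  set kk := fun ζ x => c⁻¹ * ∮ ξ in C(0, ρ), (ξ - zt x) / (ξ - ζ) * (1 / T (w + x + ξ • N))
  have hdiv :=
    differentiableOn_div (differentiable_fderiv_apply hT N).differentiableOn hT.differentiableOn fun z hz => hz
  have hinv :=
    differentiableOn_div (differentiableOn_const 1) hT.differentiableOn fun z hz => hz
  have hball : ball w ρ = (fun x => w + x) '' ball 0 ρ := by
    ext z; constructor
    · intro hz
      exact ⟨z - w, by simpa [dist_eq_norm] using hz, by simp⟩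
    · rintro ⟨x, hx, rfl⟩; simpa using hx
  have hUΩ : ∀ x ∈ ball w ρ, ∀ ξ ∈ sphere (0 : ℂ) ρ, x + ξ • N ∈ {z : Γ | T z ≠ 0} := by
    intro z hz ξ hξ
    rw [hball] at hz
    obtain ⟨x, hx, rfl⟩ := hz
    exact hcirc x hx ξ hξ
  have hmaps : MapsTo (fun x => w + x) (ball 0 ρ) (ball w ρ) := by rw [hball]; exact mapsTo_image _ _
  have hztd : Hol zt (ball 0 ρ) :=
    ((differentiableOn_circle hΩ hdiv hρ.le (a := fun ξ => ξ) continuousOn_id N isOpen_ball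
      hUΩ).comp hlin hmaps).const_mul _
  have hsub ξ (hξ : ξ ∈ sphere (0 : ℂ) ρ) ζ (hζ : ‖ζ‖ < ρ) : ξ - ζ ≠ 0 := by
    intro h4
    rw [sub_eq_zero] at h4
    rw [mem_sphere_zero_iff_norm, h4] at hξ
    linarith
  have hkd ζ (hζ : ‖ζ‖ < ρ) : Hol (kk ζ) (ball 0 ρ) := by
    have h1 := ((differentiableOn_circle hΩ hinv hρ.le (a := fun ξ => ξ / (ξ - ζ))
      (continuousOn_id.div (by fun_prop) fun ξ hξ => hsub ξ hξ ζ hζ) N isOpen_ball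
      hUΩ).comp hlin hmaps)
    have h2 := ((differentiableOn_circle hΩ hinv hρ.le (a := fun ξ => 1 / (ξ - ζ))
      (continuousOn_const.div (by fun_prop) fun ξ hξ => hsub ξ hξ ζ hζ) N isOpen_ball
      hUΩ).comp hlin hmaps)
    refine ((h1.sub (hztd.mul h2)).const_mul c⁻¹).congr fun x hx => ?_
    simp only [kk, Pi.sub_apply, comp, Pi.mul_apply]
    congr 1
    have hcont : ContinuousOn (fun ξ : ℂ => 1 / T (w + x + ξ • N)) (sphere 0 ρ) :=
      continuousOn_const.div (by fun_prop) (hcirc x hx)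
    rw [← circleIntegral.integral_const_mul, ← circleIntegral.integral_sub]
    · refine circleIntegral.integral_congr hρ.le fun ξ hξ => ?_
      ring
    · exact (((continuousOn_id.div (by fun_prop) fun ξ hξ => hsub ξ hξ ζ hζ).mul hcont)).circleIntegrable hρ.le
    · exact ((continuousOn_const.mul ((continuousOn_const.div (by fun_prop) fun ξ hξ => hsub ξ hξ ζ hζ).mul
        hcont))).circleIntegrable hρ.le
  -- near the foot point
  have hnear x (hx : x ∈ ball 0 δ) : T (w + x + zt x • N) = 0 ∧ ∀ ζ, ‖ζ‖ < ρ →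
      T (w + x + ζ • N) * kk ζ x = ζ - zt x := by
    obtain ⟨g, hg, h0, h1, hu⟩ := hloc x hx
    obtain ⟨hI, hII⟩ := unique_root_integrals (hfd (w + x)) hg h0 (by rw [(hder (w + x) g).deriv]; exact h1) hu
    have hz : zt x = g := by
      have : (fun ξ => ξ * (deriv (fun ξ => T (w + x + ξ • N)) ξ / T (w + x + ξ • N))) =
          fun ξ => ξ * (dT (w + x + ξ • N) N / T (w + x + ξ • N)) := by
        ext ξ; rw [(hder (w + x) ξ).deriv]
      rw [this] at hI
      simp [zt]
      rw [hI, inv_mul_cancel_left₀ hc]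
    refine ⟨by rw [hz]; exact h0, fun ζ hζ => ?_⟩
    have := hII ζ hζ
    simp only [kk, hz]
    rw [mul_left_comm, this, inv_mul_cancel_left₀ hc]
  have hnearN : ball (0 : Γ) δ ∈ 𝓝 0 := ball_mem_nhds _ hδ
  have hz0 : ∀ x ∈ ball 0 ρ, T (w + x + zt x • N) = 0 := by
    refine eq_zero_of_eventually hρ ?_ ?_
    · refine hT.comp_differentiableOn ?_
      exact hlin.add (hztd.smul_const N)
    · filter_upwards [hnearN] with x hx using (hnear x hx).1
  have hk ζ (hζ : ‖ζ‖ < ρ) x (hx : x ∈ ball 0 ρ) : T (w + x + ζ • N) * kk ζ x = ζ - zt x := by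
    rw [← sub_eq_zero]
    revert x
    refine eq_zero_of_eventually hρ ?_ ?_
    · refine ((hT.comp_differentiableOn (hlin.add_const _)).mul (hkd ζ hζ)).sub ?_
      exact (differentiableOn_const ζ).sub hztd
    · filter_upwards [hnearN] with x hx
      rw [(hnear x hx).2 ζ hζ, sub_self]
  -- the bound on the root
  have hbound x (hx : x ∈ ball 0 ρ) : ‖zt x‖ ≤ ‖x‖ := by
    by_contra! hlt
    have hxρ : ‖x‖ < ρ := by simpa using hx
    have hseg t (ht : t ∈ Icc (0 : ℝ) 1) : t • x ∈ ball 0 ρ := by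
      rw [mem_ball_zero_iff, norm_smul, norm_of_nonneg ht.1]
      exact (mul_le_of_le_one_left (norm_nonneg _) ht.2).trans_lt hxρ
    have hcont : ContinuousOn (fun t : ℝ => ‖zt (t • x)‖) (Icc 0 1) :=
      (hztd.continuousOn.comp (by fun_prop) hseg).norm
    have hzt0 : zt 0 = 0 := by
      obtain ⟨g, hg, h0, h1, hu⟩ := hloc 0 (mem_ball_self hδ)
      have h2 := (hnear 0 (mem_ball_self hδ)).2 0 (by simpa using hρ)
      rw [zero_smul, add_zero, add_zero, hw, zero_mul, zero_sub] at h2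
      exact neg_eq_zero.mp h2.symm
    obtain ⟨m, hm1, hm2⟩ := exists_between (lt_min hlt (hxρ.trans hρε))
    have hm : m ∈ Icc ‖zt ((0 : ℝ) • x)‖ ‖zt ((1 : ℝ) • x)‖ := by
      rw [zero_smul, one_smul, hzt0, norm_zero]
      exact ⟨(norm_nonneg _).trans hm1.le, (hm2.trans_le (min_le_left _ _)).le⟩
    obtain ⟨t, ht, htm⟩ := intermediate_value_Icc zero_le_one hcont hm
    simp only at htm
    have := hF.annulus hw (htm ▸ hm2.trans_le (min_le_right _ _)) (hz0 _ (hseg t ht))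
    rw [norm_smul, norm_of_nonneg ht.1] at this
    have := mul_le_of_le_one_left (norm_nonneg x) ht.2
    linarith
  refine ⟨zt, hztd, fun x hx => ⟨hbound x hx, hz0 x hx, ?_, fun ξ hξ h0 => ?_⟩⟩
  · -- simplicity of the root
    intro h0
    set z := zt x
    have hzρ := (hbound x hx).trans_lt (by simpa using hx)
    have hkc : ContinuousAt (fun ζ => kk ζ x) z := by
      have hci : CircleIntegrable (fun ξ => (ξ - zt x) * (1 / T (w + x + ξ • N))) 0 ρ :=
        ((continuousOn_id.sub continuousOn_const).mul
          (continuousOn_const.div (by fun_prop) (hcirc x hx))).circleIntegrable hρ.le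
      lift ρ to ℝ≥0 using hρ.le
      have := (hasFPowerSeriesOn_cauchy_integral hci hρ).continuousOn.continuousAt
        (x := z) (IsOpen.mem_nhds isOpen_eball (by rw [mem_eball, edist_eq_enorm_sub, sub_zero]; exact_mod_cast hzρ))
      refine this.congr (Eventually.of_forall fun ζ => ?_)
      simp only [smul_eq_mul]
      congr 1
      refine circleIntegral.integral_congr ρ.2 fun ξ hξ => ?_
      ring
    have hh := hder (w + x) z
    rw [h0, hasDerivAt_iff_tendsto_slope] at hh
    have h3 := hh.mul (hkc.tendsto.mono_left nhdsWithin_le_nhds)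
    have h4 : Tendsto (fun ζ => slope (fun ξ => T (w + x + ξ • N)) z ζ * kk ζ x) (𝓝[≠] z) (𝓝 1) := by
      refine (tendsto_const_nhds (x := 1)).congr' ?_
      have : ∀ᶠ ζ in 𝓝[≠] z, ‖ζ‖ < ρ := nhdsWithin_le_nhds ((continuous_norm.tendsto z).eventually (gt_mem_nhds hzρ))
      filter_upwards [this, self_mem_nhdsWithin] with ζ hζ hne
      rw [slope_def_field, hz0 x hx, sub_zero, div_mul_eq_mul_div, hk ζ hζ x hx, div_self (sub_ne_zero.mpr hne)]
    have := tendsto_nhds_unique h3 h4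
    simp at this
  · have hξ' := (hF.annulus hw (hξ.trans_lt hρε) h0).trans_lt (by simpa using hx)
    have := hk ξ hξ' x hx
    rw [h0, zero_mul] at this
    exact (sub_eq_zero.mp this.symm)

/-- Division of a holomorphic function vanishing on the zero set of `T`. -/
theorem FlatZero.exists_quotient (hF : FlatZero T ε₀) {w : Γ}
    (hw : T w = 0) {ρ : ℝ} (hρ : 0 < ρ) (hρε : ρ < ε₀) {G : Γ → ℂ}
    (hG : Hol G (ball w (2 * ρ))) (hG0 : ∀ y ∈ ball w (2 * ρ), T y = 0 → G y = 0) :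
    ∃ Q : Γ → ℂ, Hol Q (ball w ρ) ∧ ∀ y ∈ ball w ρ, G y = T y * Q y ∧
      ∀ E : Γ → ℂ, Entire E → ∀ M : ℝ,
        (∀ ξ ∈ sphere (0 : ℂ) ρ, ‖G (y + ξ • nrm T w)‖ * ‖E (y + ξ • nrm T w)‖ ≤
          M * ‖T (y + ξ • nrm T w)‖) → ‖Q y‖ * ‖E y‖ ≤ M := by
  obtain ⟨zt, -, hzt⟩ := hF.exists_root hw hρ hρε
  have hd := hF.dne w hw
  have hNn := norm_nrm hd
  set N := nrm T w
  have hT := hF.diff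
  set c := 2 * Real.pi * I
  have hc : c ≠ 0 := by simp [c, Real.pi_ne_zero, Complex.I_ne_zero]
  set Ω := ball w (2 * ρ) ∩ {z | T z ≠ 0}
  have hΩ : IsOpen Ω := isOpen_ball.inter (isOpen_ne_fun hT.continuous continuous_const)
  have hΦ : Hol (fun z => G z / T z) Ω :=
    differentiableOn_div (hG.mono inter_subset_left) hT.differentiableOn fun z hz => hz.2
  have hxy y (hy : y ∈ ball w ρ) : y - w ∈ ball 0 ρ := by
    rw [mem_ball_zero_iff, ← dist_eq_norm]; exact hy
  have hin y (hy : y ∈ ball w ρ) (ξ : ℂ) (hξ : ‖ξ‖ ≤ ρ) : y + ξ • N ∈ ball w (2 * ρ) := by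
    rw [mem_ball, dist_eq_norm, show y + ξ • N - w = (y - w) + ξ • N by abel]
    refine (norm_add_le _ _).trans_lt ?_
    rw [norm_smul, hNn, ← dist_eq_norm]
    rw [mem_ball] at hy; linarith
  have hcirc y (hy : y ∈ ball w ρ) ξ (hξ : ξ ∈ sphere (0 : ℂ) ρ) : y + ξ • N ∈ Ω := by
    rw [mem_sphere_zero_iff_norm] at hξ
    refine ⟨hin y hy ξ hξ.le, fun h0 => ?_⟩
    have h1 := hxy y hy
    have := hF.annulus (x := y - w) hw (hξ ▸ hρε) (by rw [add_sub_cancel]; exact h0)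
    rw [mem_ball_zero_iff] at h1; linarith
  refine ⟨fun y => c⁻¹ * ∮ ξ in C(0, ρ), ξ⁻¹ * (G (y + ξ • N) / T (y + ξ • N)),
    (differentiableOn_circle hΩ hΦ hρ.le (a := fun ξ => ξ⁻¹) (continuousOn_inv₀.mono ?_) N
      isOpen_ball hcirc).const_mul _, fun y hy => ?_⟩
  · intro ξ hξ
    rw [mem_sphere_zero_iff_norm] at hξ
    exact norm_pos_iff.mp (hξ ▸ hρ)
  obtain ⟨hzn, hz0, hz1, hzu⟩ := hzt (y - w) (hxy y hy)
  rw [add_sub_cancel] at hz0 hz1 hzu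
  set z := zt (y - w)
  have hzρ : ‖z‖ < ρ := hzn.trans_lt (by simpa using hxy y hy)
  set V : Set ℂ := (fun ξ => y + ξ • N) ⁻¹' ball w (2 * ρ)
  have hVo : IsOpen V := isOpen_ball.preimage (by fun_prop)
  have hBV : closedBall 0 ρ ⊆ V := fun ξ hξ => hin y hy ξ (by simpa using hξ)
  have hzV : z ∈ V := hBV (by simpa using hzρ.le)
  set f : ℂ → ℂ := fun ξ => T (y + ξ • N)
  set γ : ℂ → ℂ := fun ξ => G (y + ξ • N)
  have hfd : Entire f := hT.comp (by fun_prop)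
  have hγd : Hol γ V := hG.comp (by fun_prop) (mapsTo_preimage _ _)
  have hf0 : f z = 0 := hz0
  have hγ0 : γ z = 0 := hG0 _ hzV hz0
  have hfh ξ : f ξ = (ξ - z) * dslope f z ξ := by
    have := sub_smul_dslope f z ξ
    rw [hf0, sub_zero] at this
    exact this.symm
  have hγh ξ : γ ξ = (ξ - z) * dslope γ z ξ := by
    have := sub_smul_dslope γ z ξ
    rw [hγ0, sub_zero] at this
    exact this.symm
  have hne ξ (hξ : ‖ξ‖ ≤ ρ) : dslope f z ξ ≠ 0 := by
    intro h2
    rw [(hzu ξ hξ (by change f ξ = 0; rw [hfh, h2, mul_zero])), dslope_same] at h2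
    have h1 : HasDerivAt (fun ξ => y + ξ • N) N z := by simpa using ((hasDerivAt_id z).smul_const N).const_add y
    exact hz1 (((hT _).hasFDerivAt.comp_hasDerivAt z h1).deriv.symm.trans h2)
  have hd1 : Hol (dslope f z) V :=
    (Complex.differentiableOn_dslope (hVo.mem_nhds hzV)).mpr hfd.differentiableOn
  have hd2 : Hol (dslope γ z) V := (Complex.differentiableOn_dslope (hVo.mem_nhds hzV)).mpr hγd
  set q := fun ξ => dslope γ z ξ / dslope f z ξ
  have hqd : Hol q (closedBall 0 ρ) :=
    (hd2.mono hBV).div (hd1.mono hBV) fun ξ hξ => hne ξ (by simpa using hξ)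
  have hγq ξ (hξ : ‖ξ‖ ≤ ρ) : γ ξ = f ξ * q ξ := by
    have := hne ξ hξ
    rw [hγh, hfh]; simp [q]; field_simp
  have hfcirc ξ (hξ : ξ ∈ sphere 0 ρ) : f ξ ≠ 0 := (hcirc y hy ξ hξ).2
  have hQ : c⁻¹ * (∮ ξ in C(0, ρ), ξ⁻¹ * (G (y + ξ • N) / T (y + ξ • N))) = q 0 := by
    have := hqd.circleIntegral_sub_inv_smul (w := 0) (by simpa using hρ)
    simp at this
    have h2 : (∮ ξ in C(0, ρ), ξ⁻¹ * (G (y + ξ • N) / T (y + ξ • N))) = ∮ ξ in C(0, ρ), ξ⁻¹ * q ξ := by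
      refine circleIntegral.integral_congr hρ.le fun ξ hξ => ?_
      change ξ⁻¹ * (γ ξ / f ξ) = _
      rw [(hγq ξ (by rw [mem_sphere_zero_iff_norm] at hξ; exact hξ.le)), mul_div_cancel_left₀ _ (hfcirc ξ hξ)]
    rw [h2, this, inv_mul_cancel_left₀ hc]
  beta_reduce
  rw [hQ]
  refine ⟨?_, fun E hE M hM => ?_⟩
  · have := hγq 0 (by simpa using hρ.le)
    simpa [γ, f] using this
  · have hdc : DiffContOnCl ℂ (fun ξ => q ξ * E (y + ξ • N)) (ball 0 ρ) := by
      refine DifferentiableOn.diffContOnCl ?_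
      rw [closure_ball _ hρ.ne']
      exact hqd.mul (hE.comp (by fun_prop)).differentiableOn
    have := Complex.norm_le_of_forall_mem_frontier_norm_le isBounded_ball hdc (C := M)
      (fun ξ hξ => ?_) (z := 0) (subset_closure (by simpa using hρ))
    · simpa using this
    · rw [frontier_ball _ hρ.ne'] at hξ
      have h5 := hM ξ hξ
      change ‖γ ξ‖ * _ ≤ M * ‖f ξ‖ at h5
      rw [(hγq ξ (by rw [mem_sphere_zero_iff_norm] at hξ; exact hξ.le)), norm_mul] at h5
      rw [norm_mul]
      refine le_of_mul_le_mul_left ?_ (norm_pos_iff.mpr (hfcirc ξ hξ))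
      linarith

lemma volume_le_hausdorffMeasure (d : ℕ) : (volume : Measure (EuclideanSpace ℝ (Fin d))) ≤ μH[(d : ℝ)] := by
  refine Measure.le_iff.2 fun s hs => ?_
  have h2 : volume s = volume ((WithLp.ofLp : EuclideanSpace ℝ (Fin d) → Fin d → ℝ) '' s) := by
    have := (PiLp.volume_preserving_ofLp (Fin d)).measure_preimage_equiv (f := (MeasurableEquiv.toLp 2 (Fin d → ℝ)).symm) ((WithLp.ofLp : EuclideanSpace ℝ (Fin d) → Fin d → ℝ) '' s)
    rw [← this]
    congr 1
    exact (Set.preimage_image_eq s (WithLp.ofLp_injective 2)).symm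
  rw [h2, ← hausdorffMeasure_pi_real]
  simpa using ((PiLp.lipschitzWith_ofLp 2 (fun _ => ℝ)).hausdorffMeasure_image_le (d := d) (by positivity) s)

lemma ediam_closedBall_le_two_mul {X : Type*} [PseudoMetricSpace X] (x : X) (r : ℝ) :
    ediam (closedBall x r) ≤ 2 * ofReal r := by
  refine Metric.ediam_le fun y hy z hz => (edist_triangle_right y z x).trans ?_
  rw [two_mul, edist_dist, edist_dist]
  gcongr
  · exact hy
  · exact hz

lemma vol_ball_le (n : ℕ) : vol n (ball (0 : En n) 1) ≤ 4 ^ n := by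
  set b := vol n (ball 0 1)
  have hb0 : b ≠ 0 := (measure_ball_pos _ _ one_pos).ne'
  have hbt : b ≠ ⊤ := measure_ball_lt_top.ne
  have hball x r (hr : 0 < r) : vol n (closedBall x r) = ofReal (r ^ (2 * n)) * b := by
    rw [Measure.addHaar_closedBall _ _ hr.le, finrank_real_En]
  have key (k : ℕ) : ∃ (t : Set (En n)) (r : En n → ℝ), t.Countable ∧ t ⊆ ball 0 1 ∧
      (∀ x ∈ t, 0 < r x ∧ r x < 1 / (k + 1) ∧ closedBall x (r x) ⊆ ball 0 1) ∧
      vol n (ball 0 1 \ ⋃ x ∈ t, closedBall x (r x)) = 0 ∧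
      t.PairwiseDisjoint fun x => closedBall x (r x) := by
    obtain ⟨t, r, h1, h2, h3, h4, h5⟩ := Besicovitch.exists_disjoint_closedBall_covering_ae (vol n)
      (fun x => {r | closedBall x r ⊆ ball 0 1}) (ball 0 1) (by
        intro x hx δ hδ
        obtain ⟨e, he, he2⟩ := Metric.nhds_basis_closedBall.mem_iff.1 (isOpen_ball.mem_nhds hx)
        refine ⟨min e (δ / 2), (closedBall_subset_closedBall (min_le_left _ _)).trans he2, lt_min he (half_pos hδ), (min_le_right _ _).trans_lt (half_lt_self hδ)⟩)
      (fun _ => 1 / (k + 1)) (fun _ _ => by positivity)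
    exact ⟨t, r, h1, h2, fun x hx => ⟨(h3 x hx).2.1, (h3 x hx).2.2, (h3 x hx).1⟩, h4, h5⟩
  choose t r htc hts htr hnull hdisj using key
  set s' := ball 0 1 ∩ ⋂ k, ⋃ x ∈ t k, closedBall x (r k x)
  have hsub : ball 0 1 ⊆ s' ∪ ⋃ k, (ball 0 1 \ ⋃ x ∈ t k, closedBall x (r k x)) := by
    intro x hx
    by_cases h : x ∈ ⋂ k, ⋃ x ∈ t k, closedBall x (r k x)
    · exact Or.inl ⟨hx, h⟩
    · right
      simp only [mem_iInter, not_forall] at h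
      obtain ⟨k, hk⟩ := h
      exact mem_iUnion.2 ⟨k, hx, hk⟩
  have h1 : b ≤ vol n s' := by
    refine (measure_mono hsub).trans ((measure_union_le _ _).trans ?_)
    rw [measure_iUnion_null hnull, add_zero]
  refine h1.trans ?_
  have : ∀ k, Countable (t k) := fun k => (htc k).to_subtype
  have h2 := Measure.hausdorffMeasure_le_liminf_tsum (ι := fun k => t k) (l := atTop) (2 * n : ℝ) s'
    (fun k => ofReal (2 * (1 / (k + 1)))) (by
      have : Tendsto (fun k : ℕ => 2 * (1 / ((k : ℝ) + 1))) atTop (𝓝 (2 * 0)) :=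
        tendsto_one_div_add_atTop_nhds_zero_nat.const_mul 2
      simpa using tendsto_ofReal this)
    (fun k x => closedBall x (r k x)) (by
      refine Eventually.of_forall fun k x => ?_
      have := htr k x x.2
      refine (ediam_closedBall_le_two_mul _ _).trans ?_
      rw [ofReal_mul (by norm_num)]
      gcongr
      · simp
      · exact this.2.1.le)
    (by
      refine Eventually.of_forall fun k y hy => ?_
      have := mem_iInter.1 hy.2 k
      simpa using this)
  refine h2.trans ?_
  refine liminf_le_of_le (by isBoundedDefault) fun c hc => ?_
  obtain ⟨k, hk⟩ := hc.exists
  refine hk.trans ?_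
  have h3 (x : t k) : ediam (closedBall (x : En n) (r k x)) ^ (2 * n : ℝ) ≤ 4 ^ n * b⁻¹ * vol n (closedBall x (r k x)) := by
    have := htr k x x.2
    rw [hball _ _ this.1, mul_assoc, ← mul_assoc b⁻¹, mul_comm b⁻¹, mul_assoc, ENNReal.inv_mul_cancel hb0 hbt]
    have h4 : ediam (closedBall (x : En n) (r k x)) ≤ 2 * ofReal (r k x) := by exact ediam_closedBall_le_two_mul _ _
    calc _ ≤ (2 * ofReal (r k x)) ^ (2 * n : ℝ) := by gcongr
      _ = (2 * ofReal (r k x)) ^ (2 * n) := by rw [← ENNReal.rpow_natCast]; norm_num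
      _ = _ := by rw [mul_pow, ofReal_pow this.1.le, pow_mul]; norm_num
  calc ∑' x : t k, ediam (closedBall (x : En n) (r k x)) ^ (2 * n : ℝ)
      ≤ ∑' x : t k, 4 ^ n * b⁻¹ * vol n (closedBall x (r k x)) := ENNReal.tsum_le_tsum h3
    _ = 4 ^ n * b⁻¹ * vol n (⋃ x ∈ t k, closedBall x (r k x)) := by
      rw [ENNReal.tsum_mul_left, measure_biUnion (htc k) (hdisj k) (fun x _ => measurableSet_closedBall)]
    _ ≤ 4 ^ n * b⁻¹ * b := by
      gcongr
      exact measure_mono (iUnion₂_subset fun x hx => (htr k x hx).2.2)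
    _ = 4 ^ n := by rw [mul_assoc, ENNReal.inv_mul_cancel hb0 hbt, mul_one]

/-- The real model of the complex hyperplane orthogonal to a vector. -/
abbrev Hyp (n : ℕ) : Type := EuclideanSpace ℝ (Fin (2 * (n - 1)))

lemma exists_hyperplane_isometry (hn : 1 ≤ n) {N : Γ} (hN : ‖N‖ = 1) :
    ∃ j : Hyp n →ₗᵢ[ℝ] Γ, (∀ a, ⟪N, j a⟫_ℂ = 0) ∧ ∀ y, ⟪N, y⟫_ℂ = 0 → ∃ a, j a = y := by
  set V := (Submodule.span ℂ {N})ᗮ with hV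
  have h1 : Module.finrank ℂ V = n - 1 := by
    have : Fact (Module.finrank ℂ Γ = (n - 1) + 1) := ⟨by rw [finrank_euclideanSpace_fin]; omega⟩
    exact Submodule.finrank_orthogonal_span_singleton (by rintro rfl; simp at hN)
  let _ : InnerProductSpace ℝ V := InnerProductSpace.complexToReal
  let b := (stdOrthonormalBasis ℝ V).reindex (finCongr (by rw [finrank_real_of_complex, h1]))
  refine ⟨⟨(V.subtype.restrictScalars ℝ) ∘ₗ b.repr.symm.toLinearEquiv.toLinearMap, fun x => ?_⟩, fun a => ?_, fun y hy => ?_⟩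
  · exact b.repr.symm.norm_map x
  · have := (b.repr.symm a).2
    exact Submodule.mem_orthogonal_singleton_iff_inner_right.1 this
  · have hy' : y ∈ V := by rwa [hV, Submodule.mem_orthogonal_singleton_iff_inner_right]
    refine ⟨b.repr ⟨y, hy'⟩, ?_⟩
    simp

lemma factorial_bound : ∀ k : ℕ, (4 : ℝ) ^ (k + 1) * (k + 1).factorial / Real.pi ^ (k + 1) ≤ 2 ^ (k + 1) * k.factorial := by
  have key (k : ℕ) : (k + 1) * 2 ^ (k + 1) ≤ Real.pi ^ (k + 1) := by
    have hpi := Real.pi_gt_three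
    rcases k with _ | k
    · norm_num; linarith
    induction k with
    | zero => norm_num; nlinarith
    | succ k ih =>
      rw [pow_succ Real.pi]
      push_cast at ih ⊢
      have : (0 : ℝ) < 2 ^ (k + 1 + 1) := by positivity
      calc (k + 1 + 1 + 1) * 2 ^ (k + 1 + 1 + 1) ≤ (((k : ℝ) + 1 + 1) * 2 ^ (k + 1 + 1)) * 3 := by
            rw [pow_succ _ (k + 1 + 1)]; nlinarith
        _ ≤ _ := by gcongr
  intro k
  rw [div_le_iff₀ (by positivity), Nat.factorial_succ, show (4 : ℝ) = 2 * 2 by norm_num, mul_pow]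
  push_cast
  have := mul_le_mul_of_nonneg_left (key k) (show (0 : ℝ) ≤ 2 ^ (k + 1) * k.factorial by positivity)
  linarith

lemma exists_normal_frame (hn : 1 ≤ n) {N : Γ} (hN : ‖N‖ = 1) :
    ∃ (j : Hyp n →ₗᵢ[ℝ] Γ) (Θ : (Hyp n × ℂ) ≃L[ℝ] Γ) (c : ℝ≥0∞),
      (∀ a ζ, Θ (a, ζ) = j a + ζ • N) ∧ (∀ a ζ, ‖Θ (a, ζ)‖ ^ 2 = ‖a‖ ^ 2 + ‖ζ‖ ^ 2) ∧
      c ≤ 2 ^ n * ((n - 1).factorial : ℝ≥0∞) ∧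
      Λ = c • Measure.map Θ (volume.prod volume) := by
  obtain ⟨j, hj1, hj2⟩ := exists_hyperplane_isometry hn hN
  have hNN : ⟪N, N⟫_ℂ = 1 := by rw [inner_self_eq_norm_sq_to_K, hN]; simp
  have hin a ζ : ⟪N, j a + ζ • N⟫_ℂ = ζ := by
    rw [inner_add_right, hj1, inner_smul_right, hNN]; simp
  let L : (Hyp n × ℂ) →ₗ[ℝ] Γ :=
    j.toLinearMap ∘ₗ LinearMap.fst ℝ _ _ + ((LinearMap.toSpanSingleton ℂ Γ N).restrictScalars ℝ) ∘ₗ LinearMap.snd ℝ _ _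
  have hL a ζ : L (a, ζ) = j a + ζ • N := rfl
  have hLi : Function.Injective L := by
    rw [injective_iff_map_eq_zero]
    rintro ⟨a, ζ⟩ h
    rw [hL] at h
    have h1 := hin a ζ
    rw [h, inner_zero_right] at h1
    rw [← h1, zero_smul, add_zero] at h
    simp [(j.injective (by rw [h, map_zero]) : a = 0), ← h1]
  have hLs : Function.Surjective L := by
    intro y
    obtain ⟨a, ha⟩ := hj2 (y - ⟪N, y⟫_ℂ • N) (by rw [inner_sub_right, inner_smul_right, hNN]; simp)
    exact ⟨(a, ⟪N, y⟫_ℂ), by rw [hL, ha]; simp⟩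
  let Θ : (Hyp n × ℂ) ≃L[ℝ] Γ := (LinearEquiv.ofBijective L ⟨hLi, hLs⟩).toContinuousLinearEquiv
  have hΘ a ζ : Θ (a, ζ) = j a + ζ • N := rfl
  have hnorm a ζ : ‖Θ (a, ζ)‖ ^ 2 = ‖a‖ ^ 2 + ‖ζ‖ ^ 2 := by
    have := @norm_add_sq ℂ _ _ _ _ (j a) (ζ • N)
    rw [hΘ, this, inner_smul_right, ← inner_conj_symm, hj1, norm_smul, hN]
    simp
  let μ : Measure Γ := Measure.map Θ (volume.prod volume)
  have hμ : μ.IsAddHaarMeasure := Θ.isAddHaarMeasure_map _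
  set c := Measure.addHaarScalarFactor Λ μ
  have hc : Λ = (c : ℝ≥0∞) • μ := Measure.isAddLeftInvariant_eq_smul Λ μ
  have hunit : (volume.prod volume : Measure (Hyp n × ℂ)) (Θ ⁻¹' ball 0 1) = ofReal (Real.pi ^ n / n.factorial) := by
    have hmp := WithLp.volume_preserving_ofLp (Hyp n) ℂ
    have h1 := hmp.measure_preimage (isOpen_ball.preimage Θ.continuous : IsOpen (Θ ⁻¹' ball 0 1)).measurableSet.nullMeasurableSet
    have h2 : (WithLp.ofLp : WithLp 2 (Hyp n × ℂ) → Hyp n × ℂ) ⁻¹' (Θ ⁻¹' ball 0 1) = ball 0 1 := by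
      ext x
      obtain ⟨⟨a, ζ⟩⟩ := x
      simp
      rw [← sq_lt_one_iff₀ (norm_nonneg _), hnorm, ← sq_lt_one_iff₀ (norm_nonneg _), WithLp.prod_norm_sq_eq_of_L2]
      rfl
    have hdim : Module.finrank ℝ (WithLp 2 (Hyp n × ℂ)) = 2 * n := by
      rw [(WithLp.linearEquiv 2 ℝ (Hyp n × ℂ)).finrank_eq, Module.finrank_prod, finrank_euclideanSpace_fin, finrank_real_complex]
      omega
    have : Nontrivial (WithLp 2 (Hyp n × ℂ)) := Module.nontrivial_of_finrank_pos (R := ℝ) (by omega)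
    rw [h2] at h1
    rw [Measure.volume_eq_prod] at h1
    rw [← h1, InnerProductSpace.volume_ball_of_dim_even hdim]
    simp
  have hμb : μ (ball 0 1) = ofReal (Real.pi ^ n / n.factorial) := by
    rw [← hunit]
    exact Measure.map_apply Θ.continuous.measurable isOpen_ball.measurableSet
  refine ⟨j, Θ, c, hΘ, hnorm, ?_, hc⟩
  · have h1 := vol_ball_le n
    rw [hc, Measure.smul_apply, hμb, smul_eq_mul] at h1
    obtain ⟨k, rfl⟩ : ∃ k, n = k + 1 := ⟨n - 1, by omega⟩
    have hpos : 0 < Real.pi ^ (k + 1) / (k + 1).factorial := by positivity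
    have h3 : c * (Real.pi ^ (k + 1) / (k + 1).factorial) ≤ 4 ^ (k + 1) := by
      have := toReal_mono (by simp) h1
      rw [toReal_mul, toReal_ofReal hpos.le] at this
      simpa using this
    have h4 : (c : ℝ) ≤ 2 ^ (k + 1) * k.factorial := by
      refine le_trans ?_ (factorial_bound k)
      rw [← le_div_iff₀ hpos] at h3
      refine h3.trans (le_of_eq ?_)
      field_simp
    rw [show k + 1 - 1 = k from rfl]
    exact_mod_cast h4

lemma hyp_dim (hn : 1 ≤ n) : ((2 * (n - 1) : ℕ) : ℝ) = 2 * n - 2 := by push_cast [hn]; ring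

lemma lintegral_section_le (hn : 1 ≤ n) {A : Set (Hyp n)} (hA : MeasurableSet A) {s : Hyp n → Γ}
    (hs : ContinuousOn s A) {P : Γ → Hyp n} (hP : LipschitzWith 1 P) (hPs : ∀ a ∈ A, P (s a) = a)
    {S : Set Γ} (hsS : ∀ a ∈ A, s a ∈ S)
    {g : Γ → ℝ≥0∞} (hg : Measurable g) :
    ∫⁻ a in A, g (s a) ≤ ∫⁻ y in S, g y ∂(μH[(2 * n - 2 : ℝ)]) := by
  have hsm : AEMeasurable s (volume.restrict A) := hs.aemeasurable hA
  rw [← lintegral_map' hg.aemeasurable hsm]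
  refine lintegral_mono' (Measure.le_iff.2 fun E hE => ?_) le_rfl
  rw [Measure.map_apply_of_aemeasurable hsm hE, Measure.restrict_apply' hA, Measure.restrict_apply hE]
  set B := s ⁻¹' E ∩ A
  have h1 : volume B ≤ μH[(2 * n - 2 : ℝ)] B := by
    rw [← hyp_dim hn]
    exact volume_le_hausdorffMeasure _ B
  refine h1.trans ?_
  have h3 := hP.hausdorffMeasure_image_le (d := (2 * n - 2 : ℝ)) (by rw [← hyp_dim hn]; positivity) (s '' B)
  refine (measure_mono (fun a ha => ⟨s a, ⟨a, ha, rfl⟩, hPs a ha.2⟩ : B ⊆ P '' (s '' B))).trans (h3.trans ?_)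
  simp
  refine measure_mono ?_
  rintro _ ⟨a, ha, rfl⟩
  exact ⟨ha.1, hsS a ha.2⟩

structure IsChart (T : Γ → ℂ) (w : Γ) (ρ : ℝ) (j : Hyp n →ₗᵢ[ℝ] Γ)
    (Θ : (Hyp n × ℂ) ≃L[ℝ] Γ) (c : ℝ≥0∞) (zt : Γ → ℂ) : Prop where
  apply : ∀ a ζ, Θ (a, ζ) = j a + ζ • nrm T w
  norm_sq : ∀ a ζ, ‖Θ (a, ζ)‖ ^ 2 = ‖a‖ ^ 2 + ‖ζ‖ ^ 2
  le : c ≤ 2 ^ n * ((n - 1).factorial : ℝ≥0∞)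
  vol_eq : Λ = c • Measure.map Θ (volume.prod volume)
  diff : Hol zt (ball 0 ρ)
  norm_le : ∀ x ∈ ball (0 : Γ) ρ, ‖zt x‖ ≤ ‖x‖
  zero : ∀ x ∈ ball (0 : Γ) ρ, T (w + x + zt x • nrm T w) = 0
  unique : ∀ x ∈ ball (0 : Γ) ρ, ∀ ξ : ℂ, ‖ξ‖ ≤ ρ → T (w + x + ξ • nrm T w) = 0 → ξ = zt x
  lintegral_le : ∀ r ≤ ρ, ∀ g : Γ → ℝ≥0∞, Measurable g →
    ∫⁻ a in ball (0 : Hyp n) r, g (w + j a + zt (j a) • nrm T w) ≤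
      ∫⁻ y in T ⁻¹' {0} ∩ ball w (2 * r), g y ∂(μH[(2 * n - 2 : ℝ)])

lemma FlatZero.exists_chart (hn : 1 ≤ n) (hF : FlatZero T ε₀) {w : Γ}
    (hw : T w = 0) {ρ : ℝ} (hρ : 0 < ρ) (hρε : ρ < ε₀) :
    ∃ j Θ c zt, IsChart T w ρ j Θ c zt := by
  have hN : ‖nrm T w‖ = 1 := norm_nrm (hF.dne w hw)
  obtain ⟨j, Θ, c, h3, h4, h7, h8⟩ := exists_normal_frame hn hN
  obtain ⟨zt, hd, hz⟩ := hF.exists_root hw hρ hρε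
  refine ⟨j, Θ, c, zt, h3, h4, h7, h8, hd, fun x hx => (hz x hx).1, fun x hx => (hz x hx).2.1,
    fun x hx => (hz x hx).2.2.2, fun r hr g hg => ?_⟩
  have hj a (ha : a ∈ ball (0 : Hyp n) r) : j a ∈ ball 0 ρ := by
    rw [mem_ball_zero_iff] at ha ⊢
    rw [j.norm_map]
    exact ha.trans_le hr
  have hnormeq : ∀ a ζ, ‖j a + ζ • nrm T w‖ ^ 2 = ‖a‖ ^ 2 + ‖ζ‖ ^ 2 := fun a ζ => by rw [← h3, h4]
  refine lintegral_section_le hn measurableSet_ball (P := fun y => (Θ.symm (y - w)).1) ?_ ?_ ?_ ?_ hg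
  · refine (continuous_const.add j.continuous).continuousOn.add ?_
    exact (hd.continuousOn.comp j.continuous.continuousOn hj).smul continuousOn_const
  · refine LipschitzWith.of_dist_le_mul fun x y => ?_
    rw [NNReal.coe_one, one_mul, dist_eq_norm, dist_eq_norm, ← Prod.fst_sub, ← map_sub]
    have : x - w - (y - w) = x - y := by abel
    rw [this]
    obtain ⟨⟨a, ζ⟩, h⟩ := Θ.surjective (x - y)
    rw [← h, Θ.symm_apply_apply]
    refine le_of_sq_le_sq ?_ (norm_nonneg _)
    rw [h4]
    nlinarith
  · intro a ha
    have : w + j a + zt (j a) • nrm T w - w = Θ (a, zt (j a)) := by rw [h3]; abel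
    simp [this]
  · intro a ha
    refine ⟨(hz _ (hj a ha)).2.1, ?_⟩
    rw [mem_ball, dist_eq_norm, add_assoc, add_sub_cancel_left]
    have hz1 := (hz _ (hj a ha)).1
    rw [j.norm_map] at hz1
    rw [mem_ball_zero_iff] at ha
    calc _ ≤ ‖j a‖ + ‖zt (j a) • nrm T w‖ := norm_add_le _ _
      _ < 2 * r := by rw [j.norm_map, norm_smul, hN]; linarith

lemma FlatZero.isLocallyFinite (hn : 1 ≤ n) (hF : FlatZero T ε₀) :
    IsLocallyFiniteMeasure ((μH[(2 * n - 2 : ℝ)] : Measure Γ).restrict Z) := by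
  refine ⟨fun w => ?_⟩
  have hclosed : IsClosed Z := isClosed_singleton.preimage hF.diff.continuous
  by_cases hw : w ∈ Z
  swap
  · refine ⟨Zᶜ, hclosed.isOpen_compl.mem_nhds hw, ?_⟩
    rw [Measure.restrict_apply hclosed.isOpen_compl.measurableSet]
    simp
  have hε : 0 < ε₀ := hF.flat.1
  obtain ⟨j, Θ, c, zt, hc⟩ := hF.exists_chart hn hw (half_pos hε) (half_lt_self hε)
  have hN : ‖nrm T w‖ = 1 := norm_nrm (hF.dne w hw)
  have hcd : ContDiffAt ℝ 1 zt 0 := (contDiffAt_of_differentiableOn (half_pos hε) hc.diff).of_le (by norm_num)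
  obtain ⟨K, U, hU, hK⟩ := hcd.exists_lipschitzOnWith
  obtain ⟨δ, hδ, hδU⟩ := Metric.nhds_basis_ball.mem_iff.1 hU
  set r := min δ (ε₀ / 2)
  have hrpos : 0 < r := lt_min hδ (half_pos hε)
  have hjm a (ha : a ∈ ball (0 : Hyp n) r) : j a ∈ ball 0 r := by
    rw [mem_ball_zero_iff] at ha ⊢
    rwa [j.norm_map]
  have hs : LipschitzOnWith (1 + K) (fun a => w + j a + zt (j a) • nrm T w) (ball (0 : Hyp n) r) := by
    refine LipschitzOnWith.of_dist_le_mul fun a ha b hb => ?_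
    have h1 := hK.dist_le_mul (j a) (hδU (ball_subset_ball (min_le_left _ _) (hjm a ha))) (j b)
      (hδU (ball_subset_ball (min_le_left _ _) (hjm b hb)))
    rw [j.dist_map] at h1
    have h2 : w + j a + zt (j a) • nrm T w - (w + j b + zt (j b) • nrm T w) =
      j (a - b) + (zt (j a) - zt (j b)) • nrm T w := by rw [map_sub, sub_smul]; abel
    rw [dist_eq_norm, h2]
    refine (norm_add_le _ _).trans ?_
    rw [j.norm_map, norm_smul, hN, ← dist_eq_norm, ← dist_eq_norm]
    push_cast
    linarith
  have hd0 : (0 : ℝ) ≤ 2 * n - 2 := by rw [← hyp_dim hn]; positivity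
  have hfin : μH[(2 * n - 2 : ℝ)] ((fun a => w + j a + zt (j a) • nrm T w) '' ball (0 : Hyp n) r) < ⊤ := by
    refine (hs.hausdorffMeasure_image_le hd0).trans_lt (mul_lt_top ?_ ?_)
    · exact ENNReal.rpow_lt_top_of_nonneg hd0 ENNReal.coe_ne_top
    · have hh : (2 * n - 2 : ℝ) = Module.finrank ℝ (Hyp n) := by rw [finrank_euclideanSpace_fin, hyp_dim hn]
      rw [hh]
      exact measure_ball_lt_top
  refine ⟨ball w r, ball_mem_nhds w hrpos, ?_⟩
  rw [Measure.restrict_apply measurableSet_ball]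
  refine (measure_mono ?_).trans_lt hfin
  rintro y ⟨hy, hyT⟩
  obtain ⟨⟨a, ζ⟩, h⟩ := Θ.surjective (y - w)
  have hnorm := hc.norm_sq a ζ
  rw [h] at hnorm
  rw [mem_ball, dist_eq_norm] at hy
  have ha : ‖a‖ ≤ ‖y - w‖ := le_of_sq_le_sq (by nlinarith [sq_nonneg ‖ζ‖]) (norm_nonneg _)
  have hζ : ‖ζ‖ ≤ ‖y - w‖ := le_of_sq_le_sq (by nlinarith [sq_nonneg ‖a‖]) (norm_nonneg _)
  have har : a ∈ ball (0 : Hyp n) r := mem_ball_zero_iff.2 (ha.trans_lt hy)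
  rw [hc.apply] at h
  have hyeq : y = w + j a + ζ • nrm T w := by rw [add_assoc, h]; abel
  have hζeq : ζ = zt (j a) := by
    refine hc.unique (j a) (ball_subset_ball (min_le_right _ _) (hjm a har)) ζ ?_ ?_
    · exact (hζ.trans hy.le).trans (min_le_right _ _)
    · rw [← hyeq]; exact hyT
  refine ⟨a, har, ?_⟩
  simp only
  rw [← hζeq, ← hyeq]

lemma enorm_rpow_le_lintegral_ball (hr : 0 < r) {h : Γ → ℂ} {w : Γ}
    (hh : Hol h (ball w (3 * r))) {p : ℝ} (hp : 1 ≤ p) :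
    ‖h w‖ₑ ^ p ≤ ofReal (1 / radMass n r) * ∫⁻ y in ball w (2 * r), ‖h y‖ₑ ^ p ∂Λ := by
  have hp0 : 0 < p := by linarith
  set m := fun y => ofReal (moll r (w - y)) with hm
  have hmc : Measurable m := ((continuous_moll r).comp (continuous_const.sub continuous_id)).measurable.ennreal_ofReal
  have hm0 y (hy : y ∉ ball w (2 * r)) : m y = 0 := by
    rw [mem_ball, dist_comm, dist_eq_norm, not_lt] at hy
    simp [hm, moll_eq_zero hr hy]
  set B := ball w (2 * r)
  have hB : MeasurableSet B := measurableSet_ball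
  set ν := ((Λ).restrict B).withDensity m with hν
  have hmB (g : Γ → ℝ≥0∞) : ∫⁻ y in B, m y * g y ∂Λ = ∫⁻ y, m y * g y ∂Λ := by
    refine setLIntegral_eq_of_support_subset ?_
    intro y hy
    by_contra hyB
    exact hy (by simp [hm0 y hyB])
  have hνp : IsProbabilityMeasure ν := by
    refine ⟨?_⟩
    rw [withDensity_apply _ MeasurableSet.univ, Measure.restrict_univ]
    have := hmB 1
    simp at this
    rw [this, ← ofReal_integral_eq_lintegral_ofReal, integral_moll_sub hr, ofReal_one]
    · exact (integrable_moll hr).comp_sub_left w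
    · exact ae_of_all _ fun y => moll_nonneg hr _
  have hhm : AEStronglyMeasurable h ((Λ).restrict B) :=
    (hh.continuousOn.mono (ball_subset_ball (by linarith))).aestronglyMeasurable hB
  have hhν : AEStronglyMeasurable h ν := hhm.mono_ac (withDensity_absolutelyContinuous _ _)
  have h1 := eLpNorm'_le_eLpNorm'_of_exponent_le one_pos hp ν hhν
  have h2 : ‖h w‖ₑ ≤ eLpNorm' h 1 ν := by
    rw [eLpNorm']
    simp
    rw [lintegral_withDensity_eq_lintegral_mul₀ hmc.aemeasurable hhm.enorm]
    simp
    rw [hmB, ← mconv_eq_self hr hh, mconv_eq']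
    refine (enorm_integral_le_lintegral_enorm _).trans (le_of_eq (lintegral_congr fun y => ?_))
    rw [enorm_smul, Real.enorm_of_nonneg (moll_nonneg hr _)]
  have h3 : ‖h w‖ₑ ^ p ≤ ∫⁻ y, ‖h y‖ₑ ^ p ∂ν := by
    calc ‖h w‖ₑ ^ p ≤ (eLpNorm' h p ν) ^ p := by gcongr; exact h2.trans h1
      _ = _ := by rw [eLpNorm', ← rpow_mul, one_div_mul_cancel hp0.ne', ENNReal.rpow_one]
  refine h3.trans ?_
  rw [lintegral_withDensity_eq_lintegral_mul₀ hmc.aemeasurable (hhm.enorm.pow_const p),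
    ← lintegral_const_mul' _ _ ofReal_ne_top]
  refine lintegral_mono fun y => ?_
  simp only [Pi.mul_apply, hm]
  gcongr
  exact div_le_div_of_nonneg_right (rad_le_one _ _) (radMass_pos hr).le

lemma HolOn.comp {W : Set Γ} (hf : HolOn W f) {P : Γ → Γ} {U : Set Γ}
    (hU : IsOpen U) (hP : Hol P U) (hPW : ∀ y ∈ U, P y ∈ W) :
    Hol (fun y => f (P y)) U := by
  intro y hy
  obtain ⟨V, hV, g, hg, hfg⟩ := hf (P y) (hPW y hy)
  have hPd := (hP y hy).differentiableAt (hU.mem_nhds hy)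
  refine ((((hg _ (mem_of_mem_nhds hV)).differentiableAt hV).comp y hPd).congr_of_eventuallyEq ?_).differentiableWithinAt
  filter_upwards [hU.mem_nhds hy, hPd.continuousAt.preimage_mem_nhds hV] with x hxU hxV
  exact hfg ⟨hxV, hPW x hxU⟩

lemma HolOn.continuousOn {W : Set Γ} (hf : HolOn W f) : ContinuousOn f W := by
  intro y hy
  obtain ⟨V, hV, g, hg, hfg⟩ := hf y hy
  have hgd := ((hg _ (mem_of_mem_nhds hV)).differentiableAt hV).continuousAt
  refine (hgd.continuousWithinAt (s := W)).congr_of_eventuallyEq ?_ (hfg ⟨mem_of_mem_nhds hV, hy⟩)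
  filter_upwards [mem_nhdsWithin_of_mem_nhds hV, self_mem_nhdsWithin] with x h1 h2
  exact hfg ⟨h1, h2⟩

lemma HolOn.mul_entire {W : Set Γ} {f E : Γ → ℂ} (hf : HolOn W f) (hE : Entire E) :
    HolOn W (fun y => f y * E y) := by
  intro y hy
  obtain ⟨V, hV, g, hg, hfg⟩ := hf y hy
  exact ⟨V, hV, fun y => g y * E y, hg.fun_mul hE.differentiableOn, fun x hx => by simp [hfg hx]⟩

lemma IsChart.sub_mul {w : Γ} {ρ : ℝ} {j Θ c zt} (hc : IsChart T w ρ j Θ c zt) (hN : ‖nrm T w‖ = 1)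
    {a : Hyp n} {ζ : ℂ} (ha : ‖a‖ ≤ ρ / 4) (hζ : ‖ζ‖ ≤ ρ / 4) (hρ : 0 < ρ) :
    ζ + zt (j a + ζ • nrm T w) = zt (j a) := by
  have h2 : ‖j a + ζ • nrm T w‖ ≤ ρ / 2 := by
    refine (norm_add_le _ _).trans ?_
    rw [j.norm_map, norm_smul, hN]; linarith
  have h3 : j a + ζ • nrm T w ∈ ball 0 ρ := by rw [mem_ball_zero_iff]; linarith
  refine hc.unique (j a) (by rw [mem_ball_zero_iff, j.norm_map]; linarith) _ ?_ ?_
  · refine (norm_add_le _ _).trans ?_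
    have := hc.norm_le _ h3
    linarith
  · have := hc.zero _ h3
    rw [← this, add_smul]
    grind

lemma IsChart.lintegral_eq {w : Γ} {ρ : ℝ} {j Θ c zt} (hc : IsChart T w ρ j Θ c zt) (g : Γ → ℝ≥0∞) :
    ∫⁻ y, g y ∂Λ = c * ∫⁻ x, g (w + Θ x) ∂(volume.prod volume : Measure (Hyp n × ℂ)) := by
  rw [← lintegral_add_left_eq_self (μ := Λ) g w, hc.vol_eq, lintegral_smul_measure]
  congr 1
  exact lintegral_map_equiv (fun y => g (w + y)) Θ.toHomeomorph.toMeasurableEquiv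

lemma IsChart.continuousOn_section {w : Γ} {ρ : ℝ} {j Θ c zt} (hc : IsChart T w ρ j Θ c zt) :
    ContinuousOn (fun a => w + j a + zt (j a) • nrm T w) (ball (0 : Hyp n) ρ) := by
  refine (continuous_const.add j.continuous).continuousOn.add ?_
  have hzc :=
    hc.diff.continuousOn.comp j.continuous.continuousOn (fun a ha => by
      rw [mem_ball_zero_iff] at ha ⊢
      rwa [j.norm_map])
  exact hzc.smul continuousOn_const

lemma FlatZero.mean_value (hn : 1 ≤ n) (hF : FlatZero T ε₀) {δ : ℝ} (hδ : 0 < δ) {p : ℝ} (hp : 1 ≤ p) :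
    ∃ K : ℝ≥0∞, K ≠ ⊤ ∧ ∀ w, T w = 0 → ∀ F : Γ → ℂ, HolOn Z F →
      ‖F w‖ₑ ^ p ≤ K * ∫⁻ y in Z ∩ ball w δ, ‖F y‖ₑ ^ p ∂(μH[(2 * n - 2 : ℝ)]) := by
  have hε := hF.flat.1
  set ρ := min δ (ε₀ / 2)
  have hρ0 := lt_min hδ (half_pos hε)
  have hρε : ρ < ε₀ := (min_le_right _ _).trans_lt (half_lt_self hε)
  set r := ρ / 8 with hr
  have hr0 : 0 < r := by positivity
  refine ⟨ofReal (1 / radMass n r) * ((2 ^ n * ((n - 1).factorial : ℝ≥0∞)) * volume (ball (0 : ℂ) (2 * r))), ?_, ?_⟩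
  · refine mul_ne_top ofReal_ne_top (mul_ne_top (by finiteness) ?_)
    exact measure_ball_lt_top.ne
  intro w hw F hFh
  have hN := norm_nrm (hF.dne w hw)
  obtain ⟨j, Θ, c, zt, hc⟩ := hF.exists_chart hn hw hρ0 hρε
  set P := fun y => y + zt (y - w) • nrm T w with hP
  have hmem y (hy : y ∈ ball w ρ) : y - w ∈ ball 0 ρ := by
    rw [mem_ball_zero_iff, ← dist_eq_norm]; exact hy
  have hPd : Hol P (ball w ρ) := by
    have hz :=
      hc.diff.comp (differentiable_id.sub_const w).differentiableOn hmem
    exact differentiableOn_id.add (hz.smul_const _)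
  have hPW y (hy : y ∈ ball w ρ) : P y ∈ Z := by
    have := hc.zero _ (hmem y hy)
    rw [add_sub_cancel] at this
    exact this
  have hd := HolOn.comp hFh isOpen_ball hPd hPW
  have hPw : P w = w := by
    have : zt 0 = 0 := by
      have := hc.norm_le 0 (mem_ball_self hρ0)
      rw [norm_zero] at this
      exact norm_le_zero_iff.1 this
    simp [hP, this]
  have h1 := enorm_rpow_le_lintegral_ball (n := n) hr0 (hd.mono (ball_subset_ball (show 3 * r ≤ ρ by rw [hr]; linarith))) hp
  rw [hPw] at h1
  refine h1.trans ?_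
  rw [mul_assoc]
  gcongr
  set W := Z
  have hWc : IsClosed W := isClosed_singleton.preimage hF.diff.continuous
  set g := W.indicator (fun y => ‖F y‖ₑ ^ p) with hg
  have hgm : Measurable g := by
    classical
    rw [hg]
    refine ContinuousOn.measurable_piecewise ?_ continuousOn_const hWc.measurableSet
    exact ENNReal.continuous_rpow_const.comp_continuousOn (HolOn.continuousOn hFh).enorm
  set A := ball (0 : Hyp n) (2 * r)
  set B := ball (0 : ℂ) (2 * r)
  have hAρ : A ⊆ ball 0 ρ := ball_subset_ball (by rw [hr]; linarith)
  set s := fun a => w + j a + zt (j a) • nrm T w with hs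
  have hsm : AEMeasurable s (volume.restrict A) := (hc.continuousOn_section.mono hAρ).aemeasurable measurableSet_ball
  rw [← lintegral_indicator measurableSet_ball, hc.lintegral_eq]
  have h2 : ∀ x, (ball w (2 * r)).indicator (fun y => ‖F (P y)‖ₑ ^ p) (w + Θ x) ≤
      A.indicator (fun a => g (s a)) x.1 * B.indicator (fun _ => 1) x.2 := by
    rintro ⟨a, ζ⟩
    by_cases hx : w + Θ (a, ζ) ∈ ball w (2 * r)
    swap
    · rw [indicator_of_notMem hx]; exact zero_le
    rw [indicator_of_mem hx]
    rw [mem_ball, dist_eq_norm, add_sub_cancel_left] at hx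
    have hnorm := hc.norm_sq a ζ
    have ha : ‖a‖ ≤ ‖Θ (a, ζ)‖ := le_of_sq_le_sq (by nlinarith) (norm_nonneg _)
    have hζ : ‖ζ‖ ≤ ‖Θ (a, ζ)‖ := le_of_sq_le_sq (by nlinarith) (norm_nonneg _)
    have haA := mem_ball_zero_iff.2 (ha.trans_lt hx)
    rw [indicator_of_mem haA, indicator_of_mem (mem_ball_zero_iff.2 (hζ.trans_lt hx)), mul_one]
    have hPs : P (w + Θ (a, ζ)) = s a := by
      have := hc.sub_mul hN (a := a) (ζ := ζ) (by linarith) (by linarith) hρ0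
      simp only [hP, hs]
      rw [hc.apply, ← this, add_smul]
      abel
    rw [hPs]
    have hsW : s a ∈ W := hc.zero _ (by rw [mem_ball_zero_iff, j.norm_map]; exact mem_ball_zero_iff.1 (hAρ haA))
    rw [hg, indicator_of_mem hsW]
  have h3 : ∫⁻ x, (ball w (2 * r)).indicator (fun y => ‖F (P y)‖ₑ ^ p) (w + Θ x) ∂(volume.prod volume : Measure (Hyp n × ℂ)) ≤
      (∫⁻ a in A, g (s a)) * volume B := by
    refine (lintegral_mono h2).trans (le_of_eq ?_)
    rw [lintegral_prod_mul, lintegral_indicator measurableSet_ball, lintegral_indicator measurableSet_ball, setLIntegral_one]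
    · exact (aemeasurable_indicator_iff measurableSet_ball).2 (hgm.comp_aemeasurable hsm)
    · exact (measurable_const.indicator measurableSet_ball).aemeasurable
  have h4 := hc.lintegral_le (2 * r) (by rw [hr]; linarith) g hgm
  have h5 : ∫⁻ y in W ∩ ball w (2 * (2 * r)), g y ∂(μH[(2 * n - 2 : ℝ)]) ≤
      ∫⁻ y in W ∩ ball w δ, ‖F y‖ₑ ^ p ∂(μH[(2 * n - 2 : ℝ)]) := by
    refine (lintegral_mono (fun y => indicator_le_self _ _ y)).trans (lintegral_mono_set ?_)
    refine inter_subset_inter_right _ (ball_subset_ball ?_)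
    have := min_le_left δ (ε₀ / 2)
    rw [hr]; linarith
  calc (c : ℝ≥0∞) * _ ≤ (2 ^ n * ((n - 1).factorial : ℝ≥0∞)) *
      ((∫⁻ y in W ∩ ball w δ, ‖F y‖ₑ ^ p ∂(μH[(2 * n - 2 : ℝ)])) * volume B) := by
        gcongr
        · exact hc.le
        · refine h3.trans ?_
          gcongr
          exact h4.trans h5
    _ = _ := by ring

/-- The regularized logarithm of the modulus. -/
def lg (T : Γ → ℂ) (ε : ℝ) (z : Γ) : ℝ := 1 / 2 * Real.log (‖T z‖ ^ 2 + ε ^ 2)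

lemma contDiff_lg (hT : Entire T) {ε : ℝ} (hε : ε ≠ 0) : C∞ (lg T ε) := by
  unfold lg
  refine contDiff_const.mul (ContDiff.log ?_ fun x => by positivity)
  exact ((contDiff_of_differentiable hT).norm_sq ℝ).add contDiff_const

lemma levi_lg (hT : Entire T) {ε : ℝ} (hε : ε ≠ 0) (z v : Γ) :
    levi (lg T ε) z v = ε ^ 2 * ‖dT z v‖ ^ 2 / (2 * (‖T z‖ ^ 2 + ε ^ 2) ^ 2) := by
  set ψ := fun z => Real.log (‖T z‖ ^ 2 + ε ^ 2) with hψ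
  have hpos z : 0 < ‖T z‖ ^ 2 + ε ^ 2 := by positivity
  have hTs : C∞ T := contDiff_of_differentiable hT
  have hψs : C∞ ψ := ContDiff.log ((hTs.norm_sq ℝ).add contDiff_const) fun x => (hpos x).ne'
  have hTd := hTs.differentiable (by simp)
  have hcTd : Differentiable ℝ (fun y => conj (T y)) := fun y => conjCLE.differentiableAt.comp y (hTd y)
  have hD y : expw ψ y = T y * conj (T y) + ε ^ 2 := by
    simp only [expw]
    rw [Real.exp_log (hpos y), mul_conj, normSq_eq_norm_sq]
    push_cast; ring
  have hD' : expw ψ = fun y => T y * conj (T y) + ε ^ 2 := funext hD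
  have h1 y : expw ψ y * dbar v (cx ψ) y = T y * conj (dT y v) := by
    rw [← dbar_expw (hψs.differentiable (by simp) y), hD',
      dbar_add v ((hTd y).fun_mul (hcTd y)) (differentiableAt_const _), dbar_mul v (hTd y) (hcTd y),
      dbar_eq_zero (hT y), dbar_conj, dz_eq_fderiv (hT y), dbar_eq_zero (differentiableAt_const _)]
    ring
  have h1' : (fun y => expw ψ y * dbar v (cx ψ) y) = fun y => T y * conj (dz v T y) := by
    funext y; rw [h1, dz_eq_fderiv (hT y)]
  have hbd : Differentiable ℝ (dbar v (cx ψ)) :=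
    (contDiff_dbar (m := 1) (contDiff_ofReal hψs) (by norm_cast) v).differentiable (by simp)
  have hdzd : Differentiable ℝ (dz v T) := (contDiff_dz (m := 1) hTs (by norm_cast) v).differentiable (by simp)
  have hdzc : Differentiable ℝ (fun y => conj (dz v T y)) := fun y => conjCLE.differentiableAt.comp y (hdzd y)
  have hEd : DifferentiableAt ℝ (expw ψ) z := (contDiff_expw hψs).differentiable (by simp) z
  have h2 : dz v (fun y => expw ψ y * dbar v (cx ψ) y) z =
      expw ψ z * dz v (dbar v (cx ψ)) z + dz v (expw ψ) z * dbar v (cx ψ) z :=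
    dz_mul v hEd (hbd z)
  have h3 : dz v (expw ψ) z = dT z v * conj (T z) := by
    rw [hD', dz_add v ((hTd z).fun_mul (hcTd z)) (differentiableAt_const _), dz_mul v (hTd z) (hcTd z),
      dz_conj, dbar_eq_zero (hT z), dz_eq_fderiv (hT z), dz_eq_fderiv (differentiableAt_const _)]
    simp
  have h4 : dz v (fun y => T y * conj (dz v T y)) z = dT z v * conj (dT z v) := by
    rw [dz_mul v (hTd z) (hdzc z), dz_conj, dbar_dz_comm (hTs.of_le (by norm_cast))]
    have : dbar v T = fun _ => 0 := funext fun y => dbar_eq_zero (hT y) v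
    rw [this, dz_eq_fderiv (differentiableAt_const _), dz_eq_fderiv (hT z)]
    simp
  have hl : dz v (dbar v (cx ψ)) z = levi ψ z v := leviForm_self (hψs.of_le (by norm_cast)) z v
  rw [h1', h4, h3, hl] at h2
  have h5 := h1 z
  have hlev : levi ψ z v = ε ^ 2 * ‖dT z v‖ ^ 2 / (‖T z‖ ^ 2 + ε ^ 2) ^ 2 := by
    rw [eq_div_iff (pow_pos (hpos z) 2).ne']
    have hn1 : dT z v * conj (dT z v) = ((‖dT z v‖ ^ 2 : ℝ) : ℂ) := by
      rw [mul_conj, normSq_eq_norm_sq]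
    have hn2 : T z * conj (T z) = ((‖T z‖ ^ 2 : ℝ) : ℂ) := by rw [mul_conj, normSq_eq_norm_sq]
    rw [(by simp only [expw]; rw [Real.exp_log (hpos z)] : expw ψ z = ((‖T z‖ ^ 2 + ε ^ 2 : ℝ) : ℂ))] at h2 h5
    have h6 : ((levi ψ z v * (‖T z‖ ^ 2 + ε ^ 2) ^ 2 : ℝ) : ℂ) = ((ε ^ 2 * ‖dT z v‖ ^ 2 : ℝ) : ℂ) := by
      push_cast at h2 h5 hn1 hn2 ⊢
      linear_combination (-((‖T z‖ : ℂ) ^ 2 + ε ^ 2)) * h2 -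
        (dT z v * conj (T z)) * h5 + ((‖T z‖ : ℂ) ^ 2 + ε ^ 2) * hn1 - (‖T z‖ : ℂ) ^ 2 * hn1 - 
        (dT z v * conj (dT z v)) * hn2
    exact_mod_cast h6
  have : levi (lg T ε) z v = 1 / 2 * levi ψ z v := levi_const_mul (hψs.of_le (by norm_cast)) _ z v
  rw [this, hlev]
  have := (hpos z).ne'
  field_simp

lemma levi_lg_nonneg (hT : Entire T) {ε : ℝ} (hε : ε ≠ 0) (z v : Γ) : 0 ≤ levi (lg T ε) z v := by
  rw [levi_lg hT hε]; positivity

def kern (l : ℝ) (τ : ℂ) : ℝ := 1 / (2 * (l ^ 2 * ‖τ‖ ^ 2 + 1) ^ 2)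

lemma kern_nonneg (l : ℝ) (τ : ℂ) : 0 ≤ kern l τ := by unfold kern; positivity

lemma continuous_kern (l : ℝ) : Continuous (kern l) := by
  unfold kern
  refine continuous_const.div (by fun_prop) fun τ => by positivity

lemma kern_radial {l : ℝ} (hl : 0 < l) : IntegrableOn (fun y : ℝ => y * (1 / (2 * (l ^ 2 * y ^ 2 + 1) ^ 2))) (Ioi 0) ∧
    ∫ y in Ioi (0 : ℝ), y * (1 / (2 * (l ^ 2 * y ^ 2 + 1) ^ 2)) = 1 / (4 * l ^ 2) := by
  have hd x : HasDerivAt (fun y => -(1 / (4 * l ^ 2)) * (l ^ 2 * y ^ 2 + 1)⁻¹)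
      (x * (1 / (2 * (l ^ 2 * x ^ 2 + 1) ^ 2))) x := by
    have h1 : HasDerivAt (fun y => l ^ 2 * y ^ 2 + 1) (l ^ 2 * (2 * x)) x := by
      simpa using ((hasDerivAt_pow 2 x).const_mul (l ^ 2)).add_const 1
    refine ((h1.inv (by positivity)).const_mul (-(1 / (4 * l ^ 2)))).congr_deriv ?_
    field_simp
    ring
  have hlim : Tendsto (fun y => -(1 / (4 * l ^ 2)) * (l ^ 2 * y ^ 2 + 1)⁻¹) atTop (𝓝 (-(1 / (4 * l ^ 2)) * 0)) := by
    refine Tendsto.const_mul _ (tendsto_inv_atTop_zero.comp ?_)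
    exact tendsto_atTop_add_const_right _ _ ((tendsto_pow_atTop (by norm_num)).const_mul_atTop (by positivity))
  have hpos x (hx : x ∈ Ioi 0) : 0 ≤ x * (1 / (2 * (l ^ 2 * x ^ 2 + 1) ^ 2)) := by
    have : 0 < x := hx
    positivity
  refine ⟨integrableOn_Ioi_deriv_of_nonneg' (fun x _ => hd x) hpos hlim, ?_⟩
  rw [integral_Ioi_of_hasDerivAt_of_nonneg' (fun x _ => hd x) hpos hlim]
  norm_num

lemma integrable_kern {l : ℝ} (hl : 0 < l) : Integrable (kern l) := by
  have := (integrable_fun_norm_addHaar (E := ℂ) volume (f := fun y => 1 / (2 * (l ^ 2 * y ^ 2 + 1) ^ 2))).2 (by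
    simpa using (kern_radial hl).1)
  exact this

lemma integral_kern {l : ℝ} (hl : 0 < l) : ∫ τ, kern l τ = Real.pi / (2 * l ^ 2) := by
  have := integral_fun_norm_addHaar (E := ℂ) volume (fun y => 1 / (2 * (l ^ 2 * y ^ 2 + 1) ^ 2))
  simp only [finrank_real_complex, smul_eq_mul, Nat.add_one_sub_one, pow_one] at this
  rw [((kern_radial hl).2)] at this
  rw [(by simp [Measure.real] : volume.real (ball (0 : ℂ) 1) = Real.pi)] at this
  unfold kern
  grind

lemma lintegral_kern {l : ℝ} (hl : 0 < l) : ∫⁻ τ, ofReal (kern l τ) = ofReal (Real.pi / (2 * l ^ 2)) := by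
  rw [← integral_kern hl, ofReal_integral_eq_lintegral_ofReal (integrable_kern hl) (ae_of_all _ (kern_nonneg l))]

lemma lintegral_rescale (g : ℂ → ℝ≥0∞) (ζ₀ : ℂ) {ε : ℝ} (hε : 0 < ε) :
    ∫⁻ ζ, g ζ = ofReal (ε ^ 2) * ∫⁻ τ, g (ζ₀ + ε • τ) := by
  rw [← lintegral_add_left_eq_self g ζ₀]
  have h1 := lintegral_map_equiv (μ := (volume : Measure ℂ)) (fun ζ => g (ζ₀ + ζ)) (Homeomorph.smulOfNeZero ε hε.ne').toMeasurableEquiv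
  have h2 : Measure.map (Homeomorph.smulOfNeZero ε hε.ne').toMeasurableEquiv (volume : Measure ℂ) = ofReal ((ε ^ 2)⁻¹) • volume := by
    have := Measure.map_addHaar_smul (volume : Measure ℂ) hε.ne'
    simp_all
  rw [h2, lintegral_smul_measure] at h1
  have h3 : ∫⁻ τ, g (ζ₀ + ε • τ) = ofReal ((ε ^ 2)⁻¹) * ∫⁻ a, g (ζ₀ + a) := h1.symm
  rw [h3, ← mul_assoc, ← ofReal_mul (by positivity), mul_inv_cancel₀ (by positivity), ofReal_one, one_mul]

/-- The squared norm of the component of `v` normal to the level sets of `T`. -/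
def nsq (T : Γ → ℂ) (v : Γ) (y : Γ) : ℝ := (‖fderiv ℂ T y v‖ / ‖fderiv ℂ T y‖) ^ 2

lemma nsq_nonneg (T : Γ → ℂ) (v y : Γ) : 0 ≤ nsq T v y := sq_nonneg _

lemma nsq_le (T : Γ → ℂ) (v y : Γ) : nsq T v y ≤ ‖v‖ ^ 2 := by
  unfold nsq
  gcongr
  exact div_le_of_le_mul₀ (norm_nonneg _) (norm_nonneg _) (by rw [mul_comm]; exact (fderiv ℂ T y).le_opNorm v)

lemma continuous_fderiv_entire (hT : Entire T) : Continuous (dT) := by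
  rw [← continuousOn_univ]
  exact continuousOn_fderiv isOpen_univ hT.differentiableOn

lemma measurable_nsq (hT : Entire T) (v : Γ) : Measurable (nsq T v) := by
  have h := continuous_fderiv_entire hT
  exact (((h.clm_apply continuous_const).norm.measurable).div h.norm.measurable).pow_const 2

lemma lintegral_surf (W : Set Γ) (g : Γ → ℝ≥0∞) :
    ∫⁻ y, g y ∂(surf n W) = ((2 : ℝ≥0∞) ^ (n - 1) * (Nat.factorial (n - 1) : ℝ≥0∞)) *
      ∫⁻ y in W, g y ∂(μH[(2 * n - 2 : ℝ)]) := by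
  rw [surf, lintegral_smul_measure, smul_eq_mul]

lemma FlatZero.isClosed (hF : FlatZero T ε₀) : IsClosed Z := isClosed_singleton.preimage hF.diff.continuous

lemma FlatZero.limsup_local_le (hn : 1 ≤ n) (hF : FlatZero T ε₀) {w : Γ} (hw : T w = 0) {η : ℝ} (hη : 0 < η) :
    ∃ r > 0, ∀ G : Γ → ℝ, Continuous G → (∀ x, 0 ≤ G x) → (∀ x, G x ≠ 0 → x ∈ ball w r) →
      ∀ v, ∀ ε : ℕ → ℝ, (∀ k, 0 < ε k) → Tendsto ε atTop (𝓝 0) →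
      limsup (fun k => ∫⁻ x, ofReal (G x * levi (lg T (ε k)) x v) ∂Λ) atTop ≤ ofReal (1 + η) * (ofReal Real.pi *
          ∫⁻ x, ofReal (G x * nsq T v x) ∂(surf n Z)) := by
  have hd := hF.dne w hw
  set N := nrm T w with hN
  have hN1 : ‖N‖ = 1 := norm_nrm hd
  set L := ‖dT w‖
  have hLpos : 0 < L := norm_pos_iff.mpr hd
  obtain ⟨t, ht0, ht1, ht2⟩ : ∃ t, 0 < t ∧ t ≤ 1 / 16 ∧ 16 * t ≤ η :=
    ⟨min η 1 / 16, by positivity, by linarith [min_le_right η 1], by linarith [min_le_left η 1]⟩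
  have hratio : (1 + t) ^ 2 ≤ (1 + η) * (1 - t) ^ 2 := by
    have : (1 + 16 * t) * (1 - t) ^ 2 ≤ (1 + η) * (1 - t) ^ 2 := by gcongr
    nlinarith [pow_pos ht0 3]
  set l := (1 - t) * L with hl
  have hlpos : 0 < l := by
    have : 0 < 1 - t := by linarith
    positivity
  have hcont := continuous_fderiv_entire hF.diff
  obtain ⟨δ, hδ, hδ'⟩ := Metric.continuous_iff.1 hcont w (t * L) (by positivity)
  have hε₀ := hF.flat.1
  obtain ⟨ρ, hρ, hρ'⟩ : ∃ ρ, 0 < ρ ∧ 4 * ρ < ε₀ := ⟨ε₀ / 8, by positivity, by linarith⟩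
  obtain ⟨j, Θ, c, zt, hc⟩ := hF.exists_chart hn hw hρ (by linarith)
  refine ⟨min ρ (δ / 2), by positivity, ?_⟩
  set r := min ρ (δ / 2)
  have hrρ : r ≤ ρ := min_le_left _ _
  have hrδ : 2 * r ≤ δ := by linarith [min_le_right ρ (δ / 2)]
  have hrpos : 0 < r := by positivity
  intro G hG hG0 hGs v ε hε hεlim
  set s := fun a => w + j a + zt (j a) • N with hs
  have hja a (ha : a ∈ ball 0 r) : j a ∈ ball 0 ρ := by
    rw [mem_ball_zero_iff] at ha ⊢
    rw [j.norm_map]; linarith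
  have hsb a (ha : a ∈ ball (0 : Hyp n) r) : s a ∈ ball w δ := by
    have h1 := hc.norm_le _ (hja a ha)
    rw [mem_ball_zero_iff] at ha
    rw [mem_ball, dist_eq_norm]
    calc ‖w + j a + zt (j a) • N - w‖ = ‖j a + zt (j a) • N‖ := by congr 1; abel
      _ ≤ ‖j a‖ + ‖zt (j a)‖ * ‖N‖ := (norm_add_le _ _).trans (by rw [norm_smul])
      _ < δ := by rw [hN1, j.norm_map] at *; linarith
  set H := fun y => G y * ‖dT y v‖ ^ 2 with hH
  have hHc : Continuous H := hG.mul ((hcont.clm_apply continuous_const).norm.pow 2)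
  have hH0 y : 0 ≤ H y := mul_nonneg (hG0 y) (sq_nonneg _)
  obtain ⟨M, hM⟩ : ∃ M, ∀ y, H y ≤ M := by
    obtain ⟨M, hM⟩ := (isCompact_closedBall w r).exists_bound_of_continuousOn hHc.continuousOn
    refine ⟨max M 0, fun y => ?_⟩
    by_cases hy : G y = 0
    · simp [hH, hy]
    · exact ((le_abs_self _).trans (hM y (ball_subset_closedBall (hGs y hy)))).trans (le_max_left _ _)
  -- the key pointwise estimate
  have hpt k a (ha : a ∈ ball (0 : Hyp n) r) τ : ε k ^ 2 * (G (s a + ε k • τ • N) * levi (lg T (ε k)) (s a + ε k • τ • N) v) ≤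
        H (s a + ε k • τ • N) * kern l τ := by
    set y := s a + ε k • τ • N with hy
    have hek := hε k
    by_cases hGy : G y = 0
    · simp [hH, hGy]
    have hyb : y ∈ ball w δ := ball_subset_ball (by linarith) (hGs y hGy)
    have hmv := (convex_ball w δ).norm_image_sub_le_of_norm_fderiv_le' (𝕜 := ℂ) (f := T) (φ := dT w)
      (C := t * L) (fun x _ => hF.diff x) (fun x hx => by rw [← dist_eq_norm]; exact (hδ' x hx).le) (hsb a ha) hyb
    have hsz : T (s a) = 0 := hc.zero _ (hja a ha)
    have hys : y - s a = ε k • τ • N := by rw [hy]; abel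
    have hnn : ‖ε k • τ • N‖ = ε k * ‖τ‖ := by rw [norm_smul, norm_smul, hN1, norm_of_nonneg hek.le, mul_one]
    have hdN : ‖dT w (ε k • τ • N)‖ = L * (ε k * ‖τ‖) := by
      have : ε k • τ • N = (ε k * τ) • N := by rw [← smul_smul]; rfl
      rw [this, map_smul, smul_eq_mul, fderiv_nrm hd, norm_mul, norm_mul, norm_real,
        norm_real, norm_norm, norm_of_nonneg hek.le]
      ring
    rw [hsz, sub_zero, hys, hnn] at hmv
    have hTy : l * (ε k * ‖τ‖) ≤ ‖T y‖ := by
      have h3 := norm_sub_norm_le (dT w (ε k • τ • N)) (T y)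
      rw [norm_sub_rev] at h3
      rw [hdN] at h3
      rw [hl]
      linarith
    rw [levi_lg hF.diff hek.ne', hH, kern]
    have h4 : (l * (ε k * ‖τ‖)) ^ 2 ≤ ‖T y‖ ^ 2 := by gcongr
    have h5 : ε k ^ 4 * (l ^ 2 * ‖τ‖ ^ 2 + 1) ^ 2 ≤ (‖T y‖ ^ 2 + ε k ^ 2) ^ 2 := by
      calc ε k ^ 4 * (l ^ 2 * ‖τ‖ ^ 2 + 1) ^ 2 = ((l * (ε k * ‖τ‖)) ^ 2 + ε k ^ 2) ^ 2 := by ring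
        _ ≤ _ := by gcongr
    have hG' := hG0 y
    calc ε k ^ 2 * (G y * (ε k ^ 2 * ‖dT y v‖ ^ 2 / (2 * (‖T y‖ ^ 2 + ε k ^ 2) ^ 2)))
        = (G y * ‖dT y v‖ ^ 2) * (ε k ^ 4 / (2 * (‖T y‖ ^ 2 + ε k ^ 2) ^ 2)) := by ring
      _ ≤ (G y * ‖dT y v‖ ^ 2) * (ε k ^ 4 / (2 * (ε k ^ 4 * (l ^ 2 * ‖τ‖ ^ 2 + 1) ^ 2))) := by gcongr
      _ = _ := by field_simp
  set μ : Measure (Hyp n × ℂ) := (volume.restrict (ball 0 r)).prod volume with hμ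
  have hμ' : μ = (volume.prod volume).restrict (ball 0 r ×ˢ univ) := by
    rw [← Measure.prod_restrict, Measure.restrict_univ]
  set Fk : ℕ → Hyp n × ℂ → ℝ≥0∞ := fun k x => ofReal (H (s x.1 + ε k • x.2 • N) * kern l x.2) with hFk
  have hsc : ContinuousOn s (ball 0 r) := hc.continuousOn_section.mono (ball_subset_ball hrρ)
  have hscμ (e : ℝ) : ContinuousOn (fun x : Hyp n × ℂ => s x.1 + e • x.2 • N) (ball 0 r ×ˢ univ) := by
    refine (hsc.comp continuousOn_fst fun x hx => hx.1).add (Continuous.continuousOn ?_)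
    exact (continuous_snd.smul continuous_const).const_smul e
  have hmeas (e : ℝ) : AEMeasurable (fun x => ofReal (H (s x.1 + e • x.2 • N) * kern l x.2)) μ := by
    rw [hμ']
    refine AEMeasurable.ennreal_ofReal (ContinuousOn.aemeasurable ?_ (measurableSet_ball.prod MeasurableSet.univ))
    exact (hHc.comp_continuousOn (hscμ e)).mul ((continuous_kern l).comp continuous_snd).continuousOn
  have hFm k : AEMeasurable (Fk k) μ := hmeas (ε k)
  have hbound k : ∫⁻ x, ofReal (G x * levi (lg T (ε k)) x v) ∂Λ ≤ c * ∫⁻ x, Fk k x ∂μ := by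
    set g := fun x => ofReal (G x * levi (lg T (ε k)) x v)
    have hgm : Measurable g := by
      have : Continuous fun x => levi (lg T (ε k)) x v := by
        have : (fun x => levi (lg T (ε k)) x v) = fun x => ε k ^ 2 * ‖dT x v‖ ^ 2 / (2 * (‖T x‖ ^ 2 + ε k ^ 2) ^ 2) :=
          funext fun x => levi_lg hF.diff (hε k).ne' x v
        rw [this]
        refine (continuous_const.mul ((hcont.clm_apply continuous_const).norm.pow 2)).div
          (continuous_const.mul (((hF.diff.continuous.norm.pow 2).add continuous_const).pow 2)) fun x => ?_
        have := hε k
        positivity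
      exact ((hG.mul this).measurable).ennreal_ofReal
    rw [hc.lintegral_eq]
    refine mul_le_mul' le_rfl ?_
    rw [lintegral_prod _ (by
      exact (hgm.comp (measurable_const.add Θ.continuous.measurable)).aemeasurable), lintegral_prod _ (hFm k),
      ← lintegral_indicator measurableSet_ball]
    refine lintegral_mono fun a => ?_
    by_cases ha : a ∈ ball (0 : Hyp n) r
    · rw [indicator_of_mem ha]
      rw [lintegral_rescale _ (zt (j a)) (hε k), ← lintegral_const_mul' _ _ ofReal_ne_top]
      refine lintegral_mono fun τ => ?_
      simp only [hFk]
      have e : w + Θ (a, zt (j a) + ε k • τ) = s a + ε k • τ • N := by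
        rw [hc.apply, hs]
        simp only [add_smul, smul_assoc]
        abel
      rw [e, ← ofReal_mul (by positivity)]
      exact ofReal_le_ofReal (hpt k a ha τ)
    · rw [indicator_of_notMem ha]
      refine le_of_eq ((lintegral_congr fun ζ => ?_).trans lintegral_zero)
      have : G (w + Θ (a, ζ)) = 0 := by
        by_contra h
        have h1 := hGs _ h
        rw [mem_ball, dist_eq_norm, add_sub_cancel_left] at h1
        have h2 := hc.norm_sq a ζ
        rw [mem_ball_zero_iff] at ha
        nlinarith [norm_nonneg (Θ (a, ζ))]
      simp [this]
  have hkm : Measurable fun τ => ofReal (kern l τ) := (continuous_kern l).measurable.ennreal_ofReal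
  have hlim : Tendsto (fun k => ∫⁻ x, Fk k x ∂μ) atTop (𝓝 (∫⁻ x, ofReal (H (s x.1) * kern l x.2) ∂μ)) := by
    refine tendsto_lintegral_of_dominated_convergence' (fun x => ofReal (M * kern l x.2)) hFm
      (fun k => ae_of_all _ fun x => ?_) ?_ (ae_of_all _ fun x => ?_)
    · exact ofReal_le_ofReal (mul_le_mul_of_nonneg_right (hM _) (kern_nonneg l _))
    · have hM0 := (hH0 0).trans (hM 0)
      have e (x : Hyp n × ℂ) : ofReal (M * kern l x.2) =
          (fun _ => ofReal M) x.1 * (fun τ => ofReal (kern l τ)) x.2 :=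
        ofReal_mul hM0
      rw [lintegral_congr e, lintegral_prod_mul measurable_const.aemeasurable hkm.aemeasurable,
        lintegral_kern hlpos, setLIntegral_const]
      exact mul_ne_top (mul_ne_top ofReal_ne_top measure_ball_lt_top.ne) ofReal_ne_top
    · refine tendsto_ofReal (Tendsto.mul_const _ ?_)
      have h1 : Tendsto (fun k => s x.1 + ε k • x.2 • N) atTop (𝓝 (s x.1)) := by
        simpa using (hεlim.smul_const (x.2 • N)).const_add (s x.1)
      exact (hHc.tendsto _).comp h1
  have hle1 : limsup (fun k => ∫⁻ x, ofReal (G x * levi (lg T (ε k)) x v) ∂Λ) atTop ≤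
      c * ∫⁻ x, ofReal (H (s x.1) * kern l x.2) ∂μ := by
    rw [← (ENNReal.Tendsto.const_mul hlim (Or.inr (hc.le.trans_lt
      (mul_lt_top (ENNReal.pow_lt_top (by simp)) (ENNReal.natCast_lt_top _))).ne)).limsup_eq]
    exact limsup_le_limsup (Eventually.of_forall hbound)
  refine hle1.trans ?_
  have hmeasGJ : Measurable fun y => ofReal (G y * nsq T v y) :=
    (hG.measurable.mul (measurable_nsq hF.diff v)).ennreal_ofReal
  have hsa : AEMeasurable (fun a => ofReal (H (s a))) (volume.restrict (ball 0 r)) :=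
    ((hHc.comp_continuousOn hsc).aemeasurable measurableSet_ball).ennreal_ofReal
  have hsplit (x : Hyp n × ℂ) : ofReal (H (s x.1) * kern l x.2) =
      (fun a => ofReal (H (s a))) x.1 * (fun τ => ofReal (kern l τ)) x.2 :=
    ofReal_mul (hH0 _)
  rw [lintegral_congr hsplit, hμ, lintegral_prod_mul hsa hkm.aemeasurable, lintegral_kern hlpos]
  have hGJ : ∫⁻ a in ball (0 : Hyp n) r, ofReal (H (s a)) ≤ ofReal (((1 + t) * L) ^ 2) *
        ∫⁻ y in Z, ofReal (G y * nsq T v y) ∂(μH[(2 * n - 2 : ℝ)]) := by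
    calc ∫⁻ a in ball (0 : Hyp n) r, ofReal (H (s a)) ≤ ∫⁻ a in ball (0 : Hyp n) r, ofReal (((1 + t) * L) ^ 2) *
            ofReal (G (s a) * nsq T v (s a)) := by
          refine setLIntegral_mono' measurableSet_ball fun a ha => ?_
          rw [← ofReal_mul (by positivity)]
          refine ofReal_le_ofReal ?_
          have h1 : ‖dT (s a)‖ ≤ (1 + t) * L := by
            have h2 := hδ' _ (hsb a ha)
            rw [dist_eq_norm] at h2
            have h3 := norm_sub_norm_le (dT (s a)) (dT w)
            linarith
          have h0 : dT (s a) ≠ 0 := hF.dne _ (hc.zero _ (hja a ha))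
          have h4 : ‖dT (s a) v‖ ^ 2 = ‖dT (s a)‖ ^ 2 * nsq T v (s a) := by
            have := norm_ne_zero_iff.2 h0
            rw [nsq]
            field_simp
          have h5 := hG0 (s a)
          have h6 := nsq_nonneg T v (s a)
          simp only [hH]
          rw [h4]
          calc G (s a) * (‖dT (s a)‖ ^ 2 * nsq T v (s a)) =
              ‖dT (s a)‖ ^ 2 * (G (s a) * nsq T v (s a)) := by ring
            _ ≤ _ := by gcongr
      _ = ofReal (((1 + t) * L) ^ 2) * ∫⁻ a in ball (0 : Hyp n) r, ofReal (G (s a) * nsq T v (s a)) :=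
          lintegral_const_mul' _ _ ofReal_ne_top
      _ ≤ _ := by
          refine mul_le_mul' le_rfl ((hc.lintegral_le r hrρ _ hmeasGJ).trans ?_)
          exact lintegral_mono_set inter_subset_left
  rw [lintegral_surf]
  set I := ∫⁻ y in Z, ofReal (G y * nsq T v y) ∂(μH[(2 * n - 2 : ℝ)])
  have hconst : (2 ^ n : ℝ≥0∞) * (ofReal (((1 + t) * L) ^ 2) * ofReal (Real.pi / (2 * l ^ 2))) ≤
      ofReal (1 + η) * ofReal Real.pi * 2 ^ (n - 1) := by
    have e2 : (2 ^ n : ℝ≥0∞) = 2 ^ (n - 1) * ofReal 2 := by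
      rw [ENNReal.ofReal_ofNat, ← pow_succ, Nat.sub_add_cancel hn]
    rw [e2, mul_assoc, mul_comm _ (2 ^ (n - 1)), ← ofReal_mul (by positivity),
      ← ofReal_mul (by positivity), ← ofReal_mul (by positivity)]
    refine mul_le_mul' le_rfl (ofReal_le_ofReal ?_)
    have h1t : 0 < 1 - t := by linarith
    have : 2 * (((1 + t) * L) ^ 2 * (Real.pi / (2 * l ^ 2))) = (1 + t) ^ 2 / (1 - t) ^ 2 * Real.pi := by
      rw [hl]; field_simp
    rw [this]
    gcongr
    rwa [div_le_iff₀ (by positivity)]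
  calc c * ((∫⁻ a in ball (0 : Hyp n) r, ofReal (H (s a))) * ofReal (Real.pi / (2 * l ^ 2)))
      ≤ (2 ^ n * ((n - 1).factorial : ℝ≥0∞)) *
          ((ofReal (((1 + t) * L) ^ 2) * I) * ofReal (Real.pi / (2 * l ^ 2))) := by
        gcongr
        exact hc.le
    _ = (2 ^ n * (ofReal (((1 + t) * L) ^ 2) * ofReal (Real.pi / (2 * l ^ 2)))) *
          (((n - 1).factorial : ℝ≥0∞) * I) := by ring
    _ ≤ (ofReal (1 + η) * ofReal Real.pi * 2 ^ (n - 1)) * (((n - 1).factorial : ℝ≥0∞) * I) := by gcongr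
    _ = _ := by ring

lemma limsup_add_le_ennreal (u v : ℕ → ℝ≥0∞) :
    limsup (fun k => u k + v k) atTop ≤ limsup u atTop + limsup v atTop := by
  by_cases h : limsup u atTop + limsup v atTop = ⊤
  · rw [h]; exact le_top
  obtain ⟨hu, hv⟩ := ENNReal.add_ne_top.1 h
  refine ENNReal.le_of_forall_pos_le_add fun ε hε _ => ?_
  have h2 : ((ε / 2 : ℝ≥0) : ℝ≥0∞) ≠ 0 := by positivity
  have hu' := eventually_lt_of_limsup_lt (ENNReal.lt_add_right hu h2)
  refine limsup_le_of_le (h := ?_)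
  filter_upwards [hu', (eventually_lt_of_limsup_lt (ENNReal.lt_add_right hv h2))] with k h3 h4
  refine (add_le_add h3.le h4.le).trans (le_of_eq ?_)
  have : (ε : ℝ≥0∞) = ((ε / 2 : ℝ≥0) : ℝ≥0∞) + ((ε / 2 : ℝ≥0) : ℝ≥0∞) := by rw [← ENNReal.coe_add, add_halves]
  rw [this]; ring

lemma limsup_sum_le_ennreal {ι : Type*} (s : Finset ι) (u : ι → ℕ → ℝ≥0∞) :
    limsup (fun k => ∑ i ∈ s, u i k) atTop ≤ ∑ i ∈ s, limsup (u i) atTop := by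
  classical
  induction s using induction_on with
  | empty => simp
  | insert a s ha ih =>
    simp [sum_insert ha]
    exact (limsup_add_le_ennreal _ _).trans (add_le_add le_rfl ih)

lemma continuous_levi_lg (hT : Entire T) {ε : ℝ} (hε : ε ≠ 0) (v : Γ) :
    Continuous fun x => levi (lg T ε) x v := by
  have : (fun x => levi (lg T ε) x v) = fun x => ε ^ 2 * ‖dT x v‖ ^ 2 / (2 * (‖T x‖ ^ 2 + ε ^ 2) ^ 2) :=
    funext fun x => levi_lg hT hε x v
  rw [this]
  refine (continuous_const.mul (((continuous_fderiv_entire hT).clm_apply continuous_const).norm.pow 2)).div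
    (continuous_const.mul (((hT.continuous.norm.pow 2).add continuous_const).pow 2)) fun x => ?_
  positivity

lemma levi_lg_le (hT : Entire T) {ε : ℝ} (hε : ε ≠ 0) {m : ℝ} (hm : 0 < m)
    {x : Γ} (hx : m ≤ ‖T x‖) (v : Γ) :
    levi (lg T ε) x v ≤ ε ^ 2 * (‖dT x v‖ ^ 2 / (2 * m ^ 4)) := by
  rw [levi_lg hT hε, ← mul_div_assoc]
  gcongr
  calc m ^ 4 = (m ^ 2 + 0) ^ 2 := by ring
    _ ≤ _ := by gcongr; positivity

lemma limsup_away_le (hT : Entire T) {w : Γ} (hw : T w ≠ 0) :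
    ∃ r > 0, ∀ G : Γ → ℝ, Continuous G → (∀ x, 0 ≤ G x) → (∀ x, G x ≠ 0 → x ∈ ball w r) →
      ∀ v, ∀ ε : ℕ → ℝ, (∀ k, 0 < ε k) → Tendsto ε atTop (𝓝 0) →
      limsup (fun k => ∫⁻ x, ofReal (G x * levi (lg T (ε k)) x v) ∂Λ) atTop = 0 := by
  have hTw := norm_pos_iff.2 hw
  obtain ⟨r, hr, hr'⟩ := Metric.continuous_iff.1 hT.continuous w (‖T w‖ / 2) (by positivity)
  refine ⟨r, hr, fun G hG hG0 hGs v ε hε hlim => ?_⟩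
  set H := fun x => G x * (‖dT x v‖ ^ 2 / (2 * (‖T w‖ / 2) ^ 4)) with hH
  have hHc : Continuous H := hG.mul
    ((((continuous_fderiv_entire hT).clm_apply continuous_const).norm.pow 2).div_const _)
  have hHs : HasCompactSupport H := by
    refine HasCompactSupport.intro (isCompact_closedBall w r) fun x hx => ?_
    have : G x = 0 := by
      by_contra h
      exact hx (ball_subset_closedBall (hGs x h))
    simp [hH, this]
  have hHi : Integrable H Λ := hHc.integrable_of_hasCompactSupport hHs
  have hK := (hHi.lintegral_lt_top).ne
  have hle k : ∫⁻ x, ofReal (G x * levi (lg T (ε k)) x v) ∂Λ ≤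
      ofReal (ε k ^ 2) * ∫⁻ x, ofReal (H x) ∂Λ := by
    rw [← lintegral_const_mul' _ _ ofReal_ne_top]
    refine lintegral_mono fun x => ?_
    rw [← ofReal_mul (by positivity)]
    refine ofReal_le_ofReal ?_
    by_cases hx : G x = 0
    · simp [hH, hx]
    have h1 : ‖T w‖ / 2 ≤ ‖T x‖ := by
      have h2 := hr' x (hGs x hx)
      rw [dist_eq_norm] at h2
      have h3 := norm_sub_norm_le (T w) (T x)
      rw [norm_sub_rev] at h3
      linarith
    calc G x * levi (lg T (ε k)) x v ≤ G x * (ε k ^ 2 * (‖dT x v‖ ^ 2 / (2 * (‖T w‖ / 2) ^ 4))) :=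
          mul_le_mul_of_nonneg_left (levi_lg_le hT (hε k).ne' (by positivity) h1 v) (hG0 x)
      _ = _ := by simp [hH]; ring
  have hz : Tendsto (fun k => ofReal (ε k ^ 2) * ∫⁻ x, ofReal (H x) ∂Λ) atTop (𝓝 0) := by
    have h1 : Tendsto (fun k => ofReal (ε k ^ 2)) atTop (𝓝 0) := by simpa using tendsto_ofReal (hlim.pow 2)
    simpa using ENNReal.Tendsto.mul_const h1 (Or.inr hK)
  exact le_antisymm ((limsup_le_limsup (Eventually.of_forall hle)).trans hz.limsup_eq.le) zero_le

/-- One half of the Lelong–Poincaré formula. -/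
lemma FlatZero.limsup_le (hn : 1 ≤ n) (hF : FlatZero T ε₀)
    {G : Γ → ℝ} (hG : Continuous G) (hGs : HasCompactSupport G) (hG0 : ∀ x, 0 ≤ G x) (v : Γ)
    {ε : ℕ → ℝ} (hε : ∀ k, 0 < ε k) (hlim : Tendsto ε atTop (𝓝 0)) :
    limsup (fun k => ∫⁻ x, ofReal (G x * levi (lg T (ε k)) x v) ∂Λ) atTop ≤
      ofReal Real.pi * ∫⁻ x, ofReal (G x * nsq T v x) ∂(surf n Z) := by
  set Y := ofReal Real.pi * ∫⁻ x, ofReal (G x * nsq T v x) ∂(surf n Z) with hY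
  suffices h : ∀ η > 0, limsup (fun k => ∫⁻ x, ofReal (G x * levi (lg T (ε k)) x v) ∂Λ) atTop ≤
      ofReal (1 + η) * Y by
    have h1 : Tendsto (fun k => ofReal (1 + ε k) * Y) atTop (𝓝 (1 * Y)) := by
      refine ENNReal.Tendsto.mul_const ?_ (Or.inl one_ne_zero)
      simpa using tendsto_ofReal (hlim.const_add 1)
    rw [one_mul] at h1
    exact ge_of_tendsto' h1 fun k => h _ (hε k)
  intro η hη
  have hloc w : ∃ r > 0, ∀ G, Continuous G → (∀ x, 0 ≤ G x) → (∀ x, G x ≠ 0 → x ∈ ball w r) →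
      limsup (fun k => ∫⁻ x, ofReal (G x * levi (lg T (ε k)) x v) ∂Λ) atTop ≤ ofReal (1 + η) * (ofReal Real.pi *
          ∫⁻ x, ofReal (G x * nsq T v x) ∂(surf n Z)) := by
    by_cases hw : T w = 0
    · obtain ⟨r, hr, h⟩ := hF.limsup_local_le hn hw hη
      exact ⟨r, hr, fun G h1 h2 h3 => h G h1 h2 h3 v ε hε hlim⟩
    · obtain ⟨r, hr, h⟩ := limsup_away_le hF.diff hw
      exact ⟨r, hr, fun G h1 h2 h3 => (h G h1 h2 h3 v ε hε hlim).le.trans zero_le⟩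
  choose r hr hloc using hloc
  obtain ⟨t, -, ht⟩ := hGs.isCompact.elim_nhds_subcover (fun w => ball w (r w)) fun w _ => ball_mem_nhds w (hr w)
  set e := t.equivFin.symm
  obtain ⟨f, hf1, hf2, hf3, -⟩ := exists_continuous_sum_one_of_isOpen_isCompact
    (s := fun i => ball (e i : Γ) (r (e i))) (fun i => isOpen_ball) hGs.isCompact (by
      intro x hx
      obtain ⟨w, hw, hxw⟩ := mem_iUnion₂.1 (ht hx)
      exact mem_iUnion.2 ⟨e.symm ⟨w, hw⟩, by simpa using hxw⟩)
  have hsum x : G x = ∑ i, f i x * G x := by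
    by_cases hx : x ∈ tsupport G
    · have := hf2 hx
      rw [Finset.sum_apply] at this
      rw [← sum_mul, this, Pi.one_apply, one_mul]
    · rw [image_eq_zero_of_notMem_tsupport hx]; simp
  have hf0 i x : 0 ≤ f i x * G x := mul_nonneg (hf3 i x).1 (hG0 x)
  have hfc i : Continuous fun x => f i x * G x := (f i).continuous.mul hG
  have hi i : limsup (fun k => ∫⁻ x, ofReal ((f i x * G x) * levi (lg T (ε k)) x v) ∂Λ) atTop ≤
        ofReal (1 + η) * (ofReal Real.pi * ∫⁻ x, ofReal ((f i x * G x) * nsq T v x) ∂(surf n Z)) :=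
    hloc (e i) _ (hfc i) (hf0 i) fun x hx => hf1 i (subset_tsupport _ (left_ne_zero_of_mul hx))
  have hdecomp (g : Γ → ℝ) (hg : (∀ x, 0 ≤ g x)) x : ofReal (G x * g x) = ∑ i, ofReal ((f i x * G x) * g x) := by
    rw [← ENNReal.ofReal_sum_of_nonneg fun i _ => mul_nonneg (hf0 i x) (hg x), ← sum_mul, ← hsum]
  calc limsup (fun k => ∫⁻ x, ofReal (G x * levi (lg T (ε k)) x v) ∂Λ) atTop
      = limsup (fun k => ∑ i, ∫⁻ x, ofReal ((f i x * G x) * levi (lg T (ε k)) x v) ∂Λ) atTop := by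
        congr 1
        ext k
        rw [lintegral_congr (hdecomp _ fun x => levi_lg_nonneg hF.diff (hε k).ne' x v), lintegral_finsetSum]
        exact fun i _ => ((hfc i).mul (continuous_levi_lg hF.diff (hε k).ne' v)).measurable.ennreal_ofReal
    _ ≤ ∑ i, limsup (fun k => ∫⁻ x, ofReal ((f i x * G x) * levi (lg T (ε k)) x v) ∂Λ) atTop :=
        limsup_sum_le_ennreal _ _
    _ ≤ ∑ i, ofReal (1 + η) * (ofReal Real.pi * ∫⁻ x, ofReal ((f i x * G x) * nsq T v x) ∂(surf n Z)) :=
        sum_le_sum fun i _ => hi i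
    _ = ofReal (1 + η) * Y := by
        rw [hY, lintegral_congr (hdecomp _ (nsq_nonneg T v)), lintegral_finsetSum, mul_sum, mul_sum]
        exact fun i _ => ((hfc i).measurable.mul (measurable_nsq hF.diff v)).ennreal_ofReal

lemma hasFDerivAt_integral_translate {E : Type*} [NormedAddCommGroup E] [NormedSpace ℝ E]
    {g : Γ → ℝ} (hg : Integrable g Λ) {R : ℝ} (hgs : ∀ y, R < ‖y‖ → g y = 0) {F : Γ → E}
    (hF : ContDiff ℝ 1 F) (z : Γ) :
    HasFDerivAt (fun z => ∫ y, g y • F (z + y) ∂Λ) (∫ y, g y • ∇ F (z + y) ∂Λ) z := by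
  have hd : Differentiable ℝ F := hF.differentiable (by simp)
  have hc : Continuous (∇ F) := hF.continuous_fderiv (by simp)
  obtain ⟨M, hM⟩ := (isCompact_closedBall z (R + 1)).exists_bound_of_continuousOn hc.continuousOn
  obtain ⟨M', hM'⟩ := (isCompact_closedBall z (R + 1)).exists_bound_of_continuousOn hF.continuous.continuousOn
  have hmem x (hx : x ∈ ball z 1) y (hy : ¬ R < ‖y‖) : x + y ∈ closedBall z (R + 1) := by
    rw [mem_ball, dist_eq_norm] at hx
    rw [mem_closedBall, dist_eq_norm, show x + y - z = (x - z) + y by abel]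
    linarith [norm_add_le (x - z) y]
  refine hasFDerivAt_integral_of_dominated_of_fderiv_le (𝕜 := ℝ)
    (F := fun z y => g y • F (z + y)) (F' := fun z y => g y • ∇ F (z + y)) (bound := fun y => ‖g y‖ * M)
    (ball_mem_nhds z one_pos) ?_ ?_ ?_ ?_ (hg.norm.mul_const M) ?_
  · exact Eventually.of_forall fun x => hg.aestronglyMeasurable.smul
      (hF.continuous.comp (by fun_prop)).aestronglyMeasurable
  · refine Integrable.mono' (hg.norm.mul_const M') (hg.aestronglyMeasurable.smul
      (hF.continuous.comp (by fun_prop)).aestronglyMeasurable) (ae_of_all _ fun y => ?_)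
    rw [norm_smul]
    by_cases hy : R < ‖y‖
    · simp [hgs y hy]
    · exact mul_le_mul_of_nonneg_left (hM' _ (hmem z (mem_ball_self one_pos) y hy)) (norm_nonneg _)
  · exact hg.aestronglyMeasurable.smul (hc.comp (by fun_prop)).aestronglyMeasurable
  · refine ae_of_all _ fun y x hx => ?_
    rw [norm_smul]
    by_cases hy : R < ‖y‖
    · simp [hgs y hy]
    · exact mul_le_mul_of_nonneg_left (hM _ (hmem x hx y hy)) (norm_nonneg _)
  · refine ae_of_all _ fun y x hx => ?_
    have h1 : HasFDerivAt (fun x => F (x + y)) (∇ F (x + y)) x := by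
      have h2 : HasFDerivAt (fun x => x + y) (ContinuousLinearMap.id ℝ Γ) x :=
        (hasFDerivAt_id x).add_const y
      exact (hd (x + y)).hasFDerivAt.comp x h2
    exact h1.const_smul (g y)

lemma integrable_translate {E : Type*} [NormedAddCommGroup E] [NormedSpace ℝ E]
    {g : Γ → ℝ} (hg : Integrable g Λ) {R : ℝ} (hgs : ∀ y, R < ‖y‖ → g y = 0) {F : Γ → E}
    (hF : Continuous F) (z : Γ) [SecondCountableTopologyEither Γ E] :
    Integrable (fun y => g y • F (z + y)) Λ := by
  obtain ⟨M', hM'⟩ := (isCompact_closedBall z R).exists_bound_of_continuousOn hF.continuousOn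
  refine Integrable.mono' (hg.norm.mul_const M') (hg.aestronglyMeasurable.smul
      (hF.comp (by fun_prop)).aestronglyMeasurable) (ae_of_all _ fun y => ?_)
  rw [norm_smul]
  by_cases hy : R < ‖y‖
  · simp [hgs y hy]
  · refine mul_le_mul_of_nonneg_left (hM' _ ?_) (norm_nonneg _)
    simp_all

lemma levi_integral_translate {g : Γ → ℝ} (hg : Integrable g Λ) {R : ℝ}
    (hgs : ∀ y, R < ‖y‖ → g y = 0) (hφ : C² φ) (z v : Γ) :
    levi (fun z => ∫ y, g y * φ (z + y) ∂Λ) z v = ∫ y, g y * levi φ (z + y) v ∂Λ := by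
  have hφ1 : ContDiff ℝ 1 (∇ φ) := hφ.fderiv_right (by norm_num)
  have h1 : ∇ (fun z => ∫ y, g y * φ (z + y) ∂Λ) = fun z => ∫ y, g y • ∇ φ (z + y) ∂Λ :=
    funext fun z => (hasFDerivAt_integral_translate hg hgs (hφ.of_le (by norm_num)) z).fderiv
  have hI := integrable_translate (E := Γ →L[ℝ] Γ →L[ℝ] ℝ) hg hgs (hφ1.continuous_fderiv (by simp)) z
  have hs u : hess (fun z => ∫ y, g y * φ (z + y) ∂Λ) z u u = ∫ y, g y * hess φ (z + y) u u ∂Λ := by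
    rw [hess, h1, (hasFDerivAt_integral_translate hg hgs hφ1 z).fderiv, integral_apply hI,
      integral_apply (hI.apply_continuousLinearMap u)]
    rfl
  have hJ u : Integrable (fun y => g y * hess φ (z + y) u u) Λ :=
    (hI.apply_continuousLinearMap u).apply_continuousLinearMap u
  simp [levi]
  rw [hs, hs, ← integral_add (hJ _) (hJ _), ← integral_div]
  congr 1; ext y; ring

lemma levi_mconv (hφ : C² φ) (hr : 0 < r) (z v : Γ) :
    levi (mconv r φ) z v = ∫ y, moll r y * levi φ (z + y) v ∂Λ := by
  rw [← levi_integral_translate (integrable_moll hr) (R := 2 * r) (fun y hy => moll_eq_zero hr hy.le) hφ]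
  congr 1
  exact funext fun x => mconv_eq_add r φ x

lemma levi_avgBall (hφ : C² φ) (r : ℝ) (z v : Γ) :
    levi (avgBall φ r) z v = (Λ (ball z r)).toReal⁻¹ * ∫ x in ball z r, levi φ x v ∂Λ := by
  have hsub : ∀ (h : Γ → ℝ) z, (Λ (ball z r)).toReal⁻¹ * ∫ x in ball z r, h x ∂Λ =
      ∫ y, (ball 0 r).indicator (fun _ => (Λ (ball 0 r)).toReal⁻¹) y * h (z + y) ∂Λ := by
    intro h z
    rw [Measure.addHaar_ball_center, ← integral_const_mul, ← integral_indicator measurableSet_ball,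
      ← integral_add_left_eq_self _ z]
    congr 1
    ext y
    by_cases hy : y ∈ ball 0 r
    · rw [indicator_of_mem hy, indicator_of_mem]
      simp_all
    · rw [indicator_of_notMem hy, indicator_of_notMem, zero_mul]
      simp_all
  have hg : Integrable ((ball 0 r).indicator fun _ => (Λ (ball 0 r)).toReal⁻¹) Λ :=
    (integrable_indicator_iff measurableSet_ball).2 (integrableOn_const measure_ball_lt_top.ne)
  rw [hsub, ← levi_integral_translate hg (R := r) (fun y hy => indicator_of_notMem (by
    rw [mem_ball_zero_iff]; exact not_lt.2 hy.le) _) hφ]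
  congr 1
  exact funext fun x => hsub φ x

lemma superlevel_moll (n : ℕ) (hr : 0 < r) (z : En n) {t : ℝ} (ht : 0 ≤ t) :
    {x : En n | t < moll r (z - x)} = ∅ ∨ ∃ s ≥ r, {x : En n | t < moll r (z - x)} = ball z s := by
  set h := fun s => smoothTransition (2 - s ^ 2 / r ^ 2) / radMass n r with hh
  have hm := radMass_pos (n := n) hr
  have hmoll x : moll r (z - x) = h ‖x - z‖ := by rw [← norm_sub_rev]; rfl
  have hcont : Continuous h := (smoothTransition.continuous.comp (by fun_prop)).div_const _
  have hanti a b (ha : 0 ≤ a) (hab : a ≤ b) : h b ≤ h a := by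
    refine div_le_div_of_nonneg_right (smoothTransition.monotone ?_) hm.le
    gcongr
  have hconst a (ha : 0 ≤ a) (har : a ≤ r) : h a = h r := by
    have e b (hb : 0 ≤ b) (hbr : b ≤ r) : smoothTransition (2 - b ^ 2 / r ^ 2) = 1 := by
      refine smoothTransition.one_of_one_le ?_
      have : b ^ 2 / r ^ 2 ≤ 1 := by rw [div_le_one (by positivity)]; gcongr
      linarith
    simp [hh]
    rw [e a ha har, e r hr.le le_rfl]
  simp only [hmoll]
  by_cases htr : t < h r
  · right
    set A := {s | 0 ≤ s ∧ t < h s}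
    have hrA : r ∈ A := ⟨hr.le, htr⟩
    have hbdd : BddAbove A := by
      refine ⟨2 * r, fun s hs => ?_⟩
      by_contra hlt
      rw [not_le] at hlt
      have : h s = 0 := by
        simp only [hh]
        rw [smoothTransition.zero_of_nonpos, zero_div]
        have : 2 ≤ s ^ 2 / r ^ 2 := by
          rw [le_div_iff₀ (by positivity)]
          nlinarith
        linarith
      linarith [hs.2]
    refine ⟨sSup A, le_csSup hbdd hrA, ?_⟩
    ext x
    simp [mem_ball, dist_eq_norm]
    constructor
    · intro hx
      obtain ⟨s, hs1, hs2⟩ := (((hcont.continuousAt.eventually (lt_mem_nhds hx)).filter_mono nhdsWithin_le_nhds).and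
        (self_mem_nhdsWithin (s := Ioi ‖x - z‖))).exists
      exact lt_of_lt_of_le hs2 (le_csSup hbdd ⟨(norm_nonneg _).trans (le_of_lt hs2), hs1⟩)
    · intro hx
      obtain ⟨s, hs, hxs⟩ := exists_lt_of_lt_csSup ⟨r, hrA⟩ hx
      exact hs.2.trans_le (hanti _ _ (norm_nonneg _) hxs.le)
  · left
    ext x
    simp
    rw [not_lt] at htr
    rcases le_total ‖x - z‖ r with h1 | h1
    · rw [hconst _ (norm_nonneg _) h1]; exact htr
    · exact (hanti _ _ hr.le h1).trans htr

lemma lintegral_moll_mono {μ ν : Measure Γ} (hr : 0 < r) (z : Γ) (h : ∀ s ≥ r, μ (ball z s) ≤ ν (ball z s)) :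
    ∫⁻ x, ofReal (moll r (z - x)) ∂μ ≤ ∫⁻ x, ofReal (moll r (z - x)) ∂ν := by
  have hm : Measurable fun x => moll r (z - x) :=
    ((continuous_moll r).comp (continuous_const.sub continuous_id)).measurable
  rw [lintegral_eq_lintegral_meas_lt μ (ae_of_all _ fun x => moll_nonneg hr _) hm.aemeasurable,
    lintegral_eq_lintegral_meas_lt ν (ae_of_all _ fun x => moll_nonneg hr _) hm.aemeasurable]
  refine setLIntegral_mono' measurableSet_Ioi fun t ht => ?_
  rcases superlevel_moll n hr z (le_of_lt ht) with h1 | ⟨s, hs, h1⟩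
  · rw [h1]; simp
  · rw [h1]; exact h s hs

lemma continuous_levi (hφ : C² φ) (v : Γ) : Continuous fun x => levi φ x v := by
  unfold levi hess
  fun_prop

lemma FlatZero.surf_closedBall_lt_top (hn : 1 ≤ n) (hF : FlatZero T ε₀) (z : Γ) (s : ℝ) :
    surf n Z (closedBall z s) < ⊤ := by
  have := hF.isLocallyFinite hn
  rw [surf]
  exact mul_lt_top (mul_lt_top (ENNReal.pow_lt_top (by simp)) (ENNReal.natCast_lt_top _))
    (isCompact_closedBall z s).measure_lt_top

/-- The averaged density condition, with balls replaced by the mollifier. -/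
lemma FlatZero.density_moll (hn : 1 ≤ n) (hF : FlatZero T ε₀)     (hφ : C² φ) (h0 : ∀ z v, 0 ≤ levi φ z v) {κ r₀ : ℝ} (hκ : 0 ≤ κ)
    (hdens : ∀ r ≥ r₀, ∀ z v, Upsilon T Z r z v ≤ κ * levi (avgBall φ r) z v) (hr : 0 < r)
    (hrr : r₀ ≤ r) (z v : Γ) :
    ofReal Real.pi * ∫⁻ x, ofReal (moll r (z - x) * nsq T v x) ∂(surf n Z) ≤
      ∫⁻ x, ofReal (moll r (z - x) * (κ * levi φ x v)) ∂Λ := by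
  have hm : Measurable fun x => ofReal (moll r (z - x)) :=
    ((continuous_moll r).comp (continuous_const.sub continuous_id)).measurable.ennreal_ofReal
  have hnm := (measurable_nsq hF.diff v).ennreal_ofReal
  have hlc : Continuous fun x => κ * levi φ x v := continuous_const.mul (continuous_levi hφ v)
  have hlm := hlc.measurable.ennreal_ofReal
  have hl0 x : 0 ≤ κ * levi φ x v := mul_nonneg hκ (h0 x v)
  set μ := (ofReal Real.pi) • (surf n Z).withDensity (fun x => ofReal (nsq T v x))
  set ν := (Λ).withDensity fun x => ofReal (κ * levi φ x v)
  have key := lintegral_moll_mono (μ := μ) (ν := ν) hr z fun s hs => by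
    have hspos := hr.trans_le hs
    have h1 := hdens s (hrr.trans hs) z v
    rw [Measure.smul_apply, withDensity_apply _ measurableSet_ball, withDensity_apply _ measurableSet_ball,
      smul_eq_mul]
    have hV : 0 < (Λ (ball z s)).toReal :=
      ENNReal.toReal_pos (measure_ball_pos _ _ hspos).ne' measure_ball_lt_top.ne
    have hi : IntegrableOn (nsq T v) (ball z s) (surf n Z) := by
      refine Measure.integrableOn_of_bounded (M := ‖v‖ ^ 2)
        ((measure_mono ball_subset_closedBall).trans_lt (hF.surf_closedBall_lt_top hn z s)).ne
        (measurable_nsq hF.diff v).aestronglyMeasurable (ae_of_all _ fun x => ?_)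
      rw [norm_of_nonneg (nsq_nonneg T v x)]
      exact nsq_le T v x
    have hi2 : IntegrableOn (fun x => κ * levi φ x v) (ball z s) Λ :=
      (hlc.continuousOn.integrableOn_compact (isCompact_closedBall z s)).mono_set ball_subset_closedBall
    rw [← ofReal_integral_eq_lintegral_ofReal hi (ae_of_all _ (nsq_nonneg T v)),
      ← ofReal_integral_eq_lintegral_ofReal hi2 (ae_of_all _ hl0), ← ofReal_mul Real.pi_pos.le]
    refine ofReal_le_ofReal ?_
    rw [levi_avgBall hφ] at h1
    rw [integral_const_mul]
    have h2 := h1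
    have h3 := mul_le_mul_of_nonneg_right h2 hV.le
    calc _ = Real.pi / (Λ (ball z s)).toReal * (∫ x in ball z s, nsq T v x ∂(surf n Z)) *
          (Λ (ball z s)).toReal := by field_simp
      _ ≤ _ := h3
      _ = _ := by field_simp
  rw [lintegral_smul_measure, lintegral_withDensity_eq_lintegral_mul _ hnm hm,
    lintegral_withDensity_eq_lintegral_mul _ hlm hm, smul_eq_mul] at key
  convert key using 2
  · refine lintegral_congr fun x => ?_
    rw [Pi.mul_apply, ← ofReal_mul (nsq_nonneg T v x), mul_comm]
  · funext x
    rw [Pi.mul_apply, ← ofReal_mul (hl0 x), mul_comm]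

lemma FlatZero.limsup_moll_le (hn : 1 ≤ n) (hF : FlatZero T ε₀)     (hφ : C² φ) (h0 : ∀ z v, 0 ≤ levi φ z v) {κ r₀ : ℝ} (hκ : 0 ≤ κ)
    (hdens : ∀ r ≥ r₀, ∀ z v, Upsilon T Z r z v ≤ κ * levi (avgBall φ r) z v) (hr : 0 < r)
    (hrr : r₀ ≤ r) {ε : ℕ → ℝ} (hε : ∀ k, 0 < ε k) (hlim : Tendsto ε atTop (𝓝 0)) (z v : Γ) {a : ℝ}
    (ha : κ * levi (mconv r φ) z v < a) :
    ∀ᶠ k in atTop, levi (mconv r (lg T (ε k))) z v < a := by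
  have hmc : Continuous fun x => moll r (z - x) := (continuous_moll r).comp (continuous_const.sub continuous_id)
  have hms :=
    (hasCompactSupport_moll hr).comp_homeomorph (Homeomorph.subLeft z)
  have hrepr h (hh : C² h) (hpos : (∀ z v, 0 ≤ levi h z v)) c (hc : 0 ≤ c) : ∫⁻ x, ofReal (moll r (z - x) * (c * levi h x v)) ∂Λ = ofReal (c * levi (mconv r h) z v) := by
    have hi : Integrable (fun x => moll r (z - x) * (c * levi h x v)) Λ :=
      (hmc.mul (continuous_const.mul (continuous_levi hh v))).integrable_of_hasCompactSupport hms.mul_right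
    rw [← ofReal_integral_eq_lintegral_ofReal hi
      (ae_of_all _ fun x => mul_nonneg (moll_nonneg hr _) (mul_nonneg hc (hpos x v))),
      levi_mconv hh hr, ← integral_const_mul, ← integral_add_left_eq_self _ z]
    congr 2
    ext x
    rw [moll_congr r (x := z - (z + x)) (y := x) (by rw [sub_add_cancel_left, norm_neg])]
    ring
  have h1 := (hF.limsup_le hn hmc hms (fun x => moll_nonneg hr _) v hε hlim).trans
    (hF.density_moll hn hφ h0 hκ hdens hr hrr z v)
  rw [hrepr φ hφ h0 κ hκ] at h1
  have hpos : 0 ≤ κ * levi (mconv r φ) z v := by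
    rw [levi_mconv hφ hr]
    exact mul_nonneg hκ (integral_nonneg fun y => mul_nonneg (moll_nonneg hr _) (h0 _ _))
  have h2 := eventually_lt_of_limsup_lt (h1.trans_lt ((ENNReal.ofReal_lt_ofReal_iff (hpos.trans_lt ha)).2 ha))
  filter_upwards [h2] with k hk
  have hk' := hrepr (lg T (ε k)) ((contDiff_lg hF.diff (hε k).ne').of_le (by norm_cast)) (fun z v =>
    levi_lg_nonneg hF.diff (hε k).ne' z v) 1 zero_le_one
  simp at hk'
  rw [hk'] at hk
  exact (ENNReal.ofReal_lt_ofReal_iff (hpos.trans_lt ha)).1 hk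

lemma hess_mconv (hr : 0 < r) {f : Γ → ℝ} (hf : LocallyIntegrable f Λ) (z u v : Γ) :
    hess (mconv r f) z u v = ∫ y, ∇ (fun x => ∇ (moll r) x v) (z - y) u • f y ∂Λ := by
  have hk : ContDiff ℝ 1 fun x => ∇ (moll r) x v :=
    ((contDiff_moll (n := n) r).fderiv_right (m := 1) (by norm_cast)).clm_apply contDiff_const
  have hks :=
    (hasCompactSupport_moll hr).fderiv_apply (𝕜 := ℝ) v
  have hd :=
    ((contDiff_mconv hr hf).fderiv_right (m := 1) (by norm_cast)).differentiable (by simp) z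
  have h1 : hess (mconv r f) z u v = ∇ (fun x => ∇ (mconv r f) x v) z u := by
    rw [fderiv_clm_apply hd (differentiableAt_const v)]
    simp [hess]
  have h2 : (fun x => ∇ (mconv r f) x v) =
      MeasureTheory.convolution (fun x => ∇ (moll r) x v) f (lsmul ℝ ℝ) Λ := by
    funext x
    rw [fderiv_mconv hr hf, convolution_lsmul_swap]
  rw [h1, h2, (hks.hasFDerivAt_convolution_left (lsmul ℝ ℝ) hk hf z).fderiv, convolution_eq_swap, integral_apply]
  · rfl
  · have := ((hks.fderiv ℝ).convolutionExists_left
      ((lsmul ℝ ℝ).precompL Γ) (hk.continuous_fderiv (by simp)) hf) z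
    exact this.integrable_swap

lemma tendsto_integral_translate {k : Γ → ℝ} (hk : Continuous k) (hks : HasCompactSupport k) {f : ℕ → Γ → ℝ}
    {g b : Γ → ℝ} (hf : ∀ i, LocallyIntegrable (f i) Λ) (hb : LocallyIntegrable b Λ)
    (hfb : ∀ i, ∀ᵐ x ∂Λ, |f i x| ≤ b x) (hlim : ∀ᵐ x ∂Λ, Tendsto (fun i => f i x) atTop (𝓝 (g x)))
    (z : Γ) :
    Tendsto (fun i => ∫ y, k (z - y) • f i y ∂Λ) atTop (𝓝 (∫ y, k (z - y) • g y ∂Λ)) := by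
  have hkz : Continuous fun y => k (z - y) := hk.comp (continuous_const.sub continuous_id)
  have hkzs := hks.comp_homeomorph (Homeomorph.subLeft z)
  refine tendsto_integral_of_dominated_convergence (fun y => |k (z - y)| • b y) (fun i => ?_) ?_ (fun i => ?_) ?_
  · exact ((hf i).integrable_smul_left_of_hasCompactSupport hkz hkzs).aestronglyMeasurable
  · exact hb.integrable_smul_left_of_hasCompactSupport hkz.abs (hkzs.comp_left abs_zero)
  · filter_upwards [hfb i] with x hx
    rw [norm_smul]
    exact mul_le_mul_of_nonneg_left hx (abs_nonneg _)
  · filter_upwards [hlim] with x hx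
    exact hx.const_smul _

lemma tendsto_levi_mconv (hr : 0 < r) {f : ℕ → Γ → ℝ} {g b : Γ → ℝ}
    (hf : ∀ i, LocallyIntegrable (f i) Λ) (hg : LocallyIntegrable g Λ) (hb : LocallyIntegrable b Λ)
    (hfb : ∀ i, ∀ᵐ x ∂Λ, |f i x| ≤ b x) (hlim : ∀ᵐ x ∂Λ, Tendsto (fun i => f i x) atTop (𝓝 (g x)))
    (z v : Γ) :
    Tendsto (fun i => levi (mconv r (f i)) z v) atTop (𝓝 (levi (mconv r g) z v)) := by
  have key u : Tendsto (fun i => hess (mconv r (f i)) z u u) atTop (𝓝 (hess (mconv r g) z u u)) := by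
    have hk : ContDiff ℝ 1 fun x => ∇ (moll r) x u :=
      ((contDiff_moll (n := n) r).fderiv_right (m := 1) (by norm_cast)).clm_apply contDiff_const
    have hks :=
      (hasCompactSupport_moll hr).fderiv_apply (𝕜 := ℝ) u
    have hkc : Continuous fun x => ∇ (fun x => ∇ (moll r) x u) x u :=
      (hk.continuous_fderiv (by simp)).clm_apply continuous_const
    rw [hess_mconv hr hg]
    simp_rw [hess_mconv hr (hf _)]
    exact tendsto_integral_translate hkc (hks.fderiv_apply (𝕜 := ℝ) u) hf hb hfb hlim z
  exact ((key v).add (key (I • v))).div_const 4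

lemma FlatZero.vol_eq_zero (hn : 1 ≤ n) (hF : FlatZero T ε₀) : Λ Z = 0 := by
  have h (k : ℕ) : Λ (Z ∩ closedBall 0 k) = 0 := by
    rcases Measure.hausdorffMeasure_zero_or_top (show (2 * n - 2 : ℝ) < 2 * n by linarith) (Z ∩ closedBall 0 k)
      with h | h
    · exact h
    · have := hF.isLocallyFinite hn
      have h2 := (isCompact_closedBall 0 k).measure_lt_top (μ := (μH[(2 * n - 2 : ℝ)]).restrict Z)
      rw [Measure.restrict_apply isClosed_closedBall.measurableSet, inter_comm, h] at h2
      simp_all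
  refine measure_mono_null (fun x hx => ?_) (measure_iUnion_null h)
  obtain ⟨k, hk⟩ := exists_nat_ge ‖x‖
  exact mem_iUnion.2 ⟨k, hx, by simpa using hk⟩

lemma FlatZero.ae_ne_zero (hn : 1 ≤ n) (hF : FlatZero T ε₀) : ∀ᵐ x ∂Λ, T x ≠ 0 := by
  rw [ae_iff]
  simp
  exact hF.vol_eq_zero hn

lemma lg_mono {x : Γ} (hx : T x ≠ 0) {s t : ℝ} (hs : 0 ≤ s) (hst : s ≤ t) : lg T s x ≤ lg T t x := by
  have : 0 < ‖T x‖ := norm_pos_iff.2 hx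
  unfold lg
  gcongr

lemma tendsto_lg {x : Γ} (hx : T x ≠ 0) {ε : ℕ → ℝ} (hlim : Tendsto ε atTop (𝓝 0)) :
    Tendsto (fun k => lg T (ε k) x) atTop (𝓝 (lg T 0 x)) := by
  have : 0 < ‖T x‖ := norm_pos_iff.2 hx
  exact (((hlim.pow 2).const_add _).log (by positivity)).const_mul _

lemma lg_zero (T : Γ → ℂ) (x : Γ) : lg T 0 x = Real.log ‖T x‖ := by
  unfold lg
  simp

lemma FlatZero.locallyIntegrable_lg (hn : 1 ≤ n) (hF : FlatZero T ε₀) : LocallyIntegrable (lg T 0) Λ := by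
  have hae := hF.ae_ne_zero hn
  have hc s (hs : s ≠ 0) : Continuous (lg T s) := (contDiff_lg hF.diff hs).continuous
  have hmeas : Measurable (lg T 0) := by
    have := hF.diff.continuous.measurable
    unfold lg
    fun_prop
  intro y
  obtain ⟨z, hz, hyz⟩ : ∃ z, T z ≠ 0 ∧ y ∈ ball z 1 := by
    by_contra! h
    have : Λ (ball y 1) ≤ Λ Z := measure_mono fun z hz => by
      by_contra h2
      exact h z h2 (mem_ball_comm.1 hz)
    rw [hF.vol_eq_zero hn] at this
    exact (measure_ball_pos Λ y one_pos).not_ge this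
  obtain ⟨B, hB⟩ := (isCompact_closedBall z 2).exists_bound_of_continuousOn (hc 1 one_ne_zero).continuousOn
  have hB' x (hx : x ∈ closedBall z 2) (hTx : T x ≠ 0) s (hs : 0 ≤ s) (hs1 : s ≤ 1) : lg T s x ≤ B :=
    (lg_mono hTx hs hs1).trans ((le_abs_self _).trans (hB x hx))
  have hmc : Continuous fun x => moll 1 (z - x) := (continuous_moll 1).comp (continuous_const.sub continuous_id)
  have hms :=
    (hasCompactSupport_moll one_pos).comp_homeomorph (Homeomorph.subLeft z)
  have hnn s (hs : 0 ≤ s) (hs1 : s ≤ 1) x (hx : T x ≠ 0) : 0 ≤ moll 1 (z - x) * (B - lg T s x) := by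
    by_cases hxz : x ∈ closedBall z 2
    · exact mul_nonneg (moll_nonneg one_pos _) (sub_nonneg.2 (hB' x hxz hx s hs hs1))
    · rw [moll_eq_zero one_pos, zero_mul]
      rw [mem_closedBall, dist_eq_norm, norm_sub_rev] at hxz
      linarith
  set ε : ℕ → ℝ := fun k => 1 / (k + 1) with hε
  have hε0 k : 0 < ε k := Nat.one_div_pos_of_nat
  have hε1 k : ε k ≤ 1 := by
    rw [hε]; dsimp only
    rw [div_le_one (by positivity)]
    linarith
  have hlim : Tendsto ε atTop (𝓝 0) := tendsto_one_div_add_atTop_nhds_zero_nat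
  have hbound k : ∫⁻ x, ofReal (moll 1 (z - x) * (B - lg T (ε k) x)) ∂Λ ≤ ofReal (B - lg T 0 z) := by
    have hck := hc (ε k) (hε0 k).ne'
    have hi : Integrable (fun x => moll 1 (z - x) * (B - lg T (ε k) x)) Λ :=
      (hmc.mul (continuous_const.sub hck)).integrable_of_hasCompactSupport hms.mul_right
    rw [← ofReal_integral_eq_lintegral_ofReal hi (hae.mono fun x hx => hnn _ (hε0 k).le (hε1 k) x hx)]
    refine ofReal_le_ofReal ?_
    have h1 : ∫ x, moll 1 (z - x) * (B - lg T (ε k) x) ∂Λ = B - mconv 1 (lg T (ε k)) z := by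
      simp_rw [mul_sub]
      have hi2 : Integrable (fun x => moll 1 (z - x) * lg T (ε k) x) Λ :=
        (hmc.mul hck).integrable_of_hasCompactSupport hms.mul_right
      rw [integral_sub ((hmc.integrable_of_hasCompactSupport hms).mul_const B) hi2, integral_mul_const, integral_moll_sub one_pos,
        one_mul, mconv_eq']
      rfl
    rw [h1]
    have h2 := sub_mean ((contDiff_lg hF.diff (hε0 k).ne').of_le (by norm_cast))
      (fun z v => levi_lg_nonneg hF.diff (hε0 k).ne' z v) one_pos z
    linarith [lg_mono hz le_rfl (hε0 k).le]
  have hfatou : ∫⁻ x, ofReal (moll 1 (z - x) * (B - lg T 0 x)) ∂Λ ≤ ofReal (B - lg T 0 z) := by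
    calc _ ≤ ∫⁻ x, liminf (fun k => ofReal (moll 1 (z - x) * (B - lg T (ε k) x))) atTop ∂Λ := by
          refine lintegral_mono_ae (hae.mono fun x hx => ?_)
          refine le_of_eq (Tendsto.liminf_eq ?_).symm
          exact tendsto_ofReal (((tendsto_lg hx hlim).const_sub B).const_mul _)
      _ ≤ liminf (fun k => ∫⁻ x, ofReal (moll 1 (z - x) * (B - lg T (ε k) x)) ∂Λ) atTop :=
          lintegral_liminf_le fun k => (hmc.mul (continuous_const.sub (hc _ (hε0 k).ne'))).measurable.ennreal_ofReal
      _ ≤ _ := liminf_le_of_frequently_le' (Frequently.of_forall hbound)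
  have hint : Integrable (fun x => moll 1 (z - x) * (B - lg T 0 x)) Λ := by
    refine ⟨(hmc.measurable.mul (measurable_const.sub hmeas)).aestronglyMeasurable, ?_⟩
    rw [hasFiniteIntegral_iff_ofReal (hae.mono fun x hx => hnn 0 le_rfl zero_le_one x hx)]
    exact hfatou.trans_lt ENNReal.ofReal_lt_top
  refine ⟨ball z 1, isOpen_ball.mem_nhds hyz, ?_⟩
  have hm0 := radMass_pos (n := n) one_pos
  have h3 : IntegrableOn (fun x => B - radMass n 1 * (moll 1 (z - x) * (B - lg T 0 x))) (ball z 1) Λ :=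
    (integrableOn_const measure_ball_lt_top.ne).sub (hint.const_mul _).integrableOn
  refine h3.congr_fun (fun x hx => ?_) measurableSet_ball
  rw [mem_ball, dist_eq_norm, norm_sub_rev] at hx
  dsimp only
  rw [moll, rad_eq_one one_pos hx.le]
  field_simp
  ring

lemma abs_lg_le {x : Γ} (hx : T x ≠ 0) {s : ℝ} (hs : 0 ≤ s) (hs1 : s ≤ 1) :
    |lg T s x| ≤ |lg T 0 x| + |lg T 1 x| := by
  have h1 := lg_mono hx le_rfl hs
  have h2 := lg_mono hx hs hs1
  rw [abs_le]
  constructor <;> cases abs_cases (lg T 0 x) <;> cases abs_cases (lg T 1 x) <;> linarith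

lemma integrable_moll_mul (hr : 0 < r) {g : Γ → ℝ} (hg : Continuous g) :
    Integrable (fun y => moll r y * g y) Λ :=
  ((continuous_moll r).mul hg).integrable_of_hasCompactSupport (hasCompactSupport_moll hr).mul_right

lemma le_levi_mconv (hφ : C² φ) {c : ℝ} (h : ∀ z v : Γ, c * ‖v‖ ^ 2 ≤ levi φ z v)
    (hr : 0 < r) (z v : Γ) : c * ‖v‖ ^ 2 ≤ levi (mconv r φ) z v := by
  rw [levi_mconv hφ hr, ← one_mul (c * ‖v‖ ^ 2), ← integral_moll (n := n) hr, ← integral_mul_const]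
  exact integral_mono ((integrable_moll hr).mul_const _)
    (integrable_moll_mul hr ((continuous_levi hφ v).comp (continuous_const.add continuous_id)))
    fun y => mul_le_mul_of_nonneg_left (h _ _) (moll_nonneg hr _)

lemma levi_mconv_le (hφ : C² φ) {c : ℝ} (h : ∀ z v : Γ, levi φ z v ≤ c * ‖v‖ ^ 2)
    (hr : 0 < r) (z v : Γ) : levi (mconv r φ) z v ≤ c * ‖v‖ ^ 2 := by
  rw [levi_mconv hφ hr, ← one_mul (c * ‖v‖ ^ 2), ← integral_moll (n := n) hr, ← integral_mul_const]
  exact integral_mono (integrable_moll_mul hr ((continuous_levi hφ v).comp (continuous_const.add continuous_id)))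
    ((integrable_moll hr).mul_const _)
    fun y => mul_le_mul_of_nonneg_left (h _ _) (moll_nonneg hr _)

lemma mconv_sub_le {h : Γ → ℝ} (hh : C² h) (hl : ∀ z v, 0 ≤ levi h z v) (hr : 0 < r) {A : ℝ}
    {z : Γ} (hA : ∀ t ∈ Ioc (0 : ℝ) 1, ∀ j, ∫ y, t * levi h (z + t • y) (ee j) * pot r y ∂Λ ≤ A) :
    mconv r h z - h z ≤ 4 * (n * A) := by
  rw [mconv_sub_self hh hr]
  have h1 := intervalIntegral.norm_integral_le_of_norm_le_const (a := 0) (b := 1) (C := 4 * (n * A))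
    (f := fun t => 4 * ∑ j, (∫ y, t * levi h (z + t • y) (ee j) * pot r y ∂Λ)) (fun t ht => by
      rw [uIoc_of_le zero_le_one] at ht
      have h0 j : 0 ≤ ∫ y, t * levi h (z + t • y) (ee j) * pot r y ∂Λ :=
        integral_nonneg fun y => mul_nonneg (mul_nonneg ht.1.le (hl _ _)) (pot_nonneg hr y)
      rw [norm_of_nonneg (mul_nonneg (by norm_num) (sum_nonneg fun j _ => h0 j))]
      have := Finset.sum_le_card_nsmul Finset.univ _ A fun j _ => hA t ht j
      rw [card_univ, Fintype.card_fin, nsmul_eq_mul] at this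
      linarith)
  rw [sub_zero, abs_one, mul_one] at h1
  exact (le_abs_self _).trans h1

lemma integral_pot_le_near (hT : Entire T) (hr : 0 < r) {x : Γ} {δ : ℝ}
    (hδ : ∀ y ∈ closedBall x δ, T y ≠ 0) {ε : ℕ → ℝ} (hε : ∀ k, 0 < ε k)
    (hlim : Tendsto ε atTop (𝓝 0)) (v : Γ) :
    ∀ᶠ k in atTop, ∀ t, 0 ≤ t → t ≤ 1 → t * (2 * r) ≤ δ →
      ∫ y, t * levi (lg T (ε k)) (x + t • y) v * pot r y ∂Λ ≤ 1 := by
  rcases lt_or_ge δ 0 with h | h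
  · refine Eventually.of_forall fun k t h0 _ h2 => absurd (h2.trans_lt h) (by push Not; positivity)
  obtain ⟨m, hm0, hm⟩ : ∃ m, 0 < m ∧ ∀ y ∈ closedBall x δ, m ≤ ‖T y‖ := by
    obtain ⟨y, hy, hmin⟩ := (isCompact_closedBall x δ).exists_isMinOn (nonempty_closedBall.2 h)
      hT.continuous.norm.continuousOn
    exact ⟨‖T y‖, norm_pos_iff.2 (hδ y hy), fun z hz => hmin hz⟩
  obtain ⟨D, hD⟩ := (isCompact_closedBall x δ).exists_bound_of_continuousOn
    ((continuous_fderiv_entire hT).clm_apply continuous_const : Continuous fun y => dT y v).continuousOn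
  have hpi : Integrable (pot r : Γ → ℝ) Λ :=
    (contDiff_pot r).continuous.integrable_of_hasCompactSupport (hasCompactSupport_pot hr)
  have hz : Tendsto (fun k => ε k ^ 2 * ((D ^ 2 / (2 * m ^ 4)) * ∫ y, pot r y ∂Λ)) atTop (𝓝 0) := by
    simpa using (hlim.pow 2).mul_const ((D ^ 2 / (2 * m ^ 4)) * ∫ y, pot r y ∂Λ)
  filter_upwards [hz.eventually_le_const one_pos] with k hk t ht ht1 htr
  refine le_trans ?_ hk
  rw [← mul_assoc, ← integral_const_mul]
  refine integral_mono_of_nonneg (ae_of_all _ fun y => mul_nonneg (mul_nonneg ht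
    (levi_lg_nonneg hT (hε k).ne' _ _)) (pot_nonneg hr y)) (hpi.const_mul _) (ae_of_all _ fun y => ?_)
  rcases le_or_gt (2 * r ^ 2) (‖y‖ ^ 2) with hy | hy
  · simp only [pot_eq_zero hr hy, mul_zero, le_refl]
  · have hy2 : ‖y‖ ≤ 2 * r := abs_le_of_sq_le_sq' (by nlinarith) (by positivity) |>.2
    have hmem : x + t • y ∈ closedBall x δ := by
      rw [mem_closedBall, dist_eq_norm, add_sub_cancel_left, norm_smul, norm_of_nonneg ht]
      exact (mul_le_mul_of_nonneg_left hy2 ht).trans htr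
    refine mul_le_mul_of_nonneg_right ?_ (pot_nonneg hr y)
    calc t * levi (lg T (ε k)) (x + t • y) v ≤ 1 * levi (lg T (ε k)) (x + t • y) v :=
          mul_le_mul_of_nonneg_right ht1 (levi_lg_nonneg hT (hε k).ne' _ _)
      _ ≤ ε k ^ 2 * (‖dT (x + t • y) v‖ ^ 2 / (2 * m ^ 4)) := by
          rw [one_mul]; exact levi_lg_le hT (hε k).ne' hm0 (hm _ hmem) v
      _ ≤ _ := by
          gcongr
          exact hD _ hmem

lemma integral_pot_le_far {h : Γ → ℝ} (hh : C² h) (hl : ∀ z v, 0 ≤ levi h z v) (hr : 0 < r)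
    {P : ℝ} (hP : ∀ y : Γ, pot r y ≤ P) {t₀ t : ℝ} (ht₀ : 0 < t₀) (ht : t₀ ≤ t) (ht1 : t ≤ 1) (x v : Γ) :
    ∫ y, t * levi h (x + t • y) v * pot r y ∂Λ ≤
      P * radMass n (2 * r) * (t₀ ^ (2 * n))⁻¹ * levi (mconv (2 * r) h) x v := by
  have hP0 := (pot_nonneg hr 0).trans (hP 0)
  have htp := ht₀.trans_le ht
  have hR : 0 < 2 * r := by positivity
  have hM := radMass_pos (n := n) hR
  have hlm : 0 ≤ levi (mconv (2 * r) h) x v := by simpa using le_levi_mconv hh (c := 0) (by simpa using hl) hR x v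
  have hg : Integrable (fun y => moll (2 * r) y * levi h (x + y) v) Λ :=
    integrable_moll_mul hR ((continuous_levi hh v).comp (continuous_const.add continuous_id))
  have h1 : ∫ y, moll (2 * r) (t • y) * levi h (x + t • y) v ∂Λ =
      (t ^ (2 * n))⁻¹ * levi (mconv (2 * r) h) x v := by
    rw [Measure.integral_comp_smul Λ (fun y => moll (2 * r) y * levi h (x + y) v) t, levi_mconv hh hR,
      finrank_real_En, abs_of_nonneg (by positivity), smul_eq_mul]
  calc _ ≤ ∫ y, P * radMass n (2 * r) * (moll (2 * r) (t • y) * levi h (x + t • y) v) ∂Λ := by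
        refine integral_mono_of_nonneg (ae_of_all _ fun y => mul_nonneg (mul_nonneg htp.le (hl _ _))
          (pot_nonneg hr y)) ((hg.comp_smul htp.ne').const_mul _) (ae_of_all _ fun y => ?_)
        have hl' := hl (x + t • y) v
        have hm := moll_nonneg hR (t • y)
        rcases le_or_gt (2 * r ^ 2) (‖y‖ ^ 2) with hy | hy
        · simp only [pot_eq_zero hr hy, mul_zero]
          positivity
        · have hy2 : ‖y‖ ≤ 2 * r := abs_le_of_sq_le_sq' (by nlinarith) (by positivity) |>.2
          have hy3 : ‖t • y‖ ≤ 2 * r := by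
            rw [norm_smul, norm_of_nonneg htp.le]
            nlinarith
          dsimp only
          rw [(by rw [moll, rad_eq_one hR hy3] : moll (2 * r) (t • y) = 1 / radMass n (2 * r))]
          calc t * levi h (x + t • y) v * pot r y ≤ 1 * levi h (x + t • y) v * P := by
                gcongr
                exacts [pot_nonneg hr y, hP y]
            _ = _ := by field_simp
    _ = P * radMass n (2 * r) * ((t ^ (2 * n))⁻¹ * levi (mconv (2 * r) h) x v) := by rw [integral_const_mul, h1]
    _ ≤ P * radMass n (2 * r) * ((t₀ ^ (2 * n))⁻¹ * levi (mconv (2 * r) h) x v) := by gcongr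
    _ = _ := by ring

lemma FlatZero.exists_potential (hn : 1 ≤ n) (hF : FlatZero T ε₀)     (hφ : C² φ) {C' : ℝ} (h0 : ∀ z v, 0 ≤ levi φ z v) (hhigh : ∀ z v : Γ, levi φ z v ≤ C' * ‖v‖ ^ 2)
    {κ r₀ : ℝ} (hκ : 0 ≤ κ)
    (hdens : ∀ r ≥ r₀, ∀ z v, Upsilon T Z r z v ≤ κ * levi (avgBall φ r) z v) (hr : 0 < r)
    (hrr : r₀ ≤ r) :
    ∃ q : Γ → ℝ, C∞ q ∧ (∀ z v, 0 ≤ levi q z v) ∧ (∀ z v, levi q z v ≤ κ * levi (mconv r φ) z v) ∧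
      (∀ z, ‖T z‖ ≤ exp (q z)) ∧
      ∀ δ > 0, ∃ K, ∀ x, δ ≤ infDist x Z → exp (q x - K) ≤ ‖T x‖ := by
  have hae := hF.ae_ne_zero hn
  have hc s (hs : s ≠ 0) : C∞ (lg T s) := contDiff_lg hF.diff hs
  have hli := hF.locallyIntegrable_lg hn
  set ε : ℕ → ℝ := fun k => 1 / (k + 1) with hε
  have hε0 k : 0 < ε k := Nat.one_div_pos_of_nat
  have hε1 k : ε k ≤ 1 := by
    rw [hε]; dsimp only
    rw [div_le_one (by positivity)]
    linarith
  have hlim : Tendsto ε atTop (𝓝 0) := tendsto_one_div_add_atTop_nhds_zero_nat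
  have hck k : C² (lg T (ε k)) := (hc _ (hε0 k).ne').of_le (by norm_cast)
  have hlk : ∀ k z v, 0 ≤ levi (lg T (ε k)) z v := fun k => levi_lg_nonneg hF.diff (hε0 k).ne'
  have hlik k : LocallyIntegrable (lg T (ε k)) Λ := (hck k).continuous.locallyIntegrable
  have hb : LocallyIntegrable (fun x => |lg T 0 x| + |lg T 1 x|) Λ :=
    LocallyIntegrable.add (fun x => (hli x).norm) (hc 1 one_ne_zero).continuous.abs.locallyIntegrable
  have hfb k : ∀ᵐ x ∂Λ, |lg T (ε k) x| ≤ |lg T 0 x| + |lg T 1 x| :=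
    hae.mono fun x hx => abs_lg_le hx (hε0 k).le (hε1 k)
  have hlae : ∀ᵐ x ∂Λ, Tendsto (fun k => lg T (ε k) x) atTop (𝓝 (lg T 0 x)) :=
    hae.mono fun x hx => tendsto_lg hx hlim
  have hq z : Tendsto (fun k => mconv r (lg T (ε k)) z) atTop (𝓝 (mconv r (lg T 0) z)) := by
    simp [mconv_eq']
    exact tendsto_integral_translate (continuous_moll r) (hasCompactSupport_moll hr) hlik hb hfb hlae z
  have hlevi := tendsto_levi_mconv hr hlik hli hb hfb hlae
  refine ⟨mconv r (lg T 0), contDiff_mconv hr hli, fun z v => ?_, fun z v => ?_, fun z => ?_, fun δ hδ => ?_⟩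
  · refine ge_of_tendsto' (hlevi z v) fun k => ?_
    simpa using le_levi_mconv (hck k) (c := 0) (by simpa using hlk k) hr z v
  · refine le_of_forall_gt_imp_ge_of_dense fun a ha => ?_
    exact le_of_tendsto (hlevi z v)
      ((hF.limsup_moll_le hn hφ h0 hκ hdens hr hrr hε0 hlim z v ha).mono fun k hk => hk.le)
  · by_cases hz : T z = 0
    · rw [hz, norm_zero]; positivity
    · rw [← Real.log_le_iff_le_exp (norm_pos_iff.2 hz), ← lg_zero]
      exact le_of_tendsto_of_tendsto' (tendsto_lg hz hlim) (hq z) fun k => sub_mean (hck k) (hlk k) hr z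
  · have hR : 0 < 2 * r := by positivity
    have hC0 j x : κ * levi (mconv (2 * r) φ) x (ee j) < κ * C' + 1 := by
      have := levi_mconv_le hφ hhigh hR x (ee j)
      rw [norm_ee] at this
      nlinarith
    obtain ⟨P, hP⟩ := (contDiff_pot (n := n) r).continuous.bounded_above_of_compact_support (hasCompactSupport_pot hr)
    have hP' y : pot r y ≤ P := (le_abs_self _).trans (hP y)
    have hP0 : 0 ≤ P := (norm_nonneg _).trans (hP 0)
    have hM := radMass_pos (n := n) hR
    set t₀ := δ / 2 / (2 * r) with ht₀
    have ht0 : 0 < t₀ := by positivity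
    have hC1 : 0 ≤ κ * C' := by
      have : 0 ≤ C' := by
        have h1 := (h0 0 (ee ⟨0, hn⟩)).trans (hhigh 0 (ee ⟨0, hn⟩))
        rwa [norm_ee, one_pow, mul_one] at h1
      positivity
    set A := 1 + P * radMass n (2 * r) * (t₀ ^ (2 * n))⁻¹ * (κ * C' + 1)
    have hA1 : 1 ≤ A := by
      have : 0 ≤ P * radMass n (2 * r) * (t₀ ^ (2 * n))⁻¹ * (κ * C' + 1) := by positivity
      linarith
    refine ⟨4 * (n * A), fun x hx => ?_⟩
    have hne y (hy : y ∈ closedBall x (δ / 2)) : T y ≠ 0 := fun h => by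
      have h1 := infDist_le_dist_of_mem (x := x) (show y ∈ Z from h)
      rw [mem_closedBall, dist_comm] at hy
      linarith
    have hTx := hne x (mem_closedBall_self (by positivity))
    have hev : ∀ᶠ k in atTop, ∀ j, levi (mconv (2 * r) (lg T (ε k))) x (ee j) < κ * C' + 1 :=
      eventually_all.2 fun j => hF.limsup_moll_le hn hφ h0 hκ hdens hR (by linarith) hε0 hlim x (ee j) (hC0 j x)
    have hnear : ∀ᶠ k in atTop, ∀ j, ∀ t, 0 ≤ t → t ≤ 1 → t * (2 * r) ≤ δ / 2 →
        ∫ y, t * levi (lg T (ε k)) (x + t • y) (ee j) * pot r y ∂Λ ≤ 1 :=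
      eventually_all.2 fun j => integral_pot_le_near hF.diff hr hne hε0 hlim (ee j)
    have key : ∀ᶠ k in atTop, mconv r (lg T (ε k)) x - lg T (ε k) x ≤ 4 * (n * A) := by
      filter_upwards [hev, hnear] with k hk1 hk2
      refine mconv_sub_le (hck k) (hlk k) hr fun t ht j => ?_
      rcases le_or_gt t t₀ with h | h
      · exact (hk2 j t ht.1.le ht.2 (by rwa [ht₀, le_div_iff₀ hR] at h)).trans hA1
      · refine (integral_pot_le_far (hck k) (hlk k) hr hP' ht0 h.le ht.2 x (ee j)).trans ?_
        have := mul_le_mul_of_nonneg_left (hk1 j).le (show 0 ≤ P * radMass n (2 * r) * (t₀ ^ (2 * n))⁻¹ by positivity)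
        linarith
    have h2 := le_of_tendsto ((hq x).sub (tendsto_lg hTx hlim)) key
    rw [← Real.le_log_iff_exp_le (norm_pos_iff.2 hTx), ← lg_zero]
    linarith

lemma sum_norm_integral_le {m : Γ → ℝ} (hm : Integrable m Λ) {ι : Γ → ℕ} (hι : Measurable ι) (N : ℕ) :
    ∑ k ∈ Finset.range N, ‖∫ y, m y • (if ι y = k then (1 : ℂ) else 0) ∂Λ‖ ≤ ∫ y, ‖m y‖ ∂Λ := by
  have hi k : Integrable (fun y => ‖m y • (if ι y = k then (1 : ℂ) else 0)‖) Λ := by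
    refine (hm.norm.indicator (hι (measurableSet_singleton k))).congr (ae_of_all _ fun y => ?_)
    by_cases h : ι y = k <;> simp [h]
  calc _ ≤ ∑ k ∈ Finset.range N, ∫ y, ‖m y • (if ι y = k then 1 else 0)‖ ∂Λ :=
        sum_le_sum fun k _ => norm_integral_le_integral_norm _
    _ = ∫ y, ∑ k ∈ Finset.range N, ‖m y • (if ι y = k then 1 else 0)‖ ∂Λ :=
        (integral_finsetSum _ fun k _ => hi k).symm
    _ ≤ _ := by
        refine integral_mono (integrable_finsetSum _ fun k _ => hi k) hm.norm fun y => ?_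
        have : ∀ k, ‖m y • (if ι y = k then (1 : ℂ) else 0)‖ = if ι y = k then ‖m y‖ else 0 := fun k => by
          split_ifs <;> simp
        simp only [this, Finset.sum_ite_eq]
        grind

/-- Smooth partition of unity on `ℂⁿ` subordinate to balls of a fixed radius, with uniform gradient bounds. -/
lemma exists_partition (n : ℕ) {s : ℝ} (hs : 0 < s) :
    ∃ (c : ℕ → En n) (χ : ℕ → En n → ℂ) (D : ℝ), (∀ k, C∞ (χ k)) ∧
      (∀ k z, 3 * s ≤ dist z (c k) → χ k z = 0) ∧
      (∀ R, ∃ N, (∀ k ≥ N, ∀ z ∈ ball (0 : En n) R, χ k z = 0) ∧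
        ∀ z ∈ ball (0 : En n) R, ∑ k ∈ Finset.range N, χ k z = 1) ∧
      (∀ N z, ∑ k ∈ Finset.range N, ‖χ k z‖ ≤ 1) ∧
      ∀ N z j, ∑ k ∈ Finset.range N, ‖ð j (χ k) z‖ ≤ D := by
  classical
  set c := TopologicalSpace.denseSeq (En n)
  have hex y : ∃ k, dist y (c k) < s :=
    (TopologicalSpace.denseRange_denseSeq (En n)).exists_dist_lt y hs
  set ι := fun y => Nat.find (hex y)
  have hι : Measurable ι := measurable_find hex fun k => (isOpen_ball : IsOpen (ball (c k) s)).measurableSet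
  have hι1 y : dist y (c (ι y)) < s := Nat.find_spec (hex y)
  set a : ℕ → En n → ℂ := fun k y => if ι y = k then 1 else 0
  have ha k : LocallyIntegrable (a k) (vol n) := by
    refine (locallyIntegrable_const (1 : ℂ)).mono
      (Measurable.ite (hι (measurableSet_singleton k)) measurable_const measurable_const).aestronglyMeasurable
      (ae_of_all _ fun y => ?_)
    by_cases h : ι y = k <;> simp [a, h]
  have hms z : Integrable (fun y => moll s (z - y)) (vol n) := (integrable_moll hs).comp_sub_left z
  have hdi : Integrable (fun y => ‖∇ (moll s : En n → ℝ) y‖) (vol n) :=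
    (((contDiff_moll (n := n) s).continuous_fderiv (by simp)).integrable_of_hasCompactSupport
      ((hasCompactSupport_moll hs).fderiv ℝ)).norm
  refine ⟨c, fun k => mconv s (a k), ∫ y, ‖∇ (moll s : En n → ℝ) y‖ ∂(vol n),
    fun k => contDiff_mconv hs (ha k), fun k z hz => ?_, fun R => ?_, fun N z => ?_, fun N z j => ?_⟩
  · change mconv s (a k) z = 0
    rw [mconv_eq']
    refine integral_eq_zero_of_ae (ae_of_all _ fun y => ?_)
    by_cases h : ι y = k
    · have h1 := hι1 y
      rw [h] at h1
      have h2 := dist_triangle z y (c k)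
      dsimp only
      rw [moll_eq_zero hs (by rw [← dist_eq_norm]; linarith), zero_smul, Pi.zero_apply]
    · simp [a, h]
  · obtain ⟨t, ht⟩ := (isCompact_closedBall 0 (R + 2 * s)).elim_finite_subcover (fun k => ball (c k) s)
      (fun k => isOpen_ball) fun y _ => mem_iUnion.2 (hex y)
    obtain ⟨N, hN⟩ := t.exists_nat_subset_range
    have hιN z (hz : z ∈ ball 0 R) y (hy : moll s (z - y) ≠ 0) : ι y < N := by
      have h1 : ‖z - y‖ < 2 * s := by
        by_contra! h
        exact hy (moll_eq_zero hs h)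
      have h2 : y ∈ closedBall 0 (R + 2 * s) := by
        rw [mem_ball_zero_iff] at hz
        rw [mem_closedBall_zero_iff]
        linarith [norm_sub_norm_le y z, norm_sub_rev y z]
      obtain ⟨k, hk, hky⟩ := mem_iUnion₂.1 (ht h2)
      exact (Nat.find_min' (hex y) hky).trans_lt (Finset.mem_range.1 (hN hk))
    refine ⟨N, fun k hk z hz => ?_, fun z hz => ?_⟩
    · change mconv s (a k) z = 0
      rw [mconv_eq']
      refine integral_eq_zero_of_ae (ae_of_all _ fun y => ?_)
      by_cases h : moll s (z - y) = 0
      · simp [h]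
      · have := hιN z hz y h
        have h3 : ι y ≠ k := by omega
        simp [a, h3]
    · simp only [mconv_eq']
      rw [← integral_finsetSum _ fun k _ => integrable_moll_smul hs (ha k) z]
      have : ∀ y, ∑ k ∈ Finset.range N, moll s (z - y) • a k y = ((moll s (z - y) : ℝ) : ℂ) := fun y => by
        rw [← Finset.smul_sum]
        by_cases h : moll s (z - y) = 0
        · simp [h]
        · simp [a, hιN z hz y h]
      simp only [this]
      rw [integral_complex_ofReal, integral_moll_sub hs, Complex.ofReal_one]
  · simp [mconv_eq']
    refine (sum_norm_integral_le (hms z) hι N).trans_eq ?_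
    simp_rw [norm_of_nonneg (moll_nonneg hs _)]
    exact integral_moll_sub hs z
  · have hv v (hv : ‖v‖ = 1) : ∑ k ∈ Finset.range N, ‖∇ (mconv s (a k)) z v‖ ≤
        ∫ y, ‖∇ (moll s : En n → ℝ) y‖ ∂(vol n) := by
      simp [fderiv_mconv hs (ha _)]
      have hi : Integrable (fun y => ∇ (moll s : En n → ℝ) (z - y) v) (vol n) :=
        ((((contDiff_moll (n := n) s).continuous_fderiv (by simp)).clm_apply
          continuous_const).integrable_of_hasCompactSupport
            ((hasCompactSupport_moll hs).fderiv_apply (𝕜 := ℝ) v)).comp_sub_left z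
      refine (sum_norm_integral_le hi hι N).trans ?_
      rw [← integral_sub_left_eq_self (fun y => ‖∇ (moll s : En n → ℝ) y‖) (vol n) z]
      refine integral_mono hi.norm (hdi.comp_sub_left z) fun y => ?_
      simpa [hv] using (∇ (moll s : En n → ℝ) (z - y)).le_opNorm v
    have h1 := hv (ee j) (norm_ee j)
    have h2 := hv (I • ee j) (by rw [norm_smul, norm_ee, norm_I, one_mul])
    have h3 k : ‖ð j (mconv s (a k)) z‖ ≤ (1 / 2) * (‖∇ (mconv s (a k)) z (ee j)‖ +
        ‖∇ (mconv s (a k)) z (I • ee j)‖) := by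
      unfold dbar
      have := norm_add_le (∇ (mconv s (a k)) z (ee j)) (I * ∇ (mconv s (a k)) z (I • ee j))
      rw [norm_mul I, norm_I] at this
      simp
      linarith
    refine (sum_le_sum fun k _ => h3 k).trans ?_
    rw [← mul_sum, sum_add_distrib]
    linarith

/-- A function holomorphic on a ball agrees with a global smooth function on a smaller ball. -/
lemma exists_contDiff_eq {h : Γ → ℂ} {w : Γ} (hr : 0 < r) (hh : Hol h (ball w (3 * r))) :
    ∃ h' : Γ → ℂ, C∞ h' ∧ ∀ y ∈ closedBall w r, h' y = h y := by
  refine ⟨fun y => rad r (y - w) • h y, contDiff_iff_contDiffAt.2 fun y => ?_, fun y hy => ?_⟩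
  · by_cases hy : y ∈ ball w (3 * r)
    · obtain ⟨δ, hδ, hsub⟩ := Metric.isOpen_iff.1 isOpen_ball y hy
      exact ((contDiff_rad r).comp (contDiff_id.sub contDiff_const)).contDiffAt.smul
        (contDiffAt_of_differentiableOn hδ (hh.mono hsub))
    · have hy2 : y ∈ (closedBall w (2 * r))ᶜ := fun h => hy (closedBall_subset_ball (by linarith) h)
      refine (contDiffAt_const (c := 0)).congr_of_eventuallyEq ?_
      filter_upwards [isClosed_closedBall.isOpen_compl.mem_nhds hy2] with x hx
      rw [rad_eq_zero' hr, zero_smul]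
      rw [mem_compl_iff, mem_closedBall, dist_eq_norm] at hx
      linarith
  · rw [mem_closedBall, dist_eq_norm] at hy
    dsimp only
    rw [rad_eq_one hr hy, one_smul]

/-- On every ball of radius `2`, the function `φ` is within `K` of a pluriharmonic function. -/
def PHApprox (φ : Γ → ℝ) (K : ℝ) : Prop :=
  ∀ a : Γ, ∃ H : Γ → ℂ, Entire H ∧ ∀ z ∈ ball a 2, |φ z - (H z).re| ≤ K

/-- Nonnegative functions with at most exponential variation of rate `ε`. -/
structure Slow (ε : ℝ) (M : Γ → ℝ) : Prop where
  nonneg : ∀ z, 0 ≤ M z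
  le_exp : ∀ a z, M z ≤ M a * exp (ε * ‖z - a‖)

lemma Slow.le_three {ε : ℝ} {M : Γ → ℝ} (hM : Slow ε M) (hε : ε ≤ 1) {a z : Γ}
    (h : dist z a ≤ 1) : M z ≤ 3 * M a := by
  rw [dist_eq_norm] at h
  have h1 := mul_le_one₀ hε (norm_nonneg _) h
  have h2 : exp (ε * ‖z - a‖) ≤ 3 := (exp_le_exp.2 h1).trans (Real.exp_one_lt_d9.le.trans (by norm_num))
  rw [mul_comm]
  exact (hM.le_exp a z).trans (mul_le_mul_of_nonneg_left h2 (hM.nonneg a))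

/-- Extension of a holomorphic function on a hypersurface to a neighbourhood of uniform size. -/
lemma FlatZero.exists_local_extension (hF : FlatZero T ε₀) {K : ℝ}
    (hK : PHApprox φ K) {ε : ℝ} {M : Γ → ℝ} (hM : Slow ε M) (hε : ε ≤ 1)
    (hf : HolOn Z f)
    (hfM : ∀ w, T w = 0 → ‖f w‖ ≤ M w * exp (φ w)) {ρ : ℝ} (hρ : 0 < ρ) (hρε : ρ < ε₀) (hρ1 : ρ ≤ 1)
    {w : Γ} (hw : T w = 0) :
    ∃ h : Γ → ℂ, Hol h (ball w ρ) ∧ ∀ y ∈ ball w ρ, (T y = 0 → h y = f y) ∧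
      ‖h y‖ ≤ 3 * exp (2 * K) * M y * exp (φ y) := by
  obtain ⟨zt, hztd, hzt⟩ := hF.exists_root hw hρ hρε
  obtain ⟨H, hH, hHb⟩ := hK w
  have hb y (hy : y ∈ ball w ρ) : y - w ∈ ball 0 ρ := by rwa [mem_ball_zero_iff, ← dist_eq_norm]
  set P := fun y => y + zt (y - w) • nrm T w
  have hPd : Hol P (ball w ρ) := differentiableOn_id.add
    ((hztd.comp (differentiableOn_id.sub_const w) hb).smul_const _)
  have hPT y (hy : y ∈ ball w ρ) : T (P y) = 0 := by
    have := (hzt _ (hb y hy)).2.1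
    rwa [add_sub_cancel] at this
  have hPy y (hy : y ∈ ball w ρ) : dist (P y) y < ρ := by
    rw [dist_eq_norm, add_sub_cancel_left, norm_smul, norm_nrm (hF.dne w hw), mul_one]
    exact (hzt _ (hb y hy)).1.trans_lt (mem_ball_zero_iff.1 (hb y hy))
  refine ⟨fun y => f (P y) * Complex.exp (H y - H (P y)), ?_, fun y hy => ⟨fun hy0 => ?_, ?_⟩⟩
  · exact (HolOn.comp hf isOpen_ball hPd hPT).fun_mul
      ((hH.differentiableOn.fun_sub (hH.comp_differentiableOn hPd)).cexp)
  · have : P y = y := by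
      have := (hzt _ (hb y hy)).2.2.2 0 (by rw [norm_zero]; exact hρ.le) (by rwa [zero_smul, add_zero, add_sub_cancel])
      simp [P, ← this]
    dsimp only
    rw [this, sub_self, Complex.exp_zero, mul_one]
  · have h1 := abs_le.1 (hHb y (ball_subset_ball (by linarith) hy))
    have h2 := abs_le.1 (hHb (P y) (by
      rw [mem_ball] at hy ⊢
      linarith [dist_triangle (P y) y w, hPy y hy]))
    rw [norm_mul, norm_exp, sub_re]
    calc _ ≤ (M (P y) * exp (φ (P y))) * exp ((H y).re - (H (P y)).re) := by
          gcongr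
          exact hfM _ (hPT y hy)
      _ = M (P y) * exp (φ (P y) + ((H y).re - (H (P y)).re)) := by rw [exp_add]; ring
      _ ≤ (3 * M y) * exp (2 * K + φ y) := by
          exact mul_le_mul (hM.le_three hε ((hPy y hy).le.trans hρ1)) (exp_le_exp.2 (by linarith)) (Real.exp_nonneg _)
            (mul_nonneg (by norm_num) (hM.nonneg y))
      _ = _ := by rw [exp_add]; ring

/-- Division by the defining function with uniform weighted bounds. -/
lemma FlatZero.exists_weighted_quotient (hF : FlatZero T ε₀) {φ q : Γ → ℝ} {K K' s : ℝ}
    (hK : PHApprox (fun z => φ z - q z) K) (hs : 0 < s) (hsε : 2 * s < ε₀) (hs1 : 4 * s ≤ 1)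
    (hT : ∀ x, s ≤ infDist x Z → exp (q x - K') ≤ ‖T x‖) {w : Γ} (hw : T w = 0)
    {G : Γ → ℂ} (hG : Hol G (ball w (4 * s))) {A : ℝ} (hA : 0 ≤ A)
    (hGb : ∀ y ∈ ball w (4 * s), (T y = 0 → G y = 0) ∧ ‖G y‖ ≤ A * exp (φ y)) :
    ∃ Q : Γ → ℂ, Hol Q (ball w (2 * s)) ∧ ∀ y ∈ ball w (2 * s), G y = T y * Q y ∧
      (y ∈ ball w s → ‖Q y‖ ≤ A * exp (K' + 2 * K) * exp (φ y - q y)) := by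
  have h4 : 2 * (2 * s) = 4 * s := by ring
  obtain ⟨Q, hQ, hQb⟩ := hF.exists_quotient hw (ρ := 2 * s) (by positivity) hsε (h4 ▸ hG)
    (h4 ▸ fun y hy => (hGb y hy).1)
  obtain ⟨H, hH, hHb⟩ := hK w
  refine ⟨Q, hQ, fun y hy => ⟨(hQb y hy).1, fun hys => ?_⟩⟩
  rw [mem_ball] at hys
  have h1 := (hQb y hy).2 (fun z => Complex.exp (-H z)) hH.neg.cexp (A * exp (K' + K)) fun ξ hξ => by
    have hξ' : ‖ξ‖ = 2 * s := by simpa using hξ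
    set x := y + ξ • nrm T w
    have hxy : dist x y = 2 * s := by rw [dist_eq_norm, add_sub_cancel_left, norm_smul, (norm_nrm (hF.dne w hw)), hξ', mul_one]
    have hxw : dist x w < 4 * s := by linarith [dist_triangle x y w]
    have hi : s ≤ infDist x Z := by
      have h2 := hF.le_infDist hw (c := ξ) (by rw [hξ']; exact hsε)
      have h3 := infDist_le_infDist_add_dist (s := Z) (x := w + ξ • nrm T w) (y := x)
      have h4 : dist (w + ξ • nrm T w) x = dist y w := by rw [dist_add_right, dist_comm]
      linarith
    have h5 := abs_le.1 (hHb x (by rw [mem_ball]; linarith))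
    rw [norm_exp, neg_re]
    calc _ ≤ (A * exp (φ x)) * exp (-(H x).re) := by
          gcongr
          exact (hGb x hxw).2
      _ = A * exp (φ x - (H x).re) := by rw [sub_eq_add_neg, exp_add]; ring
      _ ≤ A * exp ((K' + K) + (q x - K')) := by gcongr; linarith
      _ = A * exp (K' + K) * exp (q x - K') := by rw [exp_add]; ring
      _ ≤ _ := by
          gcongr
          exact hT x hi
  have h5 := abs_le.1 (hHb y (by rw [mem_ball]; linarith))
  rw [norm_exp, neg_re] at h1
  calc ‖Q y‖ = ‖Q y‖ * exp (-(H y).re) * exp ((H y).re) := by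
        rw [mul_assoc, ← exp_add, neg_add_cancel, Real.exp_zero, mul_one]
    _ ≤ (A * exp (K' + K)) * exp (K + (φ y - q y)) := by
        gcongr
        linarith
    _ = _ := by rw [show K' + 2 * K = K' + K + K by ring, exp_add (K' + K) K, exp_add K]; ring

/-- Smooth functions which extend `f` near the points of the hypersurface close to the centres `c k`. -/
lemma FlatZero.exists_local_family (hF : FlatZero T ε₀) {K : ℝ}
    (hK : PHApprox φ K) {ε : ℝ} {M : Γ → ℝ} (hM : Slow ε M) (hε : ε ≤ 1)
    (hf : HolOn Z f)
    (hfM : ∀ w, T w = 0 → ‖f w‖ ≤ M w * exp (φ w)) {s : ℝ} (hs : 0 < s) (hsε : 45 * s < ε₀) (hs1 : 45 * s ≤ 1)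
    (c : Γ) :
    ∃ h : Γ → ℂ, C∞ h ∧ (∀ x, T x = 0 → dist x c < 5 * s →
      Hol h (ball x (4 * s)) ∧ ∀ y ∈ ball x (4 * s), (T y = 0 → h y = f y) ∧
        ‖h y‖ ≤ 3 * exp (2 * K) * M y * exp (φ y)) ∧
      ∀ z, dist z c ≤ 3 * s → DifferentiableAt ℂ h z ∧ ‖h z‖ ≤ 3 * exp (2 * K) * M z * exp (φ z) := by
  by_cases hw : ∃ w, T w = 0 ∧ dist w c < 6 * s
  · obtain ⟨w, hw, hwc⟩ := hw
    obtain ⟨h, hh, hb⟩ := hF.exists_local_extension hK hM hε hf hfM (by positivity) hsε hs1 hw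
    obtain ⟨h', hh', heq⟩ := exists_contDiff_eq (r := 15 * s) (by positivity)
      (by rwa [show 3 * (15 * s) = 45 * s by ring])
    have hd :=
      (hh.mono (ball_subset_ball (by linarith))).congr fun y hy => heq y (ball_subset_closedBall hy)
    have hb' y (hy : y ∈ ball w (15 * s)) : (T y = 0 → h' y = f y) ∧
        ‖h' y‖ ≤ 3 * exp (2 * K) * M y * exp (φ y) := by
      rw [heq y (ball_subset_closedBall hy)]
      exact hb y (ball_subset_ball (by linarith) hy)
    refine ⟨h', hh', fun x _ hxc => ?_, fun z hz => ?_⟩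
    · have hsub : ball x (4 * s) ⊆ ball w (15 * s) := ball_subset_ball' (by linarith [dist_triangle_right x w c])
      exact ⟨hd.mono hsub, fun y hy => hb' y (hsub hy)⟩
    · have hz : z ∈ ball w (15 * s) := by rw [mem_ball]; linarith [dist_triangle_right z w c]
      exact ⟨hd.differentiableAt (isOpen_ball.mem_nhds hz), (hb' z hz).2⟩
  · push Not at hw
    refine ⟨0, contDiff_const, fun x hx hxc => absurd (hw x hx) (by linarith), fun z _ => ⟨differentiableAt_const _, ?_⟩⟩
    rw [Pi.zero_apply, norm_zero]
    have := hM.nonneg z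
    positivity

/-- A smooth function `F` extends `f` up to a smooth multiple of `T`, with weighted bounds. -/
structure SmoothExtension (T f : Γ → ℂ) (φ q M : Γ → ℝ) (K r : ℝ) (F : Γ → ℂ) : Prop where
  smooth : C∞ F
  bound : ∀ z, ‖F z‖ ≤ K * M z * exp (φ z)
  near : ∀ x, T x = 0 → ∃ σ h : Γ → ℂ, C∞ σ ∧ Hol h (ball x r) ∧ h x = f x ∧
    ∀ z ∈ ball x r, F z = h z + T z * σ z ∧ ∀ j, ‖ð j σ z‖ ≤ K * M z * exp (φ z - q z)
  far : ∀ z, r ≤ infDist z (T ⁻¹' {0}) → ∀ j, ‖ð j F z‖ ≤ K * M z * exp (φ z - q z) * ‖T z‖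

lemma dbar_congr {f g : Γ → ℂ} {z : Γ} (h : f =ᶠ[𝓝 z] g) (v : Γ) : dbar v f z = dbar v g z := by
  unfold dbar
  rw [h.fderiv_eq]

lemma dbar_sum {ι : Type*} (s : Finset ι) {f : ι → Γ → ℂ} {z : Γ}
    (hf : ∀ i ∈ s, DifferentiableAt ℝ (f i) z) (v : Γ) :
    dbar v (fun y => ∑ i ∈ s, f i y) z = ∑ i ∈ s, dbar v (f i) z := by
  unfold dbar
  rw [fderiv_fun_sum hf]
  simp [mul_sum, ← sum_add_distrib, Finset.sum_div]

lemma FlatZero.exists_smoothExtension (hF : FlatZero T ε₀) {φ q : Γ → ℝ} {K₁ K₂ : ℝ}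
    (hK₁ : PHApprox φ K₁) (hK₂ : PHApprox (fun z => φ z - q z) K₂)
    (hlow : ∀ δ > 0, ∃ K, ∀ x, δ ≤ infDist x Z → exp (q x - K) ≤ ‖T x‖)
    {ε : ℝ} {M : Γ → ℝ} (hM : Slow ε M) (hε : ε ≤ 1) (hf : HolOn Z f)
    (hfM : ∀ w, T w = 0 → ‖f w‖ ≤ M w * exp (φ w)) :
    ∃ K r F, 0 ≤ K ∧ 0 < r ∧ SmoothExtension T f φ q M K r F := by
  obtain ⟨s, hs, hsε, hs1⟩ : ∃ s, 0 < s ∧ 45 * s < ε₀ ∧ 45 * s ≤ 1 := by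
    have := hF.flat.1
    refine ⟨min ε₀ 1 / 50, by positivity, ?_, ?_⟩
    · linarith [min_le_left ε₀ 1]
    · linarith [min_le_right ε₀ 1]
  obtain ⟨c, χ, D, hχ, hχ0, hχ1, hχs, hχD⟩ := exists_partition n hs
  choose h hh hhx hhz using fun k => hF.exists_local_family hK₁ hM hε hf hfM hs hsε hs1 (c k)
  obtain ⟨K', hK'⟩ := hlow s hs
  obtain ⟨K'', hK''⟩ := hlow (s / 2) (by positivity)
  set B := 3 * exp (2 * K₁)
  have hB0 : 0 ≤ B := by positivity
  set B₂ := 6 * B * exp (K' + 2 * K₂) with hB₂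
  set F := fun z => ∑' k, χ k z * h k z
  have hFR R N (hN : (∀ k ≥ N, ∀ z ∈ ball 0 R, χ k z = 0)) z (hz : z ∈ ball 0 R) : F z = ∑ k ∈ Finset.range N, χ k z * h k z := by
    refine tsum_eq_sum fun k hk => ?_
    rw [hN k (by simpa using hk) z hz, zero_mul]
  have hdχ0 k z (hz : 3 * s < dist z (c k)) v : dbar v (χ k) z = 0 := by
    have : χ k =ᶠ[𝓝 z] fun _ => 0 := by
      filter_upwards [(isOpen_lt continuous_const (continuous_id.dist continuous_const)).mem_nhds hz] with y hy
      exact hχ0 k y (le_of_lt hy)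
    rw [dbar_congr this]
    simp [dbar]
  have hD0 : ∀ j, 0 ≤ D := fun j => by simpa using hχD 0 0 j
  have hχd k z : DifferentiableAt ℝ (χ k) z := ((hχ k).differentiable (by simp)).differentiableAt
  have hhd k z : DifferentiableAt ℝ (h k) z := ((hh k).differentiable (by simp)).differentiableAt
  set D' := max D 0
  have hχD' N z j : ∑ k ∈ Finset.range N, ‖ð j (χ k) z‖ ≤ D' := (hχD N z j).trans (le_max_left _ _)
  have hD' : 0 ≤ D' := le_max_right _ _
  refine ⟨B + 3 * D' * B₂ + D' * B * exp K'', s / 2, F, by positivity, by positivity, ?_, fun z => ?_, fun x hx => ?_, fun z hz j => ?_⟩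
  · refine contDiff_iff_contDiffAt.2 fun z => ?_
    obtain ⟨N, hN, -⟩ := hχ1 (‖z‖ + 1)
    have : F =ᶠ[𝓝 z] fun z => ∑ k ∈ Finset.range N, χ k z * h k z := by
      filter_upwards [isOpen_ball.mem_nhds (show z ∈ ball 0 (‖z‖ + 1) by simp)] with y hy
      exact hFR _ N hN y hy
    exact (ContDiff.sum fun k _ => (hχ k).mul (hh k)).contDiffAt.congr_of_eventuallyEq this
  · obtain ⟨N, hN, -⟩ := hχ1 (‖z‖ + 1)
    rw [hFR _ N hN z (by simp)]
    have hMz := hM.nonneg z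
    calc _ ≤ ∑ k ∈ Finset.range N, ‖χ k z‖ * (B * M z * exp (φ z)) := by
          refine norm_sum_le_of_le _ fun k _ => ?_
          rw [norm_mul]
          by_cases hk : 3 * s ≤ dist z (c k)
          · simp [hχ0 k z hk]
          · exact mul_le_mul_of_nonneg_left (hhz k z (by linarith)).2 (norm_nonneg _)
      _ ≤ 1 * (B * M z * exp (φ z)) := by
          rw [← sum_mul]
          gcongr
          exact hχs N z
      _ ≤ _ := by
          rw [one_mul]
          gcongr
          have : 0 ≤ 3 * D' * B₂ + D' * B * exp K'' := by positivity
          linarith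
  · obtain ⟨h₀, hh₀, hb₀⟩ := hF.exists_local_extension hK₁ hM hε hf hfM (by positivity) hsε hs1 hx
    have hMx := hM.nonneg x
    have hq k : ∃ Q, C∞ Q ∧ (dist x (c k) < 5 * s →
        ∀ y ∈ ball x (s / 2), h k y - h₀ y = T y * Q y ∧ DifferentiableAt ℂ Q y ∧
          ‖Q y‖ ≤ B₂ * M x * exp (φ y - q y)) := by
      by_cases hk : dist x (c k) < 5 * s
      · obtain ⟨hd, hb⟩ := hhx k x hx hk
        have hsub : ball x (4 * s) ⊆ ball x (45 * s) := ball_subset_ball (by linarith)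
        obtain ⟨Q, hQ, hQb⟩ := hF.exists_weighted_quotient hK₂ hs (by linarith) (by linarith) hK' hx
          (hd.sub (hh₀.mono hsub)) (A := 6 * B * M x) (by positivity) fun y hy => by
            refine ⟨fun h0 => ?_, ?_⟩
            · rw [Pi.sub_apply, (hb y hy).1 h0, (hb₀ y (hsub hy)).1 h0, sub_self]
            · have h1 := hM.le_three hε (by rw [mem_ball] at hy; linarith)
              have h2 := (hb y hy).2
              calc _ ≤ B * M y * exp (φ y) + B * M y * exp (φ y) := (norm_sub_le _ _).trans (add_le_add h2 ((hb₀ y (hsub hy)).2))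
                _ = 2 * B * M y * exp (φ y) := by ring
                _ ≤ 2 * B * (3 * M x) * exp (φ y) := by gcongr
                _ = _ := by ring
        obtain ⟨Q', hQ', heq⟩ := exists_contDiff_eq (r := 2 * s / 3) (by positivity)
          (by rwa [show 3 * (2 * s / 3) = 2 * s by ring])
        refine ⟨Q', hQ', fun _ y hy => ?_⟩
        have hy1 : y ∈ ball x (2 * s / 3) := ball_subset_ball (by linarith) hy
        have hy2 : y ∈ ball x (2 * s) := ball_subset_ball (by linarith) hy
        have hev : Q' =ᶠ[𝓝 y] Q := by
          filter_upwards [isOpen_ball.mem_nhds hy1] with z hz using heq z (ball_subset_closedBall hz)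
        rw [hev.eq_of_nhds]
        refine ⟨(hQb y hy2).1, (hQ.differentiableAt (isOpen_ball.mem_nhds hy2)).congr_of_eventuallyEq hev,
          ((hQb y hy2).2 (ball_subset_ball (by linarith) hy)).trans_eq ?_⟩
        rw [hB₂]; ring
      · exact ⟨0, contDiff_const, fun h => absurd h hk⟩
    choose Q hQ hQb using hq
    obtain ⟨N, hN, hN1⟩ := hχ1 (‖x‖ + 1)
    have hsub : ball x (s / 2) ⊆ ball 0 (‖x‖ + 1) := ball_subset_ball' (by rw [dist_zero_right]; linarith)
    have hact y (hy : y ∈ ball x (s / 2)) k : dist x (c k) < 5 * s ∨ 3 * s < dist y (c k) := by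
      by_contra! hc
      rw [mem_ball'] at hy
      linarith [dist_triangle x y (c k)]
    refine ⟨fun y => ∑ k ∈ Finset.range N, χ k y * Q k y, h₀, ContDiff.sum fun k _ => (hχ k).mul (hQ k),
      hh₀.mono (ball_subset_ball (by linarith)), (hb₀ x (mem_ball_self (by positivity))).1 hx, fun y hy => ⟨?_, fun j => ?_⟩⟩
    · rw [hFR _ N hN y (hsub hy), ← one_mul (h₀ y), ← hN1 y (hsub hy), sum_mul, mul_sum, ← sum_add_distrib]
      refine sum_congr rfl fun k _ => ?_
      rcases hact y hy k with hk | hk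
      · linear_combination χ k y * (hQb k hk y hy).1
      · rw [hχ0 k y hk.le]; ring
    · rw [dbar_sum _ fun k _ => (hχd k y).fun_mul ((hQ k).differentiable (by simp)).differentiableAt]
      have h1 := hM.le_three hε (by rw [mem_ball'] at hy; linarith)
      have hMy := hM.nonneg y
      refine (norm_sum_le_of_le _ (fun k _ => (?_ : _ ≤ ‖ð j (χ k) y‖ *
        (B₂ * M x * exp (φ y - q y))))).trans ?_
      · rw [dbar_mul _ (hχd k y) ((hQ k).differentiable (by simp)).differentiableAt]
        rcases hact y hy k with hk | hk
        · rw [dbar_eq_zero (hQb k hk y hy).2.1, mul_zero, zero_add, norm_mul]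
          gcongr
          exact (hQb k hk y hy).2.2
        · rw [hχ0 k y hk.le, hdχ0 k y hk]
          simp
      · rw [← sum_mul]
        calc _ ≤ D' * (B₂ * (3 * M y) * exp (φ y - q y)) := by gcongr; exact hχD' N y j
          _ = 3 * D' * B₂ * M y * exp (φ y - q y) := by ring
          _ ≤ _ := by
              gcongr
              have : 0 ≤ B + D' * B * exp K'' := by positivity
              linarith
  · obtain ⟨N, hN, -⟩ := hχ1 (‖z‖ + 1)
    have hev : F =ᶠ[𝓝 z] fun z => ∑ k ∈ Finset.range N, χ k z * h k z := by
      filter_upwards [isOpen_ball.mem_nhds (by simp : z ∈ ball 0 (‖z‖ + 1))] with y hy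
      exact hFR _ N hN y hy
    rw [dbar_congr hev, dbar_sum _ fun k _ => (hχd k z).fun_mul (hhd k z)]
    have hMz := hM.nonneg z
    have hT := hK'' z hz
    refine (norm_sum_le_of_le _ (fun k _ => (?_ : _ ≤ ‖ð j (χ k) z‖ * (B * M z * exp (φ z))))).trans ?_
    · rw [dbar_mul _ (hχd k z) (hhd k z)]
      rcases le_or_gt (dist z (c k)) (3 * s) with hk | hk
      · rw [dbar_eq_zero (hhz k z hk).1, mul_zero, zero_add, norm_mul]
        gcongr
        exact (hhz k z hk).2
      · rw [hχ0 k z hk.le, hdχ0 k z hk]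
        simp
    · rw [← sum_mul]
      have h1 : exp (φ z) = exp K'' * exp (φ z - q z) * exp (q z - K'') := by
        rw [← exp_add, ← exp_add]; congr 1; ring
      calc _ ≤ D' * (B * M z * exp (φ z)) := by gcongr; exact hχD' N z j
        _ = D' * B * exp K'' * M z * exp (φ z - q z) * exp (q z - K'') := by rw [h1]; ring
        _ ≤ _ := by
            gcongr
            have : 0 ≤ B + 3 * D' * B₂ := by positivity
            linarith

lemma norm_le_of_forall_coord {v : Γ} {B : ℝ} (h : ∀ j, ‖v j‖ ≤ B) : ‖v‖ ≤ n * B := by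
  rw [sum_ee v]
  refine (norm_sum_le_of_le _ fun j _ => (?_ : _ ≤ B)).trans (by simp)
  rw [norm_smul, norm_ee, mul_one]
  exact h j

lemma FlatZero.nonempty (hF : FlatZero T ε₀) : (Z).Nonempty := by
  by_contra! h
  obtain ⟨hε, pr, -, hpr⟩ := hF.flat
  simp_all

lemma FlatZero.dense_ne_zero (hn : 1 ≤ n) (hF : FlatZero T ε₀) : Dense {x | T x ≠ 0} :=
  Measure.dense_of_ae (hF.ae_ne_zero hn)

/-- Division of `∂̄F` by `T` for a smooth extension `F`. -/
lemma SmoothExtension.exists_form (hn : 1 ≤ n) {T f : Γ → ℂ} (hF : FlatZero T ε₀) {φ q M : Γ → ℝ}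
    {K r : ℝ} {F : Γ → ℂ} (hX : SmoothExtension T f φ q M K r F) (hr : 0 < r) :
    ∃ g : Γ → Γ, Continuous g ∧ WeakClosed g ∧ (∀ z j, ð j F z = T z * g z j) ∧
      (∀ x, T x = 0 → ∃ σ h : Γ → ℂ, C∞ σ ∧ Hol h (ball x r) ∧ h x = f x ∧
        ∀ z ∈ ball x r, F z = h z + T z * σ z ∧ ∀ j, g z j = ð j σ z) ∧
      ∀ z, ‖g z‖ ≤ n * (K * M z * exp (φ z - q z)) := by
  classical
  choose! σ h hσ hh hhx hFz using hX.near
  have hTd z : DifferentiableAt ℝ T z := (hF.diff z).restrictScalars ℝ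
  have hTs : C∞ T := contDiff_of_differentiable hF.diff
  have hdF x (hx : T x = 0) z (hz : z ∈ ball x r) j : ð j F z = T z * ð j (σ x) z := by
    have hev : F =ᶠ[𝓝 z] fun z => h x z + T z * σ x z := by
      filter_upwards [isOpen_ball.mem_nhds hz] with y hy using (hFz x hx y hy).1
    have hhz := (hh x hx).differentiableAt (isOpen_ball.mem_nhds hz)
    have hσz : DifferentiableAt ℝ (σ x) z := ((hσ x hx).differentiable (by simp)).differentiableAt
    rw [dbar_congr hev, dbar_add _ (hhz.restrictScalars ℝ) ((hTd z).fun_mul hσz), dbar_eq_zero hhz, dbar_mul _ (hTd z) hσz,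
      dbar_eq_zero (hF.diff z)]
    ring
  have huniq x (hx : T x = 0) z (hz : z ∈ ball x r) (hz0 : T z = 0) j : ð j (σ z) z = ð j (σ x) z := by
    by_contra hne
    have hc x (hx : T x = 0) : Continuous (ð j (σ x)) :=
      (contDiff_dbar (m := 0) (hσ x hx) (by norm_num) _).continuous
    obtain ⟨y, ⟨⟨hy1, hy2⟩, hy3⟩, hy4⟩ := (hF.dense_ne_zero hn).inter_open_nonempty
      ((ball x r ∩ ball z r) ∩ {y | ð j (σ z) y ≠ ð j (σ x) y})
      ((isOpen_ball.inter isOpen_ball).inter (isOpen_ne_fun (hc z hz0) (hc x hx)))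
      ⟨z, ⟨hz, mem_ball_self hr⟩, hne⟩
    exact hy3 (mul_left_cancel₀ hy4 ((hdF z hz0 y hy2 j).symm.trans (hdF x hx y hy1 j)))
  set g := fun z => WithLp.toLp 2 fun j => if T z = 0 then ð j (σ z) z else (T z)⁻¹ * ð j F z
  have hgj z j : g z j = if T z = 0 then ð j (σ z) z else (T z)⁻¹ * ð j F z := rfl
  have hg1 x (hx : T x = 0) z (hz : z ∈ ball x r) j : g z j = ð j (σ x) z := by
    rw [hgj]
    split_ifs with h0
    · exact huniq x hx z hz h0 j
    · rw [hdF x hx z hz j, inv_mul_cancel_left₀ h0]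
  have hgF z j : ð j F z = T z * g z j := by
    by_cases h0 : T z = 0
    · rw [hdF z h0 z (mem_ball_self hr) j, h0, zero_mul, zero_mul]
    · rw [hgj, if_neg h0, mul_inv_cancel_left₀ h0]
  have hgs : ∀ j, C∞ fun z => g z j := by
    refine fun j => contDiff_iff_contDiffAt.2 fun z => ?_
    by_cases h0 : T z = 0
    · refine (contDiff_dbar (m := ∞) (hσ z h0) (by norm_num) (ee j)).contDiffAt.congr_of_eventuallyEq ?_
      filter_upwards [isOpen_ball.mem_nhds (mem_ball_self hr)] with y hy using hg1 z h0 y hy j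
    · refine ((hTs.contDiffAt.inv h0).mul (contDiff_dbar (m := ∞) hX.smooth (by norm_num) (ee j)).contDiffAt).congr_of_eventuallyEq ?_
      filter_upwards [(isOpen_ne_fun hTs.continuous continuous_const).mem_nhds h0] with y hy
      rw [hgj, if_neg hy]
      rfl
  have hgd j z : DifferentiableAt ℝ (fun z => g z j) z := ((hgs j).differentiable (by simp)).differentiableAt
  have hclosed z j k : ð k (fun z => g z j) z = ð j (fun z => g z k) z := by
    by_cases h0 : T z = 0
    · have hev j : (fun z => g z j) =ᶠ[𝓝 z] ð j (σ z) := by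
        filter_upwards [isOpen_ball.mem_nhds (mem_ball_self hr)] with y hy using hg1 z h0 y hy j
      rw [dbar_congr (hev j), dbar_congr (hev k)]
      exact dbar_dbar_comm ((hσ z h0).of_le (by norm_cast)) z _ _
    · have h1 j k : ð k (ð j F) z = T z * ð k (fun z => g z j) z := by
        rw [funext fun z => hgF z j, dbar_mul _ (hTd z) (hgd j z), dbar_eq_zero (hF.diff z)]
        ring
      have h2 := dbar_dbar_comm (hX.smooth.of_le (by norm_cast)) z (ee k) (ee j)
      rw [h1, h1] at h2
      exact mul_left_cancel₀ h0 h2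
  refine ⟨g, ?_, fun j k t ht => ?_, hgF, fun x hx => ⟨σ x, h x, hσ x hx, hh x hx, hhx x hx, fun z hz => ⟨(hFz x hx z hz).1, hg1 x hx z hz⟩⟩,
    fun z => norm_le_of_forall_coord fun j => ?_⟩
  · exact (PiLp.continuous_toLp 2 _).comp (continuous_pi fun j => (hgs j).continuous)
  · have h1 j : ContDiff ℝ 1 fun z => g z j := (hgs j).of_le (by norm_cast)
    rw [ibp_dbar (h1 j) (ht.smooth.of_le (by norm_cast)) ht.supp, ibp_dbar (h1 k) (ht.smooth.of_le (by norm_cast)) ht.supp]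
    simp [hclosed _ j k]
  · rcases lt_or_ge (infDist z (T ⁻¹' {0})) r with hz | hz
    · obtain ⟨x, hx, hzx⟩ := (infDist_lt_iff hF.nonempty).1 hz
      rw [hg1 x hx z hzx j]
      exact (hFz x hx z hzx).2 j
    · have h0 : T z ≠ 0 := fun h0 => by
        rw [infDist_zero_of_mem (show z ∈ T ⁻¹' {0} from h0)] at hz
        linarith
      have h1 := hX.far z hz j
      rw [hgF, norm_mul, mul_comm] at h1
      exact le_of_mul_le_mul_right h1 (norm_pos_iff.2 h0)

/-- A pointwise estimate for an entire function in terms of weighted local `L²` bounds. -/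
lemma norm_le_of_local_sq {F u : Γ → ℂ} (hF : Entire F) {φ ψ : Γ → ℝ} {K B A : ℝ} (hK : PHApprox φ K)
    {a : Γ} (hA : 0 ≤ A) (hB0 : 0 ≤ B)
    (hFu : ∀ᵐ x ∂(Λ).restrict (ball a 1), ‖F x‖ * exp (-φ x) ≤ A + ‖exp (-ψ x) • u x‖)
    (hi : IntegrableOn (fun x => ‖exp (-ψ x) • u x‖ ^ 2) (ball a 1) Λ)
    (hB : ∫ x in ball a 1, ‖exp (-ψ x) • u x‖ ^ 2 ∂Λ ≤ B * A ^ 2) :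
    ‖F a‖ ≤ exp (2 * K) * √(1 / radMass n (1 / 2) * (2 * ((Λ).real (ball 0 1) + B))) * A * exp (φ a) := by
  obtain ⟨H, hH, hHb⟩ := hK a
  set R := 1 / radMass n (1 / 2) with hR
  have hR0 : 0 ≤ R := one_div_nonneg.2 (radMass_pos (by norm_num)).le
  have h1 := enorm_rpow_le_lintegral_ball (r := 1 / 2) (by norm_num) (w := a)
    (hF.fun_mul hH.neg.cexp).differentiableOn (p := 2) (by norm_num)
  rw [show (2 : ℝ) * (1 / 2) = 1 by norm_num, ← hR] at h1
  have hfin : Λ (ball a 1) ≠ ⊤ := measure_ball_lt_top.ne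
  have hci : Integrable (fun _ => A ^ 2) ((Λ).restrict (ball a 1)) := integrableOn_const hfin
  have hGi : IntegrableOn (fun x => exp K ^ 2 * (2 * (A ^ 2 + ‖exp (-ψ x) • u x‖ ^ 2))) (ball a 1) Λ :=
    ((hci.add hi).const_mul 2).const_mul _
  have h2 : ∫⁻ y in ball a 1, ‖F y * Complex.exp (-H y)‖ₑ ^ (2 : ℝ) ∂Λ ≤
      ofReal (∫ x in ball a 1, exp K ^ 2 * (2 * (A ^ 2 + ‖exp (-ψ x) • u x‖ ^ 2)) ∂Λ) := by
    rw [ofReal_integral_eq_lintegral_ofReal hGi (ae_of_all _ fun x => by positivity)]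
    refine lintegral_mono_ae ?_
    filter_upwards [hFu, ae_restrict_mem measurableSet_ball] with x hx hxa
    have h3 := abs_le.1 (hHb x (ball_subset_ball (by norm_num) hxa))
    have h4 : ‖F x * Complex.exp (-H x)‖ ≤ exp K * (A + ‖exp (-ψ x) • u x‖) := by
      rw [norm_mul, norm_exp, neg_re]
      calc _ ≤ ‖F x‖ * (exp K * exp (-φ x)) := by rw [← exp_add]; gcongr; linarith
        _ = exp K * (‖F x‖ * exp (-φ x)) := by ring
        _ ≤ _ := by gcongr
    rw [← ofReal_norm, ENNReal.rpow_two, ← ofReal_pow (norm_nonneg _)]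
    refine ofReal_le_ofReal ?_
    calc _ ≤ (exp K * (A + ‖exp (-ψ x) • u x‖)) ^ 2 := by gcongr
      _ ≤ _ := by
        rw [mul_pow]
        gcongr
        nlinarith [sq_nonneg (A - ‖exp (-ψ x) • u x‖)]
  have h5 : ∫ x in ball a 1, exp K ^ 2 * (2 * (A ^ 2 + ‖exp (-ψ x) • u x‖ ^ 2)) ∂Λ ≤
      exp K ^ 2 * (2 * ((Λ).real (ball 0 1) + B)) * A ^ 2 := by
    rw [integral_const_mul, integral_const_mul, integral_add hci hi, setIntegral_const,
      Measure.real, Measure.addHaar_ball_center, ← Measure.real, smul_eq_mul]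
    calc _ ≤ exp K ^ 2 * (2 * ((Λ).real (ball 0 1) * A ^ 2 + B * A ^ 2)) := by gcongr
      _ = _ := by ring
  have hS : 0 ≤ R * (2 * ((Λ).real (ball 0 1) + B)) := by positivity
  have h6 : ‖F a * Complex.exp (-H a)‖ ≤ exp K * √(R * (2 * ((Λ).real (ball 0 1) + B))) * A := by
    refine le_of_sq_le_sq ?_ (by positivity)
    have h7 := h1.trans (mul_le_mul_right (h2.trans (ofReal_le_ofReal h5)) _)
    rw [← ofReal_norm, ENNReal.rpow_two, ← ofReal_pow (norm_nonneg _), ← ofReal_mul hR0,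
      ofReal_le_ofReal_iff (by positivity)] at h7
    refine h7.trans_eq ?_
    rw [mul_pow, mul_pow, sq_sqrt hS]
    ring
  have h7 := abs_le.1 (hHb a (mem_ball_self (by norm_num)))
  rw [norm_mul, norm_exp, neg_re] at h6
  calc ‖F a‖ = ‖F a‖ * exp (-(H a).re) * exp (H a).re := by
        rw [mul_assoc, ← exp_add, neg_add_cancel, Real.exp_zero, mul_one]
    _ ≤ (exp K * √(R * (2 * ((Λ).real (ball 0 1) + B))) * A) * exp (K + φ a) := by
        gcongr
        linarith
    _ = _ := by rw [exp_add, two_mul K, exp_add]; ring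

/-- Ohsawa–Takegoshi type extension from a uniformly flat hypersurface with pointwise weighted bounds. -/
theorem FlatZero.exists_extension (hn : 1 ≤ n) (hF : FlatZero T ε₀) {φ q : Γ → ℝ} {K₁ K₂ c : ℝ}
    (hK₁ : PHApprox φ K₁) (hK₂ : PHApprox (fun z => φ z - q z) K₂) (hψ : C∞ fun z => φ z - q z) (hc : 0 < c)
    (hψc : ∀ z v, c * ‖v‖ ^ 2 ≤ levi (fun z => φ z - q z) z v) (hTq : ∀ z, ‖T z‖ ≤ exp (q z))
    (hlow : ∀ δ > 0, ∃ K, ∀ x, δ ≤ infDist x Z → exp (q x - K) ≤ ‖T x‖) :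
    ∃ ε > 0, ∀ M, Slow ε M → ∀ f, HolOn Z f → (∀ w, T w = 0 → ‖f w‖ ≤ M w * exp (φ w)) →
      ∃ F, ∃ K ≥ 0, Entire F ∧ (∀ w, T w = 0 → F w = f w) ∧ ∀ z, ‖F z‖ ≤ K * M z * exp (φ z) := by
  obtain ⟨ε, hε, B, hB, hsol⟩ := exists_weighted_solution n hc
  refine ⟨min ε 1, by positivity, fun M hM f hf hfM => ?_⟩
  have hM1 a z : M z ≤ M a * exp (ε * ‖z - a‖) := (hM.le_exp a z).trans (by
    have := hM.nonneg a
    gcongr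
    exact min_le_left _ _)
  obtain ⟨K, r, F₀, hK0, hr, hX⟩ := hF.exists_smoothExtension hK₁ hK₂ hlow hM (min_le_right _ _) hf hfM
  obtain ⟨g, hgc, hgcl, hgT, hgx, hgb⟩ := hX.exists_form hn hF hr
  obtain ⟨u, hu, hug, hub⟩ := hsol _ hψ hψc g hgc hgcl (fun z => n * K * M z) (fun a z => by
      rw [mul_assoc _ (M a)]
      exact mul_le_mul_of_nonneg_left (hM1 a z) (by positivity))
    (fun z => by
      rw [← le_div_iff₀ (exp_pos _), exp_neg, div_inv_eq_mul]
      exact (hgb z).trans_eq (by ring))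
  have hTs : C∞ T := contDiff_of_differentiable hF.diff
  have hTu : LocallyIntegrable (fun x => T x * u x) Λ := hu.continuous_mul hF.diff.continuous
  have hTd z : DifferentiableAt ℝ T z := (hF.diff z).restrictScalars ℝ
  set v := fun x => F₀ x - T x * u x
  have hv : LocallyIntegrable v Λ := (hX.smooth.continuous.locallyIntegrable).sub hTu
  have hvh : WeakHol v := fun j t ht => by
    have h1 := hug j _ (IsTest.mul_left hTs ht)
    have h2 := ibp_dbar (hX.smooth.of_le (by norm_cast)) (ht.smooth.of_le (by norm_cast)) ht.supp (ee j)
    have h3 x : ð j (fun x => T x * t x) x = T x * ð j t x := by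
      rw [dbar_mul _ (hTd x) (ht.differentiable x), dbar_eq_zero (hF.diff x)]; ring
    have h4 := ht.dbar (ee j)
    simp [v, sub_mul]
    rw [integral_sub (integrable_mul_test hX.smooth.continuous.locallyIntegrable h4.continuous h4.supp)
      (integrable_mul_test hTu h4.continuous h4.supp), h2]
    simp [h3] at h1
    simp [hgT]
    have h5 x : T x * u x * ð j t x = u x * (T x * ð j t x) := by ring
    have h6 x : T x * g x j * t x = g x j * (T x * t x) := by ring
    simp [h5, h6, h1]
  obtain ⟨hFd, hFv⟩ := weyl_global hv hvh
  set F := mconv 1 v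
  set A := max (3 * K) (n * K)
  refine ⟨F, exp (2 * K₁) * √(1 / radMass n (1 / 2) * (2 * ((Λ).real (ball 0 1) + B))) * A, ?_, hFd, fun x hx => ?_,
    fun a => ?_⟩
  · have : 0 ≤ A := le_max_of_le_left (by positivity)
    positivity
  · obtain ⟨σ, h, hσ, hh, hhx, hFσ⟩ := hgx x hx
    obtain ⟨hd, hae⟩ := weyl_local (u := fun y => σ y - u y) (hσ.continuous.locallyIntegrable.sub hu) hr (w := x)
      (fun j t ht hts => by
        have h1 := hug j t ht
        have h2 := ibp_dbar (hσ.of_le (by norm_cast)) (ht.smooth.of_le (by norm_cast)) ht.supp (ee j)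
        have h4 := ht.dbar (ee j)
        simp only [sub_mul]
        rw [integral_sub (integrable_mul_test hσ.continuous.locallyIntegrable h4.continuous h4.supp)
          (integrable_mul_test hu h4.continuous h4.supp), h1, h2, sub_eq_zero, neg_inj]
        refine integral_congr_ae (ae_of_all _ fun y => ?_)
        by_cases hy : y ∈ ball x r
        · dsimp only
          rw [(hFσ y hy).2 j]
        · have : t y = 0 := image_eq_zero_of_notMem_tsupport fun h => hy (hts h)
          simp only [this, mul_zero]) (ε := r / 16) (by positivity) le_rfl
    have hx2 : x ∈ ball x (r / 2) := mem_ball_self (by positivity)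
    have hsub : ball x (r / 2) ⊆ ball x r := ball_subset_ball (by linarith)
    have heq : EqOn F (fun y => h y + T y * mconv (r / 16) (fun y => σ y - u y) y) (ball x (r / 2)) := by
      refine Measure.eqOn_open_of_ae_eq (μ := Λ) ?_ isOpen_ball hFd.continuous.continuousOn
        ((hh.mono hsub).continuousOn.add (hF.diff.continuous.continuousOn.mul hd.continuousOn))
      filter_upwards [ae_restrict_mem measurableSet_ball, ae_restrict_of_ae hae, ae_restrict_of_ae hFv] with y hy h1 h2
      rw [← h2, ← h1 hy]
      simp [v]
      rw [(hFσ y (hsub hy)).1]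
      ring
    rw [heq hx2]
    dsimp only
    rw [hx, zero_mul, add_zero, hhx]
  · have hMa := hM.nonneg a
    have hA : 0 ≤ A * M a := mul_nonneg (le_max_of_le_left (by positivity)) hMa
    refine (norm_le_of_local_sq (u := u) (ψ := fun z => φ z - q z) hFd hK₁ hA hB ?_ (hub a).1
      ((hub a).2.trans ?_)).trans_eq (by ring)
    · filter_upwards [ae_restrict_mem measurableSet_ball, ae_restrict_of_ae hFv] with x hx hxv
      rw [← hxv]
      have h1 := hM.le_three (min_le_right _ _) (le_of_lt hx)
      have h2 : ‖F₀ x‖ * exp (-φ x) ≤ A * M a := by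
        rw [← le_div_iff₀ (exp_pos _), exp_neg, div_inv_eq_mul]
        refine (hX.bound x).trans ?_
        refine mul_le_mul_of_nonneg_right ?_ (Real.exp_nonneg _)
        calc K * M x ≤ K * (3 * M a) := by gcongr
          _ = 3 * K * M a := by ring
          _ ≤ _ := by gcongr; exact le_max_left _ _
      have h3 : ‖T x * u x‖ * exp (-φ x) ≤ ‖exp (-(φ x - q x)) • u x‖ := by
        rw [norm_mul, norm_smul, norm_of_nonneg (Real.exp_nonneg _), neg_sub, sub_eq_add_neg, exp_add]
        calc _ ≤ exp (q x) * ‖u x‖ * exp (-φ x) := by gcongr; exact hTq x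
          _ = _ := by ring
      calc _ ≤ (‖F₀ x‖ + ‖T x * u x‖) * exp (-φ x) := by gcongr; exact norm_sub_le _ _
        _ ≤ _ := by rw [add_mul]; exact add_le_add h2 h3
    · gcongr
      exact le_max_right _ _

lemma mconv_sub_le_of_levi_le (hφ : C² φ) {C : ℝ} (h0 : ∀ z v, 0 ≤ levi φ z v)
    (hC : ∀ z v, levi φ z v ≤ C * ‖v‖ ^ 2) (hr : 0 < r) (z : Γ) :
    mconv r φ z - φ z ≤ 4 * (n * ∫ y : Γ, C * pot r y ∂Λ) := by
  refine mconv_sub_le hφ h0 hr fun t ht j => ?_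
  refine integral_mono_of_nonneg (ae_of_all _ fun y =>
    mul_nonneg (mul_nonneg ht.1.le (h0 _ _)) (pot_nonneg hr y))
    (((contDiff_pot r).continuous.integrable_of_hasCompactSupport (hasCompactSupport_pot hr)).const_mul _)
    (ae_of_all _ fun y => ?_)
  refine mul_le_mul_of_nonneg_right ?_ (pot_nonneg hr y)
  have h1 := hC (z + t • y) (ee j)
  rw [norm_ee] at h1
  nlinarith [h0 (z + t • y) (ee j), ht.2]

lemma levi_avgBall_nonneg (hφ : C² φ) (h0 : ∀ z v, 0 ≤ levi φ z v) (r : ℝ)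
    (z v : Γ) : 0 ≤ levi (avgBall φ r) z v := by
  rw [levi_avgBall hφ]
  exact mul_nonneg (by positivity) (integral_nonneg fun x => h0 x v)

/-- Extension from a hypersurface of density less than one with a slowly varying bound, for a
smooth weight at bounded distance from the given one. -/
lemma FlatZero.exists_slow_extension (hn : 1 ≤ n) (hF : FlatZero T ε₀)
    (hφ : C² φ) {C C' : ℝ} (hC : 0 < C) (hC' : 0 < C')
    (hlow : ∀ z v, C * ‖v‖ ^ 2 ≤ levi φ z v) (hhigh : ∀ z v, levi φ z v ≤ C' * ‖v‖ ^ 2)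
    {κ r₀ : ℝ} (hκ : κ < 1)
    (hdens : ∀ r ≥ r₀, ∀ z v, Upsilon T Z r z v ≤ κ * levi (avgBall φ r) z v) :
    ∃ (χ : Γ → ℝ) (K₀ K : ℝ), PHApprox χ K ∧ (∀ z, φ z ≤ χ z) ∧ (∀ z, χ z ≤ φ z + K₀) ∧
      ∃ ε > 0, ∀ M, Slow ε M → ∀ f, HolOn Z f → (∀ w, T w = 0 → ‖f w‖ ≤ M w * exp (χ w)) →
        ∃ F, ∃ K ≥ 0, Entire F ∧ (∀ w, T w = 0 → F w = f w) ∧ ∀ z, ‖F z‖ ≤ K * M z * exp (χ z) := by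
  have h0 z v : 0 ≤ levi φ z v := (by positivity : 0 ≤ C * ‖v‖ ^ 2).trans (hlow z v)
  set r := max r₀ 1
  have hr : 0 < r := zero_lt_one.trans_le (le_max_right _ _)
  obtain ⟨q, hq, hq0, hql, hTq, hqlow⟩ := hF.exists_potential hn hφ h0 hhigh (le_max_right κ 0)
    (fun r hr z v => (hdens r hr z v).trans
      (mul_le_mul_of_nonneg_right (le_max_left κ 0) (levi_avgBall_nonneg hφ h0 r z v)))
    hr (le_max_left _ _)
  have hk1 : max κ 0 < 1 := max_lt hκ one_pos
  have hχ : C∞ (mconv r φ) := contDiff_mconv hr hφ.continuous.locallyIntegrable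
  have hχ2 : C² (mconv r φ) := hχ.of_le (by norm_cast)
  have hq2 : C² q := hq.of_le (by norm_cast)
  have hχl := le_levi_mconv hφ hlow hr
  have hχu := levi_mconv_le hφ hhigh hr
  have hχ0 z v : 0 ≤ levi (mconv r φ) z v := (by positivity : 0 ≤ C * ‖v‖ ^ 2).trans (hχl z v)
  obtain ⟨K, hK⟩ := exists_pluriharmonic_approx n hC'.le
  have hψl z v : (1 - max κ 0) * C * ‖v‖ ^ 2 ≤ levi (fun z => mconv r φ z - q z) z v := by
    rw [levi_sub hχ2 hq2]
    nlinarith [hql z v, mul_le_mul_of_nonneg_left (hχl z v) (sub_nonneg.2 hk1.le)]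
  have hc : 0 < (1 - max κ 0) * C := mul_pos (sub_pos.2 hk1) hC
  have hPχ : PHApprox (mconv r φ) K := hK _ hχ hχ0 hχu
  have hPψ : PHApprox (fun z => mconv r φ z - q z) K := hK _ (hχ.sub hq)
    (fun z v => (by positivity : 0 ≤ (1 - max κ 0) * C * ‖v‖ ^ 2).trans (hψl z v)) fun z v => by
      rw [levi_sub hχ2 hq2]
      linarith [hχu z v, hq0 z v]
  exact ⟨mconv r φ, _, K, hPχ, sub_mean hφ h0 hr,
    fun z => sub_le_iff_le_add'.1 (mconv_sub_le_of_levi_le hφ h0 hhigh hr z),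
    hF.exists_extension hn hPχ hPψ (hχ.sub hq) hc hψl hTq hqlow⟩

lemma jap_comm (a z : Γ) : jap a z = jap z a := by simp only [jap, norm_sub_rev]

/-- The `L^p` average against an exponential kernel. -/
def expAvg (μ : Measure Γ) (c p : ℝ) (g : Γ → ℝ≥0∞) (z : Γ) : ℝ :=
  (∫⁻ w, ofReal (exp (-(c * p * jap z w))) * g w ∂μ).toReal ^ p⁻¹

lemma lintegral_exp_jap_lt_top {μ : Measure Γ} {c : ℝ} (hc : 0 ≤ c) {g : Γ → ℝ≥0∞}
    (hg : ∫⁻ w, g w ∂μ < ⊤) (z : Γ) :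
    ∫⁻ w, ofReal (exp (-(c * jap z w))) * g w ∂μ < ⊤ := by
  refine (lintegral_mono fun w => ?_).trans_lt hg
  refine (mul_le_mul_left (ENNReal.ofReal_le_one.2 (Real.exp_le_one_iff.2 ?_)) _).trans_eq (one_mul _)
  exact neg_nonpos.2 (mul_nonneg hc (zero_le_one.trans (one_le_jap z w)))

lemma slow_expAvg {μ : Measure Γ} {c p : ℝ} (hc : 0 ≤ c) (hp : 0 < p) {g : Γ → ℝ≥0∞}
    (hg : ∫⁻ w, g w ∂μ < ⊤) : Slow c (expAvg μ c p g) where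
  nonneg z := by unfold expAvg; positivity
  le_exp a z := by
    have hcp : 0 ≤ c * p := by positivity
    have h1 : ∫⁻ w, ofReal (exp (-(c * p * jap z w))) * g w ∂μ ≤ ofReal (exp (c * p * ‖z - a‖)) *
          ∫⁻ w, ofReal (exp (-(c * p * jap a w))) * g w ∂μ := by
      rw [← lintegral_const_mul' _ _ ofReal_ne_top]
      refine lintegral_mono fun w => ?_
      rw [← mul_assoc, ← ofReal_mul (exp_pos _).le, ← exp_add]
      refine mul_le_mul_left (ofReal_le_ofReal (exp_le_exp.2 ?_)) _
      have h2 := jap_sub_le a z w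
      rw [norm_sub_rev] at h2
      nlinarith
    have h3 := toReal_mono (mul_ne_top ofReal_ne_top (lintegral_exp_jap_lt_top hcp hg a).ne) h1
    rw [toReal_mul, toReal_ofReal (exp_pos _).le] at h3
    unfold expAvg
    refine (Real.rpow_le_rpow toReal_nonneg h3 (by positivity)).trans_eq ?_
    rw [mul_rpow (exp_pos _).le toReal_nonneg, mul_comm, ← Real.exp_mul]
    grind

lemma expAvg_rpow {μ : Measure Γ} {c p : ℝ} (hc : 0 ≤ c) (hp : 0 < p) {g : Γ → ℝ≥0∞}
    (hg : ∫⁻ w, g w ∂μ < ⊤) (z : Γ) : ofReal (expAvg μ c p g z ^ p) =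
      ∫⁻ w, ofReal (exp (-(c * p * jap z w))) * g w ∂μ := by
  rw [expAvg, ← Real.rpow_mul toReal_nonneg, inv_mul_cancel₀ hp.ne', Real.rpow_one,
    ENNReal.ofReal_toReal (lintegral_exp_jap_lt_top (by positivity) hg z).ne]

lemma lintegral_exp_jap_le {c : ℝ} (hc : 0 ≤ c) (w : Γ) : ∫⁻ z, ofReal (exp (-(c * jap z w))) ∂Λ ≤
      ∫⁻ z, ofReal (exp (-(c * ‖z - 0‖))) ∂Λ := by
  rw [← lintegral_sub_right_eq_self (μ := Λ) (fun z => ofReal (exp (-(c * ‖z - 0‖)))) w]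
  refine lintegral_mono fun z => ofReal_le_ofReal (exp_le_exp.2 ?_)
  rw [sub_zero, norm_sub_rev]
  exact neg_le_neg (mul_le_mul_of_nonneg_left (norm_le_jap z w) hc)

lemma lintegral_expAvg_lt_top {μ : Measure Γ} [SFinite μ] {c p : ℝ} (hc : 0 < c) (hp : 0 < p)
    {g : Γ → ℝ≥0∞} (hgm : AEMeasurable g μ) (hg : ∫⁻ w, g w ∂μ < ⊤) :
    ∫⁻ z, ofReal (expAvg μ c p g z ^ p) ∂Λ < ⊤ := by
  simp_rw [expAvg_rpow hc.le hp hg]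
  have hcp : 0 < c * p := by positivity
  have hm : Continuous fun x : Γ × Γ => ofReal (exp (-(c * p * jap x.1 x.2))) := by
    unfold jap
    exact ENNReal.continuous_ofReal.comp (by fun_prop)
  rw [lintegral_lintegral_swap (hm.aemeasurable.mul (hgm.comp_quasiMeasurePreserving
    Measure.quasiMeasurePreserving_snd))]
  set D := ∫⁻ z, ofReal (exp (-(c * p * ‖z - 0‖))) ∂Λ
  have hD : D ≠ ⊤ := (integrable_exp_neg_norm hcp 0).lintegral_lt_top.ne
  refine lt_of_le_of_lt (b := ∫⁻ w, D * g w ∂μ) (lintegral_mono fun w => ?_) ?_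
  · have hmw : Continuous fun z => ofReal (exp (-(c * p * jap z w))) :=
      ENNReal.continuous_ofReal.comp (by simp_rw [jap_comm _ w]; have := (contDiff_jap w).continuous; fun_prop)
    rw [lintegral_mul_const _ hmw.measurable]
    exact mul_le_mul_left (lintegral_exp_jap_le hcp.le w) _
  · rw [lintegral_const_mul' _ _ hD]
    exact mul_lt_top hD.lt_top hg

/-- Pointwise values on a flat hypersurface are controlled by exponential `L^p` averages. -/
lemma FlatZero.norm_le_expAvg (hn : 1 ≤ n) (hF : FlatZero T ε₀) {φ χ : Γ → ℝ}
    {K : ℝ} (hχ : PHApprox χ K) (hle : ∀ z, φ z ≤ χ z) {c p : ℝ} (hc : 0 < c) (hp : 1 ≤ p) :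
    ∃ A ≥ 0, ∀ f, HolOn Z f →
      ∫⁻ w in Z, ofReal (‖f w‖ ^ p * exp (-(p * φ w))) ∂μH[(2 * n - 2 : ℝ)] < ⊤ →
      ∀ w, T w = 0 → ‖f w‖ ≤ A * expAvg (μH[(2 * n - 2 : ℝ)].restrict Z) c p
        (fun w => ofReal (‖f w‖ ^ p * exp (-(p * φ w)))) w * exp (χ w) := by
  obtain ⟨B, hB, hmv⟩ := hF.mean_value hn one_pos hp
  have hp0 := one_pos.trans_le hp
  have hcp := mul_pos hc hp0
  refine ⟨(B.toReal * exp (p * K + c * p * 2)) ^ p⁻¹ * exp K, by positivity, fun f hf hfp w hw => ?_⟩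
  obtain ⟨H, hH, hHχ⟩ := hχ w
  set μ := μH[(2 * n - 2 : ℝ)].restrict Z
  set g := fun w => ofReal (‖f w‖ ^ p * exp (-(p * φ w))) with hg
  set N := ∫⁻ y, ofReal (exp (-(c * p * jap w y))) * g y ∂μ with hN
  have hNt := lintegral_exp_jap_lt_top hcp.le hfp w
  have hE := hH.neg.cexp
  have hnE y : ‖Complex.exp (-H y)‖ = exp (-(H y).re) := by rw [norm_exp, neg_re]
  have h1 := hmv w hw _ (HolOn.mul_entire hf hE)
  have h2 : ∫⁻ y in Z ∩ ball w 1, ‖f y * Complex.exp (-H y)‖ₑ ^ p ∂μH[(2 * n - 2 : ℝ)] ≤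
      ofReal (exp (p * K + c * p * 2)) * N := by
    rw [← lintegral_const_mul' _ _ ofReal_ne_top]
    refine (setLIntegral_mono' (hF.isClosed.measurableSet.inter measurableSet_ball) fun y hy => ?_).trans
      (lintegral_mono_set inter_subset_left)
    have hd : dist y w < 1 := hy.2
    have h3 := (abs_le.1 (hHχ y (ball_subset_ball one_le_two hy.2))).2
    have h4 := jap_le w y
    rw [← dist_eq_norm] at h4
    rw [← mul_assoc, ← ofReal_norm, ENNReal.ofReal_rpow_of_nonneg (norm_nonneg _) hp0.le,
      ← ofReal_mul (exp_pos _).le, ← ofReal_mul (by positivity), norm_mul, hnE,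
      mul_rpow (norm_nonneg _) (exp_pos _).le, ← Real.exp_mul, mul_left_comm, ← exp_add,
      ← exp_add]
    refine ofReal_le_ofReal (mul_le_mul_of_nonneg_left (exp_le_exp.2 ?_) (by positivity))
    nlinarith [hle y]
  have h3 : ‖f w * Complex.exp (-H w)‖ ^ p ≤ B.toReal * exp (p * K + c * p * 2) * N.toReal := by
    have h4 := toReal_mono (mul_ne_top hB (mul_ne_top ofReal_ne_top hNt.ne)) (h1.trans (mul_le_mul_right h2 _))
    rwa [toReal_mul, toReal_mul, toReal_ofReal (exp_pos _).le, ← ENNReal.toReal_rpow, toReal_enorm, ← mul_assoc] at h4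
  have h4 : ‖f w * Complex.exp (-H w)‖ ≤ (B.toReal * exp (p * K + c * p * 2)) ^ p⁻¹ * expAvg μ c p g w := by
    have h5 := Real.rpow_le_rpow (by positivity) h3 (inv_nonneg.2 hp0.le)
    rwa [← Real.rpow_mul (norm_nonneg _), mul_inv_cancel₀ hp0.ne', Real.rpow_one,
      mul_rpow (by positivity) toReal_nonneg] at h5
  rw [norm_mul, hnE, exp_neg, ← div_eq_mul_inv, div_le_iff₀ (exp_pos _)] at h4
  refine h4.trans ?_
  rw [mul_right_comm _ (exp K), mul_assoc _ (exp K), ← exp_add]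
  have h6 := (slow_expAvg hc.le hp0 hfp).nonneg w
  refine mul_le_mul_of_nonneg_left (exp_le_exp.2 ?_) (by positivity)
  linarith [(abs_le.1 (hHχ w (mem_ball_self two_pos))).1]

lemma Slow.const_mul {ε A : ℝ} {M : Γ → ℝ} (hM : Slow ε M) (hA : 0 ≤ A) : Slow ε fun z => A * M z where
  nonneg z := mul_nonneg hA (hM.nonneg z)
  le_exp a z := by
    rw [mul_assoc]
    exact mul_le_mul_of_nonneg_left (hM.le_exp a z) hA

lemma slow_const {ε A : ℝ} (hε : 0 ≤ ε) (hA : 0 ≤ A) : Slow ε fun _ : Γ => A where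
  nonneg _ := hA
  le_exp _ _ := le_mul_of_one_le_right hA (Real.one_le_exp (by positivity))

lemma norm_le_mul_exp_of_le {F : Γ → ℂ} {φ χ M : Γ → ℝ} {K K₀ : ℝ} (hK : 0 ≤ K)
    (hM0 : ∀ z, 0 ≤ M z) (hχ : ∀ z, χ z ≤ φ z + K₀) (hF : ∀ z, ‖F z‖ ≤ K * M z * exp (χ z)) (z : Γ) :
    ‖F z‖ ≤ K * exp K₀ * M z * exp (φ z) := by
  refine (hF z).trans ?_
  have := hM0 z
  rw [mul_right_comm K _ (M z), mul_assoc _ (exp K₀), ← exp_add]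
  refine mul_le_mul_of_nonneg_left (exp_le_exp.2 ?_) (by positivity)
  linarith [hχ z]

lemma lintegral_lt_top_of_norm_le {F : Γ → ℂ} {φ χ M : Γ → ℝ} {K K₀ p : ℝ} (hp : 0 ≤ p) (hK : 0 ≤ K)
    (hM0 : ∀ z, 0 ≤ M z) (hχ : ∀ z, χ z ≤ φ z + K₀) (hF : ∀ z, ‖F z‖ ≤ K * M z * exp (χ z))
    (hM : ∫⁻ z, ofReal (M z ^ p) ∂Λ < ⊤) :
    ∫⁻ z, ofReal (‖F z‖ ^ p * exp (-(p * φ z))) ∂Λ < ⊤ := by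
  refine lt_of_le_of_lt (b := ofReal ((K * exp K₀) ^ p) *
    ∫⁻ z, ofReal (M z ^ p) ∂Λ) ?_ (mul_lt_top ENNReal.ofReal_lt_top hM)
  rw [← lintegral_const_mul' _ _ ofReal_ne_top]
  refine lintegral_mono fun z => ?_
  rw [← ofReal_mul (by positivity)]
  refine ofReal_le_ofReal ?_
  rw [← mul_rpow (by positivity) (hM0 z), ← mul_neg, mul_comm p, Real.exp_mul,
    ← mul_rpow (norm_nonneg _) (exp_pos _).le]
  refine Real.rpow_le_rpow (by positivity) ?_ hp
  rw [exp_neg, ← div_eq_mul_inv, div_le_iff₀ (exp_pos _)]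
  exact norm_le_mul_exp_of_le hK hM0 hχ hF z

end SCV

/-- **Theorem 1 (Interpolation).**  Let `n ≥ 1`, `1 ≤ p ≤ ∞`, let `φ` be a `C²`
plurisubharmonic weight with `Cω ≤ i∂∂̄φ ≤ C'ω`, and let `W = T⁻¹(0)` be a uniformly flat
smooth closed complex hypersurface whose upper density satisfies `D⁺(W) < 1`
(here `D⁺(W) < 1` is unfolded: there are `κ < 1` and `r₀` such that for all `r ≥ r₀`,
all `z` and all directions `v`, `Υ_W(z,r)(v,v) ≤ κ · i∂∂̄φ_r(z)(v,v)`).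
Then `W` is an interpolation hypersurface: every `f ∈ bf^p_φ(W)` extends to some
`F ∈ BF^p_φ(ℂⁿ)`. -/
theorem interpolation_hypersurface
    (n : ℕ) (hn : 1 ≤ n) (p : ℝ≥0∞) (hp : 1 ≤ p)
    (φ : En n → ℝ) (hφ : ContDiff ℝ 2 φ)
    (C C' : ℝ) (hC : 0 < C) (hC' : 0 < C')
    (hlow : ∀ z v : En n, C * ‖v‖ ^ 2 ≤ levi φ z v)
    (hhigh : ∀ z v : En n, levi φ z v ≤ C' * ‖v‖ ^ 2)
    (T : En n → ℂ) (hT : Differentiable ℂ T)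
    (W : Set (En n)) (hWT : W = T ⁻¹' {0})
    (hdT : ∀ z ∈ W, fderiv ℂ T z ≠ 0)
    (hflat : UniformlyFlat W)
    (hdens : ∃ κ < (1 : ℝ), ∃ r₀ : ℝ, ∀ r ≥ r₀, ∀ z v : En n,
      Upsilon T W r z v ≤ κ * levi (avgBall φ r) z v)
    (f : En n → ℂ) (hf : HolOn W f)
    (hfW : wNorm p φ (surf n W) W f < ⊤) :
    ∃ F : En n → ℂ, Differentiable ℂ F ∧ Set.EqOn F f W ∧
      wNorm p φ (vol n) Set.univ F < ⊤ := by
  subst hWT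
  obtain ⟨ε₀, hε₀⟩ := hflat
  obtain ⟨κ, hκ, r₀, hdens⟩ := hdens
  have hF : SCV.FlatZero T ε₀ := ⟨hT, hdT, hε₀⟩
  obtain ⟨χ, K₀, K₁, hPχ, hφχ, hχφ, ε, hε, hext⟩ :=
    hF.exists_slow_extension hn hφ hC hC' hlow hhigh hκ hdens
  unfold wNorm at hfW ⊢
  split_ifs at hfW ⊢ with hpt
  · set S := ⨆ z ∈ T ⁻¹' {0}, ENNReal.ofReal (‖f z‖ * Real.exp (-φ z))
    have hS : ∀ w, T w = 0 → ‖f w‖ ≤ S.toReal * Real.exp (χ w) := fun w hw => by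
      have h1 : ENNReal.ofReal (‖f w‖ * Real.exp (-φ w)) ≤ S :=
        le_iSup₂ (f := fun z (_ : z ∈ T ⁻¹' {0}) => ENNReal.ofReal (‖f z‖ * Real.exp (-φ z))) w hw
      have h2 := (ENNReal.ofReal_le_iff_le_toReal hfW.ne).1 h1
      rw [Real.exp_neg, ← div_eq_mul_inv, div_le_iff₀ (Real.exp_pos _)] at h2
      exact h2.trans (mul_le_mul_of_nonneg_left (Real.exp_le_exp.2 (hφχ w)) ENNReal.toReal_nonneg)
    obtain ⟨F, K, hK, hFd, hFf, hFK⟩ :=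
      hext _ (SCV.slow_const hε.le (ENNReal.toReal_nonneg (a := S))) f hf hS
    refine ⟨F, hFd, hFf, lt_of_le_of_lt (iSup₂_le fun z _ => ENNReal.ofReal_le_ofReal ?_)
      (ENNReal.ofReal_lt_top (r := K * Real.exp K₀ * S.toReal))⟩
    rw [Real.exp_neg, ← div_eq_mul_inv, div_le_iff₀ (Real.exp_pos _)]
    exact SCV.norm_le_mul_exp_of_le hK (fun _ => ENNReal.toReal_nonneg) hχφ hFK z
  · have hp1 : 1 ≤ p.toReal := by
      rw [← ENNReal.toReal_one]
      exact ENNReal.toReal_mono hpt hp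
    have hp0 : 0 < p.toReal := one_pos.trans_le hp1
    set s := p.toReal
    set μ : Measure (En n) := μH[(2 * n - 2 : ℝ)].restrict (T ⁻¹' {0}) with hμ
    set g : En n → ℝ≥0∞ := fun w => ENNReal.ofReal (‖f w‖ ^ s * Real.exp (-(s * φ w))) with hg
    have hWm := hF.isClosed.measurableSet
    have hgμ : ∫⁻ w, g w ∂μ < ⊤ := by
      rw [surf, Measure.restrict_smul, lintegral_smul_measure, Measure.restrict_restrict hWm, inter_self,
        smul_eq_mul] at hfW
      exact ENNReal.lt_top_of_mul_ne_top_right hfW.ne (by simp [Nat.factorial_ne_zero])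
    have hgm : AEMeasurable g μ := by
      have h1 : ContinuousOn (fun w => ‖f w‖ ^ s * Real.exp (-(s * φ w))) (T ⁻¹' {0}) :=
        ((SCV.HolOn.continuousOn hf).norm.rpow_const fun _ _ => .inr hp0.le).mul
          ((continuous_const.mul hφ.continuous).neg.rexp).continuousOn
      exact (ENNReal.continuous_ofReal.comp_continuousOn h1).aemeasurable hWm
    have : IsLocallyFiniteMeasure μ := hF.isLocallyFinite hn
    obtain ⟨A, hA, hfA⟩ := hF.norm_le_expAvg hn hPχ hφχ hε hp1
    have hslow := (SCV.slow_expAvg hε.le hp0 hgμ).const_mul hA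
    obtain ⟨F, K, hK, hFd, hFf, hFK⟩ := hext _ hslow f hf (hfA f hf hgμ)
    refine ⟨F, hFd, hFf, ?_⟩
    rw [Measure.restrict_univ]
    refine SCV.lintegral_lt_top_of_norm_le (K := K * A) hp0.le (mul_nonneg hK hA)
      (SCV.slow_expAvg hε.le hp0 hgμ).nonneg hχφ (fun z => ?_)
      (SCV.lintegral_expAvg_lt_top hε hp0 hgm hgμ)
    rw [mul_assoc K]
    exact hFK z
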